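/- Let μ be a Borel measure with finite total mass, g ∈ W^{s,p}_loc(ℝⁿ) ∩ L^{p−1}_{sp}(ℝⁿ), and let u be a SOLA of the Dirichlet problem −L_Φ u = μ in Ω, u = g on ℝⁿ∖Ω. Then there exists a constant c depending only on n, s, p, Λ such that, whenever B_r(x₀) ⊂ Ω and the Wolff potential W^μ_{s,p}(x₀,r) is finite, one has ∫₀^r E(u; x₀, t) dt/t + |(u)_{B_r(x₀)} − u(x₀)| ≤ c·W^μ_{s,p}(x₀,r) + c·E(u; x₀, r), where u(x₀) := lim_{ρ→0}(u)_{B_ρ(x₀)} is the precise representative (which exists). -/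

import Mathlib

noncomputable section

open MeasureTheory Metric Set Filter Topology
open scoped ENNReal NNReal

/-- Euclidean space `ℝⁿ`. -/
abbrev Rn (n : ℕ) : Type := EuclideanSpace ℝ (Fin n)

/-- `q_* = max {1, p-1}`. -/
def qStar (p : ℝ) : ℝ := max 1 (p - 1)

/-- `q̄ = min {n(p-1)/(n-s), p}`. -/
def qBar (n : ℕ) (s p : ℝ) : ℝ := min ((n : ℝ) * (p - 1) / ((n : ℝ) - s)) p

/-- Gagliardo seminorm raised to the power `p`, as an `ℝ≥0∞`-valued double integral. -/
def gagliardo (n : ℕ) (s p : ℝ) (O : Set (Rn n)) (v : Rn n → ℝ) : ℝ≥0∞ :=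
  ∫⁻ x in O, ∫⁻ y in O, ENNReal.ofReal (|v x - v y| ^ p / ‖x - y‖ ^ ((n : ℝ) + s * p))

/-- `v ∈ W^{s,p}(O)`. -/
def memWsp (n : ℕ) (s p : ℝ) (O : Set (Rn n)) (v : Rn n → ℝ) : Prop :=
  AEMeasurable v (volume.restrict O) ∧
    (∫⁻ x in O, ENNReal.ofReal (|v x| ^ p)) < ⊤ ∧ gagliardo n s p O v < ⊤

/-- `Tail(v; x₀, r)`. -/
def tailFn (n : ℕ) (s p : ℝ) (v : Rn n → ℝ) (x₀ : Rn n) (r : ℝ) : ℝ≥0∞ :=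
  (ENNReal.ofReal (r ^ (s * p)) *
      ∫⁻ x in (ball x₀ r)ᶜ,
        ENNReal.ofReal (|v x| ^ (p - 1) / ‖x - x₀‖ ^ ((n : ℝ) + s * p))) ^ (1 / (p - 1))

/-- `v ∈ L^{p-1}_{sp}(ℝⁿ)`. -/
def memTailSpace (n : ℕ) (s p : ℝ) (v : Rn n → ℝ) : Prop :=
  AEMeasurable v (volume : Measure (Rn n)) ∧
    (∀ R : ℝ, (∫⁻ x in ball (0 : Rn n) R, ENNReal.ofReal (|v x| ^ (p - 1))) < ⊤) ∧
    ∀ z : Rn n, ∀ r : ℝ, 0 < r → tailFn n s p v z r < ⊤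

/-- `φ ∈ C_0^∞(O)`. -/
def IsTestFun (n : ℕ) (O : Set (Rn n)) (φ : Rn n → ℝ) : Prop :=
  ContDiff ℝ (⊤ : ℕ∞) φ ∧ HasCompactSupport φ ∧ tsupport φ ⊆ O

/-- The nonlocal form `⟨-L_Φ u, φ⟩`. -/
def nonlocalForm (n : ℕ) (Φ : ℝ → ℝ) (K : Rn n → Rn n → ℝ) (u φ : Rn n → ℝ) : ℝ :=
  ∫ x : Rn n, ∫ y : Rn n, Φ (u x - u y) * (φ x - φ y) * K x y

/-- Ellipticity/coercivity bounds on the kernel `K`. -/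
def KernelBounds (n : ℕ) (Λ s p : ℝ) (K : Rn n → Rn n → ℝ) : Prop :=
  Measurable (Function.uncurry K) ∧
    ∀ x y : Rn n, x ≠ y →
      1 / (Λ * ‖x - y‖ ^ ((n : ℝ) + s * p)) ≤ K x y ∧
        K x y ≤ Λ / ‖x - y‖ ^ ((n : ℝ) + s * p)

/-- Structure conditions on `Φ`. -/
def PhiBounds (Λ p : ℝ) (Φ : ℝ → ℝ) : Prop :=
  Continuous Φ ∧ Φ 0 = 0 ∧
    ∀ t : ℝ, |t| ^ p / Λ ≤ Φ t * t ∧ Φ t * t ≤ Λ * |t| ^ p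

/-- `∫ φ dμ` for a signed measure `μ`. -/
def sintegral (n : ℕ) (μ : MeasureTheory.SignedMeasure (Rn n)) (φ : Rn n → ℝ) : ℝ :=
  (∫ x, φ x ∂μ.toJordanDecomposition.posPart) -
    ∫ x, φ x ∂μ.toJordanDecomposition.negPart

/-- Weak (energy) solution of `-L_Φ u = f` in `Ω`, `u = g` on `ℝⁿ ∖ Ω`. -/
def WeakSol (n : ℕ) (Φ : ℝ → ℝ) (K : Rn n → Rn n → ℝ) (s p : ℝ)
    (Ω : Set (Rn n)) (f g u : Rn n → ℝ) : Prop :=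
  memWsp n s p univ u ∧ (∀ᵐ x : Rn n, x ∉ Ω → u x = g x) ∧
    ∀ φ : Rn n → ℝ, IsTestFun n Ω φ → nonlocalForm n Φ K u φ = ∫ x : Rn n, φ x * f x

/-- Weak subsolution of the homogeneous equation `-L_Φ w = 0` in `Ω`. -/
def WeakSubSol (n : ℕ) (Φ : ℝ → ℝ) (K : Rn n → Rn n → ℝ) (s p : ℝ)
    (Ω : Set (Rn n)) (w : Rn n → ℝ) : Prop :=
  memWsp n s p univ w ∧
    ∀ φ : Rn n → ℝ, IsTestFun n Ω φ → (∀ x, 0 ≤ φ x) → nonlocalForm n Φ K w φ ≤ 0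

/-- The approximation properties required of a SOLA. -/
def SOLAApprox (n : ℕ) (Φ : ℝ → ℝ) (K : Rn n → Rn n → ℝ) (s p : ℝ)
    (Ω : Set (Rn n)) (μ : MeasureTheory.SignedMeasure (Rn n)) (g u : Rn n → ℝ)
    (uj μj gj : ℕ → Rn n → ℝ) : Prop :=
  (∀ j, ContDiff ℝ (⊤ : ℕ∞) (μj j) ∧ HasCompactSupport (μj j)) ∧
  (∀ j, ContDiff ℝ (⊤ : ℕ∞) (gj j) ∧ HasCompactSupport (gj j)) ∧
  (∀ j, WeakSol n Φ K s p Ω (μj j) (gj j) (uj j)) ∧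
  (∀ᵐ x : Rn n, Tendsto (fun j => uj j x) atTop (𝓝 (u x))) ∧
  (∀ q : ℝ, qStar p ≤ q → q < qBar n s p → ∀ z : Rn n, ∀ r : ℝ, 0 < r →
    Tendsto (fun j => ∫⁻ x in ball z r, ENNReal.ofReal (|uj j x - u x| ^ q)) atTop (𝓝 0)) ∧
  (∀ φ : Rn n → ℝ, Continuous φ → HasCompactSupport φ → tsupport φ ⊆ Ω →
    Tendsto (fun j => ∫ x : Rn n, φ x * μj j x) atTop (𝓝 (sintegral n μ φ))) ∧
  (∀ z : Rn n, ∀ r : ℝ, 0 < r →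
    Filter.limsup (fun j => ∫⁻ x in ball z r, ENNReal.ofReal |μj j x|) atTop
      ≤ μ.totalVariation (closedBall z r)) ∧
  (∀ z : Rn n, ∀ r : ℝ, 0 < r →
    Tendsto (fun j =>
        (∫⁻ x in ball z r, ENNReal.ofReal (|gj j x - g x| ^ p)) +
          gagliardo n s p (ball z r) (fun x => gj j x - g x)) atTop (𝓝 0) ∧
      Tendsto (fun j => tailFn n s p (fun x => gj j x - g x) z r) atTop (𝓝 0))

/-- SOLA of the Dirichlet problem `-L_Φ u = μ` in `Ω`, `u = g` on `ℝⁿ ∖ Ω`. -/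
def IsSOLA (n : ℕ) (Φ : ℝ → ℝ) (K : Rn n → Rn n → ℝ) (s p : ℝ)
    (Ω : Set (Rn n)) (μ : MeasureTheory.SignedMeasure (Rn n)) (g u : Rn n → ℝ) : Prop :=
  (∀ h q : ℝ, 0 < h → h < s → qStar p ≤ q → q < qBar n s p → memWsp n h q Ω u) ∧
  (∀ φ : Rn n → ℝ, IsTestFun n Ω φ → nonlocalForm n Φ K u φ = sintegral n μ φ) ∧
  (∀ᵐ x : Rn n, x ∉ Ω → u x = g x) ∧
  ∃ uj μj gj : ℕ → Rn n → ℝ, SOLAApprox n Φ K s p Ω μ g u uj μj gj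

/-- Truncated Wolff potential `W^ν_{s,p}(x₀, r)`. -/
def wolff (n : ℕ) (s p : ℝ) (ν : Measure (Rn n)) (x₀ : Rn n) (r : ℝ) : ℝ≥0∞ :=
  ∫⁻ ρ in Ioc (0 : ℝ) r,
    (ν (ball x₀ ρ) / ENNReal.ofReal (ρ ^ ((n : ℝ) - s * p))) ^ (1 / (p - 1)) /
      ENNReal.ofReal ρ

/-- Integral average of `u` over `B_r(x₀)`. -/
def ballAvg (n : ℕ) (u : Rn n → ℝ) (x₀ : Rn n) (r : ℝ) : ℝ :=
  ⨍ x in ball x₀ r, u x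

/-- Local excess `A(f; x₀, r)`. -/
def locExcess (n : ℕ) (p : ℝ) (f : Rn n → ℝ) (x₀ : Rn n) (r : ℝ) : ℝ≥0∞ :=
  ((volume (ball x₀ r))⁻¹ *
      ∫⁻ x in ball x₀ r, ENNReal.ofReal (|f x - ballAvg n f x₀ r| ^ qStar p)) ^ (1 / qStar p)

/-- Global excess `E(f; x₀, r)`. -/
def excess (n : ℕ) (s p : ℝ) (f : Rn n → ℝ) (x₀ : Rn n) (r : ℝ) : ℝ≥0∞ :=
  locExcess n p f x₀ r + tailFn n s p (fun x => f x - ballAvg n f x₀ r) x₀ r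

/-- `g ∈ W^{s,p}_loc(ℝⁿ) ∩ L^{p-1}_{sp}(ℝⁿ)`. -/
def BoundaryDatum (n : ℕ) (s p : ℝ) (g : Rn n → ℝ) : Prop :=
  (∀ z : Rn n, ∀ r : ℝ, 0 < r → memWsp n s p (ball z r) g) ∧ memTailSpace n s p g

/-- Symmetric measurable kernel with ellipticity bounds. -/
def SymKernel (n : ℕ) (Λ s p : ℝ) (Kt : Rn n → Rn n → ℝ) : Prop :=
  KernelBounds n Λ s p Kt ∧ ∀ x y : Rn n, Kt x y = Kt y x

/-- Weak solution of the kernel-`Kt` fractional `p`-Laplace equation with datum `f` in `O`. -/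
def WeakSolP (n : ℕ) (Kt : Rn n → Rn n → ℝ) (s p : ℝ) (O : Set (Rn n))
    (f u : Rn n → ℝ) : Prop :=
  memWsp n s p univ u ∧
    ∀ φ : Rn n → ℝ, IsTestFun n O φ →
      (∫ x : Rn n, ∫ y : Rn n,
          |u x - u y| ^ (p - 2) * (u x - u y) * (φ x - φ y) * Kt x y) =
        ∫ x : Rn n, φ x * f x

/-- The model kernel `|x - y|^{-(n+sp)}`. -/
def fracKer (n : ℕ) (s p : ℝ) (x y : Rn n) : ℝ≥0∞ :=
  ENNReal.ofReal (‖x - y‖ ^ (-((n : ℝ) + s * p)))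

lemma fracKer_comm (n : ℕ) (s p : ℝ) (x y : Rn n) : fracKer n s p x y = fracKer n s p y x := by
  simp only [fracKer, norm_sub_rev]

lemma fracKer_ne_top (n : ℕ) (s p : ℝ) (x y : Rn n) : fracKer n s p x y ≠ ⊤ := ENNReal.ofReal_ne_top

lemma measurable_fracKer (n : ℕ) (s p : ℝ) : Measurable (Function.uncurry (fracKer n s p)) := by
  unfold fracKer Function.uncurry
  fun_prop

lemma measurable_fracKer_comp {α : Type*} [MeasurableSpace α] {n : ℕ} {s p : ℝ} {f g : α → Rn n}
    (hf : Measurable f) (hg : Measurable g) : Measurable fun a => fracKer n s p (f a) (g a) := by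
  unfold fracKer
  fun_prop

/-- Affine change of variables for the Lebesgue integral of an arbitrary function. -/
lemma lintegral_affine {n : ℕ} (x₀ : Rn n) {R : ℝ} (hR : 0 < R) (F : Rn n → ℝ≥0∞) :
    ∫⁻ x, F x = ENNReal.ofReal (R ^ n) * ∫⁻ y, F (x₀ + R • y) := by
  have h1 : ∫⁻ x, F x = ∫⁻ x, F (x₀ + x) := (lintegral_add_left_eq_self F x₀).symm
  have h2 : ∫⁻ y, F (x₀ + R • y) = ENNReal.ofReal (R ^ n)⁻¹ * ∫⁻ x, F (x₀ + x) := by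
    have := (lintegral_map_equiv (μ := (volume : Measure (Rn n))) (fun x => F (x₀ + x))
      (Homeomorph.smulOfNeZero R hR.ne').toMeasurableEquiv).symm
    simp only [Homeomorph.toMeasurableEquiv_coe, Homeomorph.smulOfNeZero_apply] at this
    rw [this]
    have h3 := Measure.map_addHaar_smul (volume : Measure (Rn n)) hR.ne'
    rw [h3, lintegral_smul_measure]
    simp [abs_of_pos (pow_pos hR n)]
  rw [h1, h2, ← mul_assoc, ← ENNReal.ofReal_mul (by positivity),
    mul_inv_cancel₀ (by positivity), ENNReal.ofReal_one, one_mul]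

lemma setLIntegral_affine {n : ℕ} (x₀ : Rn n) {R : ℝ} (hR : 0 < R) {A : Set (Rn n)}
    (hA : MeasurableSet A) (F : Rn n → ℝ≥0∞) :
    ∫⁻ x in A, F x =
      ENNReal.ofReal (R ^ n) * ∫⁻ y in (fun y => x₀ + R • y) ⁻¹' A, F (x₀ + R • y) := by
  have hm : Measurable fun y : Rn n => x₀ + R • y := by fun_prop
  rw [← lintegral_indicator hA, lintegral_affine x₀ hR, ← lintegral_indicator (hm hA)]
  rfl

lemma preimage_affine_ball {n : ℕ} (x₀ : Rn n) {R : ℝ} (hR : 0 < R) (ρ : ℝ) :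
    (fun y : Rn n => x₀ + R • y) ⁻¹' ball x₀ (R * ρ) = ball 0 ρ := by
  ext y
  simp [norm_smul, abs_of_pos hR, hR]

lemma setLIntegral_ball_affine {n : ℕ} (x₀ : Rn n) {R : ℝ} (hR : 0 < R) (ρ : ℝ)
    (F : Rn n → ℝ≥0∞) :
    ∫⁻ x in ball x₀ (R * ρ), F x =
      ENNReal.ofReal (R ^ n) * ∫⁻ y in ball 0 ρ, F (x₀ + R • y) := by
  rw [setLIntegral_affine x₀ hR measurableSet_ball, preimage_affine_ball x₀ hR]

lemma setLIntegral_ball_compl_affine {n : ℕ} (x₀ : Rn n) {R : ℝ} (hR : 0 < R) (ρ : ℝ)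
    (F : Rn n → ℝ≥0∞) :
    ∫⁻ x in (ball x₀ (R * ρ))ᶜ, F x =
      ENNReal.ofReal (R ^ n) * ∫⁻ y in (ball 0 ρ)ᶜ, F (x₀ + R • y) := by
  rw [setLIntegral_affine x₀ hR measurableSet_ball.compl, preimage_compl,
    preimage_affine_ball x₀ hR]

lemma fracKer_affine {n : ℕ} {s p : ℝ} (x₀ : Rn n) {R : ℝ} (hR : 0 < R) (x y : Rn n) :
    fracKer n s p (x₀ + R • x) (x₀ + R • y) =
      ENNReal.ofReal (R ^ (-((n : ℝ) + s * p))) * fracKer n s p x y := by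
  unfold fracKer
  rw [add_sub_add_left_eq_sub, ← smul_sub, norm_smul, Real.norm_of_nonneg hR.le,
    Real.mul_rpow hR.le (norm_nonneg _), ENNReal.ofReal_mul (by positivity)]

lemma fracKer_affine_zero {n : ℕ} {s p : ℝ} (x₀ : Rn n) {R : ℝ} (hR : 0 < R) (x : Rn n) :
    fracKer n s p x₀ (x₀ + R • x) =
      ENNReal.ofReal (R ^ (-((n : ℝ) + s * p))) * fracKer n s p 0 x := by
  have := fracKer_affine (s := s) (p := p) x₀ hR 0 x
  simpa using this

lemma exists_lintegral_ker_compl (n : ℕ) {s p : ℝ} (hsp : 0 < s * p) :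
    ∃ C : ℝ, 0 < C ∧ ∀ (x : Rn n) (r : ℝ), 0 < r →
      ∫⁻ y in (ball x r)ᶜ, fracKer n s p x y ≤ ENNReal.ofReal (C * r ^ (-(s * p))) := by
  set I := ∫⁻ y : Rn n, ENNReal.ofReal ((1 + ‖y‖) ^ (-((n : ℝ) + s * p))) with hI
  have hfin : I < ⊤ := by
    apply finite_integral_one_add_norm
    simp only [finrank_euclideanSpace, Fintype.card_fin]; linarith
  have hunit : ∫⁻ y in (ball (0 : Rn n) 1)ᶜ, fracKer n s p 0 y
      ≤ ENNReal.ofReal (2 ^ ((n : ℝ) + s * p)) * I := by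
    rw [hI, ← lintegral_const_mul' _ _ ENNReal.ofReal_ne_top]
    refine (setLIntegral_mono' measurableSet_ball.compl fun y hy => ?_).trans
      (setLIntegral_le_lintegral _ _)
    have hy1 : 1 ≤ ‖y‖ := by simpa using hy
    rw [← ENNReal.ofReal_mul (by positivity)]
    unfold fracKer
    apply ENNReal.ofReal_le_ofReal
    have hN : 0 ≤ (n : ℝ) + s * p := by positivity
    have h2 : (2 : ℝ) ^ ((n : ℝ) + s * p) = (2⁻¹) ^ (-((n : ℝ) + s * p)) := by
      rw [Real.inv_rpow (by norm_num), Real.rpow_neg (by norm_num), inv_inv]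
    rw [h2, ← Real.mul_rpow (by norm_num) (by positivity), zero_sub, norm_neg]
    apply Real.rpow_le_rpow_of_nonpos (by positivity) (by linarith) (by linarith)
  have hne : ENNReal.ofReal (2 ^ ((n : ℝ) + s * p)) * I ≠ ⊤ :=
    ENNReal.mul_ne_top ENNReal.ofReal_ne_top hfin.ne
  refine ⟨(ENNReal.ofReal (2 ^ ((n : ℝ) + s * p)) * I).toReal + 1, by positivity, ?_⟩
  intro x r hr
  have h := setLIntegral_ball_compl_affine x hr 1 (fun y => fracKer n s p x y)
  rw [mul_one] at h
  rw [h]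
  simp_rw [fracKer_affine_zero x hr]
  rw [lintegral_const_mul' _ _ ENNReal.ofReal_ne_top]
  calc _ ≤ ENNReal.ofReal (r ^ n) * (ENNReal.ofReal (r ^ (-((n : ℝ) + s * p))) *
        (ENNReal.ofReal (2 ^ ((n : ℝ) + s * p)) * I)) := by gcongr
    _ ≤ ENNReal.ofReal (r ^ n) * (ENNReal.ofReal (r ^ (-((n : ℝ) + s * p))) *
        ENNReal.ofReal ((ENNReal.ofReal (2 ^ ((n : ℝ) + s * p)) * I).toReal + 1)) := by
        gcongr
        rw [← ENNReal.ofReal_toReal hne]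
        exact ENNReal.ofReal_le_ofReal (by simp)
    _ = _ := by
        rw [← ENNReal.ofReal_mul (by positivity), ← ENNReal.ofReal_mul (by positivity)]
        congr 1
        rw [← mul_assoc, ← Real.rpow_natCast r n, ← Real.rpow_add hr, mul_comm]
        congr 2; ring

lemma exists_lintegral_ker_mul {n : ℕ} (hn : 1 ≤ n) {s p : ℝ} (hs1 : s < 1) (hp : 0 < p) (r : ℝ) :
    ∃ C : ℝ, 0 < C ∧ ∀ (x : Rn n),
      ∫⁻ y in ball x r, ENNReal.ofReal (‖x - y‖ ^ p) * fracKer n s p x y ≤ ENNReal.ofReal C := by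
  set α : ℝ := (n : ℝ) + s * p - p with hα
  have hInt : IntegrableOn (fun y : Rn n => ‖y‖ ^ p * ‖y‖ ^ (-((n : ℝ) + s * p)))
      (ball 0 r) volume := by
    refine integrableOn_ball_of_norm_le_rpow (C := 1) (α := α) (by simpa using hn)
      (by simp only [finrank_euclideanSpace, Fintype.card_fin, hα]; nlinarith) ?_
      (by fun_prop)
    refine Eventually.of_forall fun y => ?_
    rw [Real.norm_of_nonneg (by positivity), one_mul]
    rcases (norm_nonneg y).eq_or_lt with h | h
    · rw [← h, Real.zero_rpow hp.ne', zero_mul]; positivity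
    · rw [← Real.rpow_add h]
      apply le_of_eq; congr 1; rw [hα]; ring
  have hfin : ∫⁻ y in ball (0 : Rn n) r, ENNReal.ofReal (‖y‖ ^ p) * fracKer n s p 0 y < ⊤ := by
    have := hInt.lintegral_lt_top
    refine lt_of_le_of_lt (le_of_eq ?_) this
    refine lintegral_congr fun y => ?_
    rw [ENNReal.ofReal_mul (by positivity), fracKer, zero_sub, norm_neg]
  refine ⟨(∫⁻ y in ball (0 : Rn n) r, ENNReal.ofReal (‖y‖ ^ p) * fracKer n s p 0 y).toReal + 1,
    by positivity, fun x => ?_⟩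
  have h := setLIntegral_ball_affine x one_pos r
    (fun y => ENNReal.ofReal (‖x - y‖ ^ p) * fracKer n s p x y)
  rw [one_mul] at h
  rw [h]
  have h2 : ∀ y : Rn n, ENNReal.ofReal (‖x - (x + (1 : ℝ) • y)‖ ^ p) * fracKer n s p x (x + (1 : ℝ) • y)
      = ENNReal.ofReal (‖y‖ ^ p) * fracKer n s p 0 y := by
    intro y; simp [fracKer]
  simp_rw [h2]
  rw [one_pow, ENNReal.ofReal_one, one_mul, ← ENNReal.ofReal_toReal hfin.ne]
  exact ENNReal.ofReal_le_ofReal (by simp)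

/-- Lebesgue integrals of powers below the first on a set of finite measure. -/
lemma lintegral_rpow_le_of_le_one {α : Type*} [MeasurableSpace α] {μ : Measure α} {f : α → ℝ≥0∞}
    (hf : AEMeasurable f μ) {θ : ℝ} (h0 : 0 ≤ θ) (h1 : θ ≤ 1) :
    ∫⁻ x, f x ^ θ ∂μ ≤ (∫⁻ x, f x ∂μ) ^ θ * μ univ ^ (1 - θ) := by
  have := ENNReal.lintegral_mul_norm_pow_le (μ := μ) (f := f) (g := fun _ => 1) hf
    aemeasurable_const h0 (sub_nonneg.2 h1) (by ring)
  simpa using this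

lemma volume_ball_eq {n : ℕ} (hn : 1 ≤ n) (x : Rn n) {r : ℝ} (hr : 0 ≤ r) :
    volume (ball x r) = ENNReal.ofReal ((volume (ball (0 : Rn n) 1)).toReal * r ^ n) := by
  have : Nonempty (Fin n) := ⟨⟨0, hn⟩⟩
  rw [Measure.addHaar_ball _ _ hr, finrank_euclideanSpace, Fintype.card_fin, mul_comm,
    ENNReal.ofReal_mul ENNReal.toReal_nonneg, ENNReal.ofReal_toReal measure_ball_lt_top.ne]

lemma volume_unitBall_pos (n : ℕ) : 0 < (volume (ball (0 : Rn n) 1)).toReal :=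
  ENNReal.toReal_pos (measure_ball_pos _ _ one_pos).ne' measure_ball_lt_top.ne

/-- Pointwise bound behind the fractional Sobolev inequality. -/
lemma sobolev_pointwise {n : ℕ} (hn : 1 ≤ n) {s p a : ℝ} (hs : 0 < s) (hp : 0 < p) (ha : 0 < a)
    {ω : ℝ} (hω : ω = (volume (ball (0 : Rn n) 1)).toReal)
    {h : Rn n → ℝ} (hm : Measurable h) (h0 : ∀ x, 0 ≤ h x) {i : ℝ} (hi : 0 < i)
    (hI : ∫⁻ x, ENNReal.ofReal (h x ^ a) = ENNReal.ofReal i) (x : Rn n) :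
    ENNReal.ofReal (h x ^ (p + a * s * p / n)) ≤
      ENNReal.ofReal (2 ^ (p + 1) / ω * (2 ^ (1 + a) / ω) ^ (s * p / n) * i ^ (s * p / n)) *
        ∫⁻ y, ENNReal.ofReal (|h x - h y| ^ p) * fracKer n s p x y := by
  have hn' : (0 : ℝ) < n := by exact_mod_cast hn
  have hω0 : 0 < ω := hω ▸ volume_unitBall_pos n
  rcases (h0 x).eq_or_lt with hx | hx
  · rw [← hx, Real.zero_rpow (by positivity)]; simp
  set H := h x with hH
  set V : ℝ := 2 * ((2 / H) ^ a * i) / ω with hV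
  have hV0 : 0 < V := by positivity
  set t : ℝ := V ^ (1 / (n : ℝ)) with ht
  have ht0 : 0 < t := by positivity
  have htn : t ^ n = V := by
    rw [ht, ← Real.rpow_natCast, ← Real.rpow_mul hV0.le, one_div, inv_mul_cancel₀ hn'.ne',
      Real.rpow_one]
  have hcheb : volume {y | H / 2 < h y} ≤ ENNReal.ofReal (ω * V / 2) := by
    have h1 : {y | H / 2 < h y} ⊆ {y | ENNReal.ofReal ((H / 2) ^ a) ≤ ENNReal.ofReal (h y ^ a)} := by
      intro y hy
      simp only [mem_ofPred_eq] at hy ⊢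
      exact ENNReal.ofReal_le_ofReal (Real.rpow_le_rpow (by positivity) hy.le ha.le)
    have h2 := mul_meas_ge_le_lintegral₀ (μ := (volume : Measure (Rn n)))
      (f := fun y => ENNReal.ofReal (h y ^ a)) (by fun_prop) (ENNReal.ofReal ((H / 2) ^ a))
    rw [hI] at h2
    have h3 : ENNReal.ofReal ((H / 2) ^ a) * volume {y | H / 2 < h y} ≤ ENNReal.ofReal i :=
      (mul_le_mul_right (measure_mono h1) _).trans h2
    have h4 : ENNReal.ofReal (ω * V / 2) = ENNReal.ofReal i / ENNReal.ofReal ((H / 2) ^ a) := by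
      rw [← ENNReal.ofReal_div_of_pos (by positivity)]
      congr 1
      rw [hV, Real.div_rpow (by norm_num) hx.le, Real.div_rpow hx.le (by norm_num)]
      field_simp
    rw [h4, ENNReal.le_div_iff_mul_le (Or.inl (by simp; positivity))
      (Or.inl ENNReal.ofReal_ne_top), mul_comm]
    exact h3
  have hhalf : ENNReal.ofReal (ω * V / 2) ≤ volume (ball x t \ {y | H / 2 < h y}) := by
    have h1 : volume (ball x t) = ENNReal.ofReal (ω * V) := by
      rw [volume_ball_eq hn x ht0.le, ← hω, htn]
    have h2 := le_measure_sdiff (μ := (volume : Measure (Rn n))) (s₁ := ball x t)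
      (s₂ := {y | H / 2 < h y})
    refine le_trans ?_ h2
    rw [h1]
    calc ENNReal.ofReal (ω * V / 2) = ENNReal.ofReal (ω * V - ω * V / 2) := by congr 1; ring
      _ = ENNReal.ofReal (ω * V) - ENNReal.ofReal (ω * V / 2) :=
        ENNReal.ofReal_sub _ (by positivity)
      _ ≤ _ := by gcongr
  have hlow : ENNReal.ofReal ((H / 2) ^ p * t ^ (-((n : ℝ) + s * p)) * (ω * V / 2)) ≤
      ∫⁻ y, ENNReal.ofReal (|H - h y| ^ p) * fracKer n s p x y := by
    have hms : MeasurableSet (ball x t \ {y | H / 2 < h y}) :=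
      measurableSet_ball.diff (measurableSet_lt measurable_const hm)
    refine le_trans ?_ (setLIntegral_le_lintegral (ball x t \ {y | H / 2 < h y}) _)
    calc _ = ENNReal.ofReal ((H / 2) ^ p * t ^ (-((n : ℝ) + s * p))) * ENNReal.ofReal (ω * V / 2) :=
          ENNReal.ofReal_mul (by positivity)
      _ ≤ ENNReal.ofReal ((H / 2) ^ p * t ^ (-((n : ℝ) + s * p))) *
          volume (ball x t \ {y | H / 2 < h y}) := by gcongr
      _ = ∫⁻ y in ball x t \ {y | H / 2 < h y},
          ENNReal.ofReal ((H / 2) ^ p * t ^ (-((n : ℝ) + s * p))) := by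
          rw [setLIntegral_const]
      _ ≤ _ := by
          refine setLIntegral_mono' hms fun y hy => ?_
          obtain ⟨hy1, hy2⟩ := hy
          simp only [mem_ofPred_eq, not_lt] at hy2
          rw [ENNReal.ofReal_mul (by positivity)]
          unfold fracKer
          have hxy : x ≠ y := by
            rintro rfl; linarith
          have hd : 0 < ‖x - y‖ := norm_pos_iff.2 (sub_ne_zero.2 hxy)
          refine mul_le_mul' (ENNReal.ofReal_le_ofReal ?_) (ENNReal.ofReal_le_ofReal ?_)
          · refine Real.rpow_le_rpow (by positivity) ?_ hp.le
            rw [abs_of_nonneg (by linarith)]; linarith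
          · apply Real.rpow_le_rpow_of_nonpos hd
            · rw [mem_ball, dist_comm, dist_eq_norm] at hy1; exact hy1.le
            · have : 0 < s * p := by positivity
              linarith
  refine le_trans ?_ (mul_le_mul_right hlow _)
  rw [← ENNReal.ofReal_mul (by positivity)]
  apply ENNReal.ofReal_le_ofReal
  apply le_of_eq
  have e1 : t ^ (-((n : ℝ) + s * p)) = V⁻¹ * V ^ (-(s * p / n)) := by
    rw [ht, ← Real.rpow_mul hV0.le, ← Real.rpow_neg_one, ← Real.rpow_add hV0]
    congr 1; field_simp; ring
  have e2 : V = (2 ^ (1 + a) / ω) * i * H ^ (-a) := by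
    rw [hV, Real.div_rpow (by norm_num) hx.le, Real.rpow_add (by norm_num), Real.rpow_one,
      Real.rpow_neg hx.le]
    field_simp
  have e3 : V ^ (-(s * p / n)) = ((2 ^ (1 + a) / ω) ^ (s * p / n))⁻¹ * (i ^ (s * p / n))⁻¹ *
      H ^ (a * s * p / n) := by
    rw [e2, Real.mul_rpow (by positivity) (by positivity),
      Real.mul_rpow (by positivity) (by positivity), ← Real.rpow_mul hx.le, Real.rpow_neg (by positivity),
      Real.rpow_neg (by positivity)]
    congr 2; ring
  rw [e1, e3, Real.div_rpow hx.le (by norm_num), Real.rpow_add hx, Real.rpow_add (by norm_num : (0:ℝ) < 2) p 1,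
    Real.rpow_one]
  field_simp

lemma sobolev_bounded {n : ℕ} (hn : 1 ≤ n) {s p κ : ℝ} (hs : 0 < s) (hp : 0 < p) (hκ : 1 < κ)
    (hκ2 : κ * (1 - s * p / n) ≤ 1) :
    ∃ C : ℝ, 0 < C ∧ ∀ h : Rn n → ℝ, Measurable h → (∀ x, 0 ≤ h x) →
      (∀ x, x ∉ ball (0 : Rn n) 1 → h x = 0) → (∃ M, ∀ x, h x ≤ M) → ∀ A : ℝ, 0 ≤ A →
      ∫⁻ x, ∫⁻ y, ENNReal.ofReal (|h x - h y| ^ p) * fracKer n s p x y ≤ ENNReal.ofReal A →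
      ∫⁻ x, ENNReal.ofReal (h x ^ (p * κ)) ≤ ENNReal.ofReal (C * A ^ κ) := by
  have hn' : (0 : ℝ) < n := by exact_mod_cast hn
  set ω := (volume (ball (0 : Rn n) 1)).toReal with hω
  have hω0 : 0 < ω := volume_unitBall_pos n
  have hωe : volume (ball (0 : Rn n) 1) = ENNReal.ofReal ω :=
    (ENNReal.ofReal_toReal measure_ball_lt_top.ne).symm
  set a : ℝ := n * (κ - 1) / s with ha
  have ha0 : 0 < a := by have := sub_pos.2 hκ; positivity
  have hpa : p + a * s * p / n = p * κ := by rw [ha]; field_simp; ring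
  set θ : ℝ := a / (p * κ) with hθ
  have hκ0 : 0 < κ := by linarith
  have hθ0 : 0 < θ := by positivity
  have hθ1 : θ ≤ 1 := by
    rw [hθ, div_le_one (by positivity), ha, div_le_iff₀ hs]
    have : κ * (1 - s * p / n) * n ≤ 1 * n := by gcongr
    have e : κ * (1 - s * p / n) * n = κ * n - κ * (s * p) := by field_simp
    nlinarith
  have hθs : θ * (s * p / n) = (κ - 1) / κ := by
    rw [hθ, ha]; field_simp
  set C1 : ℝ := 2 ^ (p + 1) / ω * (2 ^ (1 + a) / ω) ^ (s * p / n) with hC1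
  have hC10 : 0 < C1 := by positivity
  set C2 : ℝ := C1 * (ω ^ (1 - θ)) ^ (s * p / n) with hC2
  have hC20 : 0 < C2 := by positivity
  refine ⟨C2 ^ κ, by positivity, ?_⟩
  intro h hm h0 hsupp ⟨M, hM⟩ A hA hE
  have hbd : ∀ e : ℝ, 0 < e → ∫⁻ x, ENNReal.ofReal (h x ^ e) < ⊤ := by
    intro e he
    have : ∫⁻ x, ENNReal.ofReal (h x ^ e) ≤ ∫⁻ x in ball (0 : Rn n) 1, ENNReal.ofReal (M ^ e) := by
      rw [← lintegral_indicator measurableSet_ball]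
      refine lintegral_mono fun x => ?_
      by_cases hx : x ∈ ball (0 : Rn n) 1
      · simp only [hx, indicator_of_mem]
        exact ENNReal.ofReal_le_ofReal (Real.rpow_le_rpow (h0 x) (hM x) he.le)
      · simp [hsupp x hx, Real.zero_rpow he.ne']
    refine this.trans_lt ?_
    rw [setLIntegral_const]
    exact ENNReal.mul_lt_top ENNReal.ofReal_lt_top measure_ball_lt_top
  set X := ∫⁻ x, ENNReal.ofReal (h x ^ (p * κ)) with hX
  set I := ∫⁻ x, ENNReal.ofReal (h x ^ a) with hI
  have hXf : X ≠ ⊤ := (hbd _ (by positivity)).ne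
  have hIf : I ≠ ⊤ := (hbd _ ha0).ne
  rcases eq_or_ne I 0 with hI0 | hI0
  · have hz : ∀ᵐ x, ENNReal.ofReal (h x ^ a) = 0 := by
      have := (lintegral_eq_zero_iff (by fun_prop)).1 hI0
      exact this
    have : X = 0 := by
      rw [hX, lintegral_eq_zero_iff (by fun_prop)]
      filter_upwards [hz] with x hx
      rcases (h0 x).eq_or_lt with h1 | h1
      · simp [← h1, Real.zero_rpow (by positivity : p * κ ≠ 0)]
      · exact absurd hx (by simp; positivity)
    rw [this]; exact zero_le
  set i := I.toReal with hi
  have hi0 : 0 < i := ENNReal.toReal_pos hI0 hIf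
  have hIi : I = ENNReal.ofReal i := (ENNReal.ofReal_toReal hIf).symm
  have hX1 : X ≤ ENNReal.ofReal (C1 * i ^ (s * p / n) * A) := by
    calc X = ∫⁻ x, ENNReal.ofReal (h x ^ (p + a * s * p / n)) := by rw [hpa]
      _ ≤ ∫⁻ x, ENNReal.ofReal (C1 * i ^ (s * p / n)) *
          ∫⁻ y, ENNReal.ofReal (|h x - h y| ^ p) * fracKer n s p x y :=
          lintegral_mono fun x => sobolev_pointwise hn hs hp ha0 hω hm h0 hi0 hIi x
      _ = ENNReal.ofReal (C1 * i ^ (s * p / n)) * ∫⁻ x,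
          ∫⁻ y, ENNReal.ofReal (|h x - h y| ^ p) * fracKer n s p x y :=
          lintegral_const_mul' _ _ ENNReal.ofReal_ne_top
      _ ≤ ENNReal.ofReal (C1 * i ^ (s * p / n)) * ENNReal.ofReal A := by gcongr
      _ = _ := (ENNReal.ofReal_mul (by positivity)).symm
  have hI1 : I ≤ X ^ θ * ENNReal.ofReal (ω ^ (1 - θ)) := by
    have h1 : I = ∫⁻ x in ball (0 : Rn n) 1, ENNReal.ofReal (h x ^ (p * κ)) ^ θ := by
      rw [← lintegral_indicator measurableSet_ball]
      refine lintegral_congr fun x => ?_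
      by_cases hx : x ∈ ball (0 : Rn n) 1
      · simp only [hx, indicator_of_mem]
        rw [ENNReal.ofReal_rpow_of_nonneg (Real.rpow_nonneg (h0 x) _) hθ0.le, ← Real.rpow_mul (h0 x)]
        congr 2; rw [hθ]; field_simp
      · simp [hsupp x hx, Real.zero_rpow ha0.ne', hx]
    rw [h1]
    refine (lintegral_rpow_le_of_le_one (by fun_prop) hθ0.le hθ1).trans ?_
    rw [Measure.restrict_apply_univ, hωe, ENNReal.ofReal_rpow_of_nonneg hω0.le (by linarith)]
    gcongr
    exact setLIntegral_le_lintegral _ _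
  set X' := X.toReal with hX'
  have hXe : X = ENNReal.ofReal X' := (ENNReal.ofReal_toReal hXf).symm
  have hX'0 : 0 ≤ X' := ENNReal.toReal_nonneg
  have hX2 : X' ≤ C1 * i ^ (s * p / n) * A := by
    rw [hXe] at hX1
    exact (ENNReal.ofReal_le_ofReal_iff (by positivity)).1 hX1
  have hi2 : i ≤ X' ^ θ * ω ^ (1 - θ) := by
    rw [hXe, hIi, ENNReal.ofReal_rpow_of_nonneg hX'0 hθ0.le, ← ENNReal.ofReal_mul (by positivity)] at hI1
    exact (ENNReal.ofReal_le_ofReal_iff (by positivity)).1 hI1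
  have hXpos : 0 < X' := by
    by_contra hc
    have : X' = 0 := le_antisymm (not_lt.1 hc) hX'0
    rw [this, Real.zero_rpow hθ0.ne', zero_mul] at hi2
    linarith
  have hX3 : X' ≤ C2 * A * X' ^ ((κ - 1) / κ) := by
    calc X' ≤ C1 * i ^ (s * p / n) * A := hX2
      _ ≤ C1 * (X' ^ θ * ω ^ (1 - θ)) ^ (s * p / n) * A := by gcongr
      _ = C2 * A * X' ^ ((κ - 1) / κ) := by
        rw [Real.mul_rpow (by positivity) (by positivity), ← Real.rpow_mul hX'0, hθs, hC2]; ring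
  have hX4 : X' ^ (1 / κ) ≤ C2 * A := by
    have e : X' = X' ^ (1 / κ) * X' ^ ((κ - 1) / κ) := by
      rw [← Real.rpow_add hXpos, ← add_div, add_sub_cancel, div_self hκ0.ne', Real.rpow_one]
    have : X' ^ (1 / κ) * X' ^ ((κ - 1) / κ) ≤ C2 * A * X' ^ ((κ - 1) / κ) := by rwa [← e]
    exact le_of_mul_le_mul_right this (by positivity)
  rw [hXe]
  apply ENNReal.ofReal_le_ofReal
  calc X' = (X' ^ (1 / κ)) ^ κ := by
        rw [← Real.rpow_mul hX'0, one_div, inv_mul_cancel₀ hκ0.ne', Real.rpow_one]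
    _ ≤ (C2 * A) ^ κ := by gcongr
    _ = _ := Real.mul_rpow hC20.le hA

/-- Fractional Sobolev inequality for functions supported in the unit ball. -/
lemma sobolev {n : ℕ} (hn : 1 ≤ n) {s p κ : ℝ} (hs : 0 < s) (hp : 0 < p) (hκ : 1 < κ)
    (hκ2 : κ * (1 - s * p / n) ≤ 1) :
    ∃ C : ℝ, 0 < C ∧ ∀ h : Rn n → ℝ, Measurable h → (∀ x, 0 ≤ h x) →
      (∀ x, x ∉ ball (0 : Rn n) 1 → h x = 0) → ∀ A : ℝ, 0 ≤ A →
      ∫⁻ x, ∫⁻ y, ENNReal.ofReal (|h x - h y| ^ p) * fracKer n s p x y ≤ ENNReal.ofReal A →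
      ∫⁻ x, ENNReal.ofReal (h x ^ (p * κ)) ≤ ENNReal.ofReal (C * A ^ κ) := by
  obtain ⟨C, hC, H⟩ := sobolev_bounded hn hs hp hκ hκ2
  refine ⟨C, hC, fun h hm h0 hsupp A hA hE => ?_⟩
  have hb : ∀ M : ℕ, ∫⁻ x, ENNReal.ofReal ((min (h x) M) ^ (p * κ)) ≤ ENNReal.ofReal (C * A ^ κ) := by
    intro M
    refine H (fun x => min (h x) M) (by fun_prop) (fun x => le_min (h0 x) (Nat.cast_nonneg M))
      (fun x hx => by simp [hsupp x hx]) ⟨M, fun x => min_le_right _ _⟩ A hA (le_trans ?_ hE)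
    refine lintegral_mono fun x => lintegral_mono fun y => ?_
    refine mul_le_mul_left (ENNReal.ofReal_le_ofReal (Real.rpow_le_rpow (abs_nonneg _) ?_ hp.le)) _
    have := abs_min_sub_min_le_max (h x) (M : ℝ) (h y) M
    rw [sub_self, abs_zero, max_eq_left (abs_nonneg _)] at this; exact this
  have hlim : ∀ x, Tendsto (fun M : ℕ => ENNReal.ofReal ((min (h x) M) ^ (p * κ))) atTop
      (𝓝 (ENNReal.ofReal (h x ^ (p * κ)))) := by
    intro x
    refine tendsto_const_nhds.congr' ?_
    filter_upwards [eventually_ge_atTop ⌈h x⌉₊] with M hM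
    rw [min_eq_left ((Nat.le_ceil _).trans (by exact_mod_cast hM))]
  calc ∫⁻ x, ENNReal.ofReal (h x ^ (p * κ))
      = ∫⁻ x, liminf (fun M : ℕ => ENNReal.ofReal ((min (h x) M) ^ (p * κ))) atTop :=
        lintegral_congr fun x => (hlim x).liminf_eq.symm
    _ ≤ liminf (fun M : ℕ => ∫⁻ x, ENNReal.ofReal ((min (h x) M) ^ (p * κ))) atTop :=
        lintegral_liminf_le fun M => by fun_prop
    _ ≤ _ := by
        refine liminf_le_of_frequently_le' (Frequently.of_forall hb)

/-- Admissible auxiliary exponents for the De Giorgi iteration. -/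
structure Par (n : ℕ) (s p Λ ε q κ : ℝ) : Prop where
  hn : 2 ≤ n
  hs : 0 < s
  hs1 : s < 1
  hp : 1 < p
  hΛ : 1 ≤ Λ
  hε : 0 < ε
  hεp : ε < p - 1
  hq1 : (1 + ε) * (p - 1) ≤ q
  hqs : qStar p < q
  hqp : q ≤ p
  hκ : 1 < κ
  hκ2 : κ * (1 - s * p / n) ≤ 1
  hqb : q < (p - 1 - ε) * κ
  hInt : κ * (q - qStar p) < (p - 1 - ε) * κ - qStar p

lemma exists_par {n : ℕ} {s p Λ : ℝ} (hn : 2 ≤ n) (hs : 0 < s) (hs1 : s < 1)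
    (hp : 2 - s / (n : ℝ) < p) (hΛ : 1 ≤ Λ) : ∃ ε q κ : ℝ, Par n s p Λ ε q κ := by
  have hn' : (2 : ℝ) ≤ n := by exact_mod_cast hn
  have hn0 : (0 : ℝ) < n := by linarith
  have hsn : s / n < 1 / 2 := by
    rw [div_lt_div_iff₀ hn0 two_pos]; linarith
  have hsn0 : 0 < s / n := by positivity
  have hp1 : 1 < p := by linarith
  have hqs1 : 1 ≤ qStar p := le_max_left _ _
  have hqsp : qStar p < p := max_lt hp1 (by linarith)
  obtain ⟨κ, hκ1, hκ2, hκ3⟩ : ∃ κ : ℝ, 1 < κ ∧ κ * (1 - s * p / n) ≤ 1 ∧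
      qStar p < (p - 1) * κ := by
    by_cases h : s * p < n
    · have hd : 0 < 1 - s * p / n := by
        rw [sub_pos, div_lt_one hn0]; exact h
      have hd1 : 1 - s * p / n < 1 := by
        have : 0 < s * p / n := by positivity
        linarith
      have hk : 1 < 1 / (1 - s * p / n) := by rw [lt_div_iff₀ hd]; linarith
      refine ⟨1 / (1 - s * p / n), hk, ?_, max_lt ?_ ?_⟩
      · rw [one_div, inv_mul_cancel₀ hd.ne']
      · rw [mul_one_div, lt_div_iff₀ hd]
        have : s * p / n = s / n * p := by ring
        rw [this]; nlinarith
      · nlinarith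
    · refine ⟨1 / (p - 1) + 2, ?_, ?_, max_lt ?_ ?_⟩
      · have : 0 < 1 / (p - 1) := by have := sub_pos.2 hp1; positivity
        linarith
      · have hd : 1 - s * p / n ≤ 0 := by
          rw [sub_nonpos, one_le_div hn0]; exact not_lt.1 h
        have : 0 < 1 / (p - 1) := by have := sub_pos.2 hp1; positivity
        nlinarith
      · have : (p - 1) * (1 / (p - 1)) = 1 := by
          have := (sub_pos.2 hp1).ne'; field_simp
        nlinarith
      · have : (p - 1) * (1 / (p - 1)) = 1 := by
          have := (sub_pos.2 hp1).ne'; field_simp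
        nlinarith
  have hev : ∀ᶠ ε in 𝓝[>] (0 : ℝ), ε < p - 1 ∧ qStar p * (1 + ε) < p ∧
      qStar p * (1 + ε) < (p - 1 - ε) * κ ∧
      κ * (qStar p * (1 + ε) - qStar p) < (p - 1 - ε) * κ - qStar p := by
    refine (Filter.Eventually.and ?_ (Filter.Eventually.and ?_ (Filter.Eventually.and ?_ ?_)))
    all_goals refine Filter.Eventually.filter_mono nhdsWithin_le_nhds ?_
    · exact (continuous_id.tendsto (0 : ℝ)).eventually_lt_const (by simpa using hp1)
    · exact ((by fun_prop : Continuous fun ε : ℝ => qStar p * (1 + ε)).tendsto 0).eventually_lt_const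
        (by simpa using hqsp)
    · exact Filter.Tendsto.eventually_lt
        ((by fun_prop : Continuous fun ε : ℝ => qStar p * (1 + ε)).tendsto 0)
        ((by fun_prop : Continuous fun ε : ℝ => (p - 1 - ε) * κ).tendsto 0) (by simpa using hκ3)
    · exact Filter.Tendsto.eventually_lt
        ((by fun_prop : Continuous fun ε : ℝ => κ * (qStar p * (1 + ε) - qStar p)).tendsto 0)
        ((by fun_prop : Continuous fun ε : ℝ => (p - 1 - ε) * κ - qStar p).tendsto 0)
        (by simpa using hκ3)
  obtain ⟨ε, ⟨h1, h2, h3, h4⟩, hε⟩ := (hev.and self_mem_nhdsWithin).exists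
  have hε : 0 < ε := hε
  refine ⟨ε, qStar p * (1 + ε), κ, hn, hs, hs1, hp1, hΛ, hε, h1, ?_, ?_, h2.le, hκ1, hκ2, h3, h4⟩
  · rw [mul_comm]; gcongr; exact le_max_right _ _
  · nlinarith

/-- Bounded increasing truncation. -/
def Sf (ε t : ℝ) : ℝ := 1 - (1 + t) ^ (-ε)

/-- Power truncation adapted to the energy. -/
def Hf (p ε t : ℝ) : ℝ := (1 + t) ^ ((p - 1 - ε) / p) - 1

/-- Weight for the error terms. -/
def Wf (q a : ℝ) : ℝ := if 0 < a then (1 + a) ^ q else 0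

lemma Wf_nonneg (q a : ℝ) : 0 ≤ Wf q a := by
  unfold Wf; split_ifs with h
  · positivity
  · exact le_rfl

lemma Wf_of_pos {q a : ℝ} (h : 0 < a) : Wf q a = (1 + a) ^ q := if_pos h

lemma measurable_Wf (q : ℝ) : Measurable (Wf q) := by
  unfold Wf
  exact Measurable.ite measurableSet_Ioi (by fun_prop) (by fun_prop)

lemma measurable_Sf (ε : ℝ) : Measurable (Sf ε) := by unfold Sf; fun_prop
lemma measurable_Hf (p ε : ℝ) : Measurable (Hf p ε) := by unfold Hf; fun_prop

lemma Sf_zero (ε : ℝ) : Sf ε 0 = 0 := by simp [Sf]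
lemma Hf_zero (p ε : ℝ) : Hf p ε 0 = 0 := by simp [Hf]

lemma Sf_le_one {ε t : ℝ} (ht : 0 ≤ t) : Sf ε t ≤ 1 := by
  have : 0 ≤ (1 + t) ^ (-ε) := by positivity
  unfold Sf; linarith

lemma Sf_sub_ge {ε a b : ℝ} (hε : 0 < ε) (hb : 0 ≤ b) (hab : b ≤ a) :
    ε * (1 + a) ^ (-(1 + ε)) * (a - b) ≤ Sf ε a - Sf ε b := by
  have hw : 0 < 1 + a := by linarith
  have hu : 0 < 1 + b := by linarith
  set z := (1 + b) / (1 + a) with hz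
  have hz0 : 0 < z := by positivity
  have h1 : 1 + ε * (1 - z) ≤ z ^ (-ε) := by
    rw [Real.rpow_def_of_pos hz0]
    have := Real.add_one_le_exp (Real.log z * -ε)
    have h2 := Real.log_le_sub_one_of_pos hz0
    nlinarith
  have e1 : (1 + b) ^ (-ε) = z ^ (-ε) * (1 + a) ^ (-ε) := by
    rw [hz, Real.div_rpow hu.le hw.le]; field_simp
  have e2 : (1 + a) ^ (-(1 + ε)) * (a - b) = (1 + a) ^ (-ε) * (1 - z) := by
    rw [neg_add, Real.rpow_add hw, Real.rpow_neg_one, hz]; field_simp; ring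
  have h0 : 0 < (1 + a) ^ (-ε) := by positivity
  unfold Sf
  rw [mul_assoc, e2, e1]
  nlinarith

lemma Sf_nonneg {ε t : ℝ} (hε : 0 < ε) (ht : 0 ≤ t) : 0 ≤ Sf ε t := by
  have := Sf_sub_ge hε le_rfl ht
  rw [Sf_zero, sub_zero, sub_zero] at this
  exact le_trans (by positivity) this

lemma Sf_mono {ε a b : ℝ} (hε : 0 < ε) (hb : 0 ≤ b) (hab : b ≤ a) : Sf ε b ≤ Sf ε a := by
  have := Sf_sub_ge hε hb hab
  have h0 : 0 ≤ a - b := by linarith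
  have hw : 0 < 1 + a := by linarith
  have : 0 ≤ ε * (1 + a) ^ (-(1 + ε)) * (a - b) := by positivity
  linarith

/-- `Sf` is Lipschitz on the half line. -/
lemma abs_Sf_sub_le {ε a b : ℝ} (hε : 0 < ε) (ha : 0 ≤ a) (hb : 0 ≤ b) :
    |Sf ε a - Sf ε b| ≤ ε * |a - b| := by
  wlog hab : b ≤ a generalizing a b
  · rw [abs_sub_comm, abs_sub_comm a]; exact this hb ha (le_of_not_ge hab)
  rw [abs_of_nonneg (sub_nonneg.2 (Sf_mono hε hb hab)), abs_of_nonneg (sub_nonneg.2 hab)]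
  have hw : 0 < 1 + a := by linarith
  have hu : 0 < 1 + b := by linarith
  set z := (1 + a) / (1 + b) with hz
  have hz0 : 0 < z := by positivity
  have h1 : 1 - ε * (z - 1) ≤ z ^ (-ε) := by
    rw [Real.rpow_def_of_pos hz0]
    have := Real.add_one_le_exp (Real.log z * -ε)
    have h2 := Real.log_le_sub_one_of_pos hz0
    nlinarith
  have e1 : (1 + a) ^ (-ε) = z ^ (-ε) * (1 + b) ^ (-ε) := by
    rw [hz, Real.div_rpow hw.le hu.le]; field_simp
  have h0 : 0 < (1 + b) ^ (-ε) := by positivity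
  have h01 : (1 + b) ^ (-ε) ≤ 1 := Real.rpow_le_one_of_one_le_of_nonpos (by linarith) (by linarith)
  have hz1 : z - 1 ≤ a - b := by
    rw [hz, div_sub_one hu.ne', div_le_iff₀ hu]; nlinarith
  have hz2 : 0 ≤ z - 1 := by
    rw [hz, sub_nonneg, one_le_div hu]; linarith
  unfold Sf
  rw [e1]
  have : (1 + b) ^ (-ε) * (ε * (z - 1)) ≤ 1 * (ε * (a - b)) := by gcongr
  nlinarith

lemma Hf_sub_le {p ε a b : ℝ} (hp : 0 < p) (hε : 0 < ε) (hb : 0 ≤ b) (hab : b ≤ a) :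
    Hf p ε a - Hf p ε b ≤ (1 + a) ^ (-(1 + ε) / p) * (a - b) := by
  have hw : 0 < 1 + a := by linarith
  have hu : 0 < 1 + b := by linarith
  set z := (1 + b) / (1 + a) with hz
  have hz0 : 0 < z := by positivity
  have hz1 : z ≤ 1 := by rw [hz, div_le_one hw]; linarith
  have hβ : (p - 1 - ε) / p ≤ 1 := by rw [div_le_one hp]; linarith
  have h1 : z ≤ z ^ ((p - 1 - ε) / p) := by
    nth_rewrite 1 [← Real.rpow_one z]
    exact Real.rpow_le_rpow_of_exponent_ge hz0 hz1 hβ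
  have e1 : (1 + b) ^ ((p - 1 - ε) / p) = z ^ ((p - 1 - ε) / p) * (1 + a) ^ ((p - 1 - ε) / p) := by
    rw [hz, Real.div_rpow hu.le hw.le]; field_simp
  have e2 : (1 + a) ^ (-(1 + ε) / p) * (a - b) = (1 + a) ^ ((p - 1 - ε) / p) * (1 - z) := by
    have : (p - 1 - ε) / p = -(1 + ε) / p + 1 := by field_simp; ring
    rw [this, Real.rpow_add hw, Real.rpow_one, hz]; field_simp; ring
  have h0 : 0 < (1 + a) ^ ((p - 1 - ε) / p) := by positivity
  unfold Hf
  rw [e2, e1]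
  nlinarith

lemma Hf_mono {p ε a b : ℝ} (hp : 0 < p) (hεp : ε < p - 1) (hb : 0 ≤ b) (hab : b ≤ a) :
    Hf p ε b ≤ Hf p ε a := by
  have : 0 < p - 1 - ε := by linarith
  unfold Hf; gcongr

lemma Hf_nonneg {p ε t : ℝ} (hp : 0 < p) (hεp : ε < p - 1) (ht : 0 ≤ t) : 0 ≤ Hf p ε t := by
  rw [← Hf_zero p ε]; exact Hf_mono hp hεp le_rfl ht

lemma Hf_sub_rpow_le {p ε a b : ℝ} (hp : 0 < p) (hε : 0 < ε) (hεp : ε < p - 1) (hb : 0 ≤ b)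
    (hab : b ≤ a) :
    (Hf p ε a - Hf p ε b) ^ p ≤ 1 / ε * ((a - b) ^ (p - 1) * (Sf ε a - Sf ε b)) := by
  have hw : 0 < 1 + a := by linarith
  have hd : 0 ≤ a - b := by linarith
  have h1 := Real.rpow_le_rpow (sub_nonneg.2 (Hf_mono hp hεp hb hab)) (Hf_sub_le hp hε hb hab) hp.le
  refine h1.trans ?_
  rw [Real.mul_rpow (by positivity) hd, ← Real.rpow_mul hw.le, div_mul_cancel₀ _ hp.ne']
  have h2 := Sf_sub_ge hε hb hab
  have e : (a - b) ^ p = (a - b) ^ (p - 1) * (a - b) := by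
    rcases hd.eq_or_lt with h | h
    · rw [← h, Real.zero_rpow hp.ne', mul_zero]
    · rw [Real.rpow_sub_one h.ne']; field_simp
  rw [e]
  have h3 : 0 ≤ (a - b) ^ (p - 1) := by positivity
  calc (1 + a) ^ (-(1 + ε)) * ((a - b) ^ (p - 1) * (a - b))
      = 1 / ε * ((a - b) ^ (p - 1) * (ε * (1 + a) ^ (-(1 + ε)) * (a - b))) := by field_simp
    _ ≤ _ := by gcongr

lemma Hf_rpow_le {p ε q t : ℝ} (hp : 0 < p) (hεp : ε < p - 1) (hq : p - 1 - ε ≤ q)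
    (ht : 0 ≤ t) : Hf p ε t ^ p ≤ (1 + t) ^ q := by
  have h1 : Hf p ε t ≤ (1 + t) ^ ((p - 1 - ε) / p) := by unfold Hf; linarith
  calc Hf p ε t ^ p ≤ ((1 + t) ^ ((p - 1 - ε) / p)) ^ p :=
        Real.rpow_le_rpow (Hf_nonneg hp hεp ht) h1 hp.le
    _ = (1 + t) ^ (p - 1 - ε) := by
        rw [← Real.rpow_mul (by linarith), div_mul_cancel₀ _ hp.ne']
    _ ≤ _ := Real.rpow_le_rpow_of_exponent_le (by linarith) hq

lemma rpow_sub_le_mul {p X Y : ℝ} (hp : 1 ≤ p) (hX : 0 ≤ X) (hXY : X < Y) :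
    Y ^ p - X ^ p ≤ p * Y ^ (p - 1) * (Y - X) := by
  have hY : 0 < Y := by linarith
  have h := one_add_mul_self_le_rpow_one_add (s := X / Y - 1)
    (by have : 0 ≤ X / Y := by positivity
        linarith) hp
  rw [add_sub_cancel, Real.div_rpow hX hY.le, le_div_iff₀ (by positivity)] at h
  rw [Real.rpow_sub_one hY.ne']
  have e : (1 + p * (X / Y - 1)) * Y ^ p = Y ^ p - p * (Y ^ p / Y) * (Y - X) := by
    field_simp; ring
  linarith

lemma add_rpow_le_two {p x y : ℝ} (hp : 0 ≤ p) (hx : 0 ≤ x) (hy : 0 ≤ y) :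
    (x + y) ^ p ≤ 2 ^ p * (x ^ p + y ^ p) := by
  have h1 : x + y ≤ 2 * max x y := by
    have := le_max_left x y; have := le_max_right x y; linarith
  have h0 : 0 ≤ max x y := le_max_of_le_left hx
  calc (x + y) ^ p ≤ (2 * max x y) ^ p := Real.rpow_le_rpow (by positivity) h1 hp
    _ = 2 ^ p * max x y ^ p := Real.mul_rpow zero_le_two h0
    _ ≤ _ := by
      gcongr
      rcases max_choice x y with h | h <;> rw [h]
      · have : 0 ≤ y ^ p := by positivity
        linarith
      · have : 0 ≤ x ^ p := by positivity
        linarith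

lemma Par.hp0 {n : ℕ} {s p Λ ε q κ : ℝ} (P : Par n s p Λ ε q κ) : 0 < p := by linarith [P.hp]

lemma Par.hβq {n : ℕ} {s p Λ ε q κ : ℝ} (P : Par n s p Λ ε q κ) : p - 1 - ε ≤ q := by
  have := P.hqs; have := P.hε; have : p - 1 ≤ qStar p := le_max_right _ _; linarith

lemma Par.hq0 {n : ℕ} {s p Λ ε q κ : ℝ} (P : Par n s p Λ ε q κ) : 0 < q := by
  have := P.hqs; have : 1 ≤ qStar p := le_max_left _ _; linarith

/-- Growth and coercivity of the nonlinearity along a pair of values. -/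
def GBound (Λ p G d : ℝ) : Prop := |G| ≤ Λ * |d| ^ (p - 1) ∧ |d| ^ p ≤ Λ * (G * d)

lemma GBound.neg {Λ p G d : ℝ} (h : GBound Λ p G d) : GBound Λ p (-G) (-d) := by
  unfold GBound at *; rw [abs_neg, abs_neg, neg_mul_neg]; exact h

lemma GBound.neg' {Λ p G a b : ℝ} (h : GBound Λ p G (a - b)) : GBound Λ p (-G) (b - a) := by
  have := h.neg; rwa [neg_sub] at this

lemma GBound.le_of_pos {Λ p G d : ℝ} (h : GBound Λ p G d) (hd : 0 < d) :
    d ^ (p - 1) ≤ Λ * G ∧ G ≤ Λ * d ^ (p - 1) := by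
  obtain ⟨h1, h2⟩ := h
  rw [abs_of_pos hd] at h1 h2
  refine ⟨?_, (le_abs_self G).trans h1⟩
  rw [Real.rpow_sub_one hd.ne', div_le_iff₀ hd]; linarith

lemma pair_absorb {n : ℕ} {s p Λ ε q κ : ℝ} (P : Par n s p Λ ε q κ) {D0 C' : ℝ}
    (hD0 : D0 = 2 * Λ ^ 2 * p / ε) (hC' : C' = Λ * p * D0 ^ (p - 1))
    {a b X Y G : ℝ} (hb : 0 < b) (hab : b < a) (hX : 0 ≤ X) (hY : 0 ≤ Y)
    (hG : GBound Λ p G (a - b)) :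
    (a - b) ^ (p - 1) * (Y ^ p * (Sf ε a - Sf ε b)) ≤
      2 * Λ * (G * (X ^ p * Sf ε a - Y ^ p * Sf ε b) + C' * (|X - Y| ^ p * Wf q a)) := by
  have hp0 := P.hp0
  have hp := P.hp
  have hε := P.hε
  have hΛ0 : 0 < Λ := by linarith [P.hΛ]
  have hD00 : 0 < D0 := by rw [hD0]; positivity
  have hC'0 : 0 < C' := by rw [hC']; positivity
  have hba := hab.le
  have ha : 0 < a := hb.trans hab
  have hWa := Wf_nonneg q a
  have hd : 0 < a - b := by linarith
  obtain ⟨g1, g2⟩ := hG.le_of_pos hd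
  have hSa := Sf_nonneg hε ha.le
  have hSb := Sf_nonneg hε hb.le
  have hSa1 := Sf_le_one (ε := ε) ha.le
  have hSS := Sf_mono hε hb.le hba
  have hSg := Sf_sub_ge hε hb.le hba
  set D := (a - b) ^ (p - 1) with hD
  have hDp : 0 < D := by positivity
  set F := D * (Y ^ p * (Sf ε a - Sf ε b)) with hF
  have hS0 : 0 ≤ Y ^ p * (Sf ε a - Sf ε b) := mul_nonneg (by positivity) (by linarith)
  have hF0 : 0 ≤ F := mul_nonneg hDp.le hS0
  set T := G * (X ^ p * Sf ε a - Y ^ p * Sf ε b) with hT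
  set E := |X - Y| ^ p * Wf q a with hE
  have hE0 : 0 ≤ E := by positivity
  have hG0 : 0 ≤ G := by
    have : 0 ≤ Λ * G := le_trans hDp.le g1
    exact nonneg_of_mul_nonneg_right this hΛ0
  have hFG : F ≤ Λ * (G * (Y ^ p * (Sf ε a - Sf ε b))) := by
    calc F ≤ (Λ * G) * (Y ^ p * (Sf ε a - Sf ε b)) := by rw [hF]; gcongr
      _ = _ := by ring
  clear_value D F T E
  rcases le_or_gt Y X with hYX | hXY
  · have h1 : Y ^ p ≤ X ^ p := Real.rpow_le_rpow hY hYX hp0.le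
    have h2 : G * (Y ^ p * (Sf ε a - Sf ε b)) ≤ T := by
      rw [hT]
      refine mul_le_mul_of_nonneg_left ?_ hG0
      have := mul_le_mul_of_nonneg_right h1 hSa
      linarith
    have h4 : Λ * (G * (Y ^ p * (Sf ε a - Sf ε b))) ≤ Λ * T := by gcongr
    have h5 : 0 ≤ Λ * (C' * E) := by positivity
    linarith
  · have hY0 : 0 < Y := by linarith
    have h1 := rpow_sub_le_mul hp.le hX hXY
    set Δ := Y - X with hΔ
    have hΔp : 0 < Δ := by rw [hΔ]; linarith
    have hEe : E = Δ ^ p * (1 + a) ^ q := by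
      rw [hE, Wf_of_pos ha, abs_sub_comm, abs_of_pos hΔp]
    set R := Λ * p * Δ * (D * Y ^ (p - 1)) with hR
    have h2 : G * ((Y ^ p - X ^ p) * Sf ε a) ≤ R := by
      have h0 : 0 ≤ Y ^ p - X ^ p := sub_nonneg.2 (Real.rpow_le_rpow hX hXY.le hp0.le)
      calc G * ((Y ^ p - X ^ p) * Sf ε a) ≤ (Λ * D) * ((p * Y ^ (p - 1) * Δ) * 1) := by
            gcongr
        _ = R := by rw [hR]; ring
    have h3 : T = G * (Y ^ p * (Sf ε a - Sf ε b)) - G * ((Y ^ p - X ^ p) * Sf ε a) := by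
      rw [hT]; ring
    have h4 : Λ * R ≤ 1 / 2 * F + Λ * (C' * E) := by
      rcases le_or_gt (Λ ^ 2 * p * Δ) (1 / 2 * (Y * (ε * (1 + a) ^ (-(1 + ε)) * (a - b)))) with h | h
      · have : Λ * R ≤ 1 / 2 * F := by
          calc Λ * R = (D * Y ^ (p - 1)) * (Λ ^ 2 * p * Δ) := by rw [hR]; ring
            _ ≤ (D * Y ^ (p - 1)) * (1 / 2 * (Y * (Sf ε a - Sf ε b))) := by
                refine mul_le_mul_of_nonneg_left (h.trans ?_) (by positivity)
                gcongr
            _ = 1 / 2 * F := by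
                rw [hF, Real.rpow_sub_one hY0.ne']; field_simp
        have : 0 ≤ Λ * (C' * E) := by positivity
        linarith
      · have hw : 0 < 1 + a := by linarith
        have h5 : Y * (a - b) ≤ D0 * (1 + a) ^ (1 + ε) * Δ := by
          rw [Real.rpow_neg hw.le] at h
          have hw' : 0 < (1 + a) ^ (1 + ε) := by positivity
          have : 1 / 2 * (Y * (ε * ((1 + a) ^ (1 + ε))⁻¹ * (a - b))) =
            (ε * (Y * (a - b))) / (2 * (1 + a) ^ (1 + ε)) := by field_simp
          rw [this, div_lt_iff₀ (by positivity)] at h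
          rw [hD0]
          have e : 2 * Λ ^ 2 * p / ε * (1 + a) ^ (1 + ε) * Δ =
            (Λ ^ 2 * p * Δ * (2 * (1 + a) ^ (1 + ε))) / ε := by field_simp
          rw [e, le_div_iff₀ hε]; linarith
        have h6 : D * Y ^ (p - 1) ≤ D0 ^ (p - 1) * (1 + a) ^ q * Δ ^ (p - 1) := by
          calc D * Y ^ (p - 1) = (Y * (a - b)) ^ (p - 1) := by
                rw [hD, Real.mul_rpow hY hd.le]; ring
            _ ≤ (D0 * (1 + a) ^ (1 + ε) * Δ) ^ (p - 1) :=
                Real.rpow_le_rpow (by positivity) h5 (by linarith)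
            _ = D0 ^ (p - 1) * (1 + a) ^ ((1 + ε) * (p - 1)) * Δ ^ (p - 1) := by
                rw [Real.mul_rpow (by positivity) hΔp.le, Real.mul_rpow hD00.le (by positivity),
                  ← Real.rpow_mul hw.le]
            _ ≤ _ := by
                gcongr ?_ * ?_ * ?_
                exact Real.rpow_le_rpow_of_exponent_le (by linarith) P.hq1
        have : R ≤ C' * E := by
          calc R ≤ Λ * p * Δ * (D0 ^ (p - 1) * (1 + a) ^ q * Δ ^ (p - 1)) := by
                rw [hR]; gcongr
            _ = C' * E := by
                rw [hC', hEe, Real.rpow_sub_one hΔp.ne']; field_simp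
        have : Λ * R ≤ Λ * (C' * E) := by gcongr
        linarith
    have h5 : Λ * T ≥ Λ * (G * (Y ^ p * (Sf ε a - Sf ε b))) - Λ * R := by
      rw [h3, mul_sub]
      have := mul_le_mul_of_nonneg_left h2 hΛ0.le
      linarith
    linarith

lemma pair_inner_of_le {n : ℕ} {s p Λ ε q κ : ℝ} (P : Par n s p Λ ε q κ) :
    ∃ C M : ℝ, Λ ≤ C ∧ 0 < M ∧ ∀ a b X Y G : ℝ, b ≤ a → 0 ≤ X → X ≤ 1 → 0 ≤ Y → Y ≤ 1 →
      GBound Λ p G (a - b) →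
      |X * Hf p ε (max a 0) - Y * Hf p ε (max b 0)| ^ p +
          X ^ p * Sf ε (max a 0) * (max (-b) 0) ^ (p - 1) ≤
        C * (G * (X ^ p * Sf ε (max a 0) - Y ^ p * Sf ε (max b 0))) +
          M * (|X - Y| ^ p * (Wf q a + Wf q b)) := by
  have hp0 := P.hp0
  have hp := P.hp
  have hε := P.hε
  have hεp := P.hεp
  have hΛ := P.hΛ
  have hβq := P.hβq
  have hΛ0 : 0 < Λ := by linarith
  set D0 : ℝ := 2 * Λ ^ 2 * p / ε with hD0
  have hD00 : 0 < D0 := by positivity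
  set C' : ℝ := Λ * p * D0 ^ (p - 1) with hC'
  have hC'0 : 0 < C' := by positivity
  set C : ℝ := (1 / ε + 1) * Λ + 2 ^ p * (2 * Λ / ε) with hC
  have hC0 : 0 < C := by positivity
  set M : ℝ := C * C' + 2 ^ p with hM
  have hM0 : 0 < M := by positivity
  have hCΛ : Λ ≤ C := by
    have h1 : 0 ≤ 2 ^ p * (2 * Λ / ε) := by positivity
    have h2 : 0 ≤ 1 / ε * Λ := by positivity
    rw [hC, add_mul, one_mul]; linarith
  refine ⟨C, M, hCΛ, hM0, ?_⟩
  intro a b X Y G hba hX hX1 hY hY1 hG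
  have hWa := Wf_nonneg q a
  have hWb := Wf_nonneg q b
  have hΔ0 : 0 ≤ |X - Y| ^ p := by positivity
  rcases le_or_gt a 0 with ha | ha
  · rw [max_eq_right ha, max_eq_right (hba.trans ha), Sf_zero, Hf_zero]
    simp only [mul_zero, sub_zero, abs_zero, zero_mul, Real.zero_rpow hp0.ne', add_zero, zero_add]
    positivity
  rcases le_or_gt b 0 with hb | hb
  · rw [max_eq_left ha.le, max_eq_right hb, max_eq_left (by linarith), Sf_zero, Hf_zero]
    simp only [mul_zero, sub_zero]
    have hd : 0 < a - b := by linarith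
    obtain ⟨g1, g2⟩ := hG.le_of_pos hd
    have hS := Sf_nonneg hε ha.le
    have hH := Hf_sub_rpow_le hp0 hε hεp le_rfl ha.le
    rw [Sf_zero, Hf_zero] at hH
    simp only [sub_zero] at hH
    rw [abs_of_nonneg (mul_nonneg hX (Hf_nonneg hp0 hεp ha.le)), Real.mul_rpow hX
      (Hf_nonneg hp0 hεp ha.le)]
    have i1 : a ^ (p - 1) ≤ (a - b) ^ (p - 1) :=
      Real.rpow_le_rpow ha.le (by linarith) (by linarith)
    have i2 : (-b) ^ (p - 1) ≤ (a - b) ^ (p - 1) :=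
      Real.rpow_le_rpow (by linarith) (by linarith) (by linarith)
    have hXp : 0 ≤ X ^ p := by positivity
    have hGX : 0 ≤ G * (X ^ p * Sf ε a) := by
      have : 0 ≤ G := by
        have : 0 ≤ Λ * G := le_trans (by positivity) g1
        exact nonneg_of_mul_nonneg_right this hΛ0
      positivity
    calc X ^ p * Hf p ε a ^ p + X ^ p * Sf ε a * (-b) ^ (p - 1)
        ≤ X ^ p * (1 / ε * ((a - b) ^ (p - 1) * Sf ε a)) + X ^ p * Sf ε a * (a - b) ^ (p - 1) := by
          gcongr
          exact hH.trans (by gcongr)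
      _ = (1 / ε + 1) * (X ^ p * Sf ε a) * (a - b) ^ (p - 1) := by ring
      _ ≤ (1 / ε + 1) * (X ^ p * Sf ε a) * (Λ * G) := by gcongr
      _ = ((1 / ε + 1) * Λ) * (G * (X ^ p * Sf ε a)) := by ring
      _ ≤ C * (G * (X ^ p * Sf ε a)) := by
          gcongr
          rw [hC]
          have h2 : 0 ≤ 2 ^ p * (2 * Λ / ε) := by positivity
          linarith
      _ ≤ _ := le_add_of_nonneg_right (by positivity)
  rcases hba.eq_or_lt with hab | hab
  · subst hab
    have hG0 : G = 0 := by
      have := hG.1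
      rw [sub_self, abs_zero, Real.zero_rpow (by linarith : p - 1 ≠ 0), mul_zero] at this
      exact abs_nonpos_iff.1 this
    rw [hG0, zero_mul, mul_zero, zero_add, max_eq_left ha.le, max_eq_right (by linarith : -b ≤ 0),
      Real.zero_rpow (by linarith : p - 1 ≠ 0), mul_zero, add_zero, ← sub_mul, abs_mul,
      Real.mul_rpow (abs_nonneg _) (abs_nonneg _), abs_of_nonneg (Hf_nonneg hp0 hεp ha.le)]
    have h1 := Hf_rpow_le hp0 hεp hβq ha.le
    rw [← Wf_of_pos ha] at h1
    have h2 : (1 : ℝ) ≤ M := by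
      have h3 : (1 : ℝ) ≤ 2 ^ p := Real.one_le_rpow one_le_two hp0.le
      have h4 : 0 ≤ C * C' := by positivity
      linarith
    calc _ ≤ |X - Y| ^ p * Wf q b := by gcongr
      _ ≤ 1 * (|X - Y| ^ p * (Wf q b + Wf q b)) := by
        rw [one_mul]; gcongr; linarith
      _ ≤ _ := by gcongr
  have hd : 0 < a - b := by linarith
  obtain ⟨g1, g2⟩ := hG.le_of_pos hd
  rw [max_eq_left ha.le, max_eq_left hb.le, max_eq_right (by linarith : -b ≤ 0),
      Real.zero_rpow (by linarith : p - 1 ≠ 0), mul_zero, add_zero]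
  have hSa := Sf_nonneg hε ha.le
  have hSb := Sf_nonneg hε hb.le
  have hSa1 := Sf_le_one (ε := ε) ha.le
  have hSS := Sf_mono hε hb.le hba
  have hSg := Sf_sub_ge hε hb.le hba
  have hHa := Hf_nonneg hp0 hεp ha.le
  have hHH := Hf_mono hp0 hεp hb.le hba
  set D := (a - b) ^ (p - 1) with hD
  have hDp : 0 < D := by positivity
  set F := D * (Y ^ p * (Sf ε a - Sf ε b)) with hF
  have hF0 : 0 ≤ F := mul_nonneg hDp.le (mul_nonneg (by positivity) (by linarith))
  set T := G * (X ^ p * Sf ε a - Y ^ p * Sf ε b) with hT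
  set E := |X - Y| ^ p * Wf q a with hE
  have hE0 : 0 ≤ E := by positivity
  have hG0 : 0 ≤ G := by
    have : 0 ≤ Λ * G := le_trans hDp.le g1
    exact nonneg_of_mul_nonneg_right this hΛ0
  have hFG : F ≤ Λ * (G * (Y ^ p * (Sf ε a - Sf ε b))) := by
    have : 0 ≤ Y ^ p * (Sf ε a - Sf ε b) := mul_nonneg (by positivity) (by linarith)
    calc F ≤ (Λ * G) * (Y ^ p * (Sf ε a - Sf ε b)) := by rw [hF]; gcongr
      _ = _ := by ring
  have key : F ≤ 2 * Λ * (T + C' * E) := pair_absorb P hD0 hC' hb hab hX hY hG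
  have hLHS : |X * Hf p ε a - Y * Hf p ε b| ^ p ≤ 2 ^ p * (1 / ε * F + E) := by
    have h1 : |X * Hf p ε a - Y * Hf p ε b| ≤ Y * (Hf p ε a - Hf p ε b) + |X - Y| * Hf p ε a := by
      have : X * Hf p ε a - Y * Hf p ε b = Y * (Hf p ε a - Hf p ε b) + (X - Y) * Hf p ε a := by ring
      rw [this]
      refine (abs_add_le _ _).trans ?_
      rw [abs_mul, abs_mul, abs_of_nonneg hY, abs_of_nonneg (sub_nonneg.2 hHH), abs_of_nonneg hHa]
    have hHd : 0 ≤ Hf p ε a - Hf p ε b := by linarith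
    calc _ ≤ (Y * (Hf p ε a - Hf p ε b) + |X - Y| * Hf p ε a) ^ p :=
          Real.rpow_le_rpow (abs_nonneg _) h1 hp0.le
      _ ≤ 2 ^ p * ((Y * (Hf p ε a - Hf p ε b)) ^ p + (|X - Y| * Hf p ε a) ^ p) :=
          add_rpow_le_two hp0.le (by positivity) (by positivity)
      _ = 2 ^ p * (Y ^ p * (Hf p ε a - Hf p ε b) ^ p + |X - Y| ^ p * Hf p ε a ^ p) := by
          rw [Real.mul_rpow hY hHd, Real.mul_rpow (abs_nonneg _) hHa]
      _ ≤ 2 ^ p * (Y ^ p * (1 / ε * ((a - b) ^ (p - 1) * (Sf ε a - Sf ε b))) +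
            |X - Y| ^ p * Wf q a) := by
          gcongr
          · exact Hf_sub_rpow_le hp0 hε hεp hb.le hba
          · rw [Wf_of_pos ha]; exact Hf_rpow_le hp0 hεp hβq ha.le
      _ = _ := by rw [hF, hE]; ring
  refine hLHS.trans ?_
  have hTlow : 0 ≤ T + C' * E := by
    have : 0 ≤ 2 * Λ * (T + C' * E) := hF0.trans key
    exact nonneg_of_mul_nonneg_right this (by positivity)
  have hE2 : E ≤ |X - Y| ^ p * (Wf q a + Wf q b) := by rw [hE]; gcongr; linarith
  have h1 : 2 ^ p * (1 / ε * F) ≤ C * (T + C' * E) := by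
    calc 2 ^ p * (1 / ε * F) ≤ 2 ^ p * (1 / ε * (2 * Λ * (T + C' * E))) := by gcongr
      _ = 2 ^ p * (2 * Λ / ε) * (T + C' * E) := by field_simp
      _ ≤ _ := by
        gcongr
        rw [hC]
        have : 0 ≤ (1 / ε + 1) * Λ := by positivity
        linarith
  have h2 : M * E ≤ M * (|X - Y| ^ p * (Wf q a + Wf q b)) := by gcongr
  have h3 : 2 ^ p * (1 / ε * F + E) = 2 ^ p * (1 / ε * F) + 2 ^ p * E := by ring
  have h4 : M * E = C * (C' * E) + 2 ^ p * E := by rw [hM]; ring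
  linarith

lemma pair_inner {n : ℕ} {s p Λ ε q κ : ℝ} (P : Par n s p Λ ε q κ) :
    ∃ C M : ℝ, Λ ≤ C ∧ 0 < M ∧ ∀ a b X Y G : ℝ, 0 ≤ X → X ≤ 1 → 0 ≤ Y → Y ≤ 1 →
      GBound Λ p G (a - b) →
      |X * Hf p ε (max a 0) - Y * Hf p ε (max b 0)| ^ p +
          X ^ p * Sf ε (max a 0) * (max (-b) 0) ^ (p - 1) ≤
        C * (G * (X ^ p * Sf ε (max a 0) - Y ^ p * Sf ε (max b 0))) +
          M * (|X - Y| ^ p * (Wf q a + Wf q b)) := by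
  obtain ⟨C, M, hC, hM, H⟩ := pair_inner_of_le P
  refine ⟨C, M, hC, hM, fun a b X Y G hX hX1 hY hY1 hG => ?_⟩
  rcases le_or_gt b a with h | h
  · exact H a b X Y G h hX hX1 hY hY1 hG
  have h1 := H b a Y X (-G) h.le hY hY1 hX hX1 hG.neg'
  have h2 : 0 ≤ Y ^ p * Sf ε (max b 0) * (max (-a) 0) ^ (p - 1) := by
    have := Sf_nonneg P.hε (le_max_right b 0)
    positivity
  have h3 : X ^ p * Sf ε (max a 0) * (max (-b) 0) ^ (p - 1) = 0 := by
    rcases le_or_gt a 0 with ha | ha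
    · rw [max_eq_right ha, Sf_zero]; ring
    · rw [max_eq_right (by linarith : -b ≤ 0), Real.zero_rpow (by linarith [P.hp] : p - 1 ≠ 0),
        mul_zero]
  rw [h3, add_zero, abs_sub_comm]
  rw [abs_sub_comm Y X, add_comm (Wf q b)] at h1
  have h4 : -G * (Y ^ p * Sf ε (max b 0) - X ^ p * Sf ε (max a 0)) =
      G * (X ^ p * Sf ε (max a 0) - Y ^ p * Sf ε (max b 0)) := by ring
  rw [h4] at h1
  linarith

/-- Pairs with one point outside the support of the cutoff. -/
lemma pair_outer {n : ℕ} {s p Λ ε q κ : ℝ} (P : Par n s p Λ ε q κ) {a b X G : ℝ} (hX : 0 ≤ X)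
    (hG : GBound Λ p G (a - b)) :
    |X * Hf p ε (max a 0)| ^ p + X ^ p * Sf ε (max a 0) * (max (-b) 0) ^ (p - 1) ≤
      Λ * (G * (X ^ p * Sf ε (max a 0))) +
        Λ ^ 2 * (X ^ p * (Wf q a * (1 + (max b 0) ^ (p - 1)))) := by
  have hp0 := P.hp0
  have hp := P.hp
  have hΛ := P.hΛ
  have hΛ2 : (1 : ℝ) ≤ Λ ^ 2 := one_le_pow₀ hΛ
  have hε := P.hε
  have hXp : 0 ≤ X ^ p := by positivity
  rcases le_or_gt a 0 with ha | ha
  · rw [max_eq_right ha, Sf_zero, Hf_zero]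
    have := Wf_nonneg q a
    simp only [mul_zero, abs_zero, zero_mul, Real.zero_rpow hp0.ne', add_zero, zero_add]
    positivity
  rw [max_eq_left ha.le, abs_of_nonneg (mul_nonneg hX (Hf_nonneg hp0 P.hεp ha.le)),
    Real.mul_rpow hX (Hf_nonneg hp0 P.hεp ha.le)]
  have hH := Hf_rpow_le hp0 P.hεp P.hβq ha.le
  rw [← Wf_of_pos ha] at hH
  have hS := Sf_nonneg hε ha.le
  have hS1 := Sf_le_one (ε := ε) ha.le
  have hW1 : 1 ≤ Wf q a := by
    rw [Wf_of_pos ha]; exact Real.one_le_rpow (by linarith) P.hq0.le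
  have hb0 : 0 ≤ max b 0 ^ (p - 1) := by positivity
  have hm : X ^ p * Hf p ε a ^ p ≤ Λ ^ 2 * (X ^ p * Wf q a) := by
    calc X ^ p * Hf p ε a ^ p ≤ 1 * (X ^ p * Wf q a) := by rw [one_mul]; gcongr
      _ ≤ _ := by gcongr
  have hXS : 0 ≤ X ^ p * Sf ε a := by positivity
  rcases le_or_gt b 0 with hb | hb
  · have hd : 0 < a - b := by linarith
    obtain ⟨g1, g2⟩ := hG.le_of_pos hd
    rw [max_eq_left (by linarith), max_eq_right hb, Real.zero_rpow (by linarith : p - 1 ≠ 0),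
      add_zero, mul_one]
    have i2 : (-b) ^ (p - 1) ≤ Λ * G :=
      (Real.rpow_le_rpow (by linarith) (by linarith) (by linarith)).trans g1
    have : X ^ p * Sf ε a * (-b) ^ (p - 1) ≤ X ^ p * Sf ε a * (Λ * G) := by gcongr
    linarith
  · rw [max_eq_right (by linarith : -b ≤ 0), max_eq_left hb.le,
      Real.zero_rpow (by linarith : p - 1 ≠ 0), mul_zero, add_zero]
    have hGl : -(Λ * b ^ (p - 1)) ≤ G := by
      rcases le_or_gt b a with hba | hba
      · rcases hba.eq_or_lt with h | h
        · have h1 := hG.1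
          rw [h, sub_self, abs_zero, Real.zero_rpow (by linarith : p - 1 ≠ 0), mul_zero] at h1
          rw [abs_nonpos_iff.1 h1, neg_nonpos]
          positivity
        · have g1 := (hG.le_of_pos (sub_pos.2 h)).1
          have h0 : 0 ≤ G := by
            have h3 : 0 < a - b := sub_pos.2 h
            have : 0 ≤ Λ * G := le_trans (by positivity) g1
            exact nonneg_of_mul_nonneg_right this (by linarith)
          refine le_trans ?_ h0
          rw [neg_nonpos]; positivity
      · have g2 := (hG.neg'.le_of_pos (sub_pos.2 hba)).2
        have : Λ * (b - a) ^ (p - 1) ≤ Λ * b ^ (p - 1) := by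
          have : 0 ≤ b - a := by linarith
          gcongr
          linarith
        linarith
    have h1 : X ^ p * Sf ε a * (-(Λ * b ^ (p - 1))) ≤ X ^ p * Sf ε a * G := by gcongr
    have h2 : Λ * (X ^ p * Sf ε a * (-(Λ * b ^ (p - 1)))) ≤ Λ * (X ^ p * Sf ε a * G) := by gcongr
    have h3 : Λ ^ 2 * (X ^ p * Sf ε a * b ^ (p - 1)) ≤ Λ ^ 2 * (X ^ p * Wf q a * b ^ (p - 1)) := by
      gcongr; linarith
    have e1 : Λ * (X ^ p * Sf ε a * (-(Λ * b ^ (p - 1)))) =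
      -(Λ ^ 2 * (X ^ p * Sf ε a * b ^ (p - 1))) := by ring
    have e2 : Λ ^ 2 * (X ^ p * (Wf q a * (1 + b ^ (p - 1)))) =
      Λ ^ 2 * (X ^ p * Wf q a) + Λ ^ 2 * (X ^ p * Wf q a * b ^ (p - 1)) := by ring
    have e3 : Λ * (G * (X ^ p * Sf ε a)) = Λ * (X ^ p * Sf ε a * G) := by ring
    linarith

/-- Double integral against the model kernel. -/
def dint (n : ℕ) (s p : ℝ) (F : Rn n → Rn n → ℝ) : ℝ≥0∞ :=
  ∫⁻ x, ∫⁻ y, ENNReal.ofReal (F x y) * fracKer n s p x y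

section dint

variable {n : ℕ} {s p : ℝ}

lemma dint_mono {F G : Rn n → Rn n → ℝ} (h : ∀ x y, F x y ≤ G x y) :
    dint n s p F ≤ dint n s p G := by
  refine lintegral_mono fun x => lintegral_mono fun y => ?_
  have := h x y
  gcongr

lemma measurable_dint_inner {F : Rn n → Rn n → ℝ} (hF : Measurable (Function.uncurry F)) :
    Measurable (Function.uncurry fun x y => ENNReal.ofReal (F x y) * fracKer n s p x y) :=
  hF.ennreal_ofReal.mul (measurable_fracKer n s p)

lemma dint_add {F G : Rn n → Rn n → ℝ} (hF : Measurable (Function.uncurry F))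
    (hF0 : ∀ x y, 0 ≤ F x y) (hG0 : ∀ x y, 0 ≤ G x y) :
    dint n s p (fun x y => F x y + G x y) = dint n s p F + dint n s p G := by
  unfold dint
  have h1 : Measurable fun x => ∫⁻ y, ENNReal.ofReal (F x y) * fracKer n s p x y :=
    (measurable_dint_inner hF).lintegral_prod_right'
  rw [← lintegral_add_left h1]
  refine lintegral_congr fun x => ?_
  have h2 : Measurable fun y => ENNReal.ofReal (F x y) * fracKer n s p x y :=
    (measurable_dint_inner hF).comp measurable_prodMk_left
  rw [← lintegral_add_left h2]
  refine lintegral_congr fun y => ?_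
  rw [ENNReal.ofReal_add (hF0 x y) (hG0 x y), add_mul]

lemma dint_const_mul {F : Rn n → Rn n → ℝ} {c : ℝ} (hc : 0 ≤ c) :
    dint n s p (fun x y => c * F x y) = ENNReal.ofReal c * dint n s p F := by
  unfold dint
  rw [← lintegral_const_mul' _ _ ENNReal.ofReal_ne_top]
  refine lintegral_congr fun x => ?_
  rw [← lintegral_const_mul' _ _ ENNReal.ofReal_ne_top]
  refine lintegral_congr fun y => ?_
  rw [ENNReal.ofReal_mul hc, mul_assoc]

lemma dint_swap {F : Rn n → Rn n → ℝ} (hF : Measurable (Function.uncurry F)) :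
    dint n s p (fun x y => F y x) = dint n s p F := by
  unfold dint
  rw [lintegral_lintegral_swap (measurable_dint_inner hF).aemeasurable]
  refine lintegral_congr fun x => lintegral_congr fun y => ?_
  rw [fracKer_comm]

lemma dint_affine (x₀ : Rn n) {R : ℝ} (hR : 0 < R) (F : Rn n → Rn n → ℝ) :
    dint n s p F = ENNReal.ofReal (R ^ ((n : ℝ) - s * p)) *
      dint n s p (fun x y => F (x₀ + R • x) (x₀ + R • y)) := by
  unfold dint
  rw [lintegral_affine x₀ hR]
  have : ∀ x, ∫⁻ y, ENNReal.ofReal (F (x₀ + R • x) y) * fracKer n s p (x₀ + R • x) y =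
      ENNReal.ofReal (R ^ (-(s * p))) *
        ∫⁻ y, ENNReal.ofReal (F (x₀ + R • x) (x₀ + R • y)) * fracKer n s p x y := by
    intro x
    rw [lintegral_affine x₀ hR, ← lintegral_const_mul' _ _ ENNReal.ofReal_ne_top,
      ← lintegral_const_mul' _ _ ENNReal.ofReal_ne_top]
    refine lintegral_congr fun y => ?_
    rw [fracKer_affine x₀ hR, mul_left_comm _ (ENNReal.ofReal (R ^ _)), ← mul_assoc,
      ← ENNReal.ofReal_mul (by positivity)]
    congr 2
    rw [← Real.rpow_natCast, ← Real.rpow_add hR]; congr 1; ring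
  simp_rw [this]
  rw [lintegral_const_mul' _ _ ENNReal.ofReal_ne_top, ← mul_assoc,
    ← ENNReal.ofReal_mul (by positivity)]
  congr 2
  rw [← Real.rpow_natCast, ← Real.rpow_add hR]; congr 1

end dint

/-- Energy class of solutions with right-hand side of mass at most `m` in a ball, tested with
functions bounded by one. -/
structure IsSub (n : ℕ) (s p Λ : ℝ) (v : Rn n → ℝ) (x₀ : Rn n) (R m : ℝ) : Prop where
  meas : Measurable v
  energy : dint n s p (fun x y => |v x - v y| ^ p) < ⊤
  memLp : ∫⁻ x in ball x₀ R, ENNReal.ofReal (|v x| ^ p) < ⊤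
  mass : 0 ≤ m
  ineq : ∃ g : Rn n → Rn n → ℝ, Measurable (Function.uncurry g) ∧
    (∀ x y, GBound Λ p (g x y) (v x - v y)) ∧
    ∀ φ : Rn n → ℝ, Measurable φ → (∀ x, 0 ≤ φ x) → (∀ x, φ x ≤ 1) →
      (∃ r < R, ∀ x, r < dist x x₀ → φ x = 0) →
      dint n s p (fun x y => |φ x - φ y| ^ p) < ⊤ →
      dint n s p (fun x y => g x y * (φ x - φ y)) ≤
        ENNReal.ofReal m + dint n s p (fun x y => -(g x y * (φ x - φ y)))

lemma rpow_sub_one_mul_le {p x y : ℝ} (hp : 1 ≤ p) (hx : 0 ≤ x) (hy : 0 ≤ y) :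
    x ^ (p - 1) * y ≤ x ^ p + y ^ p := by
  have h0 : 0 ≤ max x y := le_max_of_le_left hx
  have e : ∀ z : ℝ, 0 ≤ z → z ^ (p - 1) * z = z ^ p := by
    intro z hz
    rcases hz.eq_or_lt with h | h
    · rw [← h, mul_zero, Real.zero_rpow (by linarith)]
    · rw [Real.rpow_sub_one h.ne']; field_simp
  calc x ^ (p - 1) * y ≤ max x y ^ (p - 1) * max x y := by
        have : 0 ≤ p - 1 := sub_nonneg.2 hp
        gcongr
        · exact le_max_left _ _
        · exact le_max_right _ _
    _ = max x y ^ p := e _ h0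
    _ ≤ _ := by
      have : 0 ≤ x ^ p := by positivity
      have : 0 ≤ y ^ p := by positivity
      rcases max_choice x y with h | h <;> rw [h] <;> linarith

lemma dint_mul_lt_top {n : ℕ} {s p Λ : ℝ} (hp : 1 ≤ p) (hΛ : 0 ≤ Λ) {v φ : Rn n → ℝ}
    {g : Rn n → Rn n → ℝ} (hv : Measurable v)
    (hE : dint n s p (fun x y => |v x - v y| ^ p) < ⊤)
    (hφ : dint n s p (fun x y => |φ x - φ y| ^ p) < ⊤)
    (hg : ∀ x y, |g x y| ≤ Λ * |v x - v y| ^ (p - 1)) :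
    dint n s p (fun x y => |g x y * (φ x - φ y)|) < ⊤ := by
  have h1 : dint n s p (fun x y => |g x y * (φ x - φ y)|) ≤
      dint n s p (fun x y => Λ * (|v x - v y| ^ p + |φ x - φ y| ^ p)) := by
    refine dint_mono fun x y => ?_
    rw [abs_mul]
    calc |g x y| * |φ x - φ y| ≤ (Λ * |v x - v y| ^ (p - 1)) * |φ x - φ y| := by
          gcongr; exact hg x y
      _ = Λ * (|v x - v y| ^ (p - 1) * |φ x - φ y|) := by ring
      _ ≤ _ := by
          gcongr; exact rpow_sub_one_mul_le hp (abs_nonneg _) (abs_nonneg _)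
  refine h1.trans_lt ?_
  rw [dint_const_mul hΛ, dint_add (by fun_prop) (fun x y => by positivity) (fun x y => by positivity)]
  exact ENNReal.mul_lt_top ENNReal.ofReal_lt_top (ENNReal.add_lt_top.2 ⟨hE, hφ⟩)

lemma IsSub.test {n : ℕ} {s p Λ : ℝ} (hp : 1 ≤ p) (hΛ : 0 ≤ Λ) {v : Rn n → ℝ} {x₀ : Rn n} {R m : ℝ}
    (h : IsSub n s p Λ v x₀ R m) :
    ∃ g : Rn n → Rn n → ℝ, (∀ x y, GBound Λ p (g x y) (v x - v y)) ∧
    ∀ φ : Rn n → ℝ, Measurable φ → (∀ x, 0 ≤ φ x) → (∀ x, φ x ≤ 1) →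
      (∃ r < R, ∀ x, r < dist x x₀ → φ x = 0) →
      dint n s p (fun x y => |φ x - φ y| ^ p) < ⊤ →
      ∀ A B : Rn n → Rn n → ℝ, Measurable (Function.uncurry A) → (∀ x y, 0 ≤ A x y) →
        (∀ x y, 0 ≤ B x y) → (∀ x y, A x y ≤ g x y * (φ x - φ y) + B x y) →
      dint n s p A ≤ ENNReal.ofReal m + dint n s p B := by
  obtain ⟨g, hgm, hg, H⟩ := h.ineq
  refine ⟨g, hg, fun φ hφ h0 h1 hs hE A B hA hA0 hB0 hAB => ?_⟩
  have hI := H φ hφ h0 h1 hs hE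
  set t : Rn n → Rn n → ℝ := fun x y => g x y * (φ x - φ y) with ht
  have htm : Measurable (Function.uncurry t) := by
    have : Measurable fun z : Rn n × Rn n => φ z.1 - φ z.2 := by fun_prop
    exact hgm.mul this
  have hfin : dint n s p (fun x y => -(t x y)) ≠ ⊤ :=
    ((dint_mono fun x y => neg_le_abs _).trans_lt
      (dint_mul_lt_top hp hΛ h.meas h.energy hE (fun x y => (hg x y).1))).ne
  have e1 : dint n s p (fun x y => max (-(t x y)) 0) = dint n s p (fun x y => -(t x y)) := by
    unfold dint; simp
  have e2 : dint n s p (fun x y => max (t x y) 0) = dint n s p t := by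
    unfold dint; simp
  have h3 : dint n s p A + dint n s p (fun x y => -(t x y)) ≤
      dint n s p t + dint n s p B := by
    rw [← e1, ← e2, ← dint_add hA hA0 (fun x y => le_max_right _ _), ← dint_add (by
      exact htm.max measurable_const) (fun x y => le_max_right _ _) hB0]
    refine dint_mono fun x y => ?_
    have := hAB x y
    rcases le_total (t x y) 0 with h | h
    · rw [max_eq_left (by linarith), max_eq_right h]
      linarith
    · rw [max_eq_right (by linarith), max_eq_left h]
      linarith
  have h4 : dint n s p A + dint n s p (fun x y => -(t x y)) ≤
      (ENNReal.ofReal m + dint n s p B) + dint n s p (fun x y => -(t x y)) := by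
    refine h3.trans ?_
    rw [add_right_comm]
    gcongr
  exact (ENNReal.add_le_add_iff_right hfin).1 h4

lemma IsSub.mono {n : ℕ} {s p Λ : ℝ} {v : Rn n → ℝ} {x₀ : Rn n} {R R' m m' : ℝ}
    (h : IsSub n s p Λ v x₀ R m) (hR : R' ≤ R) (hm : m ≤ m') : IsSub n s p Λ v x₀ R' m' := by
  obtain ⟨g, hgm, hg, H⟩ := h.ineq
  refine ⟨h.meas, h.energy, (lintegral_mono_set (ball_subset_ball hR)).trans_lt h.memLp,
    h.mass.trans hm, g, hgm, hg, fun φ hφ h0 h1 ⟨r, hr, hs⟩ hE => ?_⟩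
  refine (H φ hφ h0 h1 ⟨r, hr.trans_le hR, hs⟩ hE).trans ?_
  gcongr

lemma GBound.div {Λ p G a d : ℝ} (hd : 0 < d) (h : GBound Λ p G a) :
    GBound Λ p (G / d ^ (p - 1)) (a / d) := by
  obtain ⟨h1, h2⟩ := h
  have hdp : 0 < d ^ (p - 1) := by positivity
  have e : d ^ p = d ^ (p - 1) * d := by rw [Real.rpow_sub_one hd.ne']; field_simp
  constructor
  · rw [abs_div, abs_of_pos hdp, abs_div, abs_of_pos hd, Real.div_rpow (abs_nonneg _) hd.le,
      ← mul_div_assoc]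
    gcongr
  · rw [abs_div, abs_of_pos hd, Real.div_rpow (abs_nonneg _) hd.le, e]
    have : Λ * (G / d ^ (p - 1) * (a / d)) = Λ * (G * a) / (d ^ (p - 1) * d) := by
      field_simp
    rw [this]
    gcongr

/-- Translation, dilation and affine normalization. -/
lemma IsSub.affine {n : ℕ} {s p Λ : ℝ} (hp : 1 < p) {v : Rn n → ℝ} {x₀ : Rn n} {R m : ℝ}
    (h : IsSub n s p Λ v x₀ R m) (hR : 0 < R) (k : ℝ) {d : ℝ} (hd : 0 < d) :
    IsSub n s p Λ (fun y => (v (x₀ + R • y) - k) / d) 0 1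
      (m * R ^ (s * p - n) / d ^ (p - 1)) := by
  obtain ⟨g, hgm, hg, H⟩ := h.ineq
  have hv := h.meas
  have hp0 : 0 < p := by linarith
  have hc0 : ENNReal.ofReal (R ^ ((n : ℝ) - s * p)) ≠ 0 := by
    simp only [ne_eq, ENNReal.ofReal_eq_zero, not_le]; positivity
  refine ⟨by fun_prop, ?_, ?_, ?_, fun x y => g (x₀ + R • x) (x₀ + R • y) / d ^ (p - 1), ?_, ?_, ?_⟩
  · have e : (fun x y : Rn n => |(v (x₀ + R • x) - k) / d - (v (x₀ + R • y) - k) / d| ^ p) =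
        fun x y => (1 / d) ^ p * |v (x₀ + R • x) - v (x₀ + R • y)| ^ p := by
      funext x y
      rw [← sub_div, sub_sub_sub_cancel_right, div_eq_mul_one_div, abs_mul,
        abs_of_pos (by positivity : 0 < 1 / d), Real.mul_rpow (abs_nonneg _) (by positivity), mul_comm]
    rw [e, dint_const_mul (by positivity)]
    refine ENNReal.mul_lt_top ENNReal.ofReal_lt_top ?_
    have h1 := h.energy
    rw [dint_affine x₀ hR] at h1
    exact ENNReal.lt_top_of_mul_ne_top_right h1.ne hc0
  · have h1 := h.memLp
    have h2 := setLIntegral_ball_affine x₀ hR 1 (fun x => ENNReal.ofReal (|v x| ^ p))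
    rw [mul_one] at h2
    rw [h2] at h1
    have h3 : ∫⁻ y in ball (0 : Rn n) 1, ENNReal.ofReal (|v (x₀ + R • y)| ^ p) < ⊤ :=
      ENNReal.lt_top_of_mul_ne_top_right h1.ne
        (by simp only [ne_eq, ENNReal.ofReal_eq_zero, not_le]; positivity)
    have h4 : ∀ y, ENNReal.ofReal (|(v (x₀ + R • y) - k) / d| ^ p) ≤
        ENNReal.ofReal (2 ^ p * (1 / d) ^ p) * (ENNReal.ofReal (|v (x₀ + R • y)| ^ p) +
          ENNReal.ofReal (|k| ^ p)) := by
      intro y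
      rw [← ENNReal.ofReal_add (by positivity) (by positivity), ← ENNReal.ofReal_mul (by positivity)]
      apply ENNReal.ofReal_le_ofReal
      rw [div_eq_mul_one_div, abs_mul, abs_of_pos (by positivity : 0 < 1 / d),
        Real.mul_rpow (abs_nonneg _) (by positivity)]
      have : |v (x₀ + R • y) - k| ^ p ≤ 2 ^ p * (|v (x₀ + R • y)| ^ p + |k| ^ p) :=
        (Real.rpow_le_rpow (abs_nonneg _) (abs_sub _ _) hp0.le).trans
          (add_rpow_le_two hp0.le (abs_nonneg _) (abs_nonneg _))
      calc _ ≤ (2 ^ p * (|v (x₀ + R • y)| ^ p + |k| ^ p)) * (1 / d) ^ p := by gcongr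
        _ = _ := by ring
    refine (lintegral_mono h4).trans_lt ?_
    rw [lintegral_const_mul' _ _ ENNReal.ofReal_ne_top, lintegral_add_right _ measurable_const,
      setLIntegral_const]
    exact ENNReal.mul_lt_top ENNReal.ofReal_lt_top (ENNReal.add_lt_top.2 ⟨h3,
      ENNReal.mul_lt_top ENNReal.ofReal_lt_top measure_ball_lt_top⟩)
  · have := h.mass
    positivity
  · have : Measurable fun z : Rn n × Rn n => (x₀ + R • z.1, x₀ + R • z.2) := by fun_prop
    exact (hgm.comp this).div_const _
  · intro x y
    have := (hg (x₀ + R • x) (x₀ + R • y)).div hd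
    rwa [← sub_div, sub_sub_sub_cancel_right]
  · intro φ hφ h0 h1 ⟨r, hr, hs⟩ hE
    set ψ : Rn n → ℝ := fun x => φ (R⁻¹ • (x - x₀)) with hψ
    have hψa : ∀ x, ψ (x₀ + R • x) = φ x := by
      intro x; simp only [hψ]; rw [add_sub_cancel_left, inv_smul_smul₀ hR.ne']
    have hψE : dint n s p (fun x y => |ψ x - ψ y| ^ p) < ⊤ := by
      rw [dint_affine x₀ hR]
      simp only [hψa]
      exact ENNReal.mul_lt_top ENNReal.ofReal_lt_top hE
    have := H ψ (by fun_prop) (fun x => h0 _) (fun x => h1 _) ⟨R * r, by nlinarith, fun x hx => by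
      apply hs
      rw [dist_zero_right, norm_smul, norm_inv, Real.norm_of_nonneg hR.le, ← dist_eq_norm,
        ← div_eq_inv_mul, lt_div_iff₀ hR, mul_comm]
      exact hx⟩ hψE
    rw [dint_affine x₀ hR, dint_affine x₀ hR (fun x y => -_)] at this
    simp only [hψa] at this
    have e1 : (fun x y : Rn n => g (x₀ + R • x) (x₀ + R • y) / d ^ (p - 1) * (φ x - φ y)) =
        fun x y => (1 / d ^ (p - 1)) * (g (x₀ + R • x) (x₀ + R • y) * (φ x - φ y)) := by
      funext x y; ring
    have e2 : (fun x y : Rn n => -(g (x₀ + R • x) (x₀ + R • y) / d ^ (p - 1) * (φ x - φ y))) =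
        fun x y => (1 / d ^ (p - 1)) * -(g (x₀ + R • x) (x₀ + R • y) * (φ x - φ y)) := by
      funext x y; ring
    rw [e1, e2, dint_const_mul (by positivity), dint_const_mul (by positivity)]
    have e3 : ENNReal.ofReal (m * R ^ (s * p - n) / d ^ (p - 1)) =
        ENNReal.ofReal (1 / d ^ (p - 1)) * ENNReal.ofReal (m * R ^ (s * p - n)) := by
      rw [← ENNReal.ofReal_mul (by positivity)]; congr 1; ring
    rw [e3, ← mul_add]
    refine mul_le_mul_right ?_ _
    have e4 : ENNReal.ofReal m = ENNReal.ofReal (R ^ ((n : ℝ) - s * p)) *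
        ENNReal.ofReal (m * R ^ (s * p - n)) := by
      rw [← ENNReal.ofReal_mul (by positivity)]
      congr 1
      rw [mul_left_comm, ← Real.rpow_add hR]
      simp
    rw [e4, ← mul_add] at this
    exact (ENNReal.mul_le_mul_iff_right hc0 ENNReal.ofReal_ne_top).1 this

/-- Radial Lipschitz cutoff. -/
def cutoff (n : ℕ) (r r' : ℝ) (x : Rn n) : ℝ := max 0 (min 1 ((r' - ‖x‖) / (r' - r)))

section cutoff

variable {n : ℕ} {r r' : ℝ}

lemma measurable_cutoff (n : ℕ) (r r' : ℝ) : Measurable (cutoff n r r') := by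
  unfold cutoff; fun_prop

lemma cutoff_nonneg (x : Rn n) : 0 ≤ cutoff n r r' x := le_max_left _ _

lemma cutoff_le_one (x : Rn n) : cutoff n r r' x ≤ 1 := max_le zero_le_one (min_le_left _ _)

lemma cutoff_eq_one (h : r < r') {x : Rn n} (hx : ‖x‖ ≤ r) : cutoff n r r' x = 1 := by
  have : 1 ≤ (r' - ‖x‖) / (r' - r) := by rw [one_le_div (by linarith)]; linarith
  unfold cutoff
  rw [min_eq_left this, max_eq_right zero_le_one]

lemma cutoff_eq_zero (h : r < r') {x : Rn n} (hx : r' ≤ ‖x‖) : cutoff n r r' x = 0 := by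
  have : (r' - ‖x‖) / (r' - r) ≤ 0 := div_nonpos_of_nonpos_of_nonneg (by linarith) (by linarith)
  unfold cutoff
  rw [max_eq_left]
  exact (min_le_right _ _).trans this

lemma abs_cutoff_sub_le (h : r < r') (x y : Rn n) :
    |cutoff n r r' x - cutoff n r r' y| ≤ 1 / (r' - r) * ‖x - y‖ := by
  unfold cutoff
  have h1 := abs_max_sub_max_le_max 0 (min 1 ((r' - ‖x‖) / (r' - r))) 0
    (min 1 ((r' - ‖y‖) / (r' - r)))
  have h2 := abs_min_sub_min_le_max 1 ((r' - ‖x‖) / (r' - r)) 1 ((r' - ‖y‖) / (r' - r))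
  rw [sub_self, abs_zero] at h1 h2
  replace h1 := h1.trans_eq (max_eq_right (abs_nonneg _))
  replace h2 := h2.trans_eq (max_eq_right (abs_nonneg _))
  refine h1.trans (h2.trans ?_)
  have hd : 0 < r' - r := by linarith
  rw [← sub_div, abs_div, abs_of_pos hd, sub_sub_sub_cancel_left, one_div, div_eq_inv_mul]
  gcongr
  rw [abs_sub_comm]
  exact abs_norm_sub_norm_le x y

end cutoff

lemma exists_lintegral_lip {n : ℕ} (hn : 1 ≤ n) {s p : ℝ} (hs : 0 < s) (hs1 : s < 1) (hp : 0 < p) :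
    ∃ C : ℝ, 0 < C ∧ ∀ (η : Rn n → ℝ) (L : ℝ), 1 ≤ L → (∀ x, 0 ≤ η x) → (∀ x, η x ≤ 1) →
      (∀ x y, |η x - η y| ≤ L * ‖x - y‖) → ∀ x,
      ∫⁻ y, ENNReal.ofReal (|η x - η y| ^ p) * fracKer n s p x y ≤ ENNReal.ofReal (C * L ^ p) := by
  obtain ⟨C1, hC1, H1⟩ := exists_lintegral_ker_compl n (s := s) (p := p) (by positivity)
  obtain ⟨C2, hC2, H2⟩ := exists_lintegral_ker_mul hn (s := s) hs1 hp 1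
  refine ⟨C1 + C2, by positivity, fun η L hL h0 h1 hη x => ?_⟩
  have hLp : 1 ≤ L ^ p := Real.one_le_rpow hL hp.le
  rw [← lintegral_add_compl _ (measurableSet_ball (x := x) (ε := 1))]
  have i1 : ∫⁻ y in ball x 1, ENNReal.ofReal (|η x - η y| ^ p) * fracKer n s p x y ≤
      ENNReal.ofReal (L ^ p * C2) := by
    calc _ ≤ ∫⁻ y in ball x 1, ENNReal.ofReal (L ^ p) *
          (ENNReal.ofReal (‖x - y‖ ^ p) * fracKer n s p x y) := by
          refine lintegral_mono fun y => ?_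
          rw [← mul_assoc, ← ENNReal.ofReal_mul (by positivity),
            ← Real.mul_rpow (by positivity) (norm_nonneg _)]
          refine mul_le_mul_left (ENNReal.ofReal_le_ofReal ?_) _
          exact Real.rpow_le_rpow (abs_nonneg _) (hη x y) hp.le
      _ ≤ _ := by
          rw [lintegral_const_mul' _ _ ENNReal.ofReal_ne_top, ENNReal.ofReal_mul (by positivity)]
          gcongr
          exact H2 x
  have i2 : ∫⁻ y in (ball x 1)ᶜ, ENNReal.ofReal (|η x - η y| ^ p) * fracKer n s p x y ≤
      ENNReal.ofReal C1 := by
    have h := H1 x 1 one_pos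
    rw [Real.one_rpow, mul_one] at h
    refine le_trans (lintegral_mono fun y => ?_) h
    have : |η x - η y| ≤ 1 := by
      rw [abs_le]; have := h0 x; have := h0 y; have := h1 x; have := h1 y
      constructor <;> linarith
    have : ENNReal.ofReal (|η x - η y| ^ p) ≤ 1 := by
      rw [ENNReal.ofReal_le_one]
      exact Real.rpow_le_one (abs_nonneg _) this hp.le
    calc _ ≤ 1 * fracKer n s p x y := by gcongr
      _ = _ := one_mul _
  refine (add_le_add i1 i2).trans ?_
  rw [← ENNReal.ofReal_add (by positivity) (by positivity)]
  apply ENNReal.ofReal_le_ofReal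
  nlinarith

lemma fracKer_far {n : ℕ} {s p : ℝ} (hs : 0 < s) (hp : 0 < p) {x y : Rn n} {r ρ : ℝ} (hx : ‖x‖ ≤ r)
    (hy : ρ ≤ ‖y‖) (hr : r < ρ) (hρ : ρ ≤ 1) :
    fracKer n s p x y ≤ ENNReal.ofReal ((2 / (ρ - r)) ^ ((n : ℝ) + s * p)) * fracKer n s p 0 y := by
  have h1 : ‖y‖ ≤ ‖x - y‖ + ‖x‖ := by
    have := norm_sub_le x (x - y); simp only [sub_sub_cancel] at this; linarith
  have hd : 0 < ρ - r := by linarith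
  have h2 : ρ - r ≤ ‖x - y‖ := by linarith
  have hr0 : 0 ≤ r := (norm_nonneg x).trans hx
  have hy0 : 0 < ‖y‖ := by linarith
  have h3 : ‖y‖ * ((ρ - r) / 2) ≤ ‖x - y‖ := by
    nlinarith [norm_nonneg (x - y)]
  have hsp : 0 < s * p := by positivity
  unfold fracKer
  rw [← ENNReal.ofReal_mul (by positivity), zero_sub, norm_neg]
  apply ENNReal.ofReal_le_ofReal
  have h4 : ‖x - y‖ ^ (-((n : ℝ) + s * p)) ≤ (‖y‖ * ((ρ - r) / 2)) ^ (-((n : ℝ) + s * p)) :=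
    Real.rpow_le_rpow_of_nonpos (by positivity) h3 (by linarith [(Nat.cast_nonneg n : (0:ℝ) ≤ n)])
  refine h4.trans (le_of_eq ?_)
  rw [Real.mul_rpow hy0.le (by positivity), mul_comm]
  congr 1
  rw [Real.rpow_neg (by positivity), ← Real.inv_rpow (by positivity), inv_div]

section pieces

variable {n : ℕ} {s p : ℝ}

lemma dint_mul_left_le {F : Rn n → Rn n → ℝ} {w : Rn n → ℝ} (hw : Measurable w)
    (hw0 : ∀ x, 0 ≤ w x) {D : ℝ≥0∞}
    (hD : ∀ x, w x ≠ 0 → ∫⁻ y, ENNReal.ofReal (F x y) * fracKer n s p x y ≤ D) :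
    dint n s p (fun x y => w x * F x y) ≤ (∫⁻ x, ENNReal.ofReal (w x)) * D := by
  unfold dint
  rw [← lintegral_mul_const _ hw.ennreal_ofReal]
  refine lintegral_mono fun x => ?_
  have : ∫⁻ y, ENNReal.ofReal (w x * F x y) * fracKer n s p x y =
      ENNReal.ofReal (w x) * ∫⁻ y, ENNReal.ofReal (F x y) * fracKer n s p x y := by
    rw [← lintegral_const_mul' _ _ ENNReal.ofReal_ne_top]
    refine lintegral_congr fun y => ?_
    rw [ENNReal.ofReal_mul (hw0 x), mul_assoc]
  simp only [this]
  rcases eq_or_ne (w x) 0 with h | h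
  · rw [h]; simp
  · gcongr
    exact hD x h

lemma dint_lip_le {η : Rn n → ℝ} (hη : Measurable η) {w : Rn n → ℝ} (hw : Measurable w)
    (hw0 : ∀ x, 0 ≤ w x) {D : ℝ≥0∞}
    (hD : ∀ x, ∫⁻ y, ENNReal.ofReal (|η x - η y| ^ p) * fracKer n s p x y ≤ D) :
    dint n s p (fun x y => |η x - η y| ^ p * (w x + w y)) ≤
      2 * ((∫⁻ x, ENNReal.ofReal (w x)) * D) := by
  have h1 := dint_mul_left_le (F := fun x y => |η x - η y| ^ p) hw hw0 fun x _ => hD x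
  have hm : Measurable (Function.uncurry fun x y => w x * |η x - η y| ^ p) := by
    unfold Function.uncurry; fun_prop
  have h2 := dint_swap (n := n) (s := s) (p := p) hm
  have : (fun x y => |η x - η y| ^ p * (w x + w y)) =
      fun x y => w x * |η x - η y| ^ p + w y * |η y - η x| ^ p := by
    funext x y; rw [abs_sub_comm (η y)]; ring
  rw [this, dint_add hm (fun x y => mul_nonneg (hw0 x) (by positivity))
    (fun x y => mul_nonneg (hw0 y) (by positivity)), h2, two_mul]
  gcongr

end pieces

lemma cacc_outer_kernel {n : ℕ} {s p : ℝ} (hs : 0 < s) (hp : 0 < p) :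
    ∃ C : ℝ, 0 < C ∧ ∀ (o : Rn n → ℝ) (r ρ T : ℝ), 1 / 4 ≤ ρ → r < ρ → ρ ≤ 1 → 0 ≤ T →
      Measurable o → (∀ x, 0 ≤ o x) →
      ∫⁻ y in (ball (0 : Rn n) ρ)ᶜ, ENNReal.ofReal (o y) * fracKer n s p 0 y ≤ ENNReal.ofReal T →
      ∀ x, ‖x‖ ≤ r → ∫⁻ y, ENNReal.ofReal ((ball (0 : Rn n) ρ)ᶜ.indicator (fun y => 1 + o y) y) *
        fracKer n s p x y ≤
        ENNReal.ofReal ((2 / (ρ - r)) ^ ((n : ℝ) + s * p) * (C + T)) := by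
  obtain ⟨C1, hC1, H1⟩ := exists_lintegral_ker_compl n (s := s) (p := p) (by positivity)
  refine ⟨C1 * (1 / 4) ^ (-(s * p)), by positivity, fun o r ρ T hρ4 hr hρ hT ho ho0 hoT x hx => ?_⟩
  have hd : 0 < ρ - r := by linarith
  have hsp : 0 < s * p := by positivity
  have e1 : ∀ y, ENNReal.ofReal ((ball (0 : Rn n) ρ)ᶜ.indicator (fun y => 1 + o y) y) *
        fracKer n s p x y =
      (ball (0 : Rn n) ρ)ᶜ.indicator
        (fun y => ENNReal.ofReal (1 + o y) * fracKer n s p x y) y := by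
    intro y
    by_cases h : y ∈ (ball (0 : Rn n) ρ)ᶜ
    · rw [indicator_of_mem h, indicator_of_mem h]
    · rw [indicator_of_notMem h, indicator_of_notMem h]; simp
  simp only [e1]
  rw [lintegral_indicator measurableSet_ball.compl]
  have h1 := H1 0 ρ (by linarith)
  have h2 : C1 * ρ ^ (-(s * p)) ≤ C1 * (1 / 4) ^ (-(s * p)) := by
    have := Real.rpow_le_rpow_of_nonpos (by norm_num : (0 : ℝ) < 1 / 4) hρ4
      (by linarith : -(s * p) ≤ 0)
    gcongr
  rw [ENNReal.ofReal_mul (by positivity), ENNReal.ofReal_add (by positivity) hT]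
  calc _ ≤ ∫⁻ y in (ball (0 : Rn n) ρ)ᶜ, ENNReal.ofReal ((2 / (ρ - r)) ^ ((n : ℝ) + s * p)) *
        (fracKer n s p 0 y + ENNReal.ofReal (o y) * fracKer n s p 0 y) := by
        refine setLIntegral_mono_ae' measurableSet_ball.compl (Eventually.of_forall fun y hy => ?_)
        have hy' : ρ ≤ ‖y‖ := by simpa using hy
        have := fracKer_far hs hp hx hy' hr hρ
        rw [ENNReal.ofReal_add zero_le_one (ho0 y), ENNReal.ofReal_one, ← one_add_mul, mul_left_comm]
        gcongr
    _ = ENNReal.ofReal ((2 / (ρ - r)) ^ ((n : ℝ) + s * p)) *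
        ((∫⁻ y in (ball (0 : Rn n) ρ)ᶜ, fracKer n s p 0 y) +
        ∫⁻ y in (ball (0 : Rn n) ρ)ᶜ, ENNReal.ofReal (o y) * fracKer n s p 0 y) := by
        rw [lintegral_const_mul' _ _ ENNReal.ofReal_ne_top, lintegral_add_left]
        exact measurable_fracKer_comp measurable_const measurable_id
    _ ≤ _ := by
        gcongr
        exact h1.trans (ENNReal.ofReal_le_ofReal h2)

/-- The integrand of the logarithmic-type energy estimate. -/
def caccInt (p ε : ℝ) {n : ℕ} (η v : Rn n → ℝ) (x y : Rn n) : ℝ :=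
  |η x * Hf p ε (max (v x) 0) - η y * Hf p ε (max (v y) 0)| ^ p +
    η x ^ p * Sf ε (max (v x) 0) * (max (-v y) 0) ^ (p - 1)

section

variable {n : ℕ} {s p Λ ε q κ : ℝ}

lemma caccInt_nonneg (hε : 0 < ε) {η v : Rn n → ℝ} (hη : ∀ x, 0 ≤ η x) (x y : Rn n) :
    0 ≤ caccInt p ε η v x y := by
  have := Sf_nonneg hε (le_max_right (v x) 0)
  have := hη x
  unfold caccInt; positivity

lemma measurable_caccInt {η v : Rn n → ℝ} (hη : Measurable η) (hv : Measurable v) :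
    Measurable (Function.uncurry (caccInt p ε η v)) := by
  have hS : Measurable fun x => Sf ε (max (v x) 0) :=
    (measurable_Sf ε).comp (hv.max measurable_const)
  have hH : Measurable fun x => Hf p ε (max (v x) 0) :=
    (measurable_Hf p ε).comp (hv.max measurable_const)
  unfold Function.uncurry caccInt
  have hS1 : Measurable fun a : Rn n × Rn n => Sf ε (max (v a.1) 0) := hS.comp measurable_fst
  have hH1 : Measurable fun a : Rn n × Rn n => Hf p ε (max (v a.1) 0) := hH.comp measurable_fst
  have hH2 : Measurable fun a : Rn n × Rn n => Hf p ε (max (v a.2) 0) := hH.comp measurable_snd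
  fun_prop

lemma dint_energy_test_lt_top (P : Par n s p Λ ε q κ) {v η : Rn n → ℝ}
    (hE : dint n s p (fun x y => |v x - v y| ^ p) < ⊤) (hη : Measurable η)
    (h0 : ∀ x, 0 ≤ η x) (h1 : ∀ x, η x ≤ 1)
    (hηE : dint n s p (fun x y => |η x - η y| ^ p) < ⊤) :
    dint n s p (fun x y => |η x ^ p * Sf ε (max (v x) 0) - η y ^ p * Sf ε (max (v y) 0)| ^ p)
      < ⊤ := by
  have hp0 := P.hp0
  have hε := P.hε
  have key : ∀ x y, |η x ^ p * Sf ε (max (v x) 0) - η y ^ p * Sf ε (max (v y) 0)| ≤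
      p * |η x - η y| + ε * |v x - v y| := by
    intro x y
    have a1 : |η x ^ p - η y ^ p| ≤ p * |η x - η y| := by
      have aux : ∀ a b : ℝ, 0 ≤ a → b ≤ 1 → a < b → |b ^ p - a ^ p| ≤ p * |b - a| := by
        intro a b ha hb hab
        have := rpow_sub_le_mul P.hp.le ha hab
        have hb1 : b ^ (p - 1) ≤ 1 := Real.rpow_le_one (by linarith) hb (by linarith [P.hp])
        have h3 : a ^ p ≤ b ^ p := Real.rpow_le_rpow ha hab.le hp0.le
        rw [abs_of_nonneg (by linarith), abs_of_pos (by linarith)]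
        refine this.trans ?_
        have : p * b ^ (p - 1) ≤ p * 1 := by gcongr
        have : 0 < b - a := by linarith
        nlinarith
      rcases lt_trichotomy (η x) (η y) with h | h | h
      · rw [abs_sub_comm, abs_sub_comm (η x)]; exact aux _ _ (h0 x) (h1 y) h
      · rw [h]; simp
      · exact aux _ _ (h0 y) (h1 x) h
    have a2 := abs_Sf_sub_le hε (le_max_right (v x) 0) (le_max_right (v y) 0)
    have a3 : |max (v x) 0 - max (v y) 0| ≤ |v x - v y| := by
      have := abs_max_sub_max_le_max (v x) 0 (v y) 0
      simpa using this
    have s0 := Sf_nonneg hε (le_max_right (v x) 0)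
    have s1 : Sf ε (max (v x) 0) ≤ 1 := Sf_le_one (le_max_right (v x) 0)
    have e0 : 0 ≤ η y ^ p := Real.rpow_nonneg (h0 y) _
    have e1 : η y ^ p ≤ 1 := Real.rpow_le_one (h0 y) (h1 y) hp0.le
    calc _ = |(η x ^ p - η y ^ p) * Sf ε (max (v x) 0) +
          η y ^ p * (Sf ε (max (v x) 0) - Sf ε (max (v y) 0))| := by congr 1; ring
      _ ≤ |η x ^ p - η y ^ p| * Sf ε (max (v x) 0) +
          η y ^ p * |Sf ε (max (v x) 0) - Sf ε (max (v y) 0)| := by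
          refine (abs_add_le _ _).trans (le_of_eq ?_)
          rw [abs_mul, abs_mul, abs_of_nonneg s0, abs_of_nonneg e0]
      _ ≤ |η x ^ p - η y ^ p| * 1 + 1 * |Sf ε (max (v x) 0) - Sf ε (max (v y) 0)| := by
          gcongr
      _ ≤ _ := by nlinarith
  have h2 : ∀ x y, |η x ^ p * Sf ε (max (v x) 0) - η y ^ p * Sf ε (max (v y) 0)| ^ p ≤
      (2 ^ p * p ^ p) * |η x - η y| ^ p + (2 ^ p * ε ^ p) * |v x - v y| ^ p := by
    intro x y
    refine (Real.rpow_le_rpow (abs_nonneg _) (key x y) hp0.le).trans ?_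
    refine (add_rpow_le_two hp0.le (by positivity) (by positivity)).trans (le_of_eq ?_)
    rw [Real.mul_rpow hp0.le (abs_nonneg _), Real.mul_rpow hε.le (abs_nonneg _)]
    ring
  refine (dint_mono h2).trans_lt ?_
  rw [dint_add (by unfold Function.uncurry; fun_prop) (fun x y => by positivity)
    (fun x y => by positivity), dint_const_mul (by positivity), dint_const_mul (by positivity)]
  exact ENNReal.add_lt_top.2 ⟨ENNReal.mul_lt_top ENNReal.ofReal_lt_top hηE,
    ENNReal.mul_lt_top ENNReal.ofReal_lt_top hE⟩

lemma exists_cacc_pointwise (P : Par n s p Λ ε q κ) :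
    ∃ C M : ℝ, 0 < C ∧ 0 < M ∧ ∀ (v η : Rn n → ℝ) (B : Set (Rn n)) (g : Rn n → Rn n → ℝ),
      (∀ x, 0 ≤ η x) → (∀ x, η x ≤ 1) → (∀ x, x ∉ B → η x = 0) →
      (∀ x y, GBound Λ p (g x y) (v x - v y)) → ∀ x y,
      caccInt p ε η v x y ≤
        C * (g x y * (η x ^ p * Sf ε (max (v x) 0) - η y ^ p * Sf ε (max (v y) 0))) +
        (M * (|η x - η y| ^ p * (B.indicator (fun z => Wf q (v z)) x +
          B.indicator (fun z => Wf q (v z)) y)) +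
        M * (η x ^ p * B.indicator (fun z => Wf q (v z)) x *
            Bᶜ.indicator (fun z => 1 + (max (v z) 0) ^ (p - 1)) y +
          η y ^ p * B.indicator (fun z => Wf q (v z)) y *
            Bᶜ.indicator (fun z => 1 + (max (v z) 0) ^ (p - 1)) x)) := by
  obtain ⟨C, M, hC, hM, H⟩ := pair_inner P
  have hΛ := P.hΛ
  have hp0 := P.hp0
  have hC0 : 0 < C := by linarith
  refine ⟨C, max M (C * Λ), hC0, lt_max_of_lt_left hM, fun v η B g h0 h1 hB hg x y => ?_⟩
  have hMM : M ≤ max M (C * Λ) := le_max_left _ _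
  have hMC : C * Λ ≤ max M (C * Λ) := le_max_right _ _
  set M' := max M (C * Λ)
  have hM' : 0 < M' := lt_of_lt_of_le hM hMM
  have scale : ∀ {Pv t w : ℝ}, 0 ≤ Pv → 0 ≤ w → Pv ≤ Λ * t + Λ ^ 2 * w → Pv ≤ C * t + M' * w := by
    intro Pv t w hP hw h
    have h2 : C / Λ * Pv ≤ C / Λ * (Λ * t + Λ ^ 2 * w) := by gcongr
    have h3 : C / Λ * (Λ * t + Λ ^ 2 * w) = C * t + C * Λ * w := by field_simp
    have h4 : 1 ≤ C / Λ := by rw [one_le_div (by linarith)]; exact hC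
    nlinarith
  have hz : (0 : ℝ) ^ p = 0 := Real.zero_rpow hp0.ne'
  have hHx := Hf_nonneg hp0 P.hεp (le_max_right (v x) 0)
  have hHy := Hf_nonneg hp0 P.hεp (le_max_right (v y) 0)
  have hSx := Sf_nonneg P.hε (le_max_right (v x) 0)
  have hSy := Sf_nonneg P.hε (le_max_right (v y) 0)
  have hWx := Wf_nonneg q (v x)
  have hWy := Wf_nonneg q (v y)
  have hx0 := h0 x
  have hy0 := h0 y
  unfold caccInt
  by_cases hx : x ∈ B <;> by_cases hy : y ∈ B
  · have hx' : x ∉ Bᶜ := fun h => h hx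
    have hy' : y ∉ Bᶜ := fun h => h hy
    rw [indicator_of_mem hx, indicator_of_mem hy, indicator_of_notMem hx', indicator_of_notMem hy',
      mul_zero, mul_zero, add_zero, mul_zero, add_zero]
    refine (H _ _ _ _ _ (h0 x) (h1 x) (h0 y) (h1 y) (hg x y)).trans ?_
    gcongr
  · have hx' : x ∉ Bᶜ := fun h => h hx
    have hy' : y ∈ Bᶜ := hy
    rw [indicator_of_mem hx, indicator_of_notMem hy, indicator_of_mem hy', indicator_of_notMem hx',
      hB y hy, hz]
    simp only [zero_mul, sub_zero, mul_zero, add_zero]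
    have := scale (by positivity) (by positivity) (pair_outer P (h0 x) (hg x y))
    refine this.trans ?_
    have : 0 ≤ M' * (|η x| ^ p * Wf q (v x)) := by positivity
    nlinarith
  · have hx' : x ∈ Bᶜ := hx
    have hy' : y ∉ Bᶜ := fun h => h hy
    rw [indicator_of_notMem hx, indicator_of_mem hy, indicator_of_mem hx', indicator_of_notMem hy',
      hB x hx, hz]
    simp only [zero_mul, zero_sub, mul_zero, add_zero, zero_add, abs_neg]
    have := scale (by positivity) (by positivity) (pair_outer P (h0 y) (hg x y).neg')
    have h5 : 0 ≤ η y ^ p * Sf ε (max (v y) 0) * max (-v x) 0 ^ (p - 1) := by positivity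
    have : 0 ≤ M' * (|η y| ^ p * Wf q (v y)) := by positivity
    nlinarith
  · rw [indicator_of_notMem hx, indicator_of_notMem hy, hB x hx, hB y hy, hz]
    simp [hz]

lemma cacc_energy (P : Par n s p Λ ε q κ) :
    ∃ C : ℝ, 0 < C ∧ ∀ (v : Rn n → ℝ) (r ρ m A T : ℝ), 1 / 4 ≤ r → r < ρ → ρ ≤ 1 → 0 ≤ A → 0 ≤ T →
      IsSub n s p Λ v 0 ρ m →
      ∫⁻ x in ball (0 : Rn n) ρ, ENNReal.ofReal (Wf q (v x)) ≤ ENNReal.ofReal A →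
      ∫⁻ y in (ball (0 : Rn n) ρ)ᶜ, ENNReal.ofReal ((max (v y) 0) ^ (p - 1)) * fracKer n s p 0 y ≤
        ENNReal.ofReal T →
      dint n s p (caccInt p ε (cutoff n r ((r + ρ) / 2)) v) ≤
        ENNReal.ofReal (C * ((ρ - r) ^ (-((n : ℝ) + s * p + p)) * (1 + T) * A + m)) := by
  obtain ⟨C, M, hC, hM, H⟩ := exists_cacc_pointwise P
  have hp0 := P.hp0
  have hs := P.hs
  have hp := P.hp
  obtain ⟨C1, hC1, H1⟩ := exists_lintegral_lip (n := n) (by linarith [P.hn]) hs P.hs1 hp0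
  obtain ⟨C2, hC2, H2⟩ := cacc_outer_kernel (n := n) hs hp0
  set N := (n : ℝ) + s * p + p with hN
  have hn0 : (0 : ℝ) ≤ n := Nat.cast_nonneg n
  have hsp : 0 < s * p := by positivity
  set K1 := M * (2 * (C1 * 2 ^ p)) with hK1
  set K2 := M * (2 * (4 ^ ((n : ℝ) + s * p) * (C2 + 1))) with hK2
  have hK1' : 0 < K1 := by positivity
  have hK2' : 0 < K2 := by positivity
  refine ⟨C + K1 + K2, by positivity, fun v r ρ m A T hr4 hr hρ hA hT hsub hW hTail => ?_⟩
  have hd : 0 < ρ - r := by linarith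
  have hd1 : ρ - r ≤ 1 := by linarith
  set η := cutoff n r ((r + ρ) / 2) with hη
  have hr2 : r < (r + ρ) / 2 := by linarith
  have hηm : Measurable η := measurable_cutoff _ _ _
  have h0 : ∀ x, 0 ≤ η x := cutoff_nonneg
  have h1 : ∀ x, η x ≤ 1 := cutoff_le_one
  have hz : ∀ x : Rn n, (r + ρ) / 2 ≤ ‖x‖ → η x = 0 := fun x hx => cutoff_eq_zero hr2 hx
  have hL : ∀ x y, |η x - η y| ≤ 2 / (ρ - r) * ‖x - y‖ := by
    intro x y
    have := abs_cutoff_sub_le hr2 x y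
    have e : 1 / ((r + ρ) / 2 - r) = 2 / (ρ - r) := by
      rw [show (r + ρ) / 2 - r = (ρ - r) / 2 by ring, one_div_div]
    rwa [e] at this
  have hL1 : 1 ≤ 2 / (ρ - r) := by rw [one_le_div hd]; linarith
  have hD := H1 η (2 / (ρ - r)) hL1 h0 h1 hL
  set B := ball (0 : Rn n) ρ with hB
  have hBm : MeasurableSet B := measurableSet_ball
  have hzB : ∀ x, x ∉ B → η x = 0 := fun x hx => hz x (by
    have : ρ ≤ ‖x‖ := by simpa [hB] using hx
    linarith)
  have hv := hsub.meas
  obtain ⟨g, hg, Ht⟩ := hsub.test hp.le (by linarith [P.hΛ])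
  set w : Rn n → ℝ := B.indicator (fun z => Wf q (v z)) with hw
  set o : Rn n → ℝ := Bᶜ.indicator (fun z => 1 + (max (v z) 0) ^ (p - 1)) with ho
  have hwm : Measurable w := ((measurable_Wf q).comp hv).indicator hBm
  have hom : Measurable o := Measurable.indicator (by fun_prop) hBm.compl
  have hw0 : ∀ x, 0 ≤ w x := indicator_nonneg fun x _ => Wf_nonneg _ _
  have ho0 : ∀ x, 0 ≤ o x := indicator_nonneg fun x _ => by positivity
  have hwA : ∫⁻ x, ENNReal.ofReal (w x) ≤ ENNReal.ofReal A := by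
    refine le_trans (le_of_eq ?_) hW
    rw [← lintegral_indicator hBm]
    refine lintegral_congr fun x => ?_
    by_cases hx : x ∈ B
    · rw [hw, indicator_of_mem hx, indicator_of_mem hx]
    · rw [hw, indicator_of_notMem hx, indicator_of_notMem hx, ENNReal.ofReal_zero]
  -- finite energy of the cutoff
  have hηE : dint n s p (fun x y => |η x - η y| ^ p) < ⊤ := by
    have hi0 : ∀ x, 0 ≤ B.indicator (fun _ => (1 : ℝ)) x := indicator_nonneg fun _ _ => zero_le_one
    have := dint_lip_le (s := s) (p := p) hηm (w := B.indicator fun _ => (1 : ℝ))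
      (measurable_const.indicator hBm) hi0 hD
    refine lt_of_le_of_lt ((dint_mono fun x y => ?_).trans this) ?_
    · by_cases hx : x ∈ B
      · have h2 : 1 ≤ B.indicator (fun _ => (1 : ℝ)) x + B.indicator (fun _ => (1 : ℝ)) y := by
          rw [indicator_of_mem hx]; linarith [hi0 y]
        exact le_mul_of_one_le_right (by positivity) h2
      · by_cases hy : y ∈ B
        · have h2 : 1 ≤ B.indicator (fun _ => (1 : ℝ)) x + B.indicator (fun _ => (1 : ℝ)) y := by
            rw [indicator_of_mem hy]; linarith [hi0 x]
          exact le_mul_of_one_le_right (by positivity) h2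
        · rw [hzB x hx, hzB y hy, sub_self, abs_zero, Real.zero_rpow hp0.ne', zero_mul]
    · refine ENNReal.mul_lt_top (by simp) (ENNReal.mul_lt_top ?_ ENNReal.ofReal_lt_top)
      have : ∀ x, ENNReal.ofReal (B.indicator (fun _ => (1 : ℝ)) x) =
          B.indicator (fun _ => (1 : ℝ≥0∞)) x := by
        intro x
        by_cases hx : x ∈ B
        · rw [indicator_of_mem hx, indicator_of_mem hx, ENNReal.ofReal_one]
        · rw [indicator_of_notMem hx, indicator_of_notMem hx, ENNReal.ofReal_zero]
      simp only [this]
      rw [lintegral_indicator hBm, setLIntegral_one]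
      exact measure_ball_lt_top
  have hS1 : ∀ x, 0 ≤ Sf ε (max (v x) 0) := fun x => Sf_nonneg P.hε (le_max_right _ _)
  have hS2 : ∀ x, Sf ε (max (v x) 0) ≤ 1 := fun x => Sf_le_one (le_max_right _ _)
  have hSm : Measurable fun x => Sf ε (max (v x) 0) :=
    (measurable_Sf ε).comp (hv.max measurable_const)
  have main := Ht (fun x => η x ^ p * Sf ε (max (v x) 0)) (by fun_prop)
    (fun x => mul_nonneg (Real.rpow_nonneg (h0 x) _) (hS1 x))
    (fun x => mul_le_one₀ (Real.rpow_le_one (h0 x) (h1 x) hp0.le) (hS1 x) (hS2 x))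
    ⟨(r + ρ) / 2, by linarith, fun x hx => by
      rw [dist_zero_right] at hx
      rw [hz x hx.le, Real.zero_rpow hp0.ne', zero_mul]⟩
    (dint_energy_test_lt_top P hsub.energy hηm h0 h1 hηE)
    (fun x y => C⁻¹ * caccInt p ε η v x y)
    (fun x y => C⁻¹ * (M * (|η x - η y| ^ p * (w x + w y)) +
        M * (η x ^ p * w x * o y + η y ^ p * w y * o x)))
    (measurable_const.mul (measurable_caccInt hηm hv))
    (fun x y => mul_nonneg (by positivity) (caccInt_nonneg P.hε h0 x y))
    (fun x y => by
      have := h0 x; have := h0 y; have := hw0 x; have := hw0 y; have := ho0 x; have := ho0 y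
      positivity)
    (fun x y => by
      have := H v η B g h0 h1 hzB hg x y
      rw [← hw, ← ho] at this
      rw [inv_mul_le_iff₀ hC, mul_add, ← mul_assoc C C⁻¹, mul_inv_cancel₀ hC.ne', one_mul]
      exact this)
  rw [dint_const_mul (by positivity), dint_const_mul (by positivity)] at main
  have hCt : ENNReal.ofReal C⁻¹ * ENNReal.ofReal C = 1 := by
    rw [← ENNReal.ofReal_mul (by positivity), inv_mul_cancel₀ hC.ne', ENNReal.ofReal_one]
  have main2 : dint n s p (caccInt p ε η v) ≤ ENNReal.ofReal (C * m) +
      dint n s p (fun x y => M * (|η x - η y| ^ p * (w x + w y)) +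
        M * (η x ^ p * w x * o y + η y ^ p * w y * o x)) := by
    have h3 := mul_le_mul_right main (ENNReal.ofReal C)
    rw [mul_add, ← mul_assoc, ← mul_assoc, mul_comm (ENNReal.ofReal C) (ENNReal.ofReal C⁻¹), hCt,
      one_mul, one_mul, ← ENNReal.ofReal_mul hC.le] at h3
    exact h3
  refine main2.trans ?_
  have hwo : Measurable (Function.uncurry fun x y => η x ^ p * w x * o y) := by
    unfold Function.uncurry; fun_prop
  have p1 : ∀ x y, 0 ≤ η x ^ p * w x * o y := fun x y =>
    mul_nonneg (mul_nonneg (Real.rpow_nonneg (h0 x) _) (hw0 x)) (ho0 y)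
  have hsw := dint_swap (n := n) (s := s) (p := p) hwo
  rw [dint_add (by unfold Function.uncurry; fun_prop)
      (fun x y => mul_nonneg hM.le (mul_nonneg (by positivity) (add_nonneg (hw0 x) (hw0 y))))
      (fun x y => mul_nonneg hM.le (add_nonneg (p1 x y) (p1 y x))),
    dint_const_mul hM.le, dint_const_mul hM.le, dint_add hwo p1 (fun x y => p1 y x), hsw]
  have b1 : dint n s p (fun x y => |η x - η y| ^ p * (w x + w y)) ≤
      2 * (ENNReal.ofReal A * ENNReal.ofReal (C1 * (2 / (ρ - r)) ^ p)) :=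
    (dint_lip_le hηm hwm hw0 hD).trans (by gcongr)
  have b2 : dint n s p (fun x y => η x ^ p * w x * o y) ≤
      ENNReal.ofReal A * ENNReal.ofReal ((4 / (ρ - r)) ^ ((n : ℝ) + s * p) * (C2 + T)) := by
    have hK := H2 (fun y => (max (v y) 0) ^ (p - 1)) ((r + ρ) / 2) ρ T (by linarith) (by linarith)
      hρ hT (by fun_prop) (fun x => by positivity) hTail
    rw [show 2 / (ρ - (r + ρ) / 2) = 4 / (ρ - r) by
      rw [show ρ - (r + ρ) / 2 = (ρ - r) / 2 by ring]; field_simp; norm_num] at hK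
    refine (dint_mul_left_le (w := fun x => η x ^ p * w x) (F := fun x y => o y) (by fun_prop)
      (fun x => mul_nonneg (Real.rpow_nonneg (h0 x) _) (hw0 x)) fun x hx => hK x ?_).trans ?_
    · by_contra hcon
      apply hx
      rw [hz x (by linarith), Real.zero_rpow hp0.ne', zero_mul]
    · refine mul_le_mul_left (le_trans (lintegral_mono fun x => ?_) hwA) _
      apply ENNReal.ofReal_le_ofReal
      exact mul_le_of_le_one_left (hw0 x) (Real.rpow_le_one (h0 x) (h1 x) hp0.le)
  refine (add_le_add le_rfl (add_le_add (mul_le_mul_right b1 _)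
    (mul_le_mul_right (add_le_add b2 b2) _))).trans ?_
  have hT2 : (0 : ℝ) ≤ C2 + T := by positivity
  rw [← ENNReal.ofReal_mul hA, ← ENNReal.ofReal_mul hA, show (2 : ℝ≥0∞) = ENNReal.ofReal 2 by simp,
    ← ENNReal.ofReal_mul (by norm_num), ← ENNReal.ofReal_mul hM.le,
    ← ENNReal.ofReal_add (by positivity) (by positivity), ← ENNReal.ofReal_mul hM.le,
    ← ENNReal.ofReal_add (by positivity) (by positivity),
    ← ENNReal.ofReal_add (mul_nonneg hC.le hsub.mass) (by positivity)]
  apply ENNReal.ofReal_le_ofReal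
  have hm := hsub.mass
  have X1 : (2 / (ρ - r)) ^ p ≤ 2 ^ p * (ρ - r) ^ (-N) := by
    rw [Real.div_rpow (by norm_num) hd.le, div_eq_mul_inv, ← Real.rpow_neg hd.le]
    have : (ρ - r) ^ (-p) ≤ (ρ - r) ^ (-N) :=
      Real.rpow_le_rpow_of_exponent_ge hd hd1 (by rw [hN]; linarith)
    gcongr
  have X2 : (4 / (ρ - r)) ^ ((n : ℝ) + s * p) ≤ 4 ^ ((n : ℝ) + s * p) * (ρ - r) ^ (-N) := by
    rw [Real.div_rpow (by norm_num) hd.le, div_eq_mul_inv, ← Real.rpow_neg hd.le]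
    have : (ρ - r) ^ (-((n : ℝ) + s * p)) ≤ (ρ - r) ^ (-N) :=
      Real.rpow_le_rpow_of_exponent_ge hd hd1 (by rw [hN]; linarith)
    gcongr
  have X3 : C2 + T ≤ (C2 + 1) * (1 + T) := by nlinarith
  set Z := (ρ - r) ^ (-N) with hZ
  have hZ0 : 0 < Z := by positivity
  have Y1 : M * (2 * (A * (C1 * (2 / (ρ - r)) ^ p))) ≤ K1 * (Z * (1 + T) * A) := by
    calc _ ≤ M * (2 * (A * (C1 * (2 ^ p * Z)))) := by gcongr
      _ = K1 * (Z * 1 * A) := by rw [hK1]; ring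
      _ ≤ _ := by gcongr; linarith
  have Y2 : M * (A * ((4 / (ρ - r)) ^ ((n : ℝ) + s * p) * (C2 + T)) +
      A * ((4 / (ρ - r)) ^ ((n : ℝ) + s * p) * (C2 + T))) ≤ K2 * (Z * (1 + T) * A) := by
    calc _ ≤ M * (A * ((4 ^ ((n : ℝ) + s * p) * Z) * ((C2 + 1) * (1 + T))) +
          A * ((4 ^ ((n : ℝ) + s * p) * Z) * ((C2 + 1) * (1 + T)))) := by gcongr
      _ = _ := by rw [hK2]; ring
  have hQ : 0 ≤ Z * (1 + T) * A := by positivity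
  nlinarith [mul_nonneg hC.le hQ, mul_nonneg hK1'.le hm, mul_nonneg hK2'.le hm]

lemma fracKer_near {r : ℝ} (hs : 0 < s) (hp : 0 < p) (hr : r ≤ 1) {x y : Rn n} (hx : x ∈ ball (0 : Rn n) r)
    (hy : y ∈ ball (0 : Rn n) r) (hxy : x ≠ y) :
    ENNReal.ofReal (2 ^ (-((n : ℝ) + s * p))) ≤ fracKer n s p x y := by
  have hsp : 0 < s * p := by positivity
  have hn0 : (0 : ℝ) ≤ n := Nat.cast_nonneg n
  rw [mem_ball_zero_iff] at hx hy
  apply ENNReal.ofReal_le_ofReal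
  apply Real.rpow_le_rpow_of_nonpos (norm_pos_iff.2 (sub_ne_zero.2 hxy)) _ (by linarith)
  have := norm_sub_le x y
  linarith

lemma caccioppoli (P : Par n s p Λ ε q κ) :
    ∃ C : ℝ, 0 < C ∧ ∀ (v : Rn n → ℝ) (r ρ m A T : ℝ), 1 / 4 ≤ r → r < ρ → ρ ≤ 1 → 0 ≤ A → 0 ≤ T →
      IsSub n s p Λ v 0 ρ m →
      ∫⁻ x in ball (0 : Rn n) ρ, ENNReal.ofReal (Wf q (v x)) ≤ ENNReal.ofReal A →
      ∫⁻ y in (ball (0 : Rn n) ρ)ᶜ, ENNReal.ofReal ((max (v y) 0) ^ (p - 1)) * fracKer n s p 0 y ≤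
        ENNReal.ofReal T →
      ∫⁻ x in ball (0 : Rn n) r, ENNReal.ofReal (Hf p ε (max (v x) 0) ^ (p * κ)) ≤
        ENNReal.ofReal (C * ((ρ - r) ^ (-((n : ℝ) + s * p + p)) * (1 + T) * A + m) ^ κ) ∧
      (∫⁻ x in ball (0 : Rn n) r, ENNReal.ofReal (Sf ε (max (v x) 0))) *
        (∫⁻ x in ball (0 : Rn n) r, ENNReal.ofReal ((max (-v x) 0) ^ (p - 1))) ≤
        ENNReal.ofReal (C * ((ρ - r) ^ (-((n : ℝ) + s * p + p)) * (1 + T) * A + m)) := by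
  obtain ⟨C, hC, H⟩ := cacc_energy P
  have hp0 := P.hp0
  have hs := P.hs
  have hκ := P.hκ
  obtain ⟨C1, hC1, H1⟩ := sobolev (n := n) (by linarith [P.hn]) hs hp0 P.hκ P.hκ2
  set k := (2 : ℝ) ^ (-((n : ℝ) + s * p)) with hk
  have hk0 : 0 < k := by positivity
  refine ⟨C1 * C ^ κ + k⁻¹ * C, by positivity,
    fun v r ρ m A T hr4 hr hρ hA hT hsub hW hTail => ?_⟩
  have hE := H v r ρ m A T hr4 hr hρ hA hT hsub hW hTail
  have hd : 0 < ρ - r := by linarith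
  have hm := hsub.mass
  have hv := hsub.meas
  set η := cutoff n r ((r + ρ) / 2) with hη
  have hr2 : r < (r + ρ) / 2 := by linarith
  have hηm : Measurable η := measurable_cutoff _ _ _
  have h0 : ∀ x, 0 ≤ η x := cutoff_nonneg
  have h1 : ∀ x ∈ ball (0 : Rn n) r, η x = 1 := fun x hx =>
    cutoff_eq_one hr2 (by rw [mem_ball_zero_iff] at hx; exact hx.le)
  have hHm : Measurable fun x => Hf p ε (max (v x) 0) :=
    (measurable_Hf p ε).comp (hv.max measurable_const)
  have hSm : Measurable fun x => Sf ε (max (v x) 0) :=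
    (measurable_Sf ε).comp (hv.max measurable_const)
  have hH0 : ∀ x, 0 ≤ Hf p ε (max (v x) 0) := fun x => Hf_nonneg hp0 P.hεp (le_max_right _ _)
  have hS0 : ∀ x, 0 ≤ Sf ε (max (v x) 0) := fun x => Sf_nonneg P.hε (le_max_right _ _)
  set D := (ρ - r) ^ (-((n : ℝ) + s * p + p)) * (1 + T) * A + m with hD
  have hD0 : 0 ≤ D := by positivity
  constructor
  · have := H1 (fun x => η x * Hf p ε (max (v x) 0)) (by fun_prop)
      (fun x => mul_nonneg (h0 x) (hH0 x)) (fun x hx => by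
        have : η x = 0 := cutoff_eq_zero hr2 (by
          have : 1 ≤ ‖x‖ := by simpa using hx
          linarith)
        rw [this, zero_mul]) (C * D) (by positivity) (le_trans (dint_mono fun x y => ?_) hE)
    · calc _ = ∫⁻ x in ball (0 : Rn n) r,
            ENNReal.ofReal ((η x * Hf p ε (max (v x) 0)) ^ (p * κ)) := by
            refine setLIntegral_congr_fun measurableSet_ball fun x hx => ?_
            simp only [h1 x hx, one_mul]
        _ ≤ _ := setLIntegral_le_lintegral _ _
        _ ≤ _ := this
        _ ≤ _ := by
            apply ENNReal.ofReal_le_ofReal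
            rw [Real.mul_rpow hC.le hD0, ← mul_assoc, add_mul]
            have : 0 ≤ k⁻¹ * C * D ^ κ := by positivity
            linarith
    · exact le_add_of_nonneg_right
        (mul_nonneg (mul_nonneg (Real.rpow_nonneg (h0 x) _) (hS0 x)) (by positivity))
  · have hlow : ENNReal.ofReal k * ((∫⁻ x in ball (0 : Rn n) r, ENNReal.ofReal (Sf ε (max (v x) 0))) *
        (∫⁻ x in ball (0 : Rn n) r, ENNReal.ofReal ((max (-v x) 0) ^ (p - 1)))) ≤
        dint n s p (caccInt p ε η v) := by
      rw [← lintegral_mul_const _ (by fun_prop), ← lintegral_const_mul' _ _ ENNReal.ofReal_ne_top]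
      unfold dint
      refine le_trans (setLIntegral_mono_ae' measurableSet_ball (Eventually.of_forall fun x hx => ?_))
        (setLIntegral_le_lintegral _ _)
      rw [← lintegral_const_mul' _ _ ENNReal.ofReal_ne_top,
        ← lintegral_const_mul' _ _ ENNReal.ofReal_ne_top]
      refine le_trans ?_ (setLIntegral_le_lintegral (ball (0 : Rn n) r) _)
      have : Nonempty (Fin n) := ⟨⟨0, by linarith [P.hn]⟩⟩
      have hne : ∀ᵐ y : Rn n, y ≠ x := by
        rw [ae_iff]; simp
      refine setLIntegral_mono_ae' measurableSet_ball ?_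
      filter_upwards [hne] with y hyx hy
      have hker := fracKer_near hs hp0 (by linarith) hx hy hyx.symm
      rw [← ENNReal.ofReal_mul (hS0 x), mul_comm]
      refine mul_le_mul' (ENNReal.ofReal_le_ofReal ?_) hker
      unfold caccInt
      rw [h1 x hx, Real.one_rpow, one_mul, one_mul]
      exact le_add_of_nonneg_left (Real.rpow_nonneg (abs_nonneg _) _)
    have h3 := mul_le_mul_right (hlow.trans hE) (ENNReal.ofReal k⁻¹)
    rw [← mul_assoc, ← ENNReal.ofReal_mul (by positivity), inv_mul_cancel₀ hk0.ne',
      ENNReal.ofReal_one, one_mul, ← ENNReal.ofReal_mul (by positivity)] at h3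
    refine h3.trans (ENNReal.ofReal_le_ofReal ?_)
    rw [← mul_assoc, add_mul]
    have : 0 ≤ C1 * C ^ κ * D := by positivity
    linarith

end

/-- Integral over `B_r` of the `q`-th power of the excess of `v` over the level `k`. -/
def posI {n : ℕ} (q k r : ℝ) (v : Rn n → ℝ) : ℝ≥0∞ :=
  ∫⁻ x in ball (0 : Rn n) r, ENNReal.ofReal ((max (v x - k) 0) ^ q)

/-- Tail integral outside `B_r` of the excess of `v` over the level `k`. -/
def posT (n : ℕ) (s p k r : ℝ) (v : Rn n → ℝ) : ℝ≥0∞ :=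
  ∫⁻ y in (ball (0 : Rn n) r)ᶜ, ENNReal.ofReal ((max (v y - k) 0) ^ (p - 1)) * fracKer n s p 0 y

section

variable {n : ℕ} {s p Λ ε q κ : ℝ}

lemma posI_anti {k k' r r' : ℝ} (hq : 0 ≤ q) (hk : k ≤ k') (hr : r' ≤ r) (v : Rn n → ℝ) :
    posI q k' r' v ≤ posI q k r v := by
  refine (lintegral_mono_set (ball_subset_ball hr)).trans (lintegral_mono fun x => ?_)
  apply ENNReal.ofReal_le_ofReal
  refine Real.rpow_le_rpow (le_max_right _ _) (max_le_max (by linarith) le_rfl) hq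

lemma posT_anti {k k' r r' : ℝ} (hp : 1 ≤ p) (hk : k ≤ k') (hr : r ≤ r') (v : Rn n → ℝ) :
    posT n s p k' r' v ≤ posT n s p k r v := by
  refine (lintegral_mono_set (compl_subset_compl.2 (ball_subset_ball hr))).trans
    (lintegral_mono fun x => ?_)
  refine mul_le_mul_left (ENNReal.ofReal_le_ofReal ?_) _
  refine Real.rpow_le_rpow (le_max_right _ _) (max_le_max (by linarith) le_rfl) (by linarith)

lemma max_div_sub {d a k l : ℝ} (hd : 0 < d) :
    max ((a - k) / d - l) 0 = max (a - (k + d * l)) 0 / d := by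
  rw [← max_div_div_right hd.le, zero_div]
  congr 1; field_simp; ring

lemma posI_scale {R d : ℝ} (hR : 0 < R) (hd : 0 < d) (k l r : ℝ) (v : Rn n → ℝ) :
    posI q l r (fun y => (v (R • y) - k) / d) =
      ENNReal.ofReal (R ^ (-(n : ℝ)) * d ^ (-q)) * posI q (k + d * l) (R * r) v := by
  have h := setLIntegral_ball_affine (n := n) 0 hR r
    (fun x => ENNReal.ofReal ((max (v x - (k + d * l)) 0) ^ q))
  unfold posI
  rw [h]
  have e : ∀ y : Rn n, ENNReal.ofReal ((max ((v (R • y) - k) / d - l) 0) ^ q) =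
      ENNReal.ofReal (d ^ (-q)) * ENNReal.ofReal ((max (v (R • y) - (k + d * l)) 0) ^ q) := by
    intro y
    rw [max_div_sub hd, Real.div_rpow (le_max_right _ _) hd.le, ← ENNReal.ofReal_mul (by positivity),
      Real.rpow_neg hd.le, div_eq_inv_mul]
  simp only [e, zero_add]
  rw [lintegral_const_mul' _ _ ENNReal.ofReal_ne_top, ← mul_assoc, ← ENNReal.ofReal_mul (by positivity)]
  congr 2
  rw [mul_right_comm, ← Real.rpow_natCast, ← Real.rpow_add hR]; simp

lemma posT_scale {R d : ℝ} (hR : 0 < R) (hd : 0 < d) (k l r : ℝ) (v : Rn n → ℝ) :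
    posT n s p l r (fun y => (v (R • y) - k) / d) =
      ENNReal.ofReal (R ^ (s * p) * d ^ (1 - p)) * posT n s p (k + d * l) (R * r) v := by
  have h := setLIntegral_ball_compl_affine (n := n) 0 hR r
    (fun x => ENNReal.ofReal ((max (v x - (k + d * l)) 0) ^ (p - 1)) * fracKer n s p 0 x)
  unfold posT
  rw [h]
  have e : ∀ y : Rn n, ENNReal.ofReal ((max ((v (R • y) - k) / d - l) 0) ^ (p - 1)) *
        fracKer n s p 0 y =
      ENNReal.ofReal (d ^ (1 - p) * R ^ ((n : ℝ) + s * p)) *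
        (ENNReal.ofReal ((max (v (R • y) - (k + d * l)) 0) ^ (p - 1)) *
          fracKer n s p 0 (R • y)) := by
    intro y
    have hk : fracKer n s p 0 y =
        ENNReal.ofReal (R ^ ((n : ℝ) + s * p)) * fracKer n s p 0 (R • y) := by
      unfold fracKer
      rw [← ENNReal.ofReal_mul (by positivity), zero_sub, zero_sub, norm_neg, norm_neg, norm_smul,
        Real.norm_of_nonneg hR.le, Real.mul_rpow hR.le (norm_nonneg _), ← mul_assoc,
        ← Real.rpow_add hR, add_neg_cancel, Real.rpow_zero, one_mul]
    rw [max_div_sub hd, Real.div_rpow (le_max_right _ _) hd.le, hk, ← neg_sub p 1,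
      Real.rpow_neg hd.le, div_eq_inv_mul, ENNReal.ofReal_mul (by positivity),
      ENNReal.ofReal_mul (by positivity)]
    ring
  simp only [e, zero_add]
  rw [lintegral_const_mul' _ _ (ENNReal.ofReal_ne_top), ← mul_assoc,
    ← ENNReal.ofReal_mul (by positivity)]
  congr 2
  rw [mul_right_comm, ← Real.rpow_natCast, ← Real.rpow_add hR, mul_comm]
  congr 2; ring

lemma IsSub.scale {v : Rn n → ℝ} {ρ m : ℝ} (hp : 1 < p)
    (h : IsSub n s p Λ v 0 ρ m) (hρ : 0 < ρ) (k : ℝ) {d : ℝ} (hd : 0 < d) :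
    IsSub n s p Λ (fun y => (v (ρ • y) - k) / d) 0 1 (m * ρ ^ (s * p - n) / d ^ (p - 1)) := by
  have := h.affine hp hρ k hd
  simpa only [zero_add] using this

lemma exists_Hf_ge (P : Par n s p Λ ε q κ) : ∃ c : ℝ, 0 < c ∧ ∀ t : ℝ, 1 ≤ t →
    c * t ^ ((p - 1 - ε) * κ) ≤ Hf p ε t ^ (p * κ) := by
  have hp0 := P.hp0
  have hκ := P.hκ
  have hβ : 0 < (p - 1 - ε) / p := div_pos (by linarith [P.hεp]) hp0
  set β := (p - 1 - ε) / p with hβd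
  have h2 : (2 : ℝ) ^ (-β) < 1 := Real.rpow_lt_one_of_one_lt_of_neg (by norm_num) (by linarith)
  refine ⟨(1 - 2 ^ (-β)) ^ (p * κ), Real.rpow_pos_of_pos (by linarith) _, fun t ht => ?_⟩
  have h3 : (2 : ℝ) ^ β ≤ (1 + t) ^ β := Real.rpow_le_rpow (by norm_num) (by linarith) hβ.le
  have h4 : t ^ β ≤ (1 + t) ^ β := Real.rpow_le_rpow (by linarith) (by linarith) hβ.le
  have h5 : (2 : ℝ) ^ (-β) * 2 ^ β = 1 := by rw [← Real.rpow_add (by norm_num)]; simp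
  have h6 : (0 : ℝ) < 2 ^ (-β) := by positivity
  have key : (1 - 2 ^ (-β)) * t ^ β ≤ Hf p ε t := by
    unfold Hf
    rw [← hβd]
    nlinarith
  have : t ^ ((p - 1 - ε) * κ) = (t ^ β) ^ (p * κ) := by
    rw [← Real.rpow_mul (by linarith), hβd]; congr 1; field_simp
  rw [this, ← Real.mul_rpow (by linarith) (by positivity)]
  exact Real.rpow_le_rpow (mul_nonneg (by linarith) (by positivity)) key (by positivity)

lemma fracKer_zero_le {r : ℝ} (hsp : 0 ≤ (n : ℝ) + s * p) (hr : 0 < r) {y : Rn n} (hy : r ≤ ‖y‖) :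
    fracKer n s p 0 y ≤ ENNReal.ofReal (r ^ (-((n : ℝ) + s * p))) := by
  unfold fracKer
  rw [zero_sub, norm_neg]
  exact ENNReal.ofReal_le_ofReal (Real.rpow_le_rpow_of_nonpos hr hy (by linarith))

lemma setLIntegral_compl_ball_le {F : Rn n → ℝ≥0∞} {r ρ : ℝ} :
    ∫⁻ y in (ball (0 : Rn n) r)ᶜ, F y ≤
      (∫⁻ y in ball (0 : Rn n) ρ \ ball 0 r, F y) + ∫⁻ y in (ball (0 : Rn n) ρ)ᶜ, F y := by
  refine le_trans (lintegral_mono_set ?_) (lintegral_union_le _ _ _)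
  intro x hx
  by_cases h : x ∈ ball (0 : Rn n) ρ
  · exact Or.inl ⟨h, hx⟩
  · exact Or.inr h

lemma tail_annulus {F : Rn n → ℝ≥0∞} (hsp : 0 ≤ (n : ℝ) + s * p) {r ρ : ℝ} (hr : 0 < r) :
    ∫⁻ y in (ball (0 : Rn n) r)ᶜ, F y * fracKer n s p 0 y ≤
      ENNReal.ofReal (r ^ (-((n : ℝ) + s * p))) * (∫⁻ y in ball (0 : Rn n) ρ, F y) +
        ∫⁻ y in (ball (0 : Rn n) ρ)ᶜ, F y * fracKer n s p 0 y := by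
  refine setLIntegral_compl_ball_le.trans (add_le_add ?_ le_rfl)
  rw [← lintegral_const_mul' _ _ ENNReal.ofReal_ne_top]
  calc _ ≤ ∫⁻ y in ball (0 : Rn n) ρ \ ball 0 r, ENNReal.ofReal (r ^ (-((n : ℝ) + s * p))) * F y := by
        refine setLIntegral_mono_ae' (measurableSet_ball.diff measurableSet_ball)
          (Eventually.of_forall fun y hy => ?_)
        rw [mul_comm]
        have : r ≤ ‖y‖ := by simpa using hy.2
        gcongr
        exact fracKer_zero_le hsp hr this
    _ ≤ _ := lintegral_mono_set sdiff_subset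

lemma posI_le_add {a k ρ : ℝ} (ha : 0 ≤ a) (haq : a ≤ q) (v : Rn n → ℝ) :
    posI a k ρ v ≤ volume (ball (0 : Rn n) ρ) + posI q k ρ v := by
  unfold posI
  rw [← setLIntegral_one, ← lintegral_add_left measurable_const]
  refine lintegral_mono fun x => ?_
  have h0 : 0 ≤ max (v x - k) 0 := le_max_right _ _
  set t := max (v x - k) 0
  rw [← ENNReal.ofReal_one, ← ENNReal.ofReal_add zero_le_one (by positivity)]
  apply ENNReal.ofReal_le_ofReal
  rcases le_total t 1 with h | h
  · have := Real.rpow_le_one h0 h ha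
    have : 0 ≤ t ^ q := by positivity
    linarith
  · have := Real.rpow_le_rpow_of_exponent_le h haq
    linarith

lemma Par.hpq (P : Par n s p Λ ε q κ) : p - 1 ≤ q := by
  have := P.hqs; have : p - 1 ≤ qStar p := le_max_right _ _; linarith

lemma Par.hN (P : Par n s p Λ ε q κ) : 0 < (n : ℝ) + s * p := by
  have hp0 := P.hp0
  have hs := P.hs
  have : (0 : ℝ) ≤ n := Nat.cast_nonneg n
  have : 0 < s * p := by positivity
  linarith

lemma dg_step (P : Par n s p Λ ε q κ) {T₀ : ℝ} (hT₀ : 0 ≤ T₀) :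
    ∃ K : ℝ, 0 < K ∧ ∀ (v : Rn n → ℝ) (m k d r ρ Y : ℝ), IsSub n s p Λ v 0 1 m →
      posI q 0 1 v ≤ 1 → posT n s p 0 1 v ≤ ENNReal.ofReal T₀ → 0 ≤ k → 0 < d → d ≤ 1 →
      1 / 4 ≤ r → r < ρ → ρ ≤ 1 → 0 ≤ Y → posI q k ρ v ≤ ENNReal.ofReal Y →
      posI q (k + 2 * d) r v ≤
        ENNReal.ofReal
          ((K * (d ^ (-(2 * q)) * (ρ - r) ^ (-((n : ℝ) + s * p + p)) * (Y + m))) ^ κ) := by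
  obtain ⟨C, hC, H⟩ := caccioppoli P
  obtain ⟨c, hc, Hc⟩ := exists_Hf_ge P
  have hp := P.hp
  have hp0 := P.hp0
  have hκ := P.hκ
  have hκ0 : 0 < κ := by linarith
  have hq0 := P.hq0
  have hpq := P.hpq
  have hNsp := P.hN
  set ω := (volume (ball (0 : Rn n) 1)).toReal with hω
  have hω0 : 0 < ω := volume_unitBall_pos n
  have hωe : volume (ball (0 : Rn n) 1) = ENNReal.ofReal ω :=
    (ENNReal.ofReal_toReal measure_ball_lt_top.ne).symm
  set K0 := 1 + (4 ^ ((n : ℝ) + s * p) * (ω + 1) + T₀) with hK0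
  have hK01 : 1 ≤ K0 := by rw [hK0]; linarith [(by positivity : (0:ℝ) ≤ 4 ^ ((n : ℝ) + s * p) * (ω + 1) + T₀)]
  refine ⟨(c⁻¹ * C) ^ (1 / κ) * K0, by positivity, fun v m k d r ρ Y hsub hY0 hT hk hd hd1 hr hrρ hρ hY hkY => ?_⟩
  have hm := hsub.mass
  have hρr : 0 < ρ - r := by linarith
  have hw := (hsub.scale hp one_pos (k + d) hd).mono hρ le_rfl
  have hpI := posI_scale (n := n) (q := q) one_pos hd (k + d) (-1) ρ v
  have hpT := posT_scale (n := n) (s := s) (p := p) one_pos hd (k + d) 0 ρ v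
  simp only [one_smul, one_mul, Real.one_rpow, mul_one, mul_zero, add_zero, mul_neg] at hw hpI hpT
  rw [add_neg_cancel_right] at hpI
  set w : Rn n → ℝ := fun y => (v y - (k + d)) / d with hwd
  have hA : ∫⁻ x in ball (0 : Rn n) ρ, ENNReal.ofReal (Wf q (w x)) ≤
      ENNReal.ofReal (d ^ (-q) * Y) := by
    rw [ENNReal.ofReal_mul (by positivity)]
    refine le_trans ?_ (hpI.le.trans (by gcongr))
    refine lintegral_mono fun x => ENNReal.ofReal_le_ofReal ?_
    unfold Wf
    split_ifs with h
    · refine Real.rpow_le_rpow (by linarith) (le_trans (by linarith) (le_max_left _ _)) hq0.le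
    · positivity
  set Tw := d ^ (1 - p) * (4 ^ ((n : ℝ) + s * p) * (ω + 1) + T₀) with hTw
  have hTail : ∫⁻ y in (ball (0 : Rn n) ρ)ᶜ, ENNReal.ofReal ((max (w y) 0) ^ (p - 1)) *
      fracKer n s p 0 y ≤ ENNReal.ofReal Tw := by
    have h1 : posT n s p 0 ρ w ≤ ENNReal.ofReal Tw := by
      rw [hpT, hTw, ENNReal.ofReal_mul (by positivity)]
      gcongr
      calc _ ≤ posT n s p 0 (1 / 4) v := posT_anti hp.le (by linarith) (by linarith) v
        _ ≤ ENNReal.ofReal ((1 / 4) ^ (-((n : ℝ) + s * p))) * posI (p - 1) 0 1 v +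
            posT n s p 0 1 v := tail_annulus hNsp.le (by norm_num)
        _ ≤ ENNReal.ofReal (4 ^ ((n : ℝ) + s * p)) * (ENNReal.ofReal ω + 1) + ENNReal.ofReal T₀ := by
            gcongr
            · rw [Real.rpow_neg (by norm_num), one_div, Real.inv_rpow (by norm_num), inv_inv]
            · refine (posI_le_add (by linarith) hpq v).trans ?_
              rw [hωe]; gcongr
        _ = _ := by
            rw [← ENNReal.ofReal_one, ← ENNReal.ofReal_add hω0.le zero_le_one,
              ← ENNReal.ofReal_mul (by positivity), ← ENNReal.ofReal_add (by positivity) hT₀]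
    unfold posT at h1
    simpa only [sub_zero] using h1
  have hC1 := (H w r ρ _ _ _ hr hrρ hρ (by positivity) (by positivity) hw hA hTail).1
  have hpt : posI q (k + 2 * d) r v ≤ ENNReal.ofReal c⁻¹ *
      ∫⁻ x in ball (0 : Rn n) r, ENNReal.ofReal (Hf p ε (max (w x) 0) ^ (p * κ)) := by
    rw [← lintegral_const_mul' _ _ ENNReal.ofReal_ne_top]
    refine lintegral_mono fun x => ?_
    have hH0 := Hf_nonneg hp0 P.hεp (le_max_right (w x) 0)
    rw [← ENNReal.ofReal_mul (by positivity)]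
    apply ENNReal.ofReal_le_ofReal
    rcases le_or_gt (v x) (k + 2 * d) with h | h
    · rw [max_eq_right (by linarith), Real.zero_rpow hq0.ne']
      positivity
    · have hw1 : 1 ≤ w x := by rw [hwd, one_le_div hd]; linarith
      rw [max_eq_left (by linarith), max_eq_left (by linarith : (0:ℝ) ≤ w x)]
      have h2 : v x - (k + 2 * d) ≤ w x := by
        have : v x - (k + d) = d * w x := by rw [hwd]; field_simp
        nlinarith
      have h3 := Hc (w x) hw1
      rw [← div_eq_inv_mul, le_div_iff₀ hc]
      calc _ ≤ w x ^ q * c := by gcongr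
        _ ≤ w x ^ ((p - 1 - ε) * κ) * c := by
          gcongr
          exact P.hqb.le
        _ ≤ _ := by linarith
  refine hpt.trans ?_
  refine (mul_le_mul_right hC1 _).trans ?_
  rw [← ENNReal.ofReal_mul (by positivity)]
  apply ENNReal.ofReal_le_ofReal
  set Z := (ρ - r) ^ (-((n : ℝ) + s * p + p)) with hZ
  have hZ1 : 1 ≤ Z := Real.one_le_rpow_of_pos_of_le_one_of_nonpos hρr (by linarith) (by linarith)
  have e1 : d ^ (1 - p) ≤ d ^ (-q) := Real.rpow_le_rpow_of_exponent_ge hd hd1 (by linarith)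
  have e2 : 1 ≤ d ^ (-q) := Real.one_le_rpow_of_pos_of_le_one_of_nonpos hd hd1 (by linarith)
  have e3 : d ^ (-(2 * q)) = d ^ (-q) * d ^ (-q) := by rw [← Real.rpow_add hd]; congr 1; ring
  set G := d ^ (-q) with hG
  have hG0 : 0 < G := by linarith
  have hTw1 : 1 + Tw ≤ G * K0 := by
    have hpos : (0:ℝ) ≤ 4 ^ ((n : ℝ) + s * p) * (ω + 1) + T₀ := by positivity
    rw [hTw, hK0, mul_add G, mul_one]
    have := mul_le_mul_of_nonneg_right e1 hpos
    linarith
  have hmm : m / d ^ (p - 1) ≤ K0 * (G * G * Z * m) := by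
    have : m / d ^ (p - 1) = d ^ (1 - p) * m := by
      rw [← neg_sub p 1, Real.rpow_neg hd.le]; field_simp
    rw [this]
    have h5 : 1 ≤ K0 * G * Z := by
      have : 1 ≤ K0 * G := one_le_mul_of_one_le_of_one_le hK01 e2
      exact one_le_mul_of_one_le_of_one_le this hZ1
    calc d ^ (1 - p) * m ≤ G * m := by gcongr
      _ = 1 * (G * m) := (one_mul _).symm
      _ ≤ K0 * G * Z * (G * m) := by gcongr
      _ = _ := by ring
  have hDle : Z * (1 + Tw) * (G * Y) + m / d ^ (p - 1) ≤ K0 * (G * G * Z * (Y + m)) := by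
    have : Z * (1 + Tw) * (G * Y) ≤ Z * (G * K0) * (G * Y) := by gcongr
    nlinarith
  rw [e3]
  have hD0 : 0 ≤ Z * (1 + Tw) * (G * Y) + m / d ^ (p - 1) := by positivity
  calc _ ≤ c⁻¹ * (C * (K0 * (G * G * Z * (Y + m))) ^ κ) := by gcongr
    _ = _ := by
      have hX : 0 ≤ K0 * (G * G * Z * (Y + m)) := by positivity
      have e4 : (c⁻¹ * C) ^ (1 / κ) * K0 * (G * G * Z * (Y + m)) =
          (c⁻¹ * C) ^ (1 / κ) * (K0 * (G * G * Z * (Y + m))) := by ring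
      rw [e4, Real.mul_rpow (by positivity) hX, ← Real.rpow_mul (by positivity),
        one_div_mul_cancel hκ0.ne', Real.rpow_one, mul_assoc c⁻¹ C]

lemma exists_geometric_seed {κ K B : ℝ} (hκ : 1 < κ) (hK : 0 < K) (hB : 1 < B) :
    ∃ ν l : ℝ, 0 < ν ∧ ν ≤ 1 ∧ 0 < l ∧ l < 1 ∧ ∀ j : ℕ,
      (K * (B ^ (j + 2) * (ν * l ^ j + ν * l ^ j))) ^ κ ≤ ν * l ^ (j + 1) := by
  have hκ1 : 0 < κ - 1 := by linarith
  have hB0 : 0 < B := by linarith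
  set l := B ^ (-(κ / (κ - 1))) with hl
  have hl0 : 0 < l := by positivity
  have hl1 : l < 1 := Real.rpow_lt_one_of_one_lt_of_neg hB (neg_neg_of_pos (by positivity))
  have hBl : B ^ κ * l ^ (κ - 1) = 1 := by
    rw [hl, ← Real.rpow_mul hB0.le, ← Real.rpow_add hB0]
    convert Real.rpow_zero B using 2
    field_simp; ring
  set M := (2 * K * B ^ 2) ^ κ with hM
  have hM0 : 0 < M := by positivity
  set ν := min 1 ((l / M) ^ (1 / (κ - 1))) with hν
  have hν0 : 0 < ν := lt_min one_pos (by positivity)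
  have hνM : M * ν ^ (κ - 1) ≤ l := by
    have : ν ^ (κ - 1) ≤ l / M := by
      calc ν ^ (κ - 1) ≤ ((l / M) ^ (1 / (κ - 1))) ^ (κ - 1) :=
            Real.rpow_le_rpow hν0.le (min_le_right _ _) hκ1.le
        _ = l / M := by
          rw [← Real.rpow_mul (by positivity), one_div_mul_cancel hκ1.ne', Real.rpow_one]
    rw [le_div_iff₀ hM0] at this
    linarith
  refine ⟨ν, l, hν0, min_le_left _ _, hl0, hl1, fun j => ?_⟩
  have e1 : K * (B ^ (j + 2) * (ν * l ^ j + ν * l ^ j)) = (2 * K * B ^ 2) * (ν * (B * l) ^ j) := by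
    rw [mul_pow, pow_add]; ring
  have e2 : (B * l) ^ κ = l := by
    rw [Real.mul_rpow hB0.le hl0.le]
    calc B ^ κ * l ^ κ = (B ^ κ * l ^ (κ - 1)) * l := by
          rw [mul_assoc]; congr 1
          conv_lhs => rw [show κ = (κ - 1) + 1 by ring, Real.rpow_add hl0, Real.rpow_one]
      _ = l := by rw [hBl, one_mul]
  rw [e1, Real.mul_rpow (x := 2 * K * B ^ 2) (by positivity) (by positivity),
    Real.mul_rpow (x := ν) (by positivity) (by positivity),
    ← Real.rpow_natCast (B * l), ← Real.rpow_mul (by positivity), mul_comm (j : ℝ) κ,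
    Real.rpow_mul (by positivity), e2, Real.rpow_natCast]
  have e3 : ν ^ κ = ν ^ (κ - 1) * ν := by
    conv_lhs => rw [show κ = (κ - 1) + 1 by ring, Real.rpow_add hν0, Real.rpow_one]
  rw [e3]
  calc M * (ν ^ (κ - 1) * ν * l ^ j) = (M * ν ^ (κ - 1)) * (ν * l ^ j) := by ring
    _ ≤ l * (ν * l ^ j) := by gcongr
    _ = _ := by ring

lemma de_giorgi (P : Par n s p Λ ε q κ) {T₀ : ℝ} (hT₀ : 0 ≤ T₀) :
    ∃ ν : ℝ, 0 < ν ∧ ν ≤ 1 ∧ ∀ τ : ℝ, 0 < τ → ∃ δ : ℝ, 0 < δ ∧ ∀ (v : Rn n → ℝ) (m : ℝ),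
      IsSub n s p Λ v 0 1 m → m ≤ δ → posI q 0 1 v ≤ ENNReal.ofReal ν →
      posT n s p 0 1 v ≤ ENNReal.ofReal T₀ → posI q 1 (1 / 2) v ≤ ENNReal.ofReal τ := by
  obtain ⟨K, hK, H⟩ := dg_step P hT₀
  have hq0 := P.hq0
  have hN := P.hN
  have hp0 := P.hp0
  set N := 2 * q + ((n : ℝ) + s * p + p) with hNd
  have hN0 : 0 < N := by positivity
  set B := (2 : ℝ) ^ N with hB
  have hB1 : 1 < B := Real.one_lt_rpow (by norm_num) hN0
  obtain ⟨ν, l, hν, hν1, hl, hl1, hrec⟩ := exists_geometric_seed P.hκ hK hB1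
  refine ⟨ν, hν, hν1, fun τ hτ => ?_⟩
  obtain ⟨J, hJ⟩ : ∃ J : ℕ, ν * l ^ J ≤ τ := by
    obtain ⟨J, hJ⟩ := exists_pow_lt_of_lt_one (div_pos hτ hν) hl1
    exact ⟨J, by rw [lt_div_iff₀ hν] at hJ; linarith⟩
  refine ⟨ν * l ^ J, by positivity, fun v m hv hm hI hT => ?_⟩
  have hmass := hv.mass
  have hI1 : posI q 0 1 v ≤ 1 := hI.trans (by simpa using ENNReal.ofReal_le_ofReal hν1)
  have key : ∀ j : ℕ, j ≤ J → posI q (1 - (1 / 2) ^ j) (1 / 2 + (1 / 2) ^ (j + 1)) v ≤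
      ENNReal.ofReal (ν * l ^ j) := by
    intro j
    induction j with
    | zero => intro _; norm_num; exact hI
    | succ j ih =>
      intro hj
      have hj' := ih (by omega)
      have hd0 : (0 : ℝ) < (1 / 2) ^ (j + 2) := by positivity
      have hd1 : ((1 : ℝ) / 2) ^ (j + 2) ≤ 1 := pow_le_one₀ (by norm_num) (by norm_num)
      have hd1' : ((1 : ℝ) / 2) ^ j ≤ 1 := pow_le_one₀ (by norm_num) (by norm_num)
      have hA : ((1 : ℝ) / 2) ^ (j + 2) = (1 / 2) ^ j / 4 := by ring
      have hA1 : ((1 : ℝ) / 2) ^ (j + 1) = (1 / 2) ^ j / 2 := by ring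
      have := H v m (1 - (1 / 2) ^ j) ((1 / 2) ^ (j + 2)) (1 / 2 + (1 / 2) ^ (j + 1 + 1))
        (1 / 2 + (1 / 2) ^ (j + 1)) (ν * l ^ j) hv hI1 hT (by linarith) hd0 hd1
        (by linarith) (by rw [show j + 1 + 1 = j + 2 by ring]; linarith) (by linarith)
        (by positivity) hj'
      have e1 : (1 : ℝ) - (1 / 2) ^ j + 2 * (1 / 2) ^ (j + 2) = 1 - (1 / 2) ^ (j + 1) := by
        ring
      have e2 : (1 : ℝ) / 2 + (1 / 2) ^ (j + 1) - (1 / 2 + (1 / 2) ^ (j + 1 + 1)) =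
          (1 / 2) ^ (j + 2) := by ring
      rw [e1, e2, ← Real.rpow_add hd0] at this
      have e3 : (((1 : ℝ) / 2) ^ (j + 2)) ^ (-(2 * q) + -((n : ℝ) + s * p + p)) = B ^ (j + 2) := by
        rw [hB, ← Real.rpow_natCast (2 ^ N), ← Real.rpow_mul (by norm_num), one_div, inv_pow,
          ← Real.rpow_natCast 2, ← Real.rpow_neg (by norm_num), ← Real.rpow_mul (by norm_num)]
        congr 1; rw [hNd]; ring
      rw [e3] at this
      refine this.trans (ENNReal.ofReal_le_ofReal (le_trans ?_ (hrec j)))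
      have hm2 : m ≤ ν * l ^ j := hm.trans (by
        gcongr ν * ?_
        exact pow_le_pow_of_le_one hl.le hl1.le (by omega))
      have : 0 ≤ ν * l ^ j := by positivity
      have hκ0 : 0 ≤ κ := by linarith [P.hκ]
      gcongr
  have hfin := (key J le_rfl).trans (ENNReal.ofReal_le_ofReal hJ)
  refine le_trans ?_ hfin
  refine (posI_anti hq0.le (k := 1 - (1 / 2) ^ J) (by linarith [(by positivity : (0:ℝ) ≤ (1/2)^J)])
    (by linarith [(by positivity : (0:ℝ) ≤ (1/2)^(J+1))]) v)

lemma Par.hq1' (P : Par n s p Λ ε q κ) : 1 ≤ q := by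
  have := P.hqs; have : 1 ≤ qStar p := le_max_left _ _; linarith

lemma exists_rpow_le_Sf (P : Par n s p Λ ε q κ) : ∃ C : ℝ, 0 < C ∧ ∀ t : ℝ, 0 ≤ t →
    t ^ q ≤ C * (Sf ε t + (max (t - 1) 0) ^ q) := by
  have hq := P.hq1'
  have hε := P.hε
  refine ⟨2 ^ q * (ε * 3 ^ (-(1 + ε)))⁻¹ + 2 ^ q, by positivity, fun t ht => ?_⟩
  have hS0 := Sf_nonneg hε ht
  have hm0 : 0 ≤ max (t - 1) 0 ^ q := by positivity
  set c := ε * (3 : ℝ) ^ (-(1 + ε)) with hc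
  have hc0 : 0 < c := by positivity
  have h2q : (0 : ℝ) < 2 ^ q := by positivity
  rcases le_total t 2 with h | h
  · have h1 := Sf_sub_ge hε le_rfl ht
    rw [Sf_zero, sub_zero, sub_zero] at h1
    have h3 : (3 : ℝ) ^ (-(1 + ε)) ≤ (1 + t) ^ (-(1 + ε)) :=
      Real.rpow_le_rpow_of_nonpos (by linarith) (by linarith) (by linarith)
    have h4 : c * t ≤ Sf ε t := le_trans (by rw [hc]; gcongr) h1
    have h5 : t ^ q ≤ 2 ^ q * t := by
      rcases ht.eq_or_lt with h0 | h0
      · rw [← h0, Real.zero_rpow (by linarith)]; simp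
      · have : t ^ q = t ^ (q - 1) * t := by rw [Real.rpow_sub_one h0.ne']; field_simp
        rw [this]
        gcongr
        calc t ^ (q - 1) ≤ 2 ^ (q - 1) := Real.rpow_le_rpow ht h (by linarith)
          _ ≤ 2 ^ q := Real.rpow_le_rpow_of_exponent_le (by norm_num) (by linarith)
    have h6 : t ≤ c⁻¹ * Sf ε t := by rw [inv_mul_eq_div, le_div_iff₀ hc0]; linarith
    have h7 : 2 ^ q * t ≤ 2 ^ q * (c⁻¹ * Sf ε t) := by gcongr
    have h8 : 0 ≤ c⁻¹ := by positivity
    nlinarith [mul_nonneg (mul_nonneg h2q.le h8) hm0, mul_nonneg h2q.le hS0, mul_nonneg h2q.le hm0]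
  · rw [max_eq_left (by linarith)] at hm0 ⊢
    have h5 : t ^ q ≤ 2 ^ q * (t - 1) ^ q := by
      rw [← Real.mul_rpow (by norm_num) (by linarith)]
      exact Real.rpow_le_rpow ht (by linarith) (by linarith)
    have h8 : 0 ≤ 2 ^ q * c⁻¹ := by positivity
    nlinarith [mul_nonneg h8 hm0, mul_nonneg h8 hS0, mul_nonneg h2q.le hS0]

lemma Wf_le (hq : 0 ≤ q) (t : ℝ) : Wf q t ≤ 2 ^ q * (2 ^ q + (max (t - 1) 0) ^ q) := by
  unfold Wf
  split_ifs with h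
  · calc (1 + t) ^ q ≤ (2 + max (t - 1) 0) ^ q :=
        Real.rpow_le_rpow (by linarith) (by linarith [le_max_left (t - 1) 0]) hq
      _ ≤ _ := add_rpow_le_two hq (by norm_num) (le_max_right _ _)
  · positivity

/-- Local boundedness in a smaller ball from small mass, rescaled to level and radius one half. -/
lemma de_giorgi_half (P : Par n s p Λ ε q κ) {T₀ : ℝ} (hT₀ : 0 ≤ T₀) :
    ∃ ν : ℝ, 0 < ν ∧ ν ≤ 1 ∧ ∀ τ : ℝ, 0 < τ → ∃ δ : ℝ, 0 < δ ∧ ∀ (v : Rn n → ℝ) (m : ℝ),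
      IsSub n s p Λ v 0 1 m → m ≤ δ → posI q 0 (1 / 2) v ≤ ENNReal.ofReal ν →
      posT n s p 0 (1 / 2) v ≤ ENNReal.ofReal T₀ →
        posI q (1 / 2) (1 / 4) v ≤ ENNReal.ofReal τ := by
  have hp := P.hp
  have hq0 := P.hq0
  set a : ℝ := (1 / 2) ^ (-(n : ℝ)) * (1 / 2) ^ (-q) with ha
  set b : ℝ := (1 / 2) ^ (s * p) * (1 / 2) ^ (1 - p) with hb
  set c : ℝ := (1 / 2) ^ (s * p - n) / (1 / 2) ^ (p - 1) with hc
  have ha0 : 0 < a := by positivity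
  have hb0 : 0 < b := by positivity
  have hc0 : 0 < c := by positivity
  have ha1 : 1 ≤ a := by
    have h1 : (1 : ℝ) ≤ (1 / 2) ^ (-(n : ℝ)) :=
      Real.one_le_rpow_of_pos_of_le_one_of_nonpos (by norm_num) (by norm_num) (by simp)
    have h2 : (1 : ℝ) ≤ (1 / 2) ^ (-q) :=
      Real.one_le_rpow_of_pos_of_le_one_of_nonpos (by norm_num) (by norm_num) (by linarith)
    exact one_le_mul_of_one_le_of_one_le h1 h2
  obtain ⟨ν, hν, hν1, H⟩ := de_giorgi P (T₀ := b * T₀) (by positivity)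
  refine ⟨ν / a, by positivity, (div_le_one ha0).2 (hν1.trans ha1), fun τ hτ => ?_⟩
  obtain ⟨δ, hδ, H⟩ := H (a * τ) (by positivity)
  refine ⟨δ / c, by positivity, fun v m hv hm hI hT => ?_⟩
  have hsc := (hv.mono (by norm_num : (1 : ℝ) / 2 ≤ 1) le_rfl).scale hp (by norm_num) 0 (by norm_num : (0 : ℝ) < 1 / 2)
  have e1 := posI_scale (n := n) (q := q) (by norm_num : (0 : ℝ) < 1 / 2) (by norm_num : (0 : ℝ) < 1 / 2) 0 0 1 v
  have e2 := posI_scale (n := n) (q := q) (by norm_num : (0 : ℝ) < 1 / 2) (by norm_num : (0 : ℝ) < 1 / 2) 0 1 (1 / 2) v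
  have e3 := posT_scale (n := n) (s := s) (p := p) (by norm_num : (0 : ℝ) < 1 / 2) (by norm_num : (0 : ℝ) < 1 / 2) 0 0 1 v
  rw [← ha] at e1 e2
  rw [← hb] at e3
  norm_num only [mul_zero, add_zero, mul_one, zero_add] at e1 e2 e3
  have hm' : m * (1 / 2) ^ (s * p - n) / (1 / 2) ^ (p - 1) ≤ δ := by
    rw [mul_div_assoc, ← hc]; rwa [le_div_iff₀ hc0] at hm
  have := H _ _ hsc hm' (by
      norm_num only at hI ⊢
      rw [e1]
      calc _ ≤ ENNReal.ofReal a * ENNReal.ofReal (ν / a) := by gcongr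
        _ = _ := by rw [← ENNReal.ofReal_mul ha0.le]; congr 1; field_simp)
    (by
      norm_num only at hT ⊢
      rw [e3, ENNReal.ofReal_mul hb0.le]; gcongr)
  norm_num only at this ⊢
  rw [e2, ENNReal.ofReal_mul ha0.le] at this
  exact (ENNReal.mul_le_mul_iff_right (by simpa using ha0) ENNReal.ofReal_ne_top).1 this

lemma growth (P : Par n s p Λ ε q κ) {T₀ : ℝ} (hT₀ : 0 ≤ T₀) :
    ∃ M : ℝ, 0 < M ∧ ∀ τ : ℝ, 0 < τ → ∃ δ : ℝ, 0 < δ ∧ ∀ (v : Rn n → ℝ) (m : ℝ),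
      IsSub n s p Λ v 0 1 m → m ≤ δ → posI q 1 1 v ≤ ENNReal.ofReal δ →
      posT n s p 0 1 v ≤ ENNReal.ofReal T₀ →
      volume (ball (0 : Rn n) (1 / 2)) ≤ 2 * volume {x ∈ ball (0 : Rn n) (1 / 2) | v x ≤ -M} →
        posI q (1 / 2) (1 / 4) v ≤ ENNReal.ofReal τ := by
  obtain ⟨C, hC, Hc⟩ := caccioppoli P
  obtain ⟨C3, hC3, H3⟩ := exists_rpow_le_Sf P
  have hp := P.hp
  have hq0 := P.hq0
  have hN := P.hN
  have hω0 : 0 < (volume (ball (0 : Rn n) 1)).toReal := volume_unitBall_pos n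
  have hωe : volume (ball (0 : Rn n) 1) = ENNReal.ofReal (volume (ball (0 : Rn n) 1)).toReal :=
    (ENNReal.ofReal_toReal measure_ball_lt_top.ne).symm
  have hw0 : 0 < (volume (ball (0 : Rn n) (1 / 2))).toReal :=
    ENNReal.toReal_pos (measure_ball_pos _ _ (by norm_num)).ne' measure_ball_lt_top.ne
  have hwe : volume (ball (0 : Rn n) (1 / 2)) =
      ENNReal.ofReal (volume (ball (0 : Rn n) (1 / 2))).toReal :=
    (ENNReal.ofReal_toReal measure_ball_lt_top.ne).symm
  set ω := (volume (ball (0 : Rn n) 1)).toReal with hω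
  set w := (volume (ball (0 : Rn n) (1 / 2))).toReal with hw
  set A : ℝ := 2 ^ q * (2 ^ q * ω + 1) with hA
  have hA0 : 0 < A := by positivity
  set I1 : ℝ := ω + A with hI1
  set T1 : ℝ := (1 / 2) ^ (-((n : ℝ) + s * p)) * I1 + T₀ with hT1
  have hT10 : 0 ≤ T1 := by positivity
  obtain ⟨ν, hν, hν1, H⟩ := de_giorgi_half P hT10
  set C2 : ℝ := C * ((1 - 1 / 2) ^ (-((n : ℝ) + s * p + p)) * (1 + T₀) * A + 1) with hC2
  have hC20 : 0 < C2 := by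
    have : (0 : ℝ) < (1 - 1 / 2) ^ (-((n : ℝ) + s * p + p)) := Real.rpow_pos_of_pos (by norm_num) _
    positivity
  set M : ℝ := (4 * C3 * C2 / (w * ν)) ^ (1 / (p - 1)) with hM
  have hM0 : 0 < M := by positivity
  refine ⟨M, hM0, fun τ hτ => ?_⟩
  obtain ⟨δ, hδ, H⟩ := H τ hτ
  refine ⟨min δ (min 1 (ν / (2 * C3))), by positivity, fun v m hv hm hI hT hvol => ?_⟩
  have hmeas := hv.meas
  have hmass := hv.mass
  have hm1 : m ≤ δ := hm.trans (min_le_left _ _)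
  have hm2 : m ≤ 1 := hm.trans ((min_le_right _ _).trans (min_le_left _ _))
  have hI2 : posI q 1 1 v ≤ ENNReal.ofReal 1 :=
    hI.trans (ENNReal.ofReal_le_ofReal ((min_le_right _ _).trans (min_le_left _ _)))
  have hI3 : posI q 1 1 v ≤ ENNReal.ofReal (ν / (2 * C3)) :=
    hI.trans (ENNReal.ofReal_le_ofReal ((min_le_right _ _).trans (min_le_right _ _)))
  have hgen : ∀ f : Rn n → ℝ, (∀ x, f x ≤ 2 ^ q * (2 ^ q + (max (v x - 1) 0) ^ q)) →
      ∫⁻ x in ball (0 : Rn n) 1, ENNReal.ofReal (f x) ≤ ENNReal.ofReal A := by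
    intro f hf
    calc _ ≤ ∫⁻ x in ball (0 : Rn n) 1, (ENNReal.ofReal (2 ^ q) * (ENNReal.ofReal (2 ^ q) +
            ENNReal.ofReal ((max (v x - 1) 0) ^ q))) := by
          refine lintegral_mono fun x => ?_
          rw [← ENNReal.ofReal_add (by positivity) (by positivity), ← ENNReal.ofReal_mul (by positivity)]
          exact ENNReal.ofReal_le_ofReal (hf x)
      _ = ENNReal.ofReal (2 ^ q) * (ENNReal.ofReal (2 ^ q) * ENNReal.ofReal ω + posI q 1 1 v) := by
          rw [lintegral_const_mul' _ _ ENNReal.ofReal_ne_top, lintegral_add_left measurable_const,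
            setLIntegral_const, hωe]; rfl
      _ ≤ ENNReal.ofReal (2 ^ q) * (ENNReal.ofReal (2 ^ q) * ENNReal.ofReal ω + ENNReal.ofReal 1) := by
          gcongr
      _ = _ := by
          rw [← ENNReal.ofReal_mul (by positivity), ← ENNReal.ofReal_add (by positivity) zero_le_one,
            ← ENNReal.ofReal_mul (by positivity)]
  have hWf := hgen (fun x => Wf q (v x)) (fun x => Wf_le hq0.le _)
  have hT' : ∫⁻ y in (ball (0 : Rn n) 1)ᶜ, ENNReal.ofReal ((max (v y) 0) ^ (p - 1)) *
      fracKer n s p 0 y ≤ ENNReal.ofReal T₀ := by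
    unfold posT at hT; simpa only [sub_zero] using hT
  have hcac := (Hc v (1 / 2) 1 m A T₀ (by norm_num) (by norm_num) le_rfl hA0.le hT₀ hv hWf hT').2
  have hcac' := hcac.trans (ENNReal.ofReal_le_ofReal (q := C2) (by rw [hC2]; gcongr))
  have hneg : ENNReal.ofReal (M ^ (p - 1) * (w / 2)) ≤
      ∫⁻ x in ball (0 : Rn n) (1 / 2), ENNReal.ofReal ((max (-v x) 0) ^ (p - 1)) := by
    have hset : MeasurableSet {x ∈ ball (0 : Rn n) (1 / 2) | v x ≤ -M} :=
      measurableSet_ball.inter (hmeas measurableSet_Iic)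
    calc ENNReal.ofReal (M ^ (p - 1) * (w / 2))
        = ENNReal.ofReal (M ^ (p - 1)) * (ENNReal.ofReal w / 2) := by
          rw [ENNReal.ofReal_mul (by positivity), ENNReal.ofReal_div_of_pos (by norm_num)]; simp
      _ ≤ ENNReal.ofReal (M ^ (p - 1)) * volume {x ∈ ball (0 : Rn n) (1 / 2) | v x ≤ -M} := by
          gcongr
          rw [← hwe]
          exact ENNReal.div_le_of_le_mul' hvol
      _ = ∫⁻ x in {x ∈ ball (0 : Rn n) (1 / 2) | v x ≤ -M}, ENNReal.ofReal (M ^ (p - 1)) := by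
          rw [setLIntegral_const]
      _ ≤ ∫⁻ x in {x ∈ ball (0 : Rn n) (1 / 2) | v x ≤ -M},
            ENNReal.ofReal ((max (-v x) 0) ^ (p - 1)) := by
          refine setLIntegral_mono' hset fun x hx => ENNReal.ofReal_le_ofReal ?_
          refine Real.rpow_le_rpow hM0.le (le_trans ?_ (le_max_left _ _)) (by linarith)
          linarith [hx.2]
      _ ≤ _ := lintegral_mono_set (sep_subset _ _)
  have hMp : M ^ (p - 1) * (w / 2) = 2 * C3 * C2 / ν := by
    rw [hM, ← Real.rpow_mul (by positivity), one_div_mul_cancel (by linarith), Real.rpow_one]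
    field_simp; ring
  have hS : ∫⁻ x in ball (0 : Rn n) (1 / 2), ENNReal.ofReal (Sf ε (max (v x) 0)) ≤
      ENNReal.ofReal (ν / (2 * C3)) := by
    rw [hMp] at hneg
    have h1 := (mul_le_mul_right hneg _).trans hcac'
    have h2 : ENNReal.ofReal C2 = ENNReal.ofReal (ν / (2 * C3)) * ENNReal.ofReal (2 * C3 * C2 / ν) := by
      rw [← ENNReal.ofReal_mul (by positivity)]; congr 1; field_simp
    rw [h2] at h1
    exact (ENNReal.mul_le_mul_iff_left (by
      have : 0 < 2 * C3 * C2 / ν := by positivity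
      simpa using this) ENNReal.ofReal_ne_top).1 h1
  refine H v m hv hm1 ?_ ?_
  · calc posI q 0 (1 / 2) v ≤ ∫⁻ x in ball (0 : Rn n) (1 / 2), ENNReal.ofReal C3 *
          (ENNReal.ofReal (Sf ε (max (v x) 0)) + ENNReal.ofReal ((max (v x - 1) 0) ^ q)) := by
          refine lintegral_mono fun x => ?_
          rw [← ENNReal.ofReal_add (Sf_nonneg P.hε (le_max_right _ _)) (by positivity),
            ← ENNReal.ofReal_mul hC3.le, sub_zero]
          apply ENNReal.ofReal_le_ofReal
          have := H3 (max (v x) 0) (le_max_right _ _)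
          have e : max (max (v x) 0 - 1) 0 = max (v x - 1) 0 := by
            rcases le_total (v x) 0 with h | h
            · rw [max_eq_right h, max_eq_right (by norm_num), max_eq_right (by linarith)]
            · rw [max_eq_left h]
          rwa [e] at this
      _ = ENNReal.ofReal C3 * ((∫⁻ x in ball (0 : Rn n) (1 / 2), ENNReal.ofReal (Sf ε (max (v x) 0))) +
            posI q 1 (1 / 2) v) := by
          rw [lintegral_const_mul' _ _ ENNReal.ofReal_ne_top, lintegral_add_left]; rfl
          exact ((measurable_Sf ε).comp (hmeas.max measurable_const)).ennreal_ofReal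
      _ ≤ ENNReal.ofReal C3 * (ENNReal.ofReal (ν / (2 * C3)) + ENNReal.ofReal (ν / (2 * C3))) := by
          gcongr
          exact (posI_anti hq0.le le_rfl (by norm_num) v).trans hI3
      _ = ENNReal.ofReal ν := by
          rw [← ENNReal.ofReal_add (by positivity) (by positivity), ← ENNReal.ofReal_mul hC3.le]
          congr 1; field_simp; ring
  · calc posT n s p 0 (1 / 2) v ≤ ENNReal.ofReal ((1 / 2) ^ (-((n : ℝ) + s * p))) *
          posI (p - 1) 0 1 v + posT n s p 0 1 v := tail_annulus hN.le (by norm_num)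
      _ ≤ ENNReal.ofReal ((1 / 2) ^ (-((n : ℝ) + s * p))) * (ENNReal.ofReal ω + ENNReal.ofReal A) +
          ENNReal.ofReal T₀ := by
          gcongr
          refine (posI_le_add (by linarith) P.hpq v).trans ?_
          rw [hωe]
          gcongr
          refine hgen _ fun x => ?_
          rw [sub_zero]
          calc max (v x) 0 ^ q ≤ (2 + max (v x - 1) 0) ^ q := by
                refine Real.rpow_le_rpow (le_max_right _ _) (max_le ?_ ?_) hq0.le
                · linarith [le_max_left (v x - 1) 0]
                · linarith [le_max_right (v x - 1) 0]
            _ ≤ _ := add_rpow_le_two hq0.le (by norm_num) (le_max_right _ _)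
      _ = _ := by
          rw [← ENNReal.ofReal_add hω0.le hA0.le, ← ENNReal.ofReal_mul (by positivity),
            ← ENNReal.ofReal_add (by positivity) hT₀]

lemma rpow_interpolate {a q b M t : ℝ} (hM : 0 < M) (ht : 0 < t) (haq : a ≤ q) (hqb : q ≤ b) :
    t ^ q ≤ M ^ (q - a) * t ^ a + M ^ (q - b) * t ^ b := by
  rcases le_total t M with h | h
  · have : t ^ q ≤ M ^ (q - a) * t ^ a := by
      calc t ^ q = t ^ (q - a) * t ^ a := by rw [← Real.rpow_add ht]; congr 1; ring
        _ ≤ _ := by gcongr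
    have : 0 ≤ M ^ (q - b) * t ^ b := by positivity
    linarith
  · have : t ^ q ≤ M ^ (q - b) * t ^ b := by
      calc t ^ q = t ^ (q - b) * t ^ b := by rw [← Real.rpow_add ht]; congr 1; ring
        _ ≤ _ := mul_le_mul_of_nonneg_right
          (Real.rpow_le_rpow_of_nonpos hM h (by linarith)) (by positivity)
    have : 0 ≤ M ^ (q - a) * t ^ a := by positivity
    linarith

lemma lintegral_abs_rpow_le {a b ρ : ℝ} (ha : 0 ≤ a) (hab : a ≤ b) (v : Rn n → ℝ) :
    ∫⁻ x in ball (0 : Rn n) ρ, ENNReal.ofReal (|v x| ^ a) ≤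
      volume (ball (0 : Rn n) ρ) + ∫⁻ x in ball (0 : Rn n) ρ, ENNReal.ofReal (|v x| ^ b) := by
  rw [← setLIntegral_one, ← lintegral_add_left measurable_const]
  refine lintegral_mono fun x => ?_
  rw [← ENNReal.ofReal_one, ← ENNReal.ofReal_add zero_le_one (by positivity)]
  apply ENNReal.ofReal_le_ofReal
  have h0 := abs_nonneg (v x)
  rcases le_total |v x| 1 with h | h
  · have := Real.rpow_le_one h0 h ha
    have : 0 ≤ |v x| ^ b := by positivity
    linarith
  · have := Real.rpow_le_rpow_of_exponent_le h hab
    linarith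

lemma posI_le_abs {k r : ℝ} (hq : 0 ≤ q) (hk : 0 ≤ k) (v : Rn n → ℝ) :
    posI q k r v ≤ ∫⁻ x in ball (0 : Rn n) r, ENNReal.ofReal (|v x| ^ q) := by
  refine lintegral_mono fun x => ENNReal.ofReal_le_ofReal (Real.rpow_le_rpow (le_max_right _ _) ?_ hq)
  exact max_le (by linarith [le_abs_self (v x)]) (abs_nonneg _)

set_option maxHeartbeats 1000000 in
lemma improve_step (P : Par n s p Λ ε q κ) :
    ∃ C : ℝ, 1 ≤ C ∧ ∀ (v : Rn n → ℝ) (m r ρ Y : ℝ), IsSub n s p Λ v 0 1 m → m ≤ 1 →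
      ∫⁻ x in ball (0 : Rn n) 1, ENNReal.ofReal (|v x| ^ qStar p) ≤ 1 → posT n s p 0 1 v ≤ 1 →
      1 / 2 ≤ r → r < ρ → ρ ≤ 1 → 1 ≤ Y → posI q 0 ρ v ≤ ENNReal.ofReal Y →
      posI q 0 r v ≤ ENNReal.ofReal
        (C * ((ρ - r) ^ (-((n : ℝ) + s * p + p)) * Y) ^
          (κ * (q - qStar p) / ((p - 1 - ε) * κ - qStar p))) := by
  obtain ⟨C, hC, H⟩ := caccioppoli P
  obtain ⟨c, hc, Hc⟩ := exists_Hf_ge P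
  have hp := P.hp
  have hp0 := P.hp0
  have hκ := P.hκ
  have hκ0 : 0 < κ := by linarith
  have hq0 := P.hq0
  have hN := P.hN
  have hqs := P.hqs
  have hqb := P.hqb
  set b := (p - 1 - ε) * κ with hb
  set a := qStar p with ha
  have ha1 : 1 ≤ a := le_max_left _ _
  have hpa : p - 1 ≤ a := le_max_right _ _
  have hba : 0 < b - a := by linarith
  set θ := κ * (q - a) / (b - a) with hθ
  have hθ0 : 0 < θ := div_pos (mul_pos hκ0 (by linarith)) hba
  have hω0 : 0 < (volume (ball (0 : Rn n) 1)).toReal := volume_unitBall_pos n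
  have hωe : volume (ball (0 : Rn n) 1) = ENNReal.ofReal (volume (ball (0 : Rn n) 1)).toReal :=
    (ENNReal.ofReal_toReal measure_ball_lt_top.ne).symm
  set ω := (volume (ball (0 : Rn n) 1)).toReal with hω
  set T1 : ℝ := (1 / 2) ^ (-((n : ℝ) + s * p)) * (ω + 1) + 1 with hT1
  have hT10 : 0 < T1 := by positivity
  set K1 : ℝ := (1 + T1) * (2 ^ q * (ω + 1)) + 1 with hK1
  have hK10 : 1 ≤ K1 := by
    have : 0 ≤ (1 + T1) * (2 ^ q * (ω + 1)) := by positivity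
    linarith
  set F : ℝ := 1 + c⁻¹ * C with hF
  have hF1 : 1 ≤ F := by
    have : 0 ≤ c⁻¹ * C := by positivity
    linarith
  have hC5 : 1 ≤ (ω + 1 + F) * K1 ^ θ :=
    one_le_mul_of_one_le_of_one_le (by linarith) (Real.one_le_rpow hK10 hθ0.le)
  refine ⟨(ω + 1 + F) * K1 ^ θ, hC5, fun v m r ρ Y hv hm hI hT hr hrρ hρ hY hX => ?_⟩
  have hmeas := hv.meas
  have hmass := hv.mass
  have hρr : 0 < ρ - r := by linarith
  set Z := (ρ - r) ^ (-((n : ℝ) + s * p + p)) with hZ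
  have hZ1 : 1 ≤ Z := Real.one_le_rpow_of_pos_of_le_one_of_nonpos hρr (by linarith) (by linarith)
  have hA : ∫⁻ x in ball (0 : Rn n) ρ, ENNReal.ofReal (Wf q (v x)) ≤
      ENNReal.ofReal (2 ^ q * (ω + 1) * Y) := by
    calc _ ≤ ∫⁻ x in ball (0 : Rn n) ρ, (ENNReal.ofReal (2 ^ q) * (1 +
            ENNReal.ofReal ((max (v x - 0) 0) ^ q))) := by
          refine lintegral_mono fun x => ?_
          rw [← ENNReal.ofReal_one, ← ENNReal.ofReal_add zero_le_one (by positivity),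
            ← ENNReal.ofReal_mul (by positivity)]
          apply ENNReal.ofReal_le_ofReal
          unfold Wf
          split_ifs with h
          · rw [sub_zero, max_eq_left h.le]
            simpa using add_rpow_le_two hq0.le zero_le_one h.le
          · positivity
      _ = ENNReal.ofReal (2 ^ q) * (volume (ball (0 : Rn n) ρ) + posI q 0 ρ v) := by
          rw [lintegral_const_mul' _ _ ENNReal.ofReal_ne_top, lintegral_add_left measurable_const,
            setLIntegral_const, one_mul]; rfl
      _ ≤ ENNReal.ofReal (2 ^ q) * (ENNReal.ofReal ω + ENNReal.ofReal Y) := by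
          gcongr
          rw [← hωe]
          exact measure_mono (ball_subset_ball hρ)
      _ = ENNReal.ofReal (2 ^ q * (ω + Y)) := by
          rw [← ENNReal.ofReal_add hω0.le (by linarith), ← ENNReal.ofReal_mul (by positivity)]
      _ ≤ _ := by
          apply ENNReal.ofReal_le_ofReal
          rw [mul_assoc]
          gcongr
          nlinarith
  have hTail : ∫⁻ y in (ball (0 : Rn n) ρ)ᶜ, ENNReal.ofReal ((max (v y) 0) ^ (p - 1)) *
      fracKer n s p 0 y ≤ ENNReal.ofReal T1 := by
    have h1 : posT n s p 0 ρ v ≤ ENNReal.ofReal T1 := by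
      calc _ ≤ posT n s p 0 (1 / 2) v := posT_anti hp.le le_rfl (by linarith) v
        _ ≤ ENNReal.ofReal ((1 / 2) ^ (-((n : ℝ) + s * p))) * posI (p - 1) 0 1 v +
            posT n s p 0 1 v := tail_annulus hN.le (by norm_num)
        _ ≤ ENNReal.ofReal ((1 / 2) ^ (-((n : ℝ) + s * p))) * (ENNReal.ofReal ω + 1) + 1 := by
            gcongr
            refine (posI_le_abs (by linarith) le_rfl v).trans ?_
            refine (lintegral_abs_rpow_le (by linarith) hpa v).trans ?_
            rw [hωe]
            gcongr
        _ = _ := by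
            rw [← ENNReal.ofReal_one, ← ENNReal.ofReal_add hω0.le zero_le_one,
              ← ENNReal.ofReal_mul (by positivity), ← ENNReal.ofReal_add (by positivity) zero_le_one]
    unfold posT at h1
    simpa only [sub_zero] using h1
  have hcac := (H v r ρ m _ _ (by linarith) hrρ hρ (by positivity) hT10.le
    (hv.mono hρ le_rfl) hA hTail).1
  set D := K1 * (Z * Y) with hD
  have hZY : 1 ≤ Z * Y := one_le_mul_of_one_le_of_one_le hZ1 hY
  have hD1 : 1 ≤ D := one_le_mul_of_one_le_of_one_le hK10 hZY
  have hD0 : 0 < D := by linarith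
  have hDle : Z * (1 + T1) * (2 ^ q * (ω + 1) * Y) + m ≤ D := by
    rw [hD, hK1]; nlinarith
  have hcac' := hcac.trans (ENNReal.ofReal_le_ofReal (q := C * D ^ κ) (by gcongr))
  set M := D ^ (κ / (b - a)) with hM
  have hM0 : 0 < M := by positivity
  have hM1 : M ^ (q - a) = D ^ θ := by
    rw [hM, ← Real.rpow_mul hD0.le]; congr 1; rw [hθ]; ring
  have hM2 : M ^ (q - b) * D ^ κ = D ^ θ := by
    rw [hM, ← Real.rpow_mul hD0.le, ← Real.rpow_add hD0]; congr 1; rw [hθ]; field_simp; ring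
  calc posI q 0 r v ≤ ∫⁻ x in ball (0 : Rn n) r, (1 + (ENNReal.ofReal (M ^ (q - a)) *
          ENNReal.ofReal (|v x| ^ a) + ENNReal.ofReal (M ^ (q - b) * c⁻¹) *
          ENNReal.ofReal (Hf p ε (max (v x) 0) ^ (p * κ)))) := by
        refine lintegral_mono fun x => ?_
        have hH0 := Hf_nonneg hp0 P.hεp (le_max_right (v x) 0)
        have h1 : 0 ≤ Hf p ε (max (v x) 0) ^ (p * κ) := by positivity
        rw [← ENNReal.ofReal_mul (by positivity), ← ENNReal.ofReal_mul (by positivity),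
          ← ENNReal.ofReal_add (by positivity) (by positivity), ← ENNReal.ofReal_one,
          ← ENNReal.ofReal_add zero_le_one (by positivity)]
        apply ENNReal.ofReal_le_ofReal
        rw [sub_zero]
        have h2 : 0 ≤ M ^ (q - a) * |v x| ^ a := by positivity
        have h3 : 0 ≤ M ^ (q - b) * c⁻¹ * Hf p ε (max (v x) 0) ^ (p * κ) := by positivity
        rcases le_total (v x) 1 with h | h
        · have : max (v x) 0 ^ q ≤ 1 :=
            Real.rpow_le_one (le_max_right _ _) (max_le h zero_le_one) hq0.le
          linarith
        · have hx : 0 < v x := by linarith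
          rw [max_eq_left hx.le, abs_of_pos hx]
          have h4 := rpow_interpolate (a := a) (b := b) (q := q) hM0 hx hqs.le hqb.le
          have h5 : v x ^ b ≤ c⁻¹ * Hf p ε (v x) ^ (p * κ) := by
            rw [← div_eq_inv_mul, le_div_iff₀ hc]; linarith [Hc _ h]
          have h6 : M ^ (q - b) * v x ^ b ≤ M ^ (q - b) * (c⁻¹ * Hf p ε (v x) ^ (p * κ)) := by
            gcongr
          linarith
    _ = volume (ball (0 : Rn n) r) + (ENNReal.ofReal (M ^ (q - a)) *
          (∫⁻ x in ball (0 : Rn n) r, ENNReal.ofReal (|v x| ^ a)) +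
          ENNReal.ofReal (M ^ (q - b) * c⁻¹) *
          ∫⁻ x in ball (0 : Rn n) r, ENNReal.ofReal (Hf p ε (max (v x) 0) ^ (p * κ))) := by
        rw [lintegral_add_left measurable_const, setLIntegral_const, one_mul, lintegral_add_left,
          lintegral_const_mul' _ _ ENNReal.ofReal_ne_top, lintegral_const_mul' _ _ ENNReal.ofReal_ne_top]
        exact ((hmeas.abs.pow_const _).ennreal_ofReal).const_mul _
    _ ≤ ENNReal.ofReal ω + (ENNReal.ofReal (M ^ (q - a)) * ENNReal.ofReal 1 +
          ENNReal.ofReal (M ^ (q - b) * c⁻¹) * ENNReal.ofReal (C * D ^ κ)) := by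
        gcongr
        · rw [← hωe]; exact measure_mono (ball_subset_ball (by linarith))
        · rw [ENNReal.ofReal_one]
          exact (lintegral_mono_set (ball_subset_ball (by linarith))).trans hI
    _ = ENNReal.ofReal (ω + (M ^ (q - a) + c⁻¹ * C * (M ^ (q - b) * D ^ κ))) := by
        rw [← ENNReal.ofReal_mul (by positivity), ← ENNReal.ofReal_mul (by positivity),
          ← ENNReal.ofReal_add (by positivity) (by positivity),
          ← ENNReal.ofReal_add (by positivity) (by positivity)]
        congr 1; ring
    _ ≤ _ := by
        apply ENNReal.ofReal_le_ofReal
        rw [hM1, hM2]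
        have h7 : D ^ θ = K1 ^ θ * (Z * Y) ^ θ := Real.mul_rpow (by positivity) (by positivity)
        rw [mul_assoc (ω + 1 + F), ← h7]
        have : 1 ≤ D ^ θ := Real.one_le_rpow hD1 hθ0.le
        nlinarith

lemma self_improve (P : Par n s p Λ ε q κ) :
    ∃ C : ℝ, 0 < C ∧ ∀ (v : Rn n → ℝ) (m : ℝ), IsSub n s p Λ v 0 1 m → m ≤ 1 →
      ∫⁻ x in ball (0 : Rn n) 1, ENNReal.ofReal (|v x| ^ qStar p) ≤ 1 → posT n s p 0 1 v ≤ 1 →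
      posI q 0 (1 / 2) v ≤ ENNReal.ofReal C := by
  obtain ⟨C, hC1, H⟩ := improve_step P
  have hq0 := P.hq0
  have hN := P.hN
  have hp0 := P.hp0
  have hqs := P.hqs
  have hInt := P.hInt
  have hqb := P.hqb
  have hκ := P.hκ
  set θ := κ * (q - qStar p) / ((p - 1 - ε) * κ - qStar p) with hθ
  have hba : 0 < (p - 1 - ε) * κ - qStar p := by linarith
  have hθ0 : 0 < θ := div_pos (mul_pos (by linarith) (by linarith)) hba
  have hθ1 : θ < 1 := by rw [hθ, div_lt_one hba]; exact hInt
  set N := (n : ℝ) + s * p + p with hNd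
  have hN0 : 0 < N := by positivity
  clear_value N
  have h1θ : 0 < 1 - θ := by linarith
  set N' := N * θ / (1 - θ) with hN'
  have hN'0 : 0 < N' := by positivity
  have hNN : (N + N') * θ = N' := by rw [hN']; field_simp; ring
  have hC0 : 0 < C := by linarith
  have hCE1 : 1 ≤ C * 2 ^ N' :=
    one_le_mul_of_one_le_of_one_le hC1 (Real.one_le_rpow (by norm_num) hN'0.le)
  set E := (C * 2 ^ N') ^ (1 / (1 - θ)) with hE
  have hE1 : 1 ≤ E := Real.one_le_rpow hCE1 (by positivity)
  have hE0 : 0 < E := by linarith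
  have hEE : C * 2 ^ N' * E ^ θ = E := by
    have : C * 2 ^ N' = E ^ (1 - θ) := by
      rw [hE, ← Real.rpow_mul (by positivity), one_div_mul_cancel h1θ.ne', Real.rpow_one]
    rw [this, ← Real.rpow_add hE0]; simp
  refine ⟨E * (1 / 2) ^ (-N') * 2, by positivity, fun v m hv hm hI hT => ?_⟩
  have hfin : posI q 0 1 v < ⊤ := by
    refine (posI_le_abs hq0.le le_rfl v).trans_lt ((lintegral_abs_rpow_le hq0.le P.hqp v).trans_lt ?_)
    exact ENNReal.add_lt_top.2 ⟨measure_ball_lt_top, hv.memLp⟩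
  set S := max 1 (posI q 0 1 v).toReal with hS
  have hS1 : 1 ≤ S := le_max_left _ _
  have hS0 : 0 < S := by linarith
  have hSI : posI q 0 1 v ≤ ENNReal.ofReal S := by
    rw [← ENNReal.ofReal_toReal hfin.ne]
    exact ENNReal.ofReal_le_ofReal (le_max_right _ _)
  have key : ∀ J : ℕ, ∀ r : ℝ, 1 / 2 ≤ r → r < 1 →
      posI q 0 r v ≤ ENNReal.ofReal (E * (1 - r) ^ (-N') * S ^ (θ ^ J)) := by
    intro J
    induction J with
    | zero =>
      intro r hr hr1
      refine (posI_anti hq0.le le_rfl hr1.le v).trans (hSI.trans (ENNReal.ofReal_le_ofReal ?_))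
      have h1 : 1 ≤ (1 - r) ^ (-N') :=
        Real.one_le_rpow_of_pos_of_le_one_of_nonpos (by linarith) (by linarith) (by linarith)
      have h2 : 1 ≤ E * (1 - r) ^ (-N') := one_le_mul_of_one_le_of_one_le hE1 h1
      simp only [pow_zero, Real.rpow_one]
      nlinarith
    | succ J ih =>
      intro r hr hr1
      have h1r : 0 < 1 - r := by linarith
      have h := ih ((1 + r) / 2) (by linarith) (by linarith)
      have e1 : 1 - (1 + r) / 2 = (1 - r) / 2 := by ring
      rw [e1] at h
      have hY1 : 1 ≤ E * ((1 - r) / 2) ^ (-N') * S ^ (θ ^ J) := by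
        refine one_le_mul_of_one_le_of_one_le (one_le_mul_of_one_le_of_one_le hE1 ?_) ?_
        · exact Real.one_le_rpow_of_pos_of_le_one_of_nonpos (by linarith) (by linarith) (by linarith)
        · exact Real.one_le_rpow hS1 (by positivity)
      have := H v m r ((1 + r) / 2) _ hv hm hI hT hr (by linarith) (by linarith) hY1 h
      refine this.trans_eq ?_
      congr 1
      have e2 : (1 + r) / 2 - r = (1 - r) / 2 := by ring
      have h2 : 0 < (1 - r) / 2 := by linarith
      rw [e2]
      have e3 : ((1 - r) / 2) ^ (-N) * (E * ((1 - r) / 2) ^ (-N') * S ^ (θ ^ J)) =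
          E * ((1 - r) / 2) ^ (-(N + N')) * S ^ (θ ^ J) := by
        rw [neg_add, Real.rpow_add h2]; ring
      rw [e3, Real.mul_rpow (by positivity) (by positivity), Real.mul_rpow hE0.le (by positivity),
        ← Real.rpow_mul h2.le, ← Real.rpow_mul hS0.le, ← pow_succ, neg_mul, hNN,
        Real.div_rpow h1r.le (by norm_num), Real.rpow_neg (by norm_num : (0 : ℝ) ≤ 2)]
      rw [div_inv_eq_mul]
      calc _ = (C * 2 ^ N' * E ^ θ) * (1 - r) ^ (-N') * S ^ (θ ^ (J + 1)) := by ring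
        _ = _ := by rw [hEE]
  obtain ⟨J, hJ⟩ : ∃ J : ℕ, S ^ (θ ^ J) ≤ 2 := by
    have h1 : Tendsto (fun J : ℕ => S ^ (θ ^ J)) atTop (𝓝 (S ^ (0 : ℝ))) :=
      (Real.continuousAt_const_rpow hS0.ne').tendsto.comp
        (tendsto_pow_atTop_nhds_zero_of_lt_one hθ0.le hθ1)
    rw [Real.rpow_zero] at h1
    exact ((h1.eventually (gt_mem_nhds one_lt_two)).exists).imp fun _ h => h.le
  refine (key J (1 / 2) le_rfl (by norm_num)).trans (ENNReal.ofReal_le_ofReal ?_)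
  rw [show (1 : ℝ) - 1 / 2 = 1 / 2 by norm_num]
  gcongr

/-- A function normalized in the unit ball which is a sub- and supersolution. -/
structure Nrm (n : ℕ) (s p Λ : ℝ) (v : Rn n → ℝ) (m : ℝ) : Prop where
  sub : IsSub n s p Λ v 0 1 m
  sub' : IsSub n s p Λ (fun x => -v x) 0 1 m
  loc : ∫⁻ x in ball (0 : Rn n) 1, ENNReal.ofReal (|v x| ^ qStar p) ≤ 1
  tail : ∫⁻ y in (ball (0 : Rn n) 1)ᶜ, ENNReal.ofReal (|v y| ^ (p - 1)) * fracKer n s p 0 y ≤ 1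

lemma Nrm.neg {v : Rn n → ℝ} {m : ℝ} (h : Nrm n s p Λ v m) : Nrm n s p Λ (fun x => -v x) m :=
  ⟨h.sub', by simpa using h.sub, by simpa using h.loc, by simpa using h.tail⟩

lemma posT_le_abs {k r : ℝ} (hp : 1 ≤ p) (hk : 0 ≤ k) (v : Rn n → ℝ) :
    posT n s p k r v ≤
      ∫⁻ y in (ball (0 : Rn n) r)ᶜ, ENNReal.ofReal (|v y| ^ (p - 1)) * fracKer n s p 0 y := by
  refine lintegral_mono fun x => mul_le_mul_left (ENNReal.ofReal_le_ofReal
    (Real.rpow_le_rpow (le_max_right _ _) ?_ (by linarith))) _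
  exact max_le (by linarith [le_abs_self (v x)]) (abs_nonneg _)

lemma Nrm.tail_le {v : Rn n → ℝ} {m r : ℝ} (h : Nrm n s p Λ v m) (hp : 1 < p)
    (hN : 0 ≤ (n : ℝ) + s * p) (hr : 0 < r) :
    ∫⁻ y in (ball (0 : Rn n) r)ᶜ, ENNReal.ofReal (|v y| ^ (p - 1)) * fracKer n s p 0 y ≤
      ENNReal.ofReal (r ^ (-((n : ℝ) + s * p)) * ((volume (ball (0 : Rn n) 1)).toReal + 1) + 1) := by
  refine (tail_annulus (ρ := 1) hN hr).trans ?_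
  set ω := (volume (ball (0 : Rn n) 1)).toReal with hω
  have hωe : volume (ball (0 : Rn n) 1) = ENNReal.ofReal ω :=
    (ENNReal.ofReal_toReal measure_ball_lt_top.ne).symm
  have hω0 : 0 ≤ ω := ENNReal.toReal_nonneg
  rw [ENNReal.ofReal_add (by positivity) zero_le_one, ENNReal.ofReal_mul (by positivity),
    ENNReal.ofReal_add hω0 zero_le_one, ENNReal.ofReal_one, ← hωe]
  gcongr
  · refine (lintegral_abs_rpow_le (by linarith) (le_max_right 1 (p - 1)) v).trans ?_
    gcongr
    exact h.loc
  · exact h.tail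

lemma exists_small_rpow {a : ℝ} (A : ℝ) {e : ℝ} (ha : 0 < a) (he : 0 < e) :
    ∃ η : ℝ, 0 < η ∧ ∀ t : ℝ, 0 < t → t ≤ η → A * t ^ a ≤ e := by
  refine ⟨(e / (|A| + 1)) ^ (1 / a), by positivity, fun t ht hte => ?_⟩
  have h1 : t ^ a ≤ e / (|A| + 1) := by
    calc t ^ a ≤ ((e / (|A| + 1)) ^ (1 / a)) ^ a := Real.rpow_le_rpow ht.le hte ha.le
      _ = _ := by rw [← Real.rpow_mul (by positivity), one_div_mul_cancel ha.ne', Real.rpow_one]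
  rw [le_div_iff₀ (by positivity)] at h1
  have h2 : 0 ≤ t ^ a := by positivity
  nlinarith [le_abs_self A]

lemma initial_bound (P : Par n s p Λ ε q κ) :
    ∃ k : ℝ, 1 ≤ k ∧ ∀ τ : ℝ, 0 < τ → ∃ δ : ℝ, 0 < δ ∧ ∀ (v : Rn n → ℝ) (m : ℝ),
      Nrm n s p Λ v m → m ≤ δ → posI q k (1 / 4) v ≤ ENNReal.ofReal τ := by
  obtain ⟨C, hC, HC⟩ := self_improve P
  have hp := P.hp
  have hq0 := P.hq0
  have hN := P.hN
  set T₁ : ℝ := (1 / 2) ^ (-((n : ℝ) + s * p)) * ((volume (ball (0 : Rn n) 1)).toReal + 1) + 1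
    with hT₁
  have hT₁0 : 0 ≤ T₁ := by positivity
  obtain ⟨ν, hν, hν1, H⟩ := de_giorgi_half P hT₁0
  set k := max 1 ((C / ν) ^ (1 / q)) with hk
  have hk1 : 1 ≤ k := le_max_left _ _
  have hk0 : 0 < k := by linarith
  have hkq : C / ν ≤ k ^ q := by
    calc C / ν = ((C / ν) ^ (1 / q)) ^ q := by
          rw [← Real.rpow_mul (by positivity), one_div_mul_cancel hq0.ne', Real.rpow_one]
      _ ≤ k ^ q := Real.rpow_le_rpow (by positivity) (le_max_right _ _) hq0.le
  refine ⟨k, hk1, fun τ hτ => ?_⟩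
  obtain ⟨δ, hδ, H⟩ := H (k ^ (-q) * τ) (by positivity)
  refine ⟨min δ 1, by positivity, fun v m hv hm => ?_⟩
  have hmass := hv.sub.mass
  have hpT1 : posT n s p 0 1 v ≤ 1 := (posT_le_abs hp.le le_rfl v).trans hv.tail
  have hI := HC v m hv.sub (hm.trans (min_le_right _ _)) hv.loc hpT1
  have hw := hv.sub.scale hp one_pos 0 hk0
  have e1 := posI_scale (n := n) (q := q) one_pos hk0 0 0 (1 / 2) v
  have e2 := posI_scale (n := n) (q := q) one_pos hk0 0 (1 / 2) (1 / 4) v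
  have e3 := posT_scale (n := n) (s := s) (p := p) one_pos hk0 0 0 (1 / 2) v
  simp only [one_smul, one_mul, Real.one_rpow, mul_one, mul_zero, add_zero, zero_add] at hw e1 e2 e3
  have hkp : 1 ≤ k ^ (p - 1) := Real.one_le_rpow hk1 (by linarith)
  have hkp' : k ^ (1 - p) ≤ 1 := Real.rpow_le_one_of_one_le_of_nonpos hk1 (by linarith)
  have := H _ _ hw ((div_le_self hmass hkp).trans (hm.trans (min_le_left _ _))) (by
      rw [e1]
      calc _ ≤ ENNReal.ofReal (k ^ (-q)) * ENNReal.ofReal C := by gcongr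
        _ = ENNReal.ofReal (C / k ^ q) := by
          rw [← ENNReal.ofReal_mul (by positivity), Real.rpow_neg hk0.le, mul_comm]; rfl
        _ ≤ _ := by
          apply ENNReal.ofReal_le_ofReal
          rw [div_le_iff₀ hν] at hkq
          rw [div_le_iff₀ (by positivity)]; linarith) (by
      rw [e3]
      calc _ ≤ ENNReal.ofReal 1 * ENNReal.ofReal T₁ := by
            gcongr
            exact (posT_le_abs hp.le le_rfl v).trans (hv.tail_le hp hN.le (by norm_num))
        _ = _ := by rw [ENNReal.ofReal_one, one_mul])
  rw [e2, ENNReal.ofReal_mul (by positivity)] at this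
  have h3 := (ENNReal.mul_le_mul_iff_right (by
    have : 0 < k ^ (-q) := by positivity
    simpa using this) ENNReal.ofReal_ne_top).1 this
  exact (posI_anti hq0.le (by linarith) le_rfl v).trans h3

lemma volume_sublevel_scale {R : ℝ} (hR : 0 < R) (r : ℝ) (S : Set (Rn n)) :
    volume {x ∈ ball (0 : Rn n) r | R • x ∈ S} =
      ENNReal.ofReal (R ^ (-(n : ℝ))) * volume {x ∈ ball (0 : Rn n) (R * r) | x ∈ S} := by
  have h : {x ∈ ball (0 : Rn n) r | R • x ∈ S} =
      (fun x : Rn n => R • x) ⁻¹' {x ∈ ball (0 : Rn n) (R * r) | x ∈ S} := by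
    ext x
    simp only [mem_ofPred_eq, mem_preimage, mem_ball_zero_iff, norm_smul, Real.norm_eq_abs,
      abs_of_pos hR, mul_lt_mul_iff_right₀ hR]
  rw [h, Measure.addHaar_preimage_smul _ hR.ne']
  congr 2
  rw [abs_of_pos (by positivity), finrank_euclideanSpace_fin, Real.rpow_neg hR.le, Real.rpow_natCast]

lemma rpow_le_add_of_le {a d e : ℝ} (ha : 0 ≤ a) (haq : a ≤ q) (hd : 0 < d) (he : 0 ≤ e) :
    e ^ a ≤ d ^ a + d ^ (a - q) * e ^ q := by
  rcases le_total e d with h | h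
  · have := Real.rpow_le_rpow he h ha
    have : 0 ≤ d ^ (a - q) * e ^ q := by positivity
    linarith
  · have he0 : 0 < e := hd.trans_le h
    have h1 : e ^ a = e ^ (a - q) * e ^ q := by rw [← Real.rpow_add he0]; congr 1; ring
    have h2 := Real.rpow_le_rpow_of_nonpos hd h (by linarith : a - q ≤ 0)
    have h3 : e ^ (a - q) * e ^ q ≤ d ^ (a - q) * e ^ q := by gcongr
    have : 0 ≤ d ^ a := by positivity
    linarith

lemma Nrm.tail_two_scale {v : Rn n → ℝ} {m C₁ R ρ α g D : ℝ} {F G : Rn n → ℝ≥0∞}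
    (h : Nrm n s p Λ v m) (hp : 1 < p) (hN : 0 ≤ (n : ℝ) + s * p) (hC : 0 < C₁)
    (H : ∀ r : ℝ, 0 < r →
      ∫⁻ y in (ball (0 : Rn n) r)ᶜ, fracKer n s p 0 y ≤ ENNReal.ofReal (C₁ * r ^ (-(s * p))))
    (hR : 0 < R) (hRρ : R ≤ ρ) (hα : 0 ≤ α) (hg : 0 ≤ g) (hD : 0 ≤ D)
    (hnear : ∀ y ∈ ball (0 : Rn n) ρ, F y ≤ ENNReal.ofReal α + G y)
    (hG : ∫⁻ y in ball (0 : Rn n) ρ, G y ≤ ENNReal.ofReal g)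
    (hfar : ∀ y, F y ≤ ENNReal.ofReal (2 ^ (p - 1) * (|v y| ^ (p - 1) + D ^ (p - 1)))) :
    ∫⁻ y in (ball (0 : Rn n) R)ᶜ, F y * fracKer n s p 0 y ≤
      ENNReal.ofReal (α * (C₁ * R ^ (-(s * p))) + R ^ (-((n : ℝ) + s * p)) * g +
        2 ^ (p - 1) * ((ρ ^ (-((n : ℝ) + s * p)) * ((volume (ball (0 : Rn n) 1)).toReal + 1) + 1) +
          D ^ (p - 1) * (C₁ * ρ ^ (-(s * p))))) := by
  have hρ : 0 < ρ := hR.trans_le hRρ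
  have hker : Measurable (fun y : Rn n => fracKer n s p 0 y) :=
    measurable_fracKer_comp measurable_const measurable_id
  have hω0 : 0 ≤ (volume (ball (0 : Rn n) 1)).toReal := ENNReal.toReal_nonneg
  set ω := (volume (ball (0 : Rn n) 1)).toReal with hω
  refine (setLIntegral_compl_ball_le (ρ := ρ)).trans ?_
  rw [ENNReal.ofReal_add (by positivity) (by positivity)]
  refine add_le_add ?_ ?_
  · calc _ ≤ ∫⁻ y in ball (0 : Rn n) ρ \ ball 0 R, (ENNReal.ofReal α * fracKer n s p 0 y +
          ENNReal.ofReal (R ^ (-((n : ℝ) + s * p))) * G y) := by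
          refine setLIntegral_mono_ae' (measurableSet_ball.diff measurableSet_ball)
            (Eventually.of_forall fun y hy => ?_)
          have hy2 : R ≤ ‖y‖ := by simpa using hy.2
          calc F y * fracKer n s p 0 y ≤ (ENNReal.ofReal α + G y) * fracKer n s p 0 y := by
                gcongr
                exact hnear y hy.1
            _ = ENNReal.ofReal α * fracKer n s p 0 y + fracKer n s p 0 y * G y := by
                rw [add_mul, mul_comm (G y)]
            _ ≤ _ := by
                gcongr
                exact fracKer_zero_le hN hR hy2
      _ = ENNReal.ofReal α * (∫⁻ y in ball (0 : Rn n) ρ \ ball 0 R, fracKer n s p 0 y) +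
          ENNReal.ofReal (R ^ (-((n : ℝ) + s * p))) * ∫⁻ y in ball (0 : Rn n) ρ \ ball 0 R, G y := by
          rw [lintegral_add_left (hker.const_mul _), lintegral_const_mul' _ _ ENNReal.ofReal_ne_top,
            lintegral_const_mul' _ _ ENNReal.ofReal_ne_top]
      _ ≤ ENNReal.ofReal α * ENNReal.ofReal (C₁ * R ^ (-(s * p))) +
          ENNReal.ofReal (R ^ (-((n : ℝ) + s * p))) * ENNReal.ofReal g := by
          gcongr
          · exact (lintegral_mono_set fun y hy => hy.2).trans (H R hR)
          · exact (lintegral_mono_set sdiff_subset).trans hG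
      _ = _ := by
          rw [← ENNReal.ofReal_mul hα, ← ENNReal.ofReal_mul (by positivity),
            ← ENNReal.ofReal_add (by positivity) (by positivity)]
  · calc _ ≤ ∫⁻ y in (ball (0 : Rn n) ρ)ᶜ, ENNReal.ofReal (2 ^ (p - 1)) *
          (ENNReal.ofReal (D ^ (p - 1)) * fracKer n s p 0 y +
            ENNReal.ofReal (|v y| ^ (p - 1)) * fracKer n s p 0 y) := by
          refine lintegral_mono fun y => ?_
          rw [← add_mul, ← mul_assoc, ← ENNReal.ofReal_add (by positivity) (by positivity),
            ← ENNReal.ofReal_mul (by positivity), add_comm (D ^ (p - 1))]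
          gcongr
          exact hfar y
      _ = ENNReal.ofReal (2 ^ (p - 1)) * (ENNReal.ofReal (D ^ (p - 1)) *
          (∫⁻ y in (ball (0 : Rn n) ρ)ᶜ, fracKer n s p 0 y) +
          ∫⁻ y in (ball (0 : Rn n) ρ)ᶜ, ENNReal.ofReal (|v y| ^ (p - 1)) * fracKer n s p 0 y) := by
          rw [lintegral_const_mul' _ _ ENNReal.ofReal_ne_top, lintegral_add_left (hker.const_mul _),
            lintegral_const_mul' _ _ ENNReal.ofReal_ne_top]
      _ ≤ ENNReal.ofReal (2 ^ (p - 1)) * (ENNReal.ofReal (D ^ (p - 1)) *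
          ENNReal.ofReal (C₁ * ρ ^ (-(s * p))) +
          ENNReal.ofReal (ρ ^ (-((n : ℝ) + s * p)) * (ω + 1) + 1)) := by
          gcongr
          · exact H ρ hρ
          · exact h.tail_le hp hN hρ
      _ = _ := by
          rw [← ENNReal.ofReal_mul (by positivity), ← ENNReal.ofReal_add (by positivity) (by positivity),
            ← ENNReal.ofReal_mul (by positivity), add_comm (D ^ (p - 1) * _)]

lemma exists_ker_const (P : Par n s p Λ ε q κ) : ∃ C : ℝ, 0 < C ∧ ∀ r : ℝ, 0 < r →
    ∫⁻ y in (ball (0 : Rn n) r)ᶜ, fracKer n s p 0 y ≤ ENNReal.ofReal (C * r ^ (-(s * p))) := by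
  obtain ⟨C, hC, H⟩ := exists_lintegral_ker_compl n (mul_pos P.hs P.hp0)
  exact ⟨C, hC, fun r hr => H 0 r hr⟩

lemma osc_reduction (P : Par n s p Λ ε q κ) {k₀ : ℝ} (hk₀ : 0 ≤ k₀) :
    ∃ M : ℝ, 0 < M ∧ ∀ ρ L : ℝ, 0 < ρ → ρ ≤ 1 → 0 < L → ∃ R : ℝ, 0 < R ∧ R ≤ ρ ∧
      ∀ τ : ℝ, 0 < τ → ∃ δ : ℝ, 0 < δ ∧ ∀ (v : Rn n → ℝ) (m hi : ℝ),
        Nrm n s p Λ v m → m ≤ δ → |hi| ≤ k₀ → posI q hi ρ v ≤ ENNReal.ofReal δ →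
        volume (ball (0 : Rn n) (R / 2)) ≤
          2 * volume {x ∈ ball (0 : Rn n) (R / 2) | v x ≤ hi - L / 2} →
        posI q (hi - L / (4 * (M + 1))) (R / 4) v ≤ ENNReal.ofReal τ := by
  obtain ⟨C₁, hC₁, H₁⟩ := exists_ker_const P
  have hp := P.hp
  have hp0 := P.hp0
  have hs := P.hs
  have hq0 := P.hq0
  have hpq := P.hpq
  have hN := P.hN
  have hsp : 0 < s * p := by positivity
  set T₀ : ℝ := 2 ^ (p - 1) * 2 * C₁ + 1 + 1 with hT₀
  obtain ⟨M, hM, H⟩ := growth P (T₀ := T₀) (by positivity)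
  refine ⟨M, hM, fun ρ L hρ hρ1 hL => ?_⟩
  have hω0 : 0 ≤ (volume (ball (0 : Rn n) 1)).toReal := ENNReal.toReal_nonneg
  set ω := (volume (ball (0 : Rn n) 1)).toReal with hω
  set d := L / (2 * (M + 1)) with hd
  have hd0 : 0 < d := by positivity
  set B : ℝ := 2 ^ (p - 1) * ((ρ ^ (-((n : ℝ) + s * p)) * (ω + 1) + 1) +
          (k₀ + d) ^ (p - 1) * (C₁ * ρ ^ (-(s * p)))) with hB
  have hB0 : 0 ≤ B := by positivity
  obtain ⟨η, hη, Hη⟩ := exists_small_rpow (d ^ (1 - p) * B) hsp one_pos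
  set R := min ρ η with hR
  have hR0 : 0 < R := lt_min hρ hη
  have hRB := Hη R hR0 (min_le_right _ _)
  refine ⟨R, hR0, min_le_left _ _, fun τ hτ => ?_⟩
  set a := R ^ (-(n : ℝ)) * d ^ (-q) with ha
  have ha0 : 0 < a := by positivity
  obtain ⟨δ, hδ, H⟩ := H (a * τ) (by positivity)
  set c := R ^ (s * p - n) / d ^ (p - 1) with hc
  have hc0 : 0 < c := by positivity
  set δ' := min (δ / c) (min (δ / a) (2 ^ (p - 1) * a)⁻¹) with hδ'
  have hδ'0 : 0 < δ' := by positivity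
  refine ⟨δ', hδ'0, fun v m hi hv hm hhi hI hvol => ?_⟩
  set k := hi - d with hk
  have hw := (hv.sub.mono ((min_le_left _ _).trans hρ1 : R ≤ 1) le_rfl).scale hp hR0 k hd0
  have hm' : m * R ^ (s * p - n) / d ^ (p - 1) ≤ δ := by
    rw [mul_div_assoc, ← hc, ← le_div_iff₀ hc0]; exact hm.trans (min_le_left _ _)
  have e1 := posI_scale (n := n) (q := q) hR0 hd0 k 1 1 v
  have e2 := posI_scale (n := n) (q := q) hR0 hd0 k (1 / 2) (1 / 4) v
  have e3 := posT_scale (n := n) (s := s) (p := p) hR0 hd0 k 0 1 v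
  rw [← ha] at e1 e2
  rw [show k + d * 1 = hi by rw [hk]; ring, mul_one] at e1
  rw [show k + d * (1 / 2) = hi - L / (4 * (M + 1)) by rw [hk, hd]; field_simp; ring,
    show R * (1 / 4) = R / 4 by ring, ENNReal.ofReal_mul (by positivity)] at e2
  rw [mul_zero, add_zero, mul_one] at e3
  have key := H _ _ hw hm' ?_ ?_ ?_
  · rw [e2, ← ENNReal.ofReal_mul (by positivity), ENNReal.ofReal_mul ha0.le] at key
    exact (ENNReal.mul_le_mul_iff_right (ENNReal.ofReal_pos.2 ha0).ne' ENNReal.ofReal_ne_top).1 key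
  · rw [e1]
    calc _ ≤ ENNReal.ofReal a * ENNReal.ofReal (δ / a) := by
          gcongr
          refine (posI_anti hq0.le le_rfl (min_le_left _ _) v).trans (hI.trans ?_)
          exact ENNReal.ofReal_le_ofReal ((min_le_right _ _).trans (min_le_left _ _))
      _ = _ := by rw [← ENNReal.ofReal_mul ha0.le]; congr 1; field_simp
  · rw [e3]
    have hG : ∫⁻ y in ball (0 : Rn n) ρ, ENNReal.ofReal (2 ^ (p - 1) * d ^ (p - 1 - q)) *
        ENNReal.ofReal ((max (v y - hi) 0) ^ q) ≤
        ENNReal.ofReal (2 ^ (p - 1) * d ^ (p - 1 - q) * δ') := by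
      rw [lintegral_const_mul' _ _ ENNReal.ofReal_ne_top,
        ENNReal.ofReal_mul (p := 2 ^ (p - 1) * d ^ (p - 1 - q)) (by positivity)]
      refine mul_le_mul_right (hI.trans (ENNReal.ofReal_le_ofReal le_rfl)) _
    have := hv.tail_two_scale (F := fun y => ENNReal.ofReal ((max (v y - k) 0) ^ (p - 1)))
      (G := fun y => ENNReal.ofReal (2 ^ (p - 1) * d ^ (p - 1 - q)) *
        ENNReal.ofReal ((max (v y - hi) 0) ^ q))
      (α := 2 ^ (p - 1) * 2 * d ^ (p - 1)) (D := k₀ + d) hp hN.le hC₁ H₁ hR0 (min_le_left _ _)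
      (by positivity) (by positivity) (by positivity) ?_ hG ?_
    · refine (mul_le_mul_right this _).trans ?_
      rw [← ENNReal.ofReal_mul (by positivity)]
      apply ENNReal.ofReal_le_ofReal
      rw [← hω, ← hB, mul_add, mul_add, hT₀]
      have hdd : d ^ (1 - p) * d ^ (p - 1) = 1 := by
        rw [← Real.rpow_add hd0]; simp
      have hRR : R ^ (s * p) * R ^ (-(s * p)) = 1 := by
        rw [← Real.rpow_add hR0]; simp
      have hRN : R ^ (s * p) * R ^ (-((n : ℝ) + s * p)) = R ^ (-(n : ℝ)) := by
        rw [← Real.rpow_add hR0]; congr 1; ring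
      have hdq : d ^ (1 - p) * d ^ (p - 1 - q) = d ^ (-q) := by
        rw [← Real.rpow_add hd0]; congr 1; ring
      refine add_le_add (add_le_add (le_of_eq ?_) ?_) ?_
      · calc _ = 2 ^ (p - 1) * 2 * C₁ * (d ^ (1 - p) * d ^ (p - 1)) *
            (R ^ (s * p) * R ^ (-(s * p))) := by ring
          _ = _ := by rw [hdd, hRR]; ring
      · calc _ = 2 ^ (p - 1) * ((R ^ (s * p) * R ^ (-((n : ℝ) + s * p))) *
            (d ^ (1 - p) * d ^ (p - 1 - q))) * δ' := by ring
          _ = 2 ^ (p - 1) * a * δ' := by rw [hRN, hdq]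
          _ ≤ 2 ^ (p - 1) * a * (2 ^ (p - 1) * a)⁻¹ := by
            gcongr
            exact (min_le_right _ _).trans (min_le_right _ _)
          _ = 1 := mul_inv_cancel₀ (by positivity)
      · linarith
    · intro y _
      rw [← ENNReal.ofReal_mul (by positivity), ← ENNReal.ofReal_add (by positivity) (by positivity)]
      apply ENNReal.ofReal_le_ofReal
      have h0 := le_max_right (v y - hi) 0
      calc _ ≤ (d + max (v y - hi) 0) ^ (p - 1) := by
            refine Real.rpow_le_rpow (le_max_right _ _) (max_le ?_ (by positivity)) (by linarith)
            rw [hk]; linarith [le_max_left (v y - hi) 0]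
        _ ≤ 2 ^ (p - 1) * (d ^ (p - 1) + (max (v y - hi) 0) ^ (p - 1)) :=
            add_rpow_le_two (by linarith) hd0.le h0
        _ ≤ 2 ^ (p - 1) * (d ^ (p - 1) + (d ^ (p - 1) + d ^ (p - 1 - q) * (max (v y - hi) 0) ^ q)) := by
            gcongr
            exact rpow_le_add_of_le (by linarith) hpq hd0 h0
        _ = _ := by ring
    · intro y
      apply ENNReal.ofReal_le_ofReal
      calc _ ≤ (|v y| + (k₀ + d)) ^ (p - 1) := by
            refine Real.rpow_le_rpow (le_max_right _ _) (max_le ?_ (by positivity)) (by linarith)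
            rw [hk]; linarith [le_abs_self (v y), neg_abs_le hi]
        _ ≤ _ := add_rpow_le_two (by linarith) (abs_nonneg _) (by positivity)
  · have hs1 := volume_sublevel_scale (n := n) hR0 (1 / 2) univ
    have hs2 := volume_sublevel_scale (n := n) hR0 (1 / 2) {x | v x ≤ hi - L / 2}
    rw [show R * (1 / 2) = R / 2 by ring] at hs1 hs2
    simp only [mem_univ, and_true, mem_ofPred_eq] at hs1 hs2
    have hset : {x ∈ ball (0 : Rn n) (1 / 2) | (v (R • x) - k) / d ≤ -M} =
        {x ∈ ball (0 : Rn n) (1 / 2) | v (R • x) ≤ hi - L / 2} := by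
      ext x
      simp only [mem_ofPred_eq, and_congr_right_iff]
      intro _
      rw [div_le_iff₀ hd0, hk]
      have : L / 2 = (M + 1) * d := by rw [hd]; field_simp
      rw [this]
      constructor <;> intro h <;> linarith
    rw [hset, hs2]
    have hs1' : volume (ball (0 : Rn n) (1 / 2)) =
        ENNReal.ofReal (R ^ (-(n : ℝ))) * volume (ball (0 : Rn n) (R / 2)) := by
      have hsep : ∀ r : ℝ, {x : Rn n | x ∈ ball (0 : Rn n) r} = ball 0 r := fun r => rfl
      rwa [hsep, hsep] at hs1
    rw [hs1', mul_left_comm]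
    gcongr

/-- At small scales and for small data, normalised solutions lie between `lo` and `lo + L`,
up to an error of size `τ`. -/
def Flat (n : ℕ) (s p Λ q k₀ L : ℝ) : Prop :=
  ∃ ρ : ℝ, 0 < ρ ∧ ρ ≤ 1 / 4 ∧ ∀ τ : ℝ, 0 < τ → ∃ δ : ℝ, 0 < δ ∧
    ∀ (v : Rn n → ℝ) (m : ℝ), Nrm n s p Λ v m → m ≤ δ →
      ∃ lo : ℝ, -k₀ ≤ lo ∧ lo + L ≤ k₀ ∧ posI q (lo + L) ρ v ≤ ENNReal.ofReal τ ∧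
        posI q (-lo) ρ (fun x => -v x) ≤ ENNReal.ofReal τ

lemma exists_flat (P : Par n s p Λ ε q κ) : ∃ k₀ : ℝ, 1 ≤ k₀ ∧ ∀ ℓ : ℝ, 0 < ℓ →
    ∃ L : ℝ, 0 < L ∧ L ≤ ℓ ∧ Flat n s p Λ q k₀ L := by
  obtain ⟨k₀, hk1, H0⟩ := initial_bound P
  have hk0 : 0 < k₀ := by linarith
  have hq0 := P.hq0
  obtain ⟨M, hM, HO⟩ := osc_reduction P hk0.le
  set κ' : ℝ := 1 / (4 * (M + 1)) with hκ'
  have hκ0 : 0 < κ' := by positivity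
  have hκ1 : κ' < 1 := by rw [hκ', div_lt_one (by positivity)]; linarith
  have hstep : ∀ i : ℕ, Flat n s p Λ q k₀ ((1 - κ') ^ i * (2 * k₀)) := by
    intro i
    induction i with
    | zero =>
      refine ⟨1 / 4, by norm_num, le_rfl, fun τ hτ => ?_⟩
      obtain ⟨δ, hδ, H⟩ := H0 τ hτ
      refine ⟨δ, hδ, fun v m hv hm => ⟨-k₀, le_rfl, by simp; linarith, ?_, ?_⟩⟩
      · have := H v m hv hm
        rwa [show -k₀ + (1 - κ') ^ 0 * (2 * k₀) = k₀ by ring]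
      · have := H _ m hv.neg hm
        rwa [neg_neg]
    | succ i ih =>
      set L := (1 - κ') ^ i * (2 * k₀) with hL
      have h1κ : 0 < 1 - κ' := by linarith
      have hL0 : 0 < L := by positivity
      have hL' : (1 - κ') ^ (i + 1) * (2 * k₀) = L - κ' * L := by rw [hL, pow_succ]; ring
      have hκL : 0 < κ' * L := by positivity
      have hLM : L / (4 * (M + 1)) = κ' * L := by rw [hκ']; ring
      rw [hL']
      obtain ⟨ρ, hρ, hρ4, ih⟩ := ih
      obtain ⟨R, hR, hRρ, HO⟩ := HO ρ L hρ (by linarith) hL0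
      rw [hLM] at HO
      refine ⟨R / 4, by positivity, by linarith, fun τ hτ => ?_⟩
      obtain ⟨δ₁, hδ₁, HO⟩ := HO τ hτ
      obtain ⟨δ₂, hδ₂, ih⟩ := ih (min δ₁ τ) (lt_min hδ₁ hτ)
      refine ⟨min δ₁ δ₂, lt_min hδ₁ hδ₂, fun v m hv hm => ?_⟩
      obtain ⟨lo, h1, h2, h3, h4⟩ := ih v m hv (hm.trans (min_le_right _ _))
      have hm1 := hm.trans (min_le_left _ _)
      have a1 : ENNReal.ofReal (min δ₁ τ) ≤ ENNReal.ofReal δ₁ :=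
        ENNReal.ofReal_le_ofReal (min_le_left _ _)
      have a2 : ENNReal.ofReal (min δ₁ τ) ≤ ENNReal.ofReal τ :=
        ENNReal.ofReal_le_ofReal (min_le_right _ _)
      have hR4 : R / 4 ≤ ρ := by linarith
      have hcover : volume (ball (0 : Rn n) (R / 2)) ≤
          volume {x ∈ ball (0 : Rn n) (R / 2) | v x ≤ lo + L - L / 2} +
          volume {x ∈ ball (0 : Rn n) (R / 2) | -v x ≤ -lo - L / 2} := by
        refine (measure_mono fun x hx => ?_).trans (measure_union_le _ _)
        rcases le_total (v x) (lo + L - L / 2) with h | h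
        · exact Or.inl ⟨hx, h⟩
        · exact Or.inr ⟨hx, by linarith⟩
      rcases le_total (volume {x ∈ ball (0 : Rn n) (R / 2) | v x ≤ lo + L - L / 2})
        (volume {x ∈ ball (0 : Rn n) (R / 2) | -v x ≤ -lo - L / 2}) with hc | hc
      · have := HO _ m (-lo) hv.neg hm1 (abs_le.2 ⟨by linarith, by linarith⟩) (h4.trans a1)
          (hcover.trans (by rw [two_mul]; gcongr))
        refine ⟨lo + κ' * L, by linarith, by linarith, ?_, ?_⟩
        · rw [show lo + κ' * L + (L - κ' * L) = lo + L by ring]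
          exact (posI_anti hq0.le le_rfl hR4 v).trans (h3.trans a2)
        · rwa [neg_add']
      · have := HO v m (lo + L) hv hm1 (abs_le.2 ⟨by linarith, by linarith⟩) (h3.trans a1)
          (hcover.trans (by rw [two_mul]; gcongr))
        refine ⟨lo, by linarith, by linarith, ?_, ?_⟩
        · rwa [← add_sub_assoc]
        · exact (posI_anti hq0.le le_rfl hR4 _).trans (h4.trans a2)
  refine ⟨k₀, hk1, fun ℓ hℓ => ?_⟩
  obtain ⟨i, hi⟩ := exists_pow_lt_of_lt_one (show 0 < ℓ / (2 * k₀) by positivity)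
    (show 1 - κ' < 1 by linarith)
  have h1κ : 0 < 1 - κ' := by linarith
  refine ⟨_, by positivity, ?_, hstep i⟩
  rw [lt_div_iff₀ (by positivity)] at hi
  exact hi.le

lemma abs_sub_rpow_le {a L lo t : ℝ} (ha : 0 ≤ a) (haq : a ≤ q) (hL : 0 < L) :
    |t - lo| ^ a ≤ 2 ^ a * (2 * L ^ a) +
      2 ^ a * L ^ (a - q) * ((max (t - (lo + L)) 0) ^ q + (max (-t - -lo) 0) ^ q) := by
  have hkey : ∀ e : ℝ, 0 ≤ e → |t - lo| ≤ L + e →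
      e ^ q ≤ (max (t - (lo + L)) 0) ^ q + (max (-t - -lo) 0) ^ q →
      |t - lo| ^ a ≤ 2 ^ a * (2 * L ^ a) +
      2 ^ a * L ^ (a - q) * ((max (t - (lo + L)) 0) ^ q + (max (-t - -lo) 0) ^ q) := by
    intro e he h1 h2
    calc |t - lo| ^ a ≤ (L + e) ^ a := Real.rpow_le_rpow (abs_nonneg _) h1 ha
      _ ≤ 2 ^ a * (L ^ a + e ^ a) := add_rpow_le_two ha hL.le he
      _ ≤ 2 ^ a * (L ^ a + (L ^ a + L ^ (a - q) * e ^ q)) := by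
        gcongr
        exact rpow_le_add_of_le ha haq hL he
      _ = 2 ^ a * (2 * L ^ a) + 2 ^ a * L ^ (a - q) * e ^ q := by ring
      _ ≤ _ := by gcongr
  have h1 : 0 ≤ max (t - (lo + L)) 0 := le_max_right _ _
  have h2 : 0 ≤ max (-t - -lo) 0 := le_max_right _ _
  have h3 : 0 ≤ max (t - (lo + L)) 0 ^ q := by positivity
  have h4 : 0 ≤ max (-t - -lo) 0 ^ q := by positivity
  rcases le_total lo t with h | h
  · refine hkey _ h1 ?_ (by linarith)
    rw [abs_of_nonneg (by linarith)]
    linarith [le_max_left (t - (lo + L)) 0]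
  · refine hkey _ h2 ?_ (by linarith)
    rw [abs_of_nonpos (by linarith)]
    linarith [le_max_left (-t - -lo) 0]

lemma normalized_decay (P : Par n s p Λ ε q κ) {ε' : ℝ} (hε' : 0 < ε') :
    ∃ σ : ℝ, 0 < σ ∧ σ ≤ 1 / 4 ∧ ∃ δ : ℝ, 0 < δ ∧ ∀ (v : Rn n → ℝ) (m : ℝ),
      Nrm n s p Λ v m → m ≤ δ → ∃ c : ℝ,
        ∫⁻ x in ball (0 : Rn n) σ, ENNReal.ofReal (|v x - c| ^ qStar p) ≤
          ENNReal.ofReal (ε' * σ ^ n) ∧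
        ENNReal.ofReal (σ ^ (s * p)) * (∫⁻ y in (ball (0 : Rn n) σ)ᶜ,
          ENNReal.ofReal (|v y - c| ^ (p - 1)) * fracKer n s p 0 y) ≤ ENNReal.ofReal ε' := by
  obtain ⟨k₀, hk1, HF⟩ := exists_flat P
  obtain ⟨C₁, hC₁, H₁⟩ := exists_ker_const P
  have hp := P.hp
  have hp0 := P.hp0
  have hs := P.hs
  have hq0 := P.hq0
  have hpq := P.hpq
  have hN := P.hN
  have hn1 : 1 ≤ n := by have := P.hn; omega
  have hsp : 0 < s * p := by positivity
  have hqs0 : 0 < qStar p := lt_of_lt_of_le one_pos (le_max_left _ _)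
  have hqsq : qStar p ≤ q := P.hqs.le
  set b := qStar p with hb
  clear_value b
  have hω0 : 0 ≤ (volume (ball (0 : Rn n) 1)).toReal := ENNReal.toReal_nonneg
  have hvol := fun (x : ℝ) (hx : 0 ≤ x) => volume_ball_eq hn1 (0 : Rn n) hx
  set ω := (volume (ball (0 : Rn n) 1)).toReal with hω
  obtain ⟨η₁, hη₁, E₁⟩ := exists_small_rpow (2 ^ b * 2 * ω) hqs0 (half_pos hε')
  obtain ⟨η₂, hη₂, E₂⟩ := exists_small_rpow (2 ^ (p - 1) * 2 * C₁)
    (show 0 < p - 1 by linarith) (show 0 < ε' / 3 by positivity)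
  obtain ⟨L, hL, hLη, ρ, hρ, hρ4, HF⟩ := HF (min η₁ η₂) (lt_min hη₁ hη₂)
  have hL1 := E₁ L hL (hLη.trans (min_le_left _ _))
  have hL2 := E₂ L hL (hLη.trans (min_le_right _ _))
  set B : ℝ := 2 ^ (p - 1) * ((ρ ^ (-((n : ℝ) + s * p)) * (ω + 1) + 1) +
          k₀ ^ (p - 1) * (C₁ * ρ ^ (-(s * p)))) with hB
  obtain ⟨η₃, hη₃, E₃⟩ := exists_small_rpow B hsp (show 0 < ε' / 3 by positivity)
  set σ := min ρ η₃ with hσ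
  have hσ0 : 0 < σ := lt_min hρ hη₃
  have hσρ : σ ≤ ρ := min_le_left _ _
  have hσB := E₃ σ hσ0 (min_le_right _ _)
  set A₁ := 2 ^ b * L ^ (b - q) with hA₁
  have hA₁0 : 0 < A₁ := by positivity
  set A₂ := 2 ^ (p - 1) * L ^ (p - 1 - q) with hA₂
  have hA₂0 : 0 < A₂ := by positivity
  set τ := min (ε' / 2 * σ ^ n / (A₁ * 2)) (ε' / 3 * σ ^ (n : ℝ) / (A₂ * 2)) with hτ
  have hτ0 : 0 < τ := by positivity
  obtain ⟨δ, hδ, H⟩ := HF τ hτ0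
  refine ⟨σ, hσ0, hσρ.trans hρ4, δ, hδ, fun v m hv hm => ?_⟩
  obtain ⟨lo, h1, h2, h3, h4⟩ := H v m hv hm
  have hvm := hv.sub.meas
  have me1 : Measurable fun y => ENNReal.ofReal ((max (v y - (lo + L)) 0) ^ q) :=
    (((hvm.sub_const _).max measurable_const).pow_const _).ennreal_ofReal
  have me2 : Measurable fun y => ENNReal.ofReal ((max (-v y - -lo) 0) ^ q) :=
    (((hvm.neg.sub_const _).max measurable_const).pow_const _).ennreal_ofReal
  have hGint : ∀ A : ℝ, 0 < A → ∀ r : ℝ, r ≤ ρ → ∫⁻ y in ball (0 : Rn n) r, ENNReal.ofReal A *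
      (ENNReal.ofReal ((max (v y - (lo + L)) 0) ^ q) +
        ENNReal.ofReal ((max (-v y - -lo) 0) ^ q)) ≤ ENNReal.ofReal (A * (2 * τ)) := by
    intro A hA r hr
    rw [lintegral_const_mul' _ _ ENNReal.ofReal_ne_top, lintegral_add_left me1,
      ENNReal.ofReal_mul hA.le, two_mul, ENNReal.ofReal_add hτ0.le hτ0.le]
    gcongr
    · exact (lintegral_mono_set (ball_subset_ball hr)).trans h3
    · exact (lintegral_mono_set (ball_subset_ball hr)).trans h4
  have hpt : ∀ a : ℝ, 0 ≤ a → a ≤ q → ∀ y, ENNReal.ofReal (|v y - lo| ^ a) ≤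
      ENNReal.ofReal (2 ^ a * (2 * L ^ a)) + ENNReal.ofReal (2 ^ a * L ^ (a - q)) *
      (ENNReal.ofReal ((max (v y - (lo + L)) 0) ^ q) +
        ENNReal.ofReal ((max (-v y - -lo) 0) ^ q)) := by
    intro a ha haq y
    rw [← ENNReal.ofReal_add (by positivity) (by positivity),
      ← ENNReal.ofReal_mul (by positivity), ← ENNReal.ofReal_add (by positivity) (by positivity)]
    exact ENNReal.ofReal_le_ofReal (abs_sub_rpow_le ha haq hL)
  refine ⟨lo, ?_, ?_⟩
  · calc _ ≤ ∫⁻ y in ball (0 : Rn n) σ, (ENNReal.ofReal (2 ^ b * (2 * L ^ b)) +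
        ENNReal.ofReal A₁ * (ENNReal.ofReal ((max (v y - (lo + L)) 0) ^ q) +
        ENNReal.ofReal ((max (-v y - -lo) 0) ^ q))) :=
          lintegral_mono fun y => hpt b hqs0.le hqsq y
      _ = ENNReal.ofReal (2 ^ b * (2 * L ^ b)) * volume (ball (0 : Rn n) σ) +
        ∫⁻ y in ball (0 : Rn n) σ, ENNReal.ofReal A₁ *
        (ENNReal.ofReal ((max (v y - (lo + L)) 0) ^ q) +
        ENNReal.ofReal ((max (-v y - -lo) 0) ^ q)) := by
          rw [lintegral_add_left measurable_const, setLIntegral_const]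
      _ ≤ ENNReal.ofReal (2 ^ b * (2 * L ^ b)) * ENNReal.ofReal (ω * σ ^ n) +
          ENNReal.ofReal (A₁ * (2 * τ)) := by
          gcongr
          · exact (hvol σ hσ0.le).le
          · exact hGint A₁ hA₁0 σ hσρ
      _ ≤ _ := by
          rw [← ENNReal.ofReal_mul (by positivity), ← ENNReal.ofReal_add (by positivity) (by positivity)]
          apply ENNReal.ofReal_le_ofReal
          have t1 : A₁ * (2 * τ) ≤ ε' / 2 * σ ^ n := by
            have : τ ≤ ε' / 2 * σ ^ n / (A₁ * 2) := min_le_left _ _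
            rw [le_div_iff₀ (by positivity)] at this
            linarith
          have t2 : 2 ^ b * 2 * ω * L ^ b * σ ^ n ≤ ε' / 2 * σ ^ n := by gcongr
          linarith
  · have key := hv.tail_two_scale (F := fun y => ENNReal.ofReal (|v y - lo| ^ (p - 1)))
      (G := fun y => ENNReal.ofReal A₂ * (ENNReal.ofReal ((max (v y - (lo + L)) 0) ^ q) +
        ENNReal.ofReal ((max (-v y - -lo) 0) ^ q)))
      (α := 2 ^ (p - 1) * (2 * L ^ (p - 1))) (D := k₀) (g := A₂ * (2 * τ)) hp hN.le hC₁ H₁ hσ0 hσρ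
      (by positivity) (by positivity) (by positivity) ?_ (hGint A₂ hA₂0 ρ le_rfl) ?_
    · refine (mul_le_mul_right key _).trans ?_
      rw [← ENNReal.ofReal_mul (by positivity)]
      apply ENNReal.ofReal_le_ofReal
      rw [← hω, ← hB, mul_add, mul_add]
      have hRR : σ ^ (s * p) * σ ^ (-(s * p)) = 1 := by
        rw [← Real.rpow_add hσ0]; simp
      have hRN : σ ^ (s * p) * σ ^ (-((n : ℝ) + s * p)) = (σ ^ (n : ℝ))⁻¹ := by
        rw [← Real.rpow_add hσ0, ← Real.rpow_neg hσ0.le]; congr 1; ring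
      have t1 : A₂ * (2 * τ) ≤ ε' / 3 * σ ^ (n : ℝ) := by
        have : τ ≤ ε' / 3 * σ ^ (n : ℝ) / (A₂ * 2) := min_le_right _ _
        rw [le_div_iff₀ (by positivity)] at this
        linarith
      have t2 : σ ^ (s * p) * (2 ^ (p - 1) * (2 * L ^ (p - 1)) * (C₁ * σ ^ (-(s * p)))) ≤ ε' / 3 := by
        calc _ = 2 ^ (p - 1) * 2 * C₁ * L ^ (p - 1) * (σ ^ (s * p) * σ ^ (-(s * p))) := by ring
          _ ≤ _ := by rw [hRR, mul_one]; exact hL2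
      have t3 : σ ^ (s * p) * (σ ^ (-((n : ℝ) + s * p)) * (A₂ * (2 * τ))) ≤ ε' / 3 := by
        rw [← mul_assoc, hRN, inv_mul_le_iff₀ (by positivity)]
        linarith
      linarith
    · intro y _
      exact hpt (p - 1) (by linarith) hpq y
    · intro y
      apply ENNReal.ofReal_le_ofReal
      calc _ ≤ (|v y| + k₀) ^ (p - 1) := by
            refine Real.rpow_le_rpow (abs_nonneg _) ?_ (by linarith)
            refine (abs_sub _ _).trans ?_
            gcongr
            exact abs_le.2 ⟨h1, by linarith⟩
        _ ≤ _ := add_rpow_le_two (by linarith) (abs_nonneg _) (by positivity)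

/-- The weighted `L^a` (quasi-)norm with weight `w`. -/
def wnorm (n : ℕ) (a : ℝ) (w : Rn n → ℝ≥0∞) (f : Rn n → ℝ) : ℝ≥0∞ :=
  (∫⁻ x, ENNReal.ofReal (|f x| ^ a) * w x) ^ (1 / a)

lemma wnorm_congr {a : ℝ} {w : Rn n → ℝ≥0∞} {f h : Rn n → ℝ} (hfh : f =ᵐ[volume] h) :
    wnorm n a w f = wnorm n a w h := by
  unfold wnorm
  congr 1
  exact lintegral_congr_ae (by filter_upwards [hfh] with x hx; rw [hx])

lemma ennreal_add_rpow_le {z : ℝ} (hz : 0 ≤ z) (x y : ℝ≥0∞) :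
    (x + y) ^ z ≤ 2 ^ z * (x ^ z + y ^ z) := by
  have key : ∀ x y : ℝ≥0∞, x ≤ y → (x + y) ^ z ≤ 2 ^ z * (x ^ z + y ^ z) := by
    intro x y h
    calc (x + y) ^ z ≤ (2 * y) ^ z := by
          refine ENNReal.rpow_le_rpow ?_ hz
          rw [two_mul]; gcongr
      _ = 2 ^ z * y ^ z := ENNReal.mul_rpow_of_nonneg _ _ hz
      _ ≤ _ := by gcongr; exact le_add_self
  rcases le_total x y with h | h
  · exact key x y h
  · rw [add_comm x, add_comm (x ^ z)]; exact key y x h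

lemma wnorm_add_le {a : ℝ} (ha : 0 < a) {w : Rn n → ℝ≥0∞} (hw : Measurable w) {f h : Rn n → ℝ}
    (hf : AEMeasurable f volume) :
    wnorm n a w (fun x => f x + h x) ≤
      ENNReal.ofReal (2 * 2 ^ (1 / a)) * (wnorm n a w f + wnorm n a w h) := by
  unfold wnorm
  have ha' : 0 ≤ 1 / a := by positivity
  have h1 : ∫⁻ x, ENNReal.ofReal (|f x + h x| ^ a) * w x ≤
      ENNReal.ofReal (2 ^ a) * ((∫⁻ x, ENNReal.ofReal (|f x| ^ a) * w x) +
        ∫⁻ x, ENNReal.ofReal (|h x| ^ a) * w x) := by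
    have hm : AEMeasurable (fun x => ENNReal.ofReal (|f x| ^ a) * w x) volume :=
      ((hf.abs.pow_const a).ennreal_ofReal).mul hw.aemeasurable
    rw [← lintegral_add_left' hm,
      ← lintegral_const_mul' _ _ ENNReal.ofReal_ne_top]
    refine lintegral_mono fun x => ?_
    rw [← add_mul, ← mul_assoc]
    gcongr
    rw [← ENNReal.ofReal_add (by positivity) (by positivity), ← ENNReal.ofReal_mul (by positivity)]
    apply ENNReal.ofReal_le_ofReal
    exact (Real.rpow_le_rpow (abs_nonneg _) (abs_add_le _ _) ha.le).trans
      (add_rpow_le_two ha.le (abs_nonneg _) (abs_nonneg _))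
  refine (ENNReal.rpow_le_rpow h1 ha').trans ?_
  rw [ENNReal.mul_rpow_of_nonneg _ _ ha', ENNReal.ofReal_rpow_of_nonneg (by positivity) ha',
    ← Real.rpow_mul (by norm_num), mul_one_div_cancel ha.ne', Real.rpow_one,
    ENNReal.ofReal_mul (by norm_num), mul_assoc]
  gcongr
  refine (ennreal_add_rpow_le ha' _ _).trans (le_of_eq ?_)
  rw [← ENNReal.ofReal_rpow_of_pos (by norm_num)]
  norm_num

lemma wnorm_const_mul {a : ℝ} (ha : 0 < a) {w : Rn n → ℝ≥0∞} (d : ℝ) (f : Rn n → ℝ) :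
    wnorm n a w (fun x => d * f x) = ENNReal.ofReal |d| * wnorm n a w f := by
  unfold wnorm
  have ha' : 0 ≤ 1 / a := by positivity
  have : ∀ x, ENNReal.ofReal (|d * f x| ^ a) * w x =
      ENNReal.ofReal (|d| ^ a) * (ENNReal.ofReal (|f x| ^ a) * w x) := by
    intro x
    rw [abs_mul, Real.mul_rpow (abs_nonneg _) (abs_nonneg _), ENNReal.ofReal_mul (by positivity),
      mul_assoc]
  simp_rw [this]
  rw [lintegral_const_mul' _ _ ENNReal.ofReal_ne_top, ENNReal.mul_rpow_of_nonneg _ _ ha',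
    ENNReal.ofReal_rpow_of_nonneg (by positivity) ha', ← Real.rpow_mul (abs_nonneg _),
    mul_one_div_cancel ha.ne', Real.rpow_one]

lemma wnorm_const {a : ℝ} (ha : 0 < a) {w : Rn n → ℝ≥0∞} (d : ℝ) :
    wnorm n a w (fun _ => d) = ENNReal.ofReal |d| * (∫⁻ x, w x) ^ (1 / a) := by
  have := wnorm_const_mul (n := n) ha (w := w) d (fun _ => 1)
  simp only [mul_one] at this
  rw [this]
  simp [wnorm]

lemma wnorm_mono_weight {a : ℝ} (ha : 0 < a) {w w' : Rn n → ℝ≥0∞} {D : ℝ≥0∞}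
    (h : ∀ x, w x ≤ D * w' x) (hD : D ≠ ⊤) (f : Rn n → ℝ) :
    wnorm n a w f ≤ D ^ (1 / a) * wnorm n a w' f := by
  unfold wnorm
  have ha' : 0 ≤ 1 / a := by positivity
  rw [← ENNReal.mul_rpow_of_nonneg _ _ ha', ← lintegral_const_mul' _ _ hD]
  refine ENNReal.rpow_le_rpow (lintegral_mono fun x => ?_) ha'
  rw [mul_left_comm]
  gcongr
  exact h x

/-- The weight of the local excess. -/
def wloc (x₀ : Rn n) (r : ℝ) : Rn n → ℝ≥0∞ :=
  (ball x₀ r).indicator fun _ => (volume (ball x₀ r))⁻¹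

/-- The weight of the tail. -/
def wtail (s p : ℝ) (x₀ : Rn n) (r : ℝ) : Rn n → ℝ≥0∞ :=
  (ball x₀ r)ᶜ.indicator fun x => ENNReal.ofReal (r ^ (s * p)) * fracKer n s p x x₀

lemma measurable_wloc (x₀ : Rn n) (r : ℝ) : Measurable (wloc x₀ r) :=
  measurable_const.indicator measurableSet_ball

lemma measurable_wtail (s p : ℝ) (x₀ : Rn n) (r : ℝ) : Measurable (wtail s p x₀ r) :=
  ((measurable_fracKer_comp measurable_id measurable_const).const_mul _).indicator
    measurableSet_ball.compl

/-- The global excess of a function without subtraction of its average. -/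
def gex (n : ℕ) (s p : ℝ) (f : Rn n → ℝ) (x₀ : Rn n) (r : ℝ) : ℝ≥0∞ :=
  wnorm n (qStar p) (wloc x₀ r) f + wnorm n (p - 1) (wtail s p x₀ r) f

lemma wnorm_wloc {a : ℝ} (f : Rn n → ℝ) (x₀ : Rn n) (r : ℝ) (hV : volume (ball x₀ r) ≠ 0) :
    wnorm n a (wloc x₀ r) f =
      ((volume (ball x₀ r))⁻¹ * ∫⁻ x in ball x₀ r, ENNReal.ofReal (|f x| ^ a)) ^ (1 / a) := by
  unfold wnorm wloc
  rw [← lintegral_const_mul' _ _ (ENNReal.inv_ne_top.2 hV),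
    ← lintegral_indicator measurableSet_ball]
  congr 2
  ext x
  by_cases hx : x ∈ ball x₀ r
  · simp only [indicator_of_mem hx, mul_comm]
  · simp [indicator_of_notMem hx]

lemma wnorm_wtail (f : Rn n → ℝ) (x₀ : Rn n) (r : ℝ) :
    wnorm n (p - 1) (wtail s p x₀ r) f =
      (ENNReal.ofReal (r ^ (s * p)) * ∫⁻ x in (ball x₀ r)ᶜ,
        ENNReal.ofReal (|f x| ^ (p - 1)) * fracKer n s p x x₀) ^ (1 / (p - 1)) := by
  unfold wnorm wtail
  rw [← lintegral_const_mul' _ _ ENNReal.ofReal_ne_top,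
    ← lintegral_indicator measurableSet_ball.compl]
  congr 2
  ext x
  by_cases hx : x ∈ (ball x₀ r)ᶜ
  · simp only [indicator_of_mem hx, mul_left_comm]
  · simp only [indicator_of_notMem hx, mul_zero]

lemma tailFn_eq (f : Rn n → ℝ) (x₀ : Rn n) (r : ℝ) :
    tailFn n s p f x₀ r = wnorm n (p - 1) (wtail s p x₀ r) f := by
  rw [wnorm_wtail, tailFn]
  congr 3
  ext x
  rw [fracKer, ← ENNReal.ofReal_mul (by positivity), Real.rpow_neg (norm_nonneg _), div_eq_mul_inv]

lemma excess_eq (f : Rn n → ℝ) (x₀ : Rn n) {r : ℝ} (hr : 0 < r) :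
    excess n s p f x₀ r = gex n s p (fun x => f x - ballAvg n f x₀ r) x₀ r := by
  rw [excess, gex, tailFn_eq, wnorm_wloc _ _ _ (measure_ball_pos _ _ hr).ne', locExcess]

lemma qStar_pos : 0 < qStar p := lt_of_lt_of_le one_pos (le_max_left _ _)

lemma gex_congr {f h : Rn n → ℝ} (hfh : f =ᵐ[volume] h) (x₀ : Rn n) (r : ℝ) :
    gex n s p f x₀ r = gex n s p h x₀ r := by
  rw [gex, gex, wnorm_congr hfh, wnorm_congr hfh]

lemma gex_const_mul (hp : 1 < p) (d : ℝ) (f : Rn n → ℝ) (x₀ : Rn n) (r : ℝ) :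
    gex n s p (fun x => d * f x) x₀ r = ENNReal.ofReal |d| * gex n s p f x₀ r := by
  rw [gex, gex, wnorm_const_mul qStar_pos, wnorm_const_mul (by linarith), mul_add]

lemma gex_neg (hp : 1 < p) (f : Rn n → ℝ) (x₀ : Rn n) (r : ℝ) :
    gex n s p (fun x => -f x) x₀ r = gex n s p f x₀ r := by
  have := gex_const_mul (n := n) (s := s) hp (-1) f x₀ r
  simpa using this

lemma exists_gex_add_le (n : ℕ) (s : ℝ) (hp : 1 < p) : ∃ C : ℝ, 1 ≤ C ∧ ∀ (f h : Rn n → ℝ),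
    AEMeasurable f volume → ∀ x₀ r,
    gex n s p (fun x => f x + h x) x₀ r ≤
      ENNReal.ofReal C * (gex n s p f x₀ r + gex n s p h x₀ r) := by
  set C := max (2 * (2 : ℝ) ^ (1 / qStar p)) (2 * 2 ^ (1 / (p - 1))) with hC
  have h1 : 1 ≤ (2 : ℝ) ^ (1 / qStar p) :=
    Real.one_le_rpow (by norm_num) (by have := qStar_pos (p := p); positivity)
  refine ⟨C, le_trans (by linarith) (le_max_left _ _), fun f h hf x₀ r => ?_⟩
  calc _ ≤ ENNReal.ofReal C * (wnorm n (qStar p) (wloc x₀ r) f + wnorm n (qStar p) (wloc x₀ r) h) +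
      ENNReal.ofReal C * (wnorm n (p - 1) (wtail s p x₀ r) f +
        wnorm n (p - 1) (wtail s p x₀ r) h) := by
        refine add_le_add ((wnorm_add_le qStar_pos (measurable_wloc _ _) hf).trans ?_)
          ((wnorm_add_le (by linarith) (measurable_wtail _ _ _ _) hf).trans ?_)
        · gcongr; exact le_max_left _ _
        · gcongr; exact le_max_right _ _
    _ = _ := by rw [gex, gex]; ring

lemma lintegral_wloc (x₀ : Rn n) {r : ℝ} (hr : 0 < r) : ∫⁻ x, wloc x₀ r x = 1 := by
  unfold wloc
  rw [lintegral_indicator measurableSet_ball, setLIntegral_const,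
    ENNReal.inv_mul_cancel (measure_ball_pos _ _ hr).ne' measure_ball_lt_top.ne]

lemma exists_gex_const_le (n : ℕ) (hs : 0 < s) (hp : 1 < p) : ∃ C : ℝ, 0 < C ∧
    ∀ (d : ℝ) (x₀ : Rn n) (r : ℝ), 0 < r →
    gex n s p (fun _ => d) x₀ r ≤ ENNReal.ofReal C * ENNReal.ofReal |d| := by
  have hsp : 0 < s * p := by positivity
  obtain ⟨C, hC, H⟩ := exists_lintegral_ker_compl n hsp
  refine ⟨1 + C ^ (1 / (p - 1)), by positivity, fun d x₀ r hr => ?_⟩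
  have hp1 : 0 ≤ 1 / (p - 1) := by have : 0 < p - 1 := by linarith
                                   positivity
  rw [gex, wnorm_const qStar_pos, wnorm_const (by linarith), lintegral_wloc x₀ hr,
    ENNReal.one_rpow, ← mul_add, mul_comm, ENNReal.ofReal_add (by norm_num) (by positivity)]
  gcongr
  · simp
  · rw [← ENNReal.ofReal_rpow_of_nonneg hC.le hp1]
    refine ENNReal.rpow_le_rpow ?_ hp1
    unfold wtail
    rw [lintegral_indicator measurableSet_ball.compl, lintegral_const_mul' _ _ ENNReal.ofReal_ne_top]
    simp_rw [fracKer_comm n s p _ x₀]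
    refine (mul_le_mul_right (H x₀ r hr) _).trans ?_
    rw [← ENNReal.ofReal_mul (by positivity)]
    apply ENNReal.ofReal_le_ofReal
    rw [mul_left_comm, ← Real.rpow_add hr]
    simp

/-- The normalised Lebesgue measure on a ball. -/
def ballProb (x₀ : Rn n) (r : ℝ) : Measure (Rn n) :=
  (volume (ball x₀ r))⁻¹ • volume.restrict (ball x₀ r)

lemma isProbabilityMeasure_ballProb (x₀ : Rn n) {r : ℝ} (hr : 0 < r) :
    IsProbabilityMeasure (ballProb x₀ r) := by
  constructor
  rw [ballProb, Measure.smul_apply, Measure.restrict_apply_univ, smul_eq_mul,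
    ENNReal.inv_mul_cancel (measure_ball_pos _ _ hr).ne' measure_ball_lt_top.ne]

lemma wnorm_wloc_eq_eLpNorm {a : ℝ} (ha : 0 < a) (f : Rn n → ℝ) (x₀ : Rn n) {r : ℝ} (hr : 0 < r) :
    wnorm n a (wloc x₀ r) f = eLpNorm' f a (ballProb x₀ r) := by
  rw [wnorm_wloc _ _ _ (measure_ball_pos _ _ hr).ne', eLpNorm', ballProb, lintegral_smul_measure,
    smul_eq_mul]
  congr 3
  ext x
  rw [Real.enorm_eq_ofReal_abs, ENNReal.ofReal_rpow_of_nonneg (abs_nonneg _) ha.le]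

lemma aestronglyMeasurable_ballProb {f : Rn n → ℝ} (hf : AEMeasurable f volume) (x₀ : Rn n)
    (r : ℝ) : AEStronglyMeasurable f (ballProb x₀ r) :=
  (hf.aestronglyMeasurable.restrict).mono_ac (Measure.smul_absolutelyContinuous)

lemma wnorm_wloc_mono {a b : ℝ} (ha : 0 < a) (hab : a ≤ b) {f : Rn n → ℝ}
    (hf : AEMeasurable f volume) (x₀ : Rn n) {r : ℝ} (hr : 0 < r) :
    wnorm n a (wloc x₀ r) f ≤ wnorm n b (wloc x₀ r) f := by
  have := isProbabilityMeasure_ballProb x₀ hr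
  rw [wnorm_wloc_eq_eLpNorm ha _ _ hr, wnorm_wloc_eq_eLpNorm (ha.trans_le hab) _ _ hr]
  exact eLpNorm'_le_eLpNorm'_of_exponent_le ha hab _ (aestronglyMeasurable_ballProb hf x₀ r)

lemma abs_ballAvg_le {f : Rn n → ℝ} (hf : AEMeasurable f volume) (x₀ : Rn n) {r : ℝ} (hr : 0 < r) :
    ENNReal.ofReal |ballAvg n f x₀ r| ≤ gex n s p f x₀ r := by
  have h1 : ENNReal.ofReal |ballAvg n f x₀ r| ≤ wnorm n 1 (wloc x₀ r) f := by
    rw [wnorm_wloc_eq_eLpNorm one_pos _ _ hr, eLpNorm', ← Real.enorm_eq_ofReal_abs]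
    have : ballAvg n f x₀ r = ∫ x, f x ∂(ballProb x₀ r) := by
      rw [ballAvg, average_eq', Measure.restrict_apply_univ, ballProb]
    rw [this]
    simpa using enorm_integral_le_lintegral_enorm f (μ := ballProb x₀ r)
  refine h1.trans ((wnorm_wloc_mono one_pos (le_max_left 1 (p - 1) : 1 ≤ qStar p) hf x₀ hr).trans ?_)
  exact le_self_add

lemma ballAvg_sub_const {f : Rn n → ℝ} (c : ℝ) (x₀ : Rn n) {r : ℝ} (hr : 0 < r)
    (hf : Integrable f (ballProb x₀ r)) :
    ballAvg n (fun x => f x - c) x₀ r = ballAvg n f x₀ r - c := by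
  have := isProbabilityMeasure_ballProb x₀ hr
  have e : ∀ h : Rn n → ℝ, ballAvg n h x₀ r = ∫ x, h x ∂(ballProb x₀ r) := fun h => by
    rw [ballAvg, average_eq', Measure.restrict_apply_univ, ballProb]
  rw [e, e, integral_sub hf (integrable_const _)]
  simp

lemma integrable_ballProb {f : Rn n → ℝ} (hf : AEMeasurable f volume) (x₀ : Rn n) {r : ℝ}
    (hr : 0 < r) (h : gex n s p f x₀ r < ⊤) : Integrable f (ballProb x₀ r) := by
  refine ⟨aestronglyMeasurable_ballProb hf x₀ r, ?_⟩
  have h1 : wnorm n 1 (wloc x₀ r) f < ⊤ :=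
    (wnorm_wloc_mono one_pos (le_max_left 1 (p - 1) : 1 ≤ qStar p) hf x₀ hr).trans_lt (le_self_add.trans_lt h)
  rw [wnorm_wloc_eq_eLpNorm one_pos _ _ hr, eLpNorm'] at h1
  simpa [HasFiniteIntegral] using h1

lemma exists_excess_le_gex (n : ℕ) (hs : 0 < s) (hp : 1 < p) : ∃ C : ℝ, 1 ≤ C ∧
    ∀ (f : Rn n → ℝ), AEMeasurable f volume → ∀ (c : ℝ) (x₀ : Rn n) (r : ℝ), 0 < r →
    excess n s p f x₀ r ≤ ENNReal.ofReal C * gex n s p (fun x => f x - c) x₀ r := by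
  obtain ⟨C₁, hC₁, H₁⟩ := exists_gex_add_le n s hp
  obtain ⟨C₂, hC₂, H₂⟩ := exists_gex_const_le n hs hp
  refine ⟨C₁ * (1 + C₂), by nlinarith, fun f hf c x₀ r hr => ?_⟩
  rcases eq_or_ne (gex n s p (fun x => f x - c) x₀ r) ⊤ with htop | htop
  · rw [htop, ENNReal.mul_top (ENNReal.ofReal_pos.2 (by positivity)).ne']; exact le_top
  have hfc : AEMeasurable (fun x => f x - c) volume := hf.sub_const c
  have hI := integrable_ballProb hfc x₀ hr htop.lt_top
  have hI' : Integrable f (ballProb x₀ r) := by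
    have := isProbabilityMeasure_ballProb x₀ hr
    have h1 := hI.add (integrable_const c)
    have h2 : (fun x => f x - c) + (fun _ => c) = f := by ext x; simp
    rwa [h2] at h1
  have hav := ballAvg_sub_const c x₀ hr hI'
  rw [excess_eq _ _ hr]
  have e : (fun x => f x - ballAvg n f x₀ r) =
      fun x => (f x - c) + (-(ballAvg n (fun x => f x - c) x₀ r)) := by
    ext x; rw [hav]; ring
  rw [e]
  refine (H₁ _ _ hfc x₀ r).trans ?_
  rw [ENNReal.ofReal_mul (by positivity), mul_assoc]
  gcongr
  rw [ENNReal.ofReal_add (by norm_num) hC₂.le, add_mul, ENNReal.ofReal_one, one_mul]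
  gcongr
  refine (H₂ _ x₀ r hr).trans ?_
  rw [abs_neg]
  gcongr
  exact abs_ballAvg_le hfc x₀ hr

lemma exists_gex_radius_le (hn : 1 ≤ n) (hs : 0 < s) (hp : 1 < p) {σ : ℝ} (hσ : 0 < σ) :
    ∃ C : ℝ, 1 ≤ C ∧
    ∀ (f : Rn n → ℝ), AEMeasurable f volume → ∀ (x₀ : Rn n) (t r : ℝ), 0 < t → σ * r ≤ t → t ≤ r →
    gex n s p f x₀ t ≤ ENNReal.ofReal C * gex n s p f x₀ r := by
  have hp1 : 0 < p - 1 := by linarith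
  have hp0 : 0 < p := by linarith
  set ω := (volume (ball (0 : Rn n) 1)).toReal with hω
  have hω0 : 0 < ω := volume_unitBall_pos n
  set D₁ : ℝ := (σ ^ n)⁻¹ with hD₁
  have hD₁0 : 0 < D₁ := by positivity
  set D₂ : ℝ := ω * (σ ^ n)⁻¹ with hD₂
  have hD₂0 : 0 < D₂ := by positivity
  set z := 1 / (p - 1) with hz
  have hz0 : 0 ≤ z := by positivity
  set C := 1 + D₁ ^ (1 / qStar p) + 2 ^ z * (1 + D₂ ^ z) with hC
  refine ⟨C, by rw [hC]; have : 0 ≤ D₁ ^ (1 / qStar p) := by positivity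
                have : 0 ≤ 2 ^ z * (1 + D₂ ^ z) := by positivity
                linarith, fun f hf x₀ t r ht hσt htr => ?_⟩
  have hr : 0 < r := ht.trans_le htr
  have hVr := volume_ball_eq hn x₀ hr.le
  have hVt := volume_ball_eq hn x₀ ht.le
  rw [← hω] at hVr hVt
  have hwr : ∀ x ∈ ball x₀ r, wloc x₀ r x = ENNReal.ofReal ((ω * r ^ n)⁻¹) := by
    intro x hx
    rw [wloc, indicator_of_mem hx, hVr, ENNReal.ofReal_inv_of_pos (by positivity)]
  have hpow : (t ^ n)⁻¹ ≤ (σ ^ n)⁻¹ * (r ^ n)⁻¹ := by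
    rw [← mul_inv, ← mul_pow]
    gcongr
  have hw1 : ∀ x, wloc x₀ t x ≤ ENNReal.ofReal D₁ * wloc x₀ r x := by
    intro x
    by_cases hx : x ∈ ball x₀ t
    · rw [hwr x (ball_subset_ball htr hx), wloc, indicator_of_mem hx, hVt,
        ← ENNReal.ofReal_inv_of_pos (by positivity), ← ENNReal.ofReal_mul hD₁0.le]
      apply ENNReal.ofReal_le_ofReal
      rw [mul_inv, mul_inv, mul_left_comm]
      gcongr
    · rw [wloc, indicator_of_notMem hx]; exact zero_le
  have hw2 : ∀ x, wtail s p x₀ t x ≤ wtail s p x₀ r x + ENNReal.ofReal D₂ * wloc x₀ r x := by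
    intro x
    by_cases hx : x ∈ ball x₀ t
    · rw [wtail, indicator_of_notMem (by simpa using hx)]; exact zero_le
    by_cases hxr : x ∈ ball x₀ r
    · refine le_trans ?_ le_add_self
      rw [hwr x hxr, wtail, indicator_of_mem (by simpa using hx), ← ENNReal.ofReal_mul hD₂0.le,
        fracKer, ← ENNReal.ofReal_mul (by positivity)]
      apply ENNReal.ofReal_le_ofReal
      have hx' : t ≤ ‖x - x₀‖ := by simpa [dist_eq_norm] using hx
      calc _ ≤ t ^ (s * p) * t ^ (-((n : ℝ) + s * p)) := by
            refine mul_le_mul_of_nonneg_left ?_ (by positivity)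
            exact Real.rpow_le_rpow_of_nonpos ht hx' (by
              have : 0 < s * p := by positivity
              have : (0 : ℝ) ≤ n := by positivity
              linarith)
        _ = (t ^ n)⁻¹ := by
            rw [← Real.rpow_add ht, ← Real.rpow_natCast, ← Real.rpow_neg ht.le]; congr 1; ring
        _ ≤ _ := by
            refine hpow.trans (le_of_eq ?_)
            rw [hD₂]; field_simp
    · refine le_trans ?_ le_self_add
      rw [wtail, wtail, indicator_of_mem (by simpa using hx), indicator_of_mem (by simpa using hxr)]
      gcongr
  have hb1 : wnorm n (qStar p) (wloc x₀ t) f ≤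
      ENNReal.ofReal (D₁ ^ (1 / qStar p)) * wnorm n (qStar p) (wloc x₀ r) f := by
    refine (wnorm_mono_weight qStar_pos hw1 ENNReal.ofReal_ne_top f).trans (le_of_eq ?_)
    rw [ENNReal.ofReal_rpow_of_pos hD₁0]
  have hb2 : wnorm n (p - 1) (wtail s p x₀ t) f ≤ ENNReal.ofReal (2 ^ z) *
      (wnorm n (p - 1) (wtail s p x₀ r) f +
        ENNReal.ofReal (D₂ ^ z) * wnorm n (qStar p) (wloc x₀ r) f) := by
    have hle : ∫⁻ x, ENNReal.ofReal (|f x| ^ (p - 1)) * wtail s p x₀ t x ≤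
        (∫⁻ x, ENNReal.ofReal (|f x| ^ (p - 1)) * wtail s p x₀ r x) +
        ENNReal.ofReal D₂ * ∫⁻ x, ENNReal.ofReal (|f x| ^ (p - 1)) * wloc x₀ r x := by
      have hm : AEMeasurable (fun x => ENNReal.ofReal (|f x| ^ (p - 1)) * wtail s p x₀ r x) volume :=
        ((hf.abs.pow_const _).ennreal_ofReal).mul (measurable_wtail _ _ _ _).aemeasurable
      rw [← lintegral_const_mul' _ _ ENNReal.ofReal_ne_top, ← lintegral_add_left' hm]
      refine lintegral_mono fun x => ?_
      rw [mul_left_comm, ← mul_add]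
      exact mul_le_mul_right (hw2 x) _
    calc _ ≤ _ := ENNReal.rpow_le_rpow hle hz0
      _ ≤ _ := ennreal_add_rpow_le hz0 _ _
      _ = ENNReal.ofReal (2 ^ z) * (wnorm n (p - 1) (wtail s p x₀ r) f +
        ENNReal.ofReal (D₂ ^ z) * wnorm n (p - 1) (wloc x₀ r) f) := by
          rw [ENNReal.mul_rpow_of_nonneg _ _ hz0, ENNReal.ofReal_rpow_of_pos hD₂0,
            ← ENNReal.ofReal_rpow_of_pos (p := z) (show (0 : ℝ) < 2 by norm_num), ENNReal.ofReal_ofNat]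
          rfl
      _ ≤ _ := by
          gcongr
          exact wnorm_wloc_mono hp1 (le_max_right _ _) hf x₀ hr
  rw [gex, gex]
  set X := wnorm n (qStar p) (wloc x₀ r) f
  set Y := wnorm n (p - 1) (wtail s p x₀ r) f
  calc _ ≤ ENNReal.ofReal (D₁ ^ (1 / qStar p)) * X +
        ENNReal.ofReal (2 ^ z) * (Y + ENNReal.ofReal (D₂ ^ z) * X) := add_le_add hb1 hb2
    _ ≤ ENNReal.ofReal (D₁ ^ (1 / qStar p)) * (X + Y) +
        ENNReal.ofReal (2 ^ z) * ((X + Y) + ENNReal.ofReal (D₂ ^ z) * (X + Y)) := by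
        gcongr <;> first | exact le_self_add | exact le_add_self
    _ = ENNReal.ofReal (D₁ ^ (1 / qStar p) + 2 ^ z * (1 + D₂ ^ z)) * (X + Y) := by
        rw [ENNReal.ofReal_add (by positivity) (by positivity), ENNReal.ofReal_mul (by positivity),
          ENNReal.ofReal_add (by norm_num) (by positivity), ENNReal.ofReal_one]
        ring
    _ ≤ _ := by
        gcongr
        rw [hC]; linarith

lemma ennreal_rpow_one_div_le_iff {x y : ℝ≥0∞} {z : ℝ} (hz : 0 < z) : x ^ (1 / z) ≤ y ↔ x ≤ y ^ z := by
  rw [one_div, ENNReal.rpow_inv_le_iff hz]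

lemma gex_affine (f : Rn n → ℝ) (x₀ : Rn n) {R ρ : ℝ} (hR : 0 < R) (hρ : 0 < ρ) :
    gex n s p (fun y => f (x₀ + R • y)) 0 ρ = gex n s p f x₀ (R * ρ) := by
  have hRn : ENNReal.ofReal (R ^ n) ≠ 0 := (ENNReal.ofReal_pos.2 (by positivity)).ne'
  have hV : volume (ball x₀ (R * ρ)) = ENNReal.ofReal (R ^ n) * volume (ball (0 : Rn n) ρ) := by
    have := setLIntegral_ball_affine x₀ hR ρ (fun _ => 1)
    simpa only [setLIntegral_const, one_mul] using this
  have hVρ : volume (ball (0 : Rn n) ρ) ≠ 0 := (measure_ball_pos _ _ hρ).ne'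
  rw [gex, gex, wnorm_wloc _ _ _ hVρ, wnorm_wloc _ _ _ (measure_ball_pos _ _ (by positivity)).ne',
    wnorm_wtail, wnorm_wtail, setLIntegral_ball_affine x₀ hR, setLIntegral_ball_compl_affine x₀ hR,
    hV]
  congr 2
  · rw [ENNReal.mul_inv (Or.inl hRn) (Or.inl ENNReal.ofReal_ne_top), mul_mul_mul_comm,
      ENNReal.inv_mul_cancel hRn ENNReal.ofReal_ne_top, one_mul]
  · have h1 : ∀ y : Rn n, fracKer n s p (x₀ + R • y) x₀ =
        ENNReal.ofReal (R ^ (-((n : ℝ) + s * p))) * fracKer n s p y 0 := fun y => by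
      rw [fracKer_comm, fracKer_affine_zero x₀ hR, fracKer_comm n s p 0]
    simp_rw [h1, mul_left_comm _ (ENNReal.ofReal (R ^ (-((n : ℝ) + s * p))))]
    rw [lintegral_const_mul' _ _ ENNReal.ofReal_ne_top, ← mul_assoc, ← mul_assoc,
      ← ENNReal.ofReal_mul (by positivity), ← ENNReal.ofReal_mul (by positivity)]
    congr 2
    rw [Real.mul_rpow hR.le hρ.le, ← Real.rpow_natCast]
    have : R ^ (s * p) * R ^ (n : ℝ) * R ^ (-((n : ℝ) + s * p)) = 1 := by
      rw [← Real.rpow_add hR, ← Real.rpow_add hR, ← Real.rpow_zero R]; congr 1; ring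
    linear_combination (-ρ ^ (s * p)) * this

set_option maxHeartbeats 1000000 in
lemma sub_decay (P : Par n s p Λ ε q κ) {θ : ℝ} (hθ : 0 < θ) :
    ∃ σ : ℝ, 0 < σ ∧ σ ≤ 1 / 4 ∧ ∃ C : ℝ, 0 < C ∧ ∀ (v : Rn n → ℝ) (x₀ : Rn n) (R m : ℝ), 0 < R →
      IsSub n s p Λ v x₀ R m → IsSub n s p Λ (fun x => -v x) x₀ R m →
      excess n s p v x₀ (R * σ) ≤ ENNReal.ofReal θ * excess n s p v x₀ R +
        ENNReal.ofReal (C * (m * R ^ (s * p - n)) ^ (1 / (p - 1))) := by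
  have hp := P.hp
  have hp0 := P.hp0
  have hs := P.hs
  have hp1 : 0 < p - 1 := by linarith
  have hn1 : 1 ≤ n := by have := P.hn; omega
  obtain ⟨C₄, hC₄, H₄⟩ := exists_excess_le_gex n hs hp
  set b := qStar p with hb
  have hb0 : 0 < b := qStar_pos
  set ω := (volume (ball (0 : Rn n) 1)).toReal with hω
  have hω0 : 0 < ω := volume_unitBall_pos n
  have hωe : volume (ball (0 : Rn n) 1) = ENNReal.ofReal ω :=
    (ENNReal.ofReal_toReal measure_ball_lt_top.ne).symm
  set A := 1 + ω ^ (1 / b) with hA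
  have hA0 : 0 < A := by positivity
  have hA1 : 1 ≤ A := by rw [hA]; have : 0 ≤ ω ^ (1 / b) := by positivity
                         linarith
  have hAω : ω ≤ A ^ b := by
    calc ω = (ω ^ (1 / b)) ^ b := by
          rw [← Real.rpow_mul hω0.le, one_div_mul_cancel hb0.ne', Real.rpow_one]
      _ ≤ A ^ b := by gcongr; rw [hA]; linarith
  set e₀ := θ / (C₄ * A) with he₀
  have he₀0 : 0 < e₀ := by positivity
  obtain ⟨η₁, hη₁, E₁⟩ := exists_small_rpow ((1 / ω) ^ (1 / b)) (show 0 < 1 / b by positivity)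
    (half_pos he₀0)
  obtain ⟨η₂, hη₂, E₂⟩ := exists_small_rpow 1 (show 0 < 1 / (p - 1) by positivity)
    (half_pos he₀0)
  set ε' := min η₁ η₂ with hε'
  have hε'0 : 0 < ε' := lt_min hη₁ hη₂
  have E₁ := E₁ ε' hε'0 (min_le_left _ _)
  have E₂ := E₂ ε' hε'0 (min_le_right _ _)
  rw [one_mul] at E₂
  obtain ⟨σ, hσ, hσ4, δ, hδ, HD⟩ := normalized_decay P hε'0
  refine ⟨σ, hσ, hσ4, θ * (1 / δ) ^ (1 / (p - 1)), by positivity, fun v x₀ R m hR h1 h2 => ?_⟩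
  have hvm : AEMeasurable v volume := h1.meas.aemeasurable
  rcases eq_or_ne (excess n s p v x₀ R) ⊤ with htop | htop
  · rw [htop, ENNReal.mul_top (ENNReal.ofReal_pos.2 hθ).ne', top_add]; exact le_top
  set e := (excess n s p v x₀ R).toReal with he
  have he0 : 0 ≤ e := ENNReal.toReal_nonneg
  have hee : excess n s p v x₀ R = ENNReal.ofReal e := (ENNReal.ofReal_toReal htop).symm
  rw [hee]
  set μ := m * R ^ (s * p - n) with hμ
  have hm0 := h1.mass
  have hμ0 : 0 ≤ μ := by positivity
  refine ENNReal.le_of_forall_pos_le_add fun η₀ hη₀ _ => ?_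
  set η : ℝ := η₀ / θ with hη
  have hη0 : 0 < η := by have : (0 : ℝ) < η₀ := hη₀
                         positivity
  set l := A * e + (μ / δ) ^ (1 / (p - 1)) + η with hl
  have hμδ : 0 ≤ (μ / δ) ^ (1 / (p - 1)) := by positivity
  have hl0 : 0 < l := by positivity
  set c₀ := ballAvg n v x₀ R with hc₀
  have hgw : gex n s p (fun y => (v (x₀ + R • y) - c₀) / l) 0 1 = ENNReal.ofReal (e / l) := by
    have e1 : (fun y : Rn n => (v (x₀ + R • y) - c₀) / l) =
        fun y => l⁻¹ * (v (x₀ + R • y) - c₀) := by ext y; rw [div_eq_inv_mul]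
    rw [e1, gex_const_mul hp, gex_affine (fun x => v x - c₀) x₀ hR one_pos, mul_one,
      ← excess_eq _ _ hR, hee, ← ENNReal.ofReal_mul (abs_nonneg _), abs_of_pos (by positivity),
      div_eq_inv_mul]
  have hel : e / l ≤ 1 / A := by
    rw [div_le_div_iff₀ hl0 hA0, one_mul, mul_comm, hl]
    linarith
  have hmass : m * R ^ (s * p - n) / l ^ (p - 1) ≤ δ := by
    rw [← hμ, div_le_iff₀ (by positivity), mul_comm, ← div_le_iff₀ hδ]
    calc μ / δ = ((μ / δ) ^ (1 / (p - 1))) ^ (p - 1) := by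
          rw [← Real.rpow_mul (by positivity), one_div_mul_cancel hp1.ne', Real.rpow_one]
      _ ≤ l ^ (p - 1) := by
          gcongr
          have : 0 ≤ A * e := by positivity
          linarith
  have hN : Nrm n s p Λ (fun y => (v (x₀ + R • y) - c₀) / l) (m * R ^ (s * p - n) / l ^ (p - 1)) := by
    refine ⟨h1.affine hp hR c₀ hl0, ?_, ?_, ?_⟩
    · have := h2.affine hp hR (-c₀) hl0
      convert this using 2
      ring
    · have h3 := le_self_add.trans hgw.le
      rw [wnorm_wloc _ _ _ (measure_ball_pos _ _ one_pos).ne',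
        ennreal_rpow_one_div_le_iff qStar_pos, hωe, ENNReal.inv_mul_le_iff
        (ENNReal.ofReal_pos.2 hω0).ne' ENNReal.ofReal_ne_top,
        ENNReal.ofReal_rpow_of_nonneg (by positivity) hb0.le, ← ENNReal.ofReal_mul hω0.le] at h3
      refine h3.trans ?_
      rw [← ENNReal.ofReal_one]
      apply ENNReal.ofReal_le_ofReal
      calc ω * (e / l) ^ b ≤ A ^ b * (1 / A) ^ b := by gcongr
        _ = 1 := by rw [← Real.mul_rpow hA0.le (by positivity), mul_one_div_cancel hA0.ne',
                      Real.one_rpow]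
    · have h3 := le_add_self.trans hgw.le
      rw [wnorm_wtail, ennreal_rpow_one_div_le_iff hp1, Real.one_rpow, ENNReal.ofReal_one,
        one_mul] at h3
      simp_rw [fracKer_comm n s p _ 0] at h3
      refine h3.trans ?_
      rw [ENNReal.ofReal_rpow_of_nonneg (by positivity) hp1.le, ← ENNReal.ofReal_one]
      apply ENNReal.ofReal_le_ofReal
      refine Real.rpow_le_one (by positivity) (hel.trans ?_) hp1.le
      rwa [div_le_one hA0]
  obtain ⟨c, hc1, hc2⟩ := HD _ _ hN hmass
  have hgc : gex n s p (fun y => (v (x₀ + R • y) - c₀) / l - c) 0 σ ≤ ENNReal.ofReal e₀ := by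
    rw [show e₀ = e₀ / 2 + e₀ / 2 by ring, ENNReal.ofReal_add (half_pos he₀0).le (half_pos he₀0).le,
      gex]
    refine add_le_add ?_ ?_
    · rw [wnorm_wloc _ _ _ (measure_ball_pos _ _ hσ).ne', ennreal_rpow_one_div_le_iff qStar_pos,
        volume_ball_eq hn1 _ hσ.le, ← hω, ENNReal.inv_mul_le_iff
        (ENNReal.ofReal_pos.2 (by positivity)).ne' ENNReal.ofReal_ne_top,
        ENNReal.ofReal_rpow_of_nonneg (by positivity) hb0.le, ← ENNReal.ofReal_mul (by positivity)]
      refine hc1.trans (ENNReal.ofReal_le_ofReal ?_)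
      have : ε' / ω ≤ (e₀ / 2) ^ b := by
        calc ε' / ω = ((1 / ω) ^ (1 / b) * ε' ^ (1 / b)) ^ b := by
              rw [← Real.mul_rpow (by positivity) hε'0.le, ← Real.rpow_mul (by positivity),
                one_div_mul_cancel hb0.ne', Real.rpow_one]
              ring
          _ ≤ _ := by gcongr
      rw [div_le_iff₀ hω0] at this
      calc ε' * σ ^ n ≤ ((e₀ / 2) ^ b * ω) * σ ^ n := by gcongr
        _ = _ := by ring
    · rw [wnorm_wtail]
      simp_rw [fracKer_comm n s p _ 0]
      refine (ENNReal.rpow_le_rpow hc2 (by positivity)).trans ?_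
      rw [ENNReal.ofReal_rpow_of_nonneg hε'0.le (by positivity)]
      exact ENNReal.ofReal_le_ofReal E₂
  have hfin : gex n s p (fun x => v x - (c₀ + l * c)) x₀ (R * σ) ≤ ENNReal.ofReal (l * e₀) := by
    rw [← gex_affine _ x₀ hR hσ]
    have e1 : (fun y : Rn n => v (x₀ + R • y) - (c₀ + l * c)) =
        fun y => l * ((v (x₀ + R • y) - c₀) / l - c) := by ext y; field_simp; ring
    rw [e1, gex_const_mul hp, abs_of_pos hl0, ENNReal.ofReal_mul hl0.le]
    gcongr
  refine (H₄ v hvm (c₀ + l * c) x₀ (R * σ) (by positivity)).trans ?_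
  refine (mul_le_mul_right hfin _).trans ?_
  rw [← ENNReal.ofReal_mul (by positivity), ← ENNReal.ofReal_mul hθ.le,
    ← ENNReal.ofReal_add (by positivity) (by positivity), ← ENNReal.ofReal_coe_nnreal,
    ← ENNReal.ofReal_add (by positivity) (by positivity)]
  apply ENNReal.ofReal_le_ofReal
  have hCl : C₄ * (l * e₀) = θ * (l / A) := by rw [he₀]; field_simp
  have hlA : l / A ≤ e + (μ / δ) ^ (1 / (p - 1)) + η := by
    rw [div_le_iff₀ hA0, hl]
    nlinarith
  have hμ' : (μ / δ) ^ (1 / (p - 1)) = (1 / δ) ^ (1 / (p - 1)) * μ ^ (1 / (p - 1)) := by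
    rw [← Real.mul_rpow (by positivity) hμ0]; congr 1; ring
  have hηθ : θ * η = η₀ := by rw [hη]; field_simp
  rw [hCl]
  calc θ * (l / A) ≤ θ * (e + (μ / δ) ^ (1 / (p - 1)) + η) := by gcongr
    _ = _ := by rw [mul_add, mul_add, hηθ, hμ']; ring

lemma ofReal_abs_integral_mul_rpow_le (hp : 1 ≤ p) {ρ h : Rn n → ℝ} (hρm : Measurable ρ)
    (hρ : ∀ z, 0 ≤ ρ z) (hρ1 : ∫⁻ z, ENNReal.ofReal (ρ z) = 1) (hh : Measurable h) :
    ENNReal.ofReal (|∫ z, ρ z * h z| ^ p) ≤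
      ∫⁻ z, ENNReal.ofReal (ρ z) * ENNReal.ofReal (|h z| ^ p) := by
  have hp0 : 0 < p := by linarith
  set ν : Measure (Rn n) := volume.withDensity fun z => ENNReal.ofReal (ρ z) with hν
  have hνp : IsProbabilityMeasure ν := ⟨by rw [hν, withDensity_apply _ MeasurableSet.univ]; simpa⟩
  have hi : ∀ f : Rn n → ℝ≥0∞, Measurable f →
      ∫⁻ z, f z ∂ν = ∫⁻ z, ENNReal.ofReal (ρ z) * f z := fun f hf => by
    rw [hν, lintegral_withDensity_eq_lintegral_mul _ hρm.ennreal_ofReal hf]; rfl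
  have h1 : ENNReal.ofReal |∫ z, ρ z * h z| ≤ eLpNorm' h 1 ν := by
    rw [← Real.enorm_eq_ofReal_abs]
    refine (enorm_integral_le_lintegral_enorm _).trans (le_of_eq ?_)
    simp only [eLpNorm', ENNReal.rpow_one, div_one]
    rw [hi _ hh.enorm]
    refine lintegral_congr fun z => ?_
    rw [enorm_mul, Real.enorm_eq_ofReal (hρ z)]
  have h2 := h1.trans (eLpNorm'_le_eLpNorm'_of_exponent_le one_pos hp ν
    hh.aestronglyMeasurable)
  rw [eLpNorm', one_div, ENNReal.le_rpow_inv_iff hp0, hi _ (hh.enorm.pow_const p)] at h2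
  rw [← ENNReal.ofReal_rpow_of_nonneg (abs_nonneg _) hp0.le]
  refine h2.trans (le_of_eq (lintegral_congr fun z => ?_))
  rw [Real.enorm_eq_ofReal_abs, ENNReal.ofReal_rpow_of_nonneg (abs_nonneg _) hp0.le]

lemma dint_translate (z : Rn n) (F : Rn n → Rn n → ℝ) :
    dint n s p (fun x y => F (x - z) (y - z)) = dint n s p F := by
  calc dint n s p (fun x y => F (x - z) (y - z))
      = ∫⁻ x, (fun x' => ∫⁻ y', ENNReal.ofReal (F x' y') * fracKer n s p x' y') (x - z) := by
        refine lintegral_congr fun x => ?_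
        simp only []
        rw [← lintegral_sub_right_eq_self
          (fun y' => ENNReal.ofReal (F (x - z) y') * fracKer n s p (x - z) y') z]
        refine lintegral_congr fun y => ?_
        simp only [fracKer, sub_sub_sub_cancel_right]
    _ = _ := lintegral_sub_right_eq_self
        (fun x' => ∫⁻ y', ENNReal.ofReal (F x' y') * fracKer n s p x' y') z

lemma dint_convolution_le (hp : 1 ≤ p) {ρ φ ψ : Rn n → ℝ} (hρm : Measurable ρ)
    (hρ : ∀ z, 0 ≤ ρ z) (hρ1 : ∫⁻ z, ENNReal.ofReal (ρ z) = 1) (hφ : Measurable φ)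
    (hψ : ∀ x y, ψ x - ψ y = ∫ z, ρ z * (φ (x - z) - φ (y - z))) :
    dint n s p (fun x y => |ψ x - ψ y| ^ p) ≤ dint n s p (fun x y => |φ x - φ y| ^ p) := by
  have hK := measurable_fracKer n s p
  have hm : Measurable fun w : (Rn n × Rn n) × Rn n =>
      ENNReal.ofReal (ρ w.2) * ENNReal.ofReal (|φ (w.1.1 - w.2) - φ (w.1.2 - w.2)| ^ p) *
        fracKer n s p w.1.1 w.1.2 := by
    have : Measurable fun w : (Rn n × Rn n) × Rn n => fracKer n s p w.1.1 w.1.2 :=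
      hK.comp measurable_fst
    fun_prop
  calc dint n s p (fun x y => |ψ x - ψ y| ^ p)
      ≤ ∫⁻ x, ∫⁻ y, ∫⁻ z, ENNReal.ofReal (ρ z) *
          ENNReal.ofReal (|φ (x - z) - φ (y - z)| ^ p) * fracKer n s p x y := by
        refine lintegral_mono fun x => lintegral_mono fun y => ?_
        rw [lintegral_mul_const' _ _ (fracKer_ne_top n s p x y)]
        beta_reduce
        rw [hψ]
        gcongr
        exact ofReal_abs_integral_mul_rpow_le hp hρm hρ hρ1 (by fun_prop)
    _ = ∫⁻ z, ∫⁻ x, ∫⁻ y, ENNReal.ofReal (ρ z) *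
          ENNReal.ofReal (|φ (x - z) - φ (y - z)| ^ p) * fracKer n s p x y := by
        have e1 : ∀ x, ∫⁻ y, ∫⁻ z, ENNReal.ofReal (ρ z) *
          ENNReal.ofReal (|φ (x - z) - φ (y - z)| ^ p) * fracKer n s p x y =
          ∫⁻ z, ∫⁻ y, ENNReal.ofReal (ρ z) *
          ENNReal.ofReal (|φ (x - z) - φ (y - z)| ^ p) * fracKer n s p x y := fun x =>
          lintegral_lintegral_swap (hm.comp
            (by fun_prop : Measurable fun w : Rn n × Rn n => ((x, w.1), w.2))).aemeasurable
        simp_rw [e1]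
        refine lintegral_lintegral_swap (Measurable.aemeasurable ?_)
        unfold Function.uncurry
        have := (hm.comp (by fun_prop : Measurable fun w : (Rn n × Rn n) × Rn n =>
          ((w.1.1, w.2), w.1.2))).lintegral_prod_right'
            (ν := (volume : Measure (Rn n)))
        exact this
    _ = ∫⁻ z, ENNReal.ofReal (ρ z) * dint n s p (fun x y => |φ x - φ y| ^ p) := by
        refine lintegral_congr fun z => ?_
        rw [← dint_translate z, dint, ← lintegral_const_mul' _ _ ENNReal.ofReal_ne_top]
        refine lintegral_congr fun x => ?_
        rw [← lintegral_const_mul' _ _ ENNReal.ofReal_ne_top]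
        refine lintegral_congr fun y => ?_
        rw [mul_assoc]
    _ = _ := by
        rw [lintegral_mul_const _ hρm.ennreal_ofReal, hρ1, one_mul]

lemma exists_mollification (hp : 1 ≤ p) {φ : Rn n → ℝ} (hφ : Measurable φ) (h0 : ∀ x, 0 ≤ φ x)
    (h1 : ∀ x, φ x ≤ 1) {x₀ : Rn n} {r₀ r₁ : ℝ} (hr : r₀ < r₁)
    (hsupp : ∀ x, r₀ < dist x x₀ → φ x = 0) :
    ∃ ψ : ℕ → Rn n → ℝ, (∀ k, ContDiff ℝ (⊤ : ℕ∞) (ψ k)) ∧ (∀ k x, 0 ≤ ψ k x) ∧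
      (∀ k x, ψ k x ≤ 1) ∧ (∀ k x, r₁ < dist x x₀ → ψ k x = 0) ∧
      (∀ k, dint n s p (fun x y => |ψ k x - ψ k y| ^ p) ≤
        dint n s p (fun x y => |φ x - φ y| ^ p)) ∧
      ∀ᵐ x, Tendsto (fun k => ψ k x) atTop (𝓝 (φ x)) := by
  have hd : 0 < r₁ - r₀ := by linarith
  let B : ℕ → ContDiffBump (0 : Rn n) := fun k =>
    ⟨(r₁ - r₀) / (2 * (k + 1)), (r₁ - r₀) / (k + 1), by positivity, by
      apply div_lt_div_of_pos_left hd (by positivity)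
      linarith [(by positivity : (0 : ℝ) < k + 1)]⟩
  have hout : Tendsto (fun k => (B k).rOut) atTop (𝓝 0) := by
    have : Tendsto (fun k : ℕ => (r₁ - r₀) * (1 / ((k : ℝ) + 1))) atTop (𝓝 ((r₁ - r₀) * 0)) :=
      tendsto_one_div_add_atTop_nhds_zero_nat.const_mul _
    rw [mul_zero] at this
    refine this.congr fun k => ?_
    show _ = (r₁ - r₀) / (k + 1)
    ring
  have hle : ∀ k, (B k).rOut ≤ r₁ - r₀ := fun k =>
    div_le_self hd.le (by linarith [(by positivity : (0 : ℝ) ≤ k)])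
  have hφb : ∀ x, ‖φ x‖ ≤ 1 := fun x => by rw [Real.norm_of_nonneg (h0 x)]; exact h1 x
  have hloc : LocallyIntegrable φ volume :=
    (locallyIntegrable_const (1 : ℝ)).mono hφ.aestronglyMeasurable
      (Eventually.of_forall fun x => by simpa using hφb x)
  have hρint : ∀ k, Integrable ((B k).normed volume) volume := fun k => (B k).integrable_normed
  have hInt : ∀ k x, Integrable (fun z => (B k).normed volume z * φ (x - z)) volume := by
    intro k x
    refine (hρint k).mul_bdd (c := 1) ?_ (Eventually.of_forall fun z => hφb _)
    exact (hφ.comp (measurable_const.sub measurable_id)).aestronglyMeasurable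
  have hnn : ∀ k z, 0 ≤ (B k).normed volume z := fun k z => (B k).nonneg_normed z
  have hρ1 : ∀ k, ∫ z, (B k).normed volume z = 1 := fun k => (B k).integral_normed
  have hform : ∀ k x, (convolution ((B k).normed volume) φ (ContinuousLinearMap.lsmul ℝ ℝ) volume) x
      = ∫ z, (B k).normed volume z * φ (x - z) := fun k x => by
    rw [convolution_def]; rfl
  refine ⟨fun k => convolution ((B k).normed volume) φ (ContinuousLinearMap.lsmul ℝ ℝ) volume,
    fun k => ?_, fun k x => ?_, fun k x => ?_, fun k x hx => ?_, fun k => ?_, ?_⟩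
  · exact (B k).hasCompactSupport_normed.contDiff_convolution_left _ (B k).contDiff_normed hloc
  · beta_reduce
    rw [hform]
    exact integral_nonneg fun z => mul_nonneg (hnn k z) (h0 _)
  · beta_reduce
    rw [hform, ← hρ1 k]
    exact integral_mono (hInt k x) (hρint k) fun z => mul_le_of_le_one_right (hnn k z) (h1 _)
  · beta_reduce
    rw [hform]
    refine integral_eq_zero_of_ae (Eventually.of_forall fun z => ?_)
    by_cases hz : z ∈ ball (0 : Rn n) (B k).rOut
    · have hz' : ‖z‖ < (B k).rOut := by simpa using hz
      have : φ (x - z) = 0 := by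
        apply hsupp
        have h3 : dist x x₀ ≤ dist (x - z) x₀ + ‖z‖ := by
          have := dist_triangle x (x - z) x₀
          have h4 : dist x (x - z) = ‖z‖ := by rw [dist_eq_norm]; congr 1; abel
          linarith
        linarith [hle k]
      simp [this]
    · have : (B k).normed volume z = 0 := by
        rw [← Function.notMem_support, (B k).support_normed_eq]
        exact hz
      simp [this]
  · refine dint_convolution_le hp (B k).continuous_normed.measurable (hnn k) ?_ hφ fun x y => ?_
    · rw [← ofReal_integral_eq_lintegral_ofReal (hρint k) (Eventually.of_forall (hnn k)), hρ1,
        ENNReal.ofReal_one]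
    · beta_reduce
      rw [hform, hform, ← integral_sub (hInt k x) (hInt k y)]
      simp only [mul_sub]
  · refine ContDiffBump.ae_convolution_tendsto_right_of_locallyIntegrable (K := 2) hout
      (Eventually.of_forall fun k => le_of_eq ?_) hloc
    show (r₁ - r₀) / (k + 1) = 2 * ((r₁ - r₀) / (2 * (k + 1)))
    field_simp

lemma dint_max_zero (t : Rn n → Rn n → ℝ) :
    dint n s p (fun x y => max (t x y) 0) = dint n s p t := by
  unfold dint; simp

lemma dint_le_of_le_add {t : Rn n → Rn n → ℝ} (ht : Measurable (Function.uncurry t))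
    (hfin : dint n s p (fun x y => |t x y|) < ⊤) {M : ℝ≥0∞}
    (hI : dint n s p t ≤ M + dint n s p (fun x y => -(t x y))) {A B : Rn n → Rn n → ℝ}
    (hA : Measurable (Function.uncurry A)) (hA0 : ∀ x y, 0 ≤ A x y) (hB0 : ∀ x y, 0 ≤ B x y)
    (hAB : ∀ x y, A x y ≤ t x y + B x y) : dint n s p A ≤ M + dint n s p B := by
  have hfin : dint n s p (fun x y => -(t x y)) ≠ ⊤ :=
    ((dint_mono fun x y => neg_le_abs _).trans_lt hfin).ne
  have e1 := dint_max_zero (s := s) (p := p) fun x y => -(t x y)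
  have e2 := dint_max_zero (s := s) (p := p) t
  have h3 : dint n s p A + dint n s p (fun x y => -(t x y)) ≤
      dint n s p t + dint n s p B := by
    rw [← e1, ← e2, ← dint_add hA hA0 (fun x y => le_max_right _ _), ← dint_add (by
      exact ht.max measurable_const) (fun x y => le_max_right _ _) hB0]
    refine dint_mono fun x y => ?_
    have := hAB x y
    rcases le_total (t x y) 0 with h | h
    · rw [max_eq_left (by linarith), max_eq_right h]
      linarith
    · rw [max_eq_right (by linarith), max_eq_left h]
      linarith
  have h4 : dint n s p A + dint n s p (fun x y => -(t x y)) ≤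
      (M + dint n s p B) + dint n s p (fun x y => -(t x y)) := by
    refine h3.trans ?_
    rw [add_right_comm]
    gcongr
  exact (ENNReal.add_le_add_iff_right hfin).1 h4

lemma dint_liminf_le {A : ℕ → Rn n → Rn n → ℝ} {A' : Rn n → Rn n → ℝ}
    (hA : ∀ k, Measurable (Function.uncurry (A k)))
    (h : ∀ᵐ x, ∀ᵐ y, Tendsto (fun k => A k x y) atTop (𝓝 (A' x y))) {M : ℝ≥0∞}
    (hM : ∀ k, dint n s p (A k) ≤ M) : dint n s p A' ≤ M := by
  have hm : ∀ k, Measurable (Function.uncurry fun x y =>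
      ENNReal.ofReal (A k x y) * fracKer n s p x y) := fun k => measurable_dint_inner (hA k)
  calc dint n s p A'
      ≤ ∫⁻ x, liminf (fun k => ∫⁻ y, ENNReal.ofReal (A k x y) * fracKer n s p x y) atTop := by
        refine lintegral_mono_ae ?_
        filter_upwards [h] with x hx
        calc ∫⁻ y, ENNReal.ofReal (A' x y) * fracKer n s p x y
            ≤ ∫⁻ y, liminf (fun k => ENNReal.ofReal (A k x y) * fracKer n s p x y) atTop := by
              refine lintegral_mono_ae ?_
              filter_upwards [hx] with y hy
              refine le_of_eq (Tendsto.liminf_eq ?_).symm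
              exact ENNReal.Tendsto.mul_const (ENNReal.tendsto_ofReal hy)
                (Or.inr (fracKer_ne_top n s p x y))
          _ ≤ _ := lintegral_liminf_le fun k => (hm k).comp measurable_prodMk_left
    _ ≤ liminf (fun k => dint n s p (A k)) atTop :=
        lintegral_liminf_le fun k => (hm k).lintegral_prod_right'
    _ ≤ M := liminf_le_of_le (by isBoundedDefault) fun b hb => by
        obtain ⟨k, hk⟩ := hb.exists
        exact hk.trans (hM k)

lemma abs_mul_sub_le (hp : 1 ≤ p) (hΛ : 0 ≤ Λ) {G a d : ℝ} (hG : |G| ≤ Λ * |a| ^ (p - 1)) :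
    |G * d| ≤ Λ * (|a| ^ p + |d| ^ p) := by
  rw [abs_mul]
  calc |G| * |d| ≤ (Λ * |a| ^ (p - 1)) * |d| := by gcongr
    _ = Λ * (|a| ^ (p - 1) * |d|) := by ring
    _ ≤ _ := by
        gcongr; exact rpow_sub_one_mul_le hp (abs_nonneg _) (abs_nonneg _)

/-- It suffices to test the subsolution inequality with smooth functions. -/
lemma isSub_of_smooth (hp : 1 < p) (hΛ : 0 ≤ Λ) {v : Rn n → ℝ} {x₀ : Rn n} {R m : ℝ}
    (hv : Measurable v) (hE : dint n s p (fun x y => |v x - v y| ^ p) < ⊤)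
    (hL : ∫⁻ x in ball x₀ R, ENNReal.ofReal (|v x| ^ p) < ⊤) (hm : 0 ≤ m)
    {g : Rn n → Rn n → ℝ} (hgm : Measurable (Function.uncurry g))
    (hg : ∀ x y, GBound Λ p (g x y) (v x - v y))
    (H : ∀ φ : Rn n → ℝ, ContDiff ℝ (⊤ : ℕ∞) φ → (∀ x, 0 ≤ φ x) → (∀ x, φ x ≤ 1) →
      (∃ r < R, ∀ x, r < dist x x₀ → φ x = 0) →
      dint n s p (fun x y => |φ x - φ y| ^ p) < ⊤ →
      dint n s p (fun x y => g x y * (φ x - φ y)) ≤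
        ENNReal.ofReal m + dint n s p (fun x y => -(g x y * (φ x - φ y)))) :
    IsSub n s p Λ v x₀ R m := by
  have hp0 : 0 < p := by linarith
  refine ⟨hv, hE, hL, hm, g, hgm, hg, fun φ hφ h0 h1 ⟨r, hr, hs⟩ hEφ => ?_⟩
  obtain ⟨ψ, hψs, hψ0, hψ1, hψr, hψE, hψt⟩ := exists_mollification (s := s) hp.le hφ h0 h1
    (show r < (r + R) / 2 by linarith) hs
  have hψm : ∀ k, Measurable (ψ k) := fun k => (hψs k).continuous.measurable
  set B : (Rn n → ℝ) → Rn n → Rn n → ℝ := fun φ x y =>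
    Λ * (|v x - v y| ^ p + |φ x - φ y| ^ p) with hB
  set A : (Rn n → ℝ) → Rn n → Rn n → ℝ := fun φ x y => g x y * (φ x - φ y) + B φ x y with hA
  have hB0 : ∀ φ x y, 0 ≤ B φ x y := fun φ x y => by simp only [hB]; positivity
  have hA0 : ∀ φ x y, 0 ≤ A φ x y := fun φ x y => by
    have := abs_mul_sub_le hp.le hΛ (hg x y).1 (d := φ x - φ y)
    have := neg_abs_le (g x y * (φ x - φ y))
    simp only [hA, hB]
    linarith
  have htm : ∀ φ : Rn n → ℝ, Measurable φ →
      Measurable (Function.uncurry fun x y => g x y * (φ x - φ y)) := fun φ hφ => by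
    have : Measurable fun z : Rn n × Rn n => φ z.1 - φ z.2 := by fun_prop
    exact hgm.mul this
  have hvm : Measurable fun z : Rn n × Rn n => |v z.1 - v z.2| ^ p := by fun_prop
  have hBm : ∀ φ : Rn n → ℝ, Measurable φ → Measurable (Function.uncurry (B φ)) := fun φ hφ => by
    have : Measurable fun z : Rn n × Rn n => Λ * (|v z.1 - v z.2| ^ p + |φ z.1 - φ z.2| ^ p) := by
      fun_prop
    exact this
  have hAm : ∀ φ : Rn n → ℝ, Measurable φ → Measurable (Function.uncurry (A φ)) := fun φ hφ =>
    (htm φ hφ).add (hBm φ hφ)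
  have hBE : ∀ φ, dint n s p (B φ) = ENNReal.ofReal Λ *
      (dint n s p (fun x y => |v x - v y| ^ p) + dint n s p (fun x y => |φ x - φ y| ^ p)) :=
    fun φ => by
      rw [hB, dint_const_mul hΛ, dint_add hvm (fun _ _ => by positivity) fun _ _ => by positivity]
  have hk : ∀ k, dint n s p (A (ψ k)) ≤ ENNReal.ofReal m + dint n s p (B φ) := fun k => by
    have hEk := (hψE k).trans_lt hEφ
    refine (dint_le_of_le_add (htm _ (hψm k)) (dint_mul_lt_top hp.le hΛ hv hE hEk
      fun x y => (hg x y).1) (H _ (hψs k) (hψ0 k) (hψ1 k) ⟨_, by linarith, hψr k⟩ hEk)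
      (hAm _ (hψm k)) (hA0 _) (hB0 (ψ k)) fun x y => le_rfl).trans ?_
    rw [hBE, hBE]
    gcongr
    exact hψE k
  have hlim : dint n s p (A φ) ≤ ENNReal.ofReal m + dint n s p (B φ) := by
    refine dint_liminf_le (fun k => hAm _ (hψm k)) ?_ hk
    filter_upwards [hψt] with x hx
    filter_upwards [hψt] with y hy
    have hd := hx.sub hy
    have hdp := (hd.abs.rpow_const (p := p) (Or.inr hp0.le))
    exact (hd.const_mul _).add ((hdp.const_add _).const_mul _)
  have hBfin : dint n s p (B φ) ≠ ⊤ := by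
    rw [hBE]
    exact ENNReal.mul_ne_top ENNReal.ofReal_ne_top (ENNReal.add_lt_top.2 ⟨hE, hEφ⟩).ne
  refine (ENNReal.add_le_add_iff_right hBfin).1 ?_
  set t : Rn n → Rn n → ℝ := fun x y => g x y * (φ x - φ y) with ht
  have e1 := dint_max_zero (s := s) (p := p) fun x y => -(t x y)
  have e2 := dint_max_zero (s := s) (p := p) t
  calc dint n s p t + dint n s p (B φ)
      = dint n s p (fun x y => A φ x y + max (-(t x y)) 0) := by
        rw [← e2, ← dint_add ((htm φ hφ).max measurable_const) (fun _ _ => le_max_right _ _)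
          (hB0 φ)]
        congr 1
        ext x y
        simp only [hA]
        rcases le_total (t x y) 0 with h | h
        · rw [max_eq_left (neg_nonneg.2 h), max_eq_right h]
          ring
        · rw [max_eq_right (neg_nonpos.2 h), max_eq_left h]
          ring
    _ = dint n s p (A φ) + dint n s p (fun x y => -(t x y)) := by
        rw [dint_add (hAm φ hφ) (hA0 φ) (fun _ _ => le_max_right _ _), e1]
    _ ≤ _ := by
        rw [add_right_comm]
        gcongr

lemma PhiBounds.abs_le (hΛ : 1 ≤ Λ) {Φ : ℝ → ℝ} (h : PhiBounds Λ p Φ) (t : ℝ) :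
    |Φ t| ≤ Λ * |t| ^ (p - 1) ∧ |t| ^ p ≤ Λ * (Φ t * t) := by
  obtain ⟨-, h0, hb⟩ := h
  have hΛ0 : 0 < Λ := by linarith
  obtain ⟨h1, h2⟩ := hb t
  refine ⟨?_, by rwa [div_le_iff₀' hΛ0] at h1⟩
  rcases eq_or_ne t 0 with rfl | ht
  · rw [h0, abs_zero]; positivity
  · have ht0 : 0 < |t| := abs_pos.2 ht
    have hnn : 0 ≤ Φ t * t := le_trans (by positivity) h1
    rw [← mul_le_mul_iff_left₀ ht0, ← abs_mul, abs_of_nonneg hnn, mul_assoc]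
    refine h2.trans (le_of_eq ?_)
    rw [Real.rpow_sub_one ht0.ne']
    field_simp

lemma gBound_kernel (hp : 1 < p) (hΛ : 1 ≤ Λ) {Φ : ℝ → ℝ} {K : Rn n → Rn n → ℝ}
    (hΦ : PhiBounds Λ p Φ) (hK : KernelBounds n Λ s p K) (v : Rn n → ℝ) (x y : Rn n) :
    GBound (Λ ^ 2) p (Φ (v x - v y) * (K x y * ‖x - y‖ ^ ((n : ℝ) + s * p))) (v x - v y) := by
  have hΛ0 : 0 < Λ := by linarith
  obtain ⟨h1, h2⟩ := hΦ.abs_le hΛ (v x - v y)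
  rcases eq_or_ne x y with rfl | hxy
  · simp only [sub_self, hΦ.2.1, zero_mul]
    refine ⟨by rw [abs_zero]; positivity, ?_⟩
    rw [abs_zero, Real.zero_rpow (by linarith)]
    simp
  have hd : 0 < ‖x - y‖ ^ ((n : ℝ) + s * p) := by
    have : 0 < ‖x - y‖ := norm_pos_iff.2 (sub_ne_zero.2 hxy)
    positivity
  obtain ⟨k1, k2⟩ := hK.2 x y hxy
  rw [le_div_iff₀ hd] at k2
  have k1 : 1 / Λ ≤ K x y * ‖x - y‖ ^ ((n : ℝ) + s * p) := by
    rw [← div_le_iff₀ hd, div_div]; exact k1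
  set k := K x y * ‖x - y‖ ^ ((n : ℝ) + s * p) with hk
  have hk0 : 0 < k := lt_of_lt_of_le (by positivity) k1
  constructor
  · rw [abs_mul, abs_of_pos hk0]
    calc |Φ (v x - v y)| * k ≤ (Λ * |v x - v y| ^ (p - 1)) * Λ := by gcongr
      _ = _ := by ring
  · have hnn : 0 ≤ Φ (v x - v y) * (v x - v y) :=
      le_trans (by positivity) (hΦ.2.2 (v x - v y)).1
    have k3 : 1 ≤ Λ * k := by rwa [div_le_iff₀' hΛ0] at k1
    calc |v x - v y| ^ p ≤ Λ * (Φ (v x - v y) * (v x - v y)) * 1 := by rw [mul_one]; exact h2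
      _ ≤ Λ * (Φ (v x - v y) * (v x - v y)) * (Λ * k) := by gcongr
      _ = _ := by ring

lemma ofReal_div_eq_mul_fracKer (a : ℝ) (x y : Rn n) :
    ENNReal.ofReal (a / ‖x - y‖ ^ ((n : ℝ) + s * p)) = ENNReal.ofReal a * fracKer n s p x y := by
  rw [div_eq_mul_inv, ← Real.rpow_neg (norm_nonneg _), ENNReal.ofReal_mul' (by positivity)]
  rfl

lemma gagliardo_univ (v : Rn n → ℝ) :
    gagliardo n s p univ v = dint n s p (fun x y => |v x - v y| ^ p) := by
  simp only [gagliardo, dint, Measure.restrict_univ, ofReal_div_eq_mul_fracKer]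

lemma dint_congr_ae {v w : Rn n → ℝ} (h : v =ᵐ[volume] w) (F : ℝ → ℝ → ℝ) :
    dint n s p (fun x y => F (v x) (v y)) = dint n s p (fun x y => F (w x) (w y)) := by
  unfold dint
  refine lintegral_congr_ae ?_
  filter_upwards [h] with x hx
  refine lintegral_congr_ae ?_
  filter_upwards [h] with y hy
  rw [hx, hy]

lemma toReal_dint_sub {t F : Rn n → Rn n → ℝ} (hF : Measurable (Function.uncurry F))
    (htF : ∀ x y, t x y * ‖x - y‖ ^ (-((n : ℝ) + s * p)) = F x y)
    (hfin : dint n s p (fun x y => |t x y|) < ⊤) :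
    ∫ x, ∫ y, F x y = (dint n s p t).toReal - (dint n s p (fun x y => -(t x y))).toReal := by
  have e1 : ∀ x y, ENNReal.ofReal (F x y) = ENNReal.ofReal (t x y) * fracKer n s p x y := by
    intro x y
    rw [← htF, ENNReal.ofReal_mul' (by positivity)]; rfl
  have e2 : ∀ x y, ENNReal.ofReal (-(F x y)) =
      ENNReal.ofReal (-(t x y)) * fracKer n s p x y := by
    intro x y
    rw [← htF, ← neg_mul, ENNReal.ofReal_mul' (by positivity)]; rfl
  have e3 : ∀ x y, ENNReal.ofReal |F x y| = ENNReal.ofReal |t x y| * fracKer n s p x y := by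
    intro x y
    rw [← htF, abs_mul, ENNReal.ofReal_mul' (abs_nonneg _), abs_of_nonneg
      (show 0 ≤ ‖x - y‖ ^ (-((n : ℝ) + s * p)) by positivity)]
    rfl
  have hInt : Integrable (Function.uncurry F) ((volume : Measure (Rn n)).prod volume) := by
    refine ⟨hF.aestronglyMeasurable, ?_⟩
    rw [hasFiniteIntegral_iff_enorm, lintegral_prod _ hF.enorm.aemeasurable]
    refine lt_of_le_of_lt (le_of_eq ?_) hfin
    refine lintegral_congr fun x => lintegral_congr fun y => ?_
    rw [Real.enorm_eq_ofReal_abs, ← e3]; rfl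
  have h1 := integral_integral hInt
  rw [h1]
  have h2 := integral_eq_lintegral_pos_part_sub_lintegral_neg_part hInt
  simp only [Function.uncurry] at h2
  rw [h2]
  congr 2
  · rw [lintegral_prod _ (by exact hF.ennreal_ofReal.aemeasurable)]
    exact lintegral_congr fun x => lintegral_congr fun y => e1 x y
  · rw [lintegral_prod _ (by exact hF.neg.ennreal_ofReal.aemeasurable)]
    exact lintegral_congr fun x => lintegral_congr fun y => e2 x y

lemma nonlocalForm_congr_ae {v w : Rn n → ℝ} (h : v =ᵐ[volume] w) (Φ : ℝ → ℝ)
    (K : Rn n → Rn n → ℝ) (φ : Rn n → ℝ) :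
    nonlocalForm n Φ K v φ = nonlocalForm n Φ K w φ := by
  unfold nonlocalForm
  refine integral_congr_ae ?_
  filter_upwards [h] with x hx
  refine integral_congr_ae ?_
  filter_upwards [h] with y hy
  rw [hx, hy]

lemma ofReal_abs_integral_test_le {f φ : Rn n → ℝ} {x₀ : Rn n} {R r : ℝ} (h0 : ∀ x, 0 ≤ φ x)
    (h1 : ∀ x, φ x ≤ 1) (hr : r < R) (hs : ∀ x, r < dist x x₀ → φ x = 0) :
    ENNReal.ofReal |∫ x, φ x * f x| ≤ ∫⁻ x in ball x₀ R, ENNReal.ofReal |f x| := by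
  rw [← Real.enorm_eq_ofReal_abs, ← lintegral_indicator measurableSet_ball]
  refine (enorm_integral_le_lintegral_enorm _).trans (lintegral_mono fun x => ?_)
  by_cases hx : x ∈ ball x₀ R
  · rw [indicator_of_mem hx, Real.enorm_eq_ofReal_abs, abs_mul, abs_of_nonneg (h0 x)]
    exact ENNReal.ofReal_le_ofReal (mul_le_of_le_one_left (abs_nonneg _) (h1 x))
  · have : φ x = 0 := hs x (by rw [mem_ball, not_lt] at hx; linarith)
    simp [this]

lemma WeakSol.exists_isSub (hp : 1 < p) (hΛ : 1 ≤ Λ) {Φ : ℝ → ℝ} {K : Rn n → Rn n → ℝ}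
    (hΦ : PhiBounds Λ p Φ) (hK : KernelBounds n Λ s p K) {Ω : Set (Rn n)} {f g u : Rn n → ℝ}
    (hf : Continuous f) (hfc : HasCompactSupport f) (hu : WeakSol n Φ K s p Ω f g u) :
    ∃ v : Rn n → ℝ, v =ᵐ[volume] u ∧ ∀ (x₀ : Rn n) (R : ℝ), ball x₀ R ⊆ Ω →
      (∫⁻ x in ball x₀ R, ENNReal.ofReal |f x|) < ⊤ ∧
      IsSub n s p (Λ ^ 2) v x₀ R (∫⁻ x in ball x₀ R, ENNReal.ofReal |f x|).toReal ∧
      IsSub n s p (Λ ^ 2) (fun x => -v x) x₀ R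
        (∫⁻ x in ball x₀ R, ENNReal.ofReal |f x|).toReal := by
  obtain ⟨⟨hum, huL, huE⟩, -, hT⟩ := hu
  rw [Measure.restrict_univ] at hum huL
  have hΛ0 : 0 < Λ := by linarith
  refine ⟨hum.mk u, hum.ae_eq_mk.symm, fun x₀ R hR => ?_⟩
  set v := hum.mk u with hv
  have hvu : v =ᵐ[volume] u := hum.ae_eq_mk.symm
  have hvm : Measurable v := hum.measurable_mk
  have hE : dint n s p (fun x y => |v x - v y| ^ p) < ⊤ := by
    rw [dint_congr_ae hvu fun a b => |a - b| ^ p, ← gagliardo_univ]; exact huE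
  have hL : ∫⁻ x in ball x₀ R, ENNReal.ofReal (|v x| ^ p) < ⊤ := by
    refine (setLIntegral_le_lintegral _ _).trans_lt ?_
    rw [lintegral_congr_ae (g := fun x => ENNReal.ofReal (|u x| ^ p))
      (by filter_upwards [hvu] with x hx; rw [hx])]
    exact huL
  have hM : (∫⁻ x in ball x₀ R, ENNReal.ofReal |f x|) < ⊤ := by
    refine (setLIntegral_le_lintegral _ _).trans_lt ?_
    have := (hf.integrable_of_hasCompactSupport (μ := volume) hfc).2
    rw [hasFiniteIntegral_iff_enorm] at this
    simpa only [Real.enorm_eq_ofReal_abs] using this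
  set G : Rn n → Rn n → ℝ := fun x y =>
    Φ (v x - v y) * (K x y * ‖x - y‖ ^ ((n : ℝ) + s * p)) with hG
  have hGb : ∀ x y, GBound (Λ ^ 2) p (G x y) (v x - v y) := gBound_kernel hp hΛ hΦ hK v
  have hΦm : Measurable fun z : Rn n × Rn n => Φ (v z.1 - v z.2) :=
    hΦ.1.measurable.comp (by fun_prop)
  have hGm : Measurable (Function.uncurry G) := by
    refine hΦm.mul (hK.1.mul ?_)
    fun_prop
  have key : ∀ φ : Rn n → ℝ, ContDiff ℝ (⊤ : ℕ∞) φ → (∀ x, 0 ≤ φ x) → (∀ x, φ x ≤ 1) →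
      (∃ r < R, ∀ x, r < dist x x₀ → φ x = 0) →
      dint n s p (fun x y => |φ x - φ y| ^ p) < ⊤ →
      dint n s p (fun x y => G x y * (φ x - φ y)) ≤ (∫⁻ x in ball x₀ R, ENNReal.ofReal |f x|) +
          dint n s p (fun x y => -(G x y * (φ x - φ y))) ∧
      dint n s p (fun x y => -(G x y * (φ x - φ y))) ≤
        (∫⁻ x in ball x₀ R, ENNReal.ofReal |f x|) +
          dint n s p (fun x y => G x y * (φ x - φ y)) := by
    intro φ hφ h0 h1 ⟨r, hr, hs⟩ hEφ
    have hsub : tsupport φ ⊆ closedBall x₀ r := by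
      refine closure_minimal (fun x hx => ?_) isClosed_closedBall
      by_contra h
      exact hx (hs x (by simpa using h))
    have hc : HasCompactSupport φ :=
      (isCompact_closedBall x₀ r).of_isClosed_subset (isClosed_tsupport φ) hsub
    have hT := hT φ ⟨hφ, hc, hsub.trans ((closedBall_subset_ball hr).trans hR)⟩
    rw [← nonlocalForm_congr_ae hvu] at hT
    have hφm : Measurable φ := hφ.continuous.measurable
    have hfin := dint_mul_lt_top hp.le (by positivity) hvm hE hEφ (fun x y => (hGb x y).1)
    have hF := toReal_dint_sub (s := s) (p := p) (t := fun x y => G x y * (φ x - φ y))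
      (F := fun x y => Φ (v x - v y) * (φ x - φ y) * K x y)
      ((hΦm.mul (by fun_prop)).mul hK.1) (fun x y => by
        rcases eq_or_ne x y with rfl | hxy
        · simp
        · have hd : 0 < ‖x - y‖ := norm_pos_iff.2 (sub_ne_zero.2 hxy)
          have : ‖x - y‖ ^ ((n : ℝ) + s * p) * ‖x - y‖ ^ (-((n : ℝ) + s * p)) = 1 := by
            rw [← Real.rpow_add hd, add_neg_cancel, Real.rpow_zero]
          simp only [hG]
          linear_combination (Φ (v x - v y) * (φ x - φ y) * K x y) * this) hfin
    have hF : nonlocalForm n Φ K v φ = _ := hF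
    rw [hT] at hF
    have hpos : dint n s p (fun x y => G x y * (φ x - φ y)) ≠ ⊤ :=
      ((dint_mono fun x y => le_abs_self _).trans_lt hfin).ne
    have hneg : dint n s p (fun x y => -(G x y * (φ x - φ y))) ≠ ⊤ :=
      ((dint_mono fun x y => neg_le_abs _).trans_lt hfin).ne
    have hmass := ofReal_abs_integral_test_le (f := f) h0 h1 hr hs
    constructor
    · refine le_trans ?_ (add_le_add_left hmass _)
      rw [← ENNReal.ofReal_toReal hneg, ← ENNReal.ofReal_toReal hpos,
        ← ENNReal.ofReal_add (abs_nonneg _) ENNReal.toReal_nonneg]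
      apply ENNReal.ofReal_le_ofReal
      have := le_abs_self (∫ x, φ x * f x)
      linarith
    · refine le_trans ?_ (add_le_add_left hmass _)
      rw [← ENNReal.ofReal_toReal hneg, ← ENNReal.ofReal_toReal hpos,
        ← ENNReal.ofReal_add (abs_nonneg _) ENNReal.toReal_nonneg]
      apply ENNReal.ofReal_le_ofReal
      have := neg_abs_le (∫ x, φ x * f x)
      linarith
  refine ⟨hM, ?_, ?_⟩
  · refine isSub_of_smooth hp (by positivity) hvm hE hL ENNReal.toReal_nonneg hGm hGb
      fun φ h1 h2 h3 h4 h5 => ?_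
    rw [ENNReal.ofReal_toReal hM.ne]
    exact (key φ h1 h2 h3 h4 h5).1
  · have e : ∀ x y, |-v x - -v y| = |v x - v y| := fun x y => by
      rw [← abs_neg]; congr 1; ring
    refine isSub_of_smooth hp (by positivity) hvm.neg (by simpa only [e]) (by simpa only [abs_neg])
      ENNReal.toReal_nonneg (g := fun x y => -G x y) hGm.neg (fun x y => ?_)
      fun φ h1 h2 h3 h4 h5 => ?_
    · have := (hGb x y).neg
      rwa [neg_sub'] at this
    · rw [ENNReal.ofReal_toReal hM.ne]
      simpa only [neg_mul, neg_neg] using (key φ h1 h2 h3 h4 h5).2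

lemma one_lt_exponent (hn : 2 ≤ n) (hs1 : s < 1) (hp : 2 - s / (n : ℝ) < p) : 1 < p := by
  have hn' : (2 : ℝ) ≤ n := by exact_mod_cast hn
  have : s / (n : ℝ) < 1 := by rw [div_lt_one (by linarith)]; linarith
  linarith

lemma qStar_lt_qBar (hn : 2 ≤ n) (hs : 0 < s) (hs1 : s < 1) (hp : 2 - s / (n : ℝ) < p) :
    qStar p < qBar n s p := by
  have hp1 := one_lt_exponent hn hs1 hp
  have hn' : (2 : ℝ) ≤ n := by exact_mod_cast hn
  have hns : 0 < (n : ℝ) - s := by linarith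
  refine lt_min (max_lt ?_ ?_) (max_lt hp1 (by linarith))
  · rw [lt_div_iff₀ hns, one_mul]
    have : s / (n : ℝ) * n = s := by field_simp
    nlinarith
  · rw [lt_div_iff₀ hns]
    nlinarith

lemma SOLAApprox.aemeasurable_approx {Φ : ℝ → ℝ} {K : Rn n → Rn n → ℝ} {Ω : Set (Rn n)}
    {μ : SignedMeasure (Rn n)} {g u : Rn n → ℝ} {uj μj gj : ℕ → Rn n → ℝ}
    (h : SOLAApprox n Φ K s p Ω μ g u uj μj gj) (j : ℕ) : AEMeasurable (uj j) volume := by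
  have := (h.2.2.1 j).1.1
  rwa [Measure.restrict_univ] at this

lemma SOLAApprox.aemeasurable {Φ : ℝ → ℝ} {K : Rn n → Rn n → ℝ} {Ω : Set (Rn n)}
    {μ : SignedMeasure (Rn n)} {g u : Rn n → ℝ} {uj μj gj : ℕ → Rn n → ℝ}
    (h : SOLAApprox n Φ K s p Ω μ g u uj μj gj) : AEMeasurable u volume :=
  aemeasurable_of_tendsto_metrizable_ae atTop h.aemeasurable_approx h.2.2.2.1

lemma wnorm_wtail_congr {f h : Rn n → ℝ} {Ω : Set (Rn n)} {x₀ : Rn n} {r : ℝ}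
    (hΩ : Ω ⊆ ball x₀ r) (hfh : ∀ᵐ x, x ∉ Ω → f x = h x) :
    wnorm n (p - 1) (wtail s p x₀ r) f = wnorm n (p - 1) (wtail s p x₀ r) h := by
  unfold wnorm wtail
  congr 1
  refine lintegral_congr_ae ?_
  filter_upwards [hfh] with x hx
  by_cases hxr : x ∈ ball x₀ r
  · rw [indicator_of_notMem (by simpa using hxr), mul_zero, mul_zero]
  · rw [hx fun h => hxr (hΩ h)]

lemma SOLAApprox.tendsto_gex (hn : 2 ≤ n) (hs : 0 < s) (hs1 : s < 1)
    (hp : 2 - s / (n : ℝ) < p) {Φ : ℝ → ℝ} {K : Rn n → Rn n → ℝ} {Ω : Set (Rn n)}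
    {μ : SignedMeasure (Rn n)} {g u : Rn n → ℝ} {uj μj gj : ℕ → Rn n → ℝ}
    (h : SOLAApprox n Φ K s p Ω μ g u uj μj gj) (hug : ∀ᵐ x, x ∉ Ω → u x = g x)
    (hΩ : Bornology.IsBounded Ω) (x₀ : Rn n) {t : ℝ} (ht : 0 < t) :
    Tendsto (fun j => gex n s p (fun x => uj j x - u x) x₀ t) atTop (𝓝 0) := by
  have hp1 := one_lt_exponent hn hs1 hp
  obtain ⟨P₀, hP₀⟩ := hΩ.subset_ball x₀
  set P := max P₀ t with hP
  have hPt : t ≤ P := le_max_right _ _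
  have hP0 : 0 < P := ht.trans_le hPt
  have hΩP : Ω ⊆ ball x₀ P := hP₀.trans (ball_subset_ball (le_max_left _ _))
  have hbig : Tendsto (fun j => gex n s p (fun x => uj j x - u x) x₀ P) atTop (𝓝 0) := by
    have h1 := h.2.2.2.2.1 (qStar p) le_rfl (qStar_lt_qBar hn hs hs1 hp) x₀ P hP0
    have h2 := (h.2.2.2.2.2.2.2 x₀ P hP0).2
    have hV : volume (ball x₀ P) ≠ 0 := (measure_ball_pos _ _ hP0).ne'
    have h3 : Tendsto (fun j => wnorm n (qStar p) (wloc x₀ P) fun x => uj j x - u x)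
        atTop (𝓝 0) := by
      simp_rw [wnorm_wloc _ _ _ hV]
      have := (ENNReal.Tendsto.const_mul h1 (a := (volume (ball x₀ P))⁻¹)
        (Or.inr (ENNReal.inv_ne_top.2 hV))).ennrpow_const (1 / qStar p)
      rwa [mul_zero, ENNReal.zero_rpow_of_pos (one_div_pos.2 qStar_pos)] at this
    have h4 : Tendsto (fun j => wnorm n (p - 1) (wtail s p x₀ P) fun x => uj j x - u x)
        atTop (𝓝 0) := by
      refine h2.congr fun j => ?_
      rw [tailFn_eq]
      refine (wnorm_wtail_congr hΩP ?_).symm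
      filter_upwards [hug, (h.2.2.1 j).2.1] with x hx hx' hxΩ
      rw [hx hxΩ, hx' hxΩ]
    simpa [gex] using h3.add h4
  obtain ⟨C, -, H⟩ := exists_gex_radius_le (n := n) (by omega) hs hp1 (σ := t / P) (by positivity)
  have hC := ENNReal.Tendsto.const_mul hbig (a := ENNReal.ofReal C) (Or.inr ENNReal.ofReal_ne_top)
  rw [mul_zero] at hC
  refine tendsto_of_tendsto_of_tendsto_of_le_of_le tendsto_const_nhds hC (fun _ => zero_le)
    fun j => ?_
  exact H _ ((h.aemeasurable_approx j).sub h.aemeasurable) x₀ t P ht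
    (by rw [div_mul_cancel₀ _ hP0.ne']) hPt

lemma exists_excess_perturb (n : ℕ) (hs : 0 < s) (hp : 1 < p) : ∃ A : ℝ, 1 ≤ A ∧
    ∀ v w : Rn n → ℝ, AEMeasurable v volume → AEMeasurable w volume → ∀ (x₀ : Rn n) (r : ℝ),
      0 < r → excess n s p v x₀ r ≤
        ENNReal.ofReal A * (excess n s p w x₀ r + gex n s p (fun x => v x - w x) x₀ r) := by
  obtain ⟨C₁, hC₁, H₁⟩ := exists_gex_add_le n s hp
  obtain ⟨C₂, hC₂, H₂⟩ := exists_excess_le_gex n hs hp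
  refine ⟨C₂ * C₁, by nlinarith, fun v w hv hw x₀ r hr => ?_⟩
  rw [ENNReal.ofReal_mul (by linarith), mul_assoc]
  refine (H₂ v hv (ballAvg n w x₀ r) x₀ r hr).trans (mul_le_mul_right ?_ _)
  rw [excess_eq w x₀ hr]
  have e : (fun x => v x - ballAvg n w x₀ r) =
      fun x => (w x - ballAvg n w x₀ r) + (v x - w x) := by ext x; ring
  rw [e]
  exact H₁ _ _ (hw.sub_const _) x₀ r

lemma excess_congr {v w : Rn n → ℝ} (h : v =ᵐ[volume] w) (x₀ : Rn n) {r : ℝ} (hr : 0 < r) :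
    excess n s p v x₀ r = excess n s p w x₀ r := by
  have : ballAvg n v x₀ r = ballAvg n w x₀ r := by
    rw [ballAvg, ballAvg]
    exact average_congr (ae_restrict_of_ae h)
  rw [excess_eq _ _ hr, excess_eq _ _ hr, this]
  exact gex_congr (by filter_upwards [h] with x hx; rw [hx]) _ _

lemma sola_decay (hn : 2 ≤ n) (hs : 0 < s) (hs1 : s < 1) (hp : 2 - s / (n : ℝ) < p)
    (hΛ : 1 ≤ Λ) {θ : ℝ} (hθ : 0 < θ) :
    ∃ σ : ℝ, 0 < σ ∧ σ ≤ 1 / 4 ∧ ∃ C : ℝ, 0 < C ∧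
      ∀ (Φ : ℝ → ℝ) (K : Rn n → Rn n → ℝ) (Ω : Set (Rn n)) (μ : SignedMeasure (Rn n))
        (g u : Rn n → ℝ) (uj μj gj : ℕ → Rn n → ℝ) (x₀ : Rn n) (R : ℝ),
        KernelBounds n Λ s p K → PhiBounds Λ p Φ → Bornology.IsBounded Ω →
        (∀ᵐ x, x ∉ Ω → u x = g x) → SOLAApprox n Φ K s p Ω μ g u uj μj gj →
        0 < R → ball x₀ R ⊆ Ω →
        excess n s p u x₀ (R * σ) ≤ ENNReal.ofReal θ * excess n s p u x₀ R +
          ENNReal.ofReal (C * ((μ.totalVariation (closedBall x₀ R)).toReal *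
            R ^ (s * p - n)) ^ (1 / (p - 1))) := by
  have hp1 := one_lt_exponent hn hs1 hp
  obtain ⟨ε, q, κ, P⟩ := exists_par hn hs hs1 hp (show 1 ≤ Λ ^ 2 by nlinarith)
  obtain ⟨A, hA, HA⟩ := exists_excess_perturb n hs hp1
  have hA0 : 0 < A := by linarith
  obtain ⟨σ, hσ, hσ4, C, hC, H⟩ := sub_decay P (θ := θ / A ^ 2) (by positivity)
  refine ⟨σ, hσ, hσ4, A * C, by positivity,
    fun Φ K Ω μ g u uj μj gj x₀ R hK hΦ hΩ hug h hR hRΩ => ?_⟩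
  have hum := h.aemeasurable
  have hRσ : 0 < R * σ := by positivity
  have hD := h.tendsto_gex hn hs hs1 hp hug hΩ x₀ hR
  have hD' := h.tendsto_gex hn hs hs1 hp hug hΩ x₀ hRσ
  set ν := μ.totalVariation (closedBall x₀ R) with hν
  have hνt : ν ≠ ⊤ := measure_ne_top _ _
  have hlim := h.2.2.2.2.2.2.1 x₀ R hR
  have hA2 : A * (θ / A ^ 2 * A) = θ := by field_simp
  have main : ∀ N : ℝ, ν.toReal < N → excess n s p u x₀ (R * σ) ≤
      ENNReal.ofReal θ * excess n s p u x₀ R +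
        ENNReal.ofReal (A * C * (N * R ^ (s * p - n)) ^ (1 / (p - 1))) := by
    intro N hN
    have hN0 : 0 < N := ENNReal.toReal_nonneg.trans_lt hN
    have hev : ∀ᶠ j in atTop, (∫⁻ x in ball x₀ R, ENNReal.ofReal |μj j x|) < ENNReal.ofReal N :=
      eventually_lt_of_limsup_lt (hlim.trans_lt ((ENNReal.lt_ofReal_iff_toReal_lt hνt).2 hN))
    have hT : Tendsto (fun j => ENNReal.ofReal A * ((ENNReal.ofReal (θ / A ^ 2) *
          (ENNReal.ofReal A * (excess n s p u x₀ R +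
            gex n s p (fun x => uj j x - u x) x₀ R)) +
          ENNReal.ofReal (C * (N * R ^ (s * p - n)) ^ (1 / (p - 1)))) +
          gex n s p (fun x => uj j x - u x) x₀ (R * σ))) atTop
        (𝓝 (ENNReal.ofReal A * ((ENNReal.ofReal (θ / A ^ 2) *
          (ENNReal.ofReal A * (excess n s p u x₀ R + 0)) +
          ENNReal.ofReal (C * (N * R ^ (s * p - n)) ^ (1 / (p - 1)))) + 0))) := by
      refine ENNReal.Tendsto.const_mul ?_ (Or.inr ENNReal.ofReal_ne_top)
      refine Tendsto.add (Tendsto.add ?_ tendsto_const_nhds) hD'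
      refine ENNReal.Tendsto.const_mul ?_ (Or.inr ENNReal.ofReal_ne_top)
      refine ENNReal.Tendsto.const_mul ?_ (Or.inr ENNReal.ofReal_ne_top)
      exact tendsto_const_nhds.add hD
    have hle := ge_of_tendsto hT (by
      filter_upwards [hev] with j hj
      obtain ⟨v, hvu, hv⟩ := (h.2.2.1 j).exists_isSub hp1 hΛ hΦ hK (h.1 j).1.continuous (h.1 j).2
      obtain ⟨hM, hv1, hv2⟩ := hv x₀ R hRΩ
      have hdec := H v x₀ R _ hR hv1 hv2
      have hjm := h.aemeasurable_approx j
      refine (HA u (uj j) hum hjm x₀ _ hRσ).trans (mul_le_mul_right ?_ _)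
      have e1 : gex n s p (fun x => u x - uj j x) x₀ (R * σ) =
          gex n s p (fun x => uj j x - u x) x₀ (R * σ) := by
        rw [← gex_neg hp1]; simp only [neg_sub]
      rw [e1, ← excess_congr hvu x₀ hRσ]
      refine add_le_add_left (hdec.trans (add_le_add (mul_le_mul_right ?_ _)
        (ENNReal.ofReal_le_ofReal ?_))) _
      · rw [excess_congr hvu x₀ hR]
        exact HA _ _ hjm hum x₀ R hR
      · have hm : (∫⁻ x in ball x₀ R, ENNReal.ofReal |μj j x|).toReal ≤ N :=
          ENNReal.toReal_le_of_le_ofReal hN0.le hj.le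
        have : 0 ≤ 1 / (p - 1) := by have : 0 < p - 1 := by linarith
                                     positivity
        have h0 : 0 ≤ (∫⁻ x in ball x₀ R, ENNReal.ofReal |μj j x|).toReal :=
          ENNReal.toReal_nonneg
        gcongr)
    refine hle.trans (le_of_eq ?_)
    rw [add_zero, add_zero, mul_add, ← mul_assoc, ← mul_assoc, mul_assoc (ENNReal.ofReal A),
      ← ENNReal.ofReal_mul (by positivity), ← ENNReal.ofReal_mul (by positivity),
      ← ENNReal.ofReal_mul (by positivity), hA2, mul_assoc A C]
  have hcont : Tendsto (fun N : ℝ => ENNReal.ofReal θ * excess n s p u x₀ R +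
        ENNReal.ofReal (A * C * (N * R ^ (s * p - n)) ^ (1 / (p - 1)))) (𝓝[>] ν.toReal)
      (𝓝 (ENNReal.ofReal θ * excess n s p u x₀ R +
        ENNReal.ofReal (A * C * (ν.toReal * R ^ (s * p - n)) ^ (1 / (p - 1))))) := by
    refine tendsto_const_nhds.add (ENNReal.tendsto_ofReal (Tendsto.const_mul _ ?_))
    refine Tendsto.rpow_const (Tendsto.mul_const _ ?_) (Or.inr ?_)
    · exact tendsto_nhdsWithin_of_tendsto_nhds tendsto_id
    · have : 0 < p - 1 := by linarith
      positivity
  exact ge_of_tendsto hcont (by filter_upwards [self_mem_nhdsWithin] with N hN using main N hN)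

lemma setLIntegral_Ioc_scale {c : ℝ} (hc : 0 < c) (a b : ℝ) (f : ℝ → ℝ≥0∞) :
    ∫⁻ t in Ioc (c * a) (c * b), f t = ENNReal.ofReal c * ∫⁻ t in Ioc a b, f (c * t) := by
  have hme : MeasurableEmbedding fun t : ℝ => c * t :=
    (Homeomorph.mulLeft₀ c hc.ne').measurableEmbedding
  have hpre : (fun t : ℝ => c * t) ⁻¹' Ioc (c * a) (c * b) = Ioc a b := by
    ext t
    simp only [mem_preimage, mem_Ioc, mul_lt_mul_iff_right₀ hc, mul_le_mul_iff_right₀ hc]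
  have h1 := Real.smul_map_volume_mul_left hc.ne'
  rw [abs_of_pos hc] at h1
  calc ∫⁻ t in Ioc (c * a) (c * b), f t
      = ∫⁻ t in Ioc (c * a) (c * b), f t
          ∂(ENNReal.ofReal c • Measure.map (fun t => c * t) volume) := by rw [h1]
    _ = ENNReal.ofReal c * ∫⁻ t in Ioc a b, f (c * t) := by
        rw [Measure.restrict_smul, lintegral_smul_measure, hme.restrict_map, hme.lintegral_map,
          hpre, smul_eq_mul]

lemma ennreal_le_of_le_half_add {F G : ℝ≥0∞} (hF : F ≠ ⊤) (h : F ≤ ENNReal.ofReal (1 / 2) * F + G) :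
    F ≤ 2 * G := by
  rcases eq_or_ne G ⊤ with rfl | hG
  · simp
  lift F to ℝ≥0 using hF
  lift G to ℝ≥0 using hG
  have e : ENNReal.ofReal (1 / 2) = ((1 / 2 : ℝ≥0) : ℝ≥0∞) := by
    rw [ENNReal.ofReal, Real.toNNReal_div zero_le_one]; simp
  rw [e] at h
  have h' : F ≤ 1 / 2 * F + G := by exact_mod_cast h
  have hReal : (F : ℝ) ≤ 1 / 2 * F + G := by exact_mod_cast h'
  have : F ≤ 2 * G := by
    rw [← NNReal.coe_le_coe]
    push_cast
    linarith
  exact_mod_cast this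

lemma setLIntegral_div_le {E : ℝ → ℝ≥0∞} {a b : ℝ} (ha : 0 < a) {M : ℝ≥0∞}
    (h : ∀ t, a ≤ t → t ≤ b → E t ≤ M) :
    ∫⁻ t in Ioc a b, E t / ENNReal.ofReal t ≤ ENNReal.ofReal (b / a) * M := by
  calc ∫⁻ t in Ioc a b, E t / ENNReal.ofReal t
      ≤ ∫⁻ _ in Ioc a b, M / ENNReal.ofReal a := by
        refine setLIntegral_mono measurable_const fun t ht => ?_
        exact ENNReal.div_le_div (h t ht.1.le ht.2) (ENNReal.ofReal_le_ofReal ht.1.le)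
    _ = ENNReal.ofReal ((b - a) / a) * M := by
        rw [setLIntegral_const, Real.volume_Ioc, ENNReal.ofReal_div_of_pos ha, div_eq_mul_inv,
          div_eq_mul_inv]
        ring
    _ ≤ _ := by
        gcongr
        linarith

lemma setLIntegral_Ioc_le_of_forall {f : ℝ → ℝ≥0∞} {b : ℝ} {M : ℝ≥0∞}
    (h : ∀ ε, 0 < ε → ∫⁻ t in Ioc ε b, f t ≤ M) : ∫⁻ t in Ioc 0 b, f t ≤ M := by
  have hU : Ioc 0 b = ⋃ k : ℕ, Ioc (1 / ((k : ℝ) + 1)) b := by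
    ext t
    simp only [mem_Ioc, mem_iUnion]
    constructor
    · rintro ⟨h1, h2⟩
      obtain ⟨k, hk⟩ := exists_nat_one_div_lt h1
      exact ⟨k, hk, h2⟩
    · rintro ⟨k, h1, h2⟩
      exact ⟨lt_trans (by positivity) h1, h2⟩
  rw [hU, setLIntegral_iUnion_of_directed]
  · exact iSup_le fun k => h _ (by positivity)
  · refine Monotone.directed_le fun i j hij => ?_
    apply Ioc_subset_Ioc_left
    exact Nat.one_div_le_one_div hij

lemma dini_absorb {E W : ℝ → ℝ≥0∞} {r σ C₁ : ℝ} (hr : 0 < r) (hσ : 0 < σ) (hσ1 : σ ≤ 1 / 4)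
    (hW : Measurable W) (hEr : E r < ⊤)
    (hrad : ∀ τ, 0 < τ → ∃ C : ℝ, ∀ t, 0 < t → τ * r ≤ t → t ≤ r → E t ≤ ENNReal.ofReal C * E r)
    (hC₁ : ∀ t, 0 < t → σ / 2 * r ≤ t → t ≤ r → E t ≤ ENNReal.ofReal C₁ * E r)
    (hdec : ∀ R, 0 < R → R ≤ r / 2 → E (R * σ) ≤ ENNReal.ofReal (1 / 2) * E R + W R) :
    ∫⁻ t in Ioc 0 r, E t / ENNReal.ofReal t ≤
      2 * (ENNReal.ofReal (2 / σ) * (ENNReal.ofReal C₁ * E r) +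
        ∫⁻ t in Ioc 0 (r / 2), W t / ENNReal.ofReal t) := by
  set b := σ * (r / 2) with hb
  have hb0 : 0 < b := by positivity
  have hbr : b ≤ r := by rw [hb]; nlinarith
  set f : ℝ → ℝ≥0∞ := fun t => E t / ENNReal.ofReal t with hf
  set G := ∫⁻ t in Ioc b r, f t with hG
  set Wi := ∫⁻ t in Ioc 0 (r / 2), W t / ENNReal.ofReal t with hWi
  have hGle : G ≤ ENNReal.ofReal (2 / σ) * (ENNReal.ofReal C₁ * E r) := by
    have := setLIntegral_div_le hb0 (E := E) (b := r) fun t h1 h2 =>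
      hC₁ t (hb0.trans_le h1) (by rw [hb] at h1; linarith) h2
    have e : r / b = 2 / σ := by rw [hb]; field_simp
    rwa [e] at this
  have hF : ∀ ε, 0 < ε → ∫⁻ t in Ioc ε b, f t ≤ G + 2 * Wi := by
    intro ε hε
    set F := ∫⁻ t in Ioc ε b, f t with hFdef
    have hFfin : F ≠ ⊤ := by
      obtain ⟨C, hC⟩ := hrad (ε / r) (by positivity)
      refine ((setLIntegral_div_le hε (E := E) fun t h1 h2 => hC t (hε.trans_le h1) (by
        rwa [div_mul_cancel₀ _ hr.ne']) (h2.trans hbr)).trans_lt ?_).ne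
      exact ENNReal.mul_lt_top ENNReal.ofReal_lt_top
        (ENNReal.mul_lt_top ENNReal.ofReal_lt_top hEr)
    have h1 : F ≤ ENNReal.ofReal (1 / 2) * F + (ENNReal.ofReal (1 / 2) * G + Wi) := by
      have hεσ : 0 < ε / σ := by positivity
      have hεε : ε ≤ ε / σ := by rw [le_div_iff₀ hσ]; nlinarith
      calc F = ∫⁻ t in Ioc (σ * (ε / σ)) (σ * (r / 2)), f t := by
            rw [mul_div_cancel₀ _ hσ.ne']
        _ = ∫⁻ R in Ioc (ε / σ) (r / 2), ENNReal.ofReal σ * f (σ * R) := by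
            rw [setLIntegral_Ioc_scale hσ, lintegral_const_mul' _ _ ENNReal.ofReal_ne_top]
        _ ≤ ∫⁻ R in Ioc (ε / σ) (r / 2),
              (ENNReal.ofReal (1 / 2) * f R + W R / ENNReal.ofReal R) := by
            refine lintegral_mono_ae ?_
            filter_upwards [ae_restrict_mem measurableSet_Ioc] with R hR
            have hR0 : 0 < R := hεσ.trans hR.1
            have e : ENNReal.ofReal σ * f (σ * R) = E (R * σ) / ENNReal.ofReal R := by
              simp only [hf]
              rw [mul_comm R σ, ENNReal.ofReal_mul hσ.le, ← mul_div_assoc,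
                ENNReal.mul_div_mul_left _ _ (ENNReal.ofReal_pos.2 hσ).ne' ENNReal.ofReal_ne_top]
            rw [e, hf, ← mul_div_assoc, ← ENNReal.add_div]
            exact ENNReal.div_le_div_right (hdec R hR0 hR.2) _
        _ = ENNReal.ofReal (1 / 2) * (∫⁻ R in Ioc (ε / σ) (r / 2), f R) +
              ∫⁻ R in Ioc (ε / σ) (r / 2), W R / ENNReal.ofReal R := by
            have hWm : Measurable fun R => W R / ENNReal.ofReal R :=
              hW.div ENNReal.measurable_ofReal
            rw [lintegral_add_right _ hWm,
              lintegral_const_mul' _ _ ENNReal.ofReal_ne_top]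
        _ ≤ ENNReal.ofReal (1 / 2) * (F + G) + Wi := by
            gcongr
            · refine (lintegral_mono_set fun t ht => ?_).trans (lintegral_union_le _ _ _)
              rcases le_or_gt t b with h | h
              · exact Or.inl ⟨hεε.trans_lt ht.1, h⟩
              · exact Or.inr ⟨h, ht.2.trans (by linarith)⟩
            · exact lintegral_mono_set (Ioc_subset_Ioc_left hεσ.le)
        _ = _ := by rw [mul_add, add_assoc]
    refine (ennreal_le_of_le_half_add hFfin h1).trans (le_of_eq ?_)
    have : (2 : ℝ≥0∞) * ENNReal.ofReal (1 / 2) = 1 := by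
      rw [← ENNReal.ofReal_ofNat 2, ← ENNReal.ofReal_mul (by norm_num)]; norm_num
    rw [mul_add, ← mul_assoc, this, one_mul]
  have hsub : Ioc 0 r ⊆ Ioc 0 b ∪ Ioc b r := fun t ht => by
    rcases le_or_gt t b with h | h
    · exact Or.inl ⟨ht.1, h⟩
    · exact Or.inr ⟨h, ht.2⟩
  calc ∫⁻ t in Ioc 0 r, f t ≤ (∫⁻ t in Ioc 0 b, f t) + G :=
        (lintegral_mono_set hsub).trans (lintegral_union_le _ _ _)
    _ ≤ (G + 2 * Wi) + G := by
        gcongr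
        exact setLIntegral_Ioc_le_of_forall hF
    _ = 2 * (G + Wi) := by ring
    _ ≤ _ := by gcongr

lemma tsum_pow_le {E : ℝ → ℝ≥0∞} {r σ C : ℝ} (hr : 0 < r) (hσ : 0 < σ) (hσ1 : σ ≤ 1 / 4)
    (hrad : ∀ t R, 0 < t → R ≤ r → σ * R ≤ t → t ≤ R → E t ≤ ENNReal.ofReal C * E R) :
    ∑' k : ℕ, E (σ ^ k * r) ≤
      E r + ENNReal.ofReal (2 * C) * ∫⁻ t in Ioc 0 r, E t / ENNReal.ofReal t := by
  rw [tsum_eq_zero_add' ENNReal.summable, pow_zero, one_mul]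
  refine add_le_add_right ?_ _
  set I : ℕ → Set ℝ := fun k => Ioc (σ ^ (k + 1) * r) (σ ^ k * r) with hI
  have hanti : Antitone fun k : ℕ => σ ^ k * r := fun i j hij => by
    have := pow_le_pow_of_le_one hσ.le (by linarith) hij
    show σ ^ j * r ≤ σ ^ i * r
    gcongr
  have hdisj : Pairwise (Function.onFun Disjoint I) := hanti.pairwise_disjoint_on_Ioc_succ
  have hsub : (⋃ k, I k) ⊆ Ioc 0 r := by
    refine iUnion_subset fun k t ht => ⟨lt_of_lt_of_le (by positivity) ht.1.le, ht.2.trans ?_⟩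
    have := hanti (Nat.zero_le k)
    simpa using this
  have hk : ∀ k, E (σ ^ (k + 1) * r) ≤
      ENNReal.ofReal (2 * C) * ∫⁻ t in I k, E t / ENNReal.ofReal t := by
    intro k
    set R := σ ^ k * r with hR
    have hR0 : 0 < R := by positivity
    have hRr : R ≤ r := by have := hanti (Nat.zero_le k); simpa using this
    have e1 : σ ^ (k + 1) * r = σ * R := by rw [hR]; ring
    have hIk : I k = Ioc (σ * R) R := by simp only [hI]; rw [e1]
    rw [hIk, e1, ← lintegral_const_mul' _ _ ENNReal.ofReal_ne_top]
    calc E (σ * R) = ENNReal.ofReal (R - σ * R) * (E (σ * R) / ENNReal.ofReal (R - σ * R)) := by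
          rw [ENNReal.mul_div_cancel (ENNReal.ofReal_pos.2 (by nlinarith)).ne'
            ENNReal.ofReal_ne_top]
      _ = ∫⁻ _ in Ioc (σ * R) R, E (σ * R) / ENNReal.ofReal (R - σ * R) := by
          rw [setLIntegral_const, Real.volume_Ioc, mul_comm]
      _ ≤ _ := by
          refine lintegral_mono_ae ?_
          filter_upwards [ae_restrict_mem measurableSet_Ioc] with t ht
          have ht0 : 0 < t := lt_of_lt_of_le (by positivity) ht.1.le
          have h1 := hrad (σ * R) t (by positivity) (ht.2.trans hRr)
            (by have := ht.2; gcongr) ht.1.le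
          have h2 : 1 / (R - σ * R) ≤ 2 / t := by
            rw [div_le_div_iff₀ (by nlinarith) ht0]
            nlinarith [ht.2]
          calc E (σ * R) / ENNReal.ofReal (R - σ * R)
              = E (σ * R) * ENNReal.ofReal (1 / (R - σ * R)) := by
                rw [ENNReal.ofReal_div_of_pos (by nlinarith), ENNReal.ofReal_one, one_div,
                  div_eq_mul_inv]
            _ ≤ (ENNReal.ofReal C * E t) * ENNReal.ofReal (2 / t) := by gcongr
            _ = _ := by
                rw [ENNReal.ofReal_div_of_pos ht0, ENNReal.ofReal_mul two_pos.le, div_eq_mul_inv,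
                  div_eq_mul_inv]
                ring
  calc ∑' k : ℕ, E (σ ^ (k + 1) * r)
      ≤ ∑' k, ENNReal.ofReal (2 * C) * ∫⁻ t in I k, E t / ENNReal.ofReal t :=
        ENNReal.tsum_le_tsum hk
    _ = ENNReal.ofReal (2 * C) * ∫⁻ t in ⋃ k, I k, E t / ENNReal.ofReal t := by
        rw [ENNReal.tsum_mul_left, lintegral_iUnion (fun k => measurableSet_Ioc) hdisj]
    _ ≤ _ := by
        gcongr

lemma exists_limit_of_dini {E : ℝ → ℝ≥0∞} {a : ℝ → ℝ} {r σ C : ℝ} (hr : 0 < r) (hσ : 0 < σ)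
    (hσ1 : σ ≤ 1 / 4) (hEr : E r < ⊤)
    (hInt : ∫⁻ t in Ioc 0 r, E t / ENNReal.ofReal t < ⊤)
    (hrad : ∀ t R, 0 < t → R ≤ r → σ * R ≤ t → t ≤ R → E t ≤ ENNReal.ofReal C * E R)
    (ha : ∀ t R, 0 < t → R ≤ r → σ * R ≤ t → t ≤ R →
      ENNReal.ofReal |a t - a R| ≤ ENNReal.ofReal C * E R) :
    ∃ L : ℝ, Tendsto a (𝓝[>] 0) (𝓝 L) ∧ ENNReal.ofReal |a r - L| ≤ ENNReal.ofReal C *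
      (E r + ENNReal.ofReal (2 * C) * ∫⁻ t in Ioc 0 r, E t / ENNReal.ofReal t) := by
  have hsum := tsum_pow_le hr hσ hσ1 hrad
  have hσl : σ < 1 := by linarith
  have hle : ∀ k : ℕ, σ ^ k * r ≤ r := fun k =>
    mul_le_of_le_one_left hr.le (pow_le_one₀ hσ.le hσl.le)
  set d : ℕ → ℝ≥0∞ := fun k => ENNReal.ofReal C * E (σ ^ k * r) with hd
  have hdsum : ∑' k, d k ≤ ENNReal.ofReal C *
      (E r + ENNReal.ofReal (2 * C) * ∫⁻ t in Ioc 0 r, E t / ENNReal.ofReal t) := by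
    rw [ENNReal.tsum_mul_left]
    gcongr
  have hdfin : ∑' k, d k ≠ ⊤ := (hdsum.trans_lt (ENNReal.mul_lt_top ENNReal.ofReal_lt_top
    (ENNReal.add_lt_top.2 ⟨hEr, ENNReal.mul_lt_top ENNReal.ofReal_lt_top hInt⟩))).ne
  have hed : ∀ x y : ℝ, edist x y = ENNReal.ofReal |x - y| := fun x y => by
    rw [edist_dist, Real.dist_eq]
  have hstep : ∀ k : ℕ, edist (a (σ ^ k * r)) (a (σ ^ (k + 1) * r)) ≤ d k := by
    intro k
    have hk : 0 < σ ^ k * r := by positivity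
    rw [edist_comm, hed]
    refine ha _ _ (by positivity) (hle k) (le_of_eq (by ring)) ?_
    rw [pow_succ, mul_assoc, mul_comm σ r, ← mul_assoc]
    exact mul_le_of_le_one_right hk.le hσl.le
  obtain ⟨L, hL⟩ := cauchySeq_tendsto_of_complete
    (cauchySeq_of_edist_le_of_tsum_ne_top d hstep hdfin)
  have hd0 : Tendsto d atTop (𝓝 0) := ENNReal.tendsto_atTop_zero_of_tsum_ne_top hdfin
  refine ⟨L, ?_, ?_⟩
  · rw [EMetric.tendsto_nhds]
    intro η hη
    have hη2 : 0 < η / 2 := ENNReal.half_pos hη.ne'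
    have h1 := (EMetric.tendsto_nhds.1 hL) _ hη2
    have h2 := hd0.eventually_lt_const hη2
    obtain ⟨N, hN⟩ := eventually_atTop.1 (h1.and h2)
    have hN0 : 0 < σ ^ N * r := by positivity
    filter_upwards [Ioo_mem_nhdsGT hN0] with t ht
    have htr : t / r ≤ 1 := by rw [div_le_one hr]; exact ht.2.le.trans (hle N)
    obtain ⟨k, hk1, hk2⟩ := exists_nat_pow_near_of_lt_one (div_pos ht.1 hr) htr hσ hσl
    rw [lt_div_iff₀ hr] at hk1
    rw [div_le_iff₀ hr] at hk2
    have hNk : N ≤ k := by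
      have h3 : σ ^ (k + 1) < σ ^ N := by
        have := hk1.trans ht.2
        exact lt_of_mul_lt_mul_right this hr.le
      have := (pow_lt_pow_iff_right_of_lt_one₀ hσ hσl).1 h3
      omega
    obtain ⟨h4, h5⟩ := hN k hNk
    have h6 : edist (a t) (a (σ ^ k * r)) ≤ d k := by
      rw [hed]
      refine ha _ _ ht.1 (hle k) ?_ hk2
      rw [← mul_assoc, ← pow_succ']
      exact hk1.le
    calc edist (a t) L ≤ edist (a t) (a (σ ^ k * r)) + edist (a (σ ^ k * r)) L :=
          edist_triangle _ _ _
      _ < η / 2 + η / 2 := ENNReal.add_lt_add (h6.trans_lt h5) h4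
      _ = η := ENNReal.add_halves η
  · have := edist_le_tsum_of_edist_le_of_tendsto₀ d hstep hL
    rw [pow_zero, one_mul, hed] at this
    exact this.trans hdsum

lemma IsSOLA.gex_lt_top (hn : 2 ≤ n) (hs : 0 < s) (hs1 : s < 1)
    (hp : 2 - s / (n : ℝ) < p) {Φ : ℝ → ℝ} {K : Rn n → Rn n → ℝ} {Ω : Set (Rn n)}
    {μ : SignedMeasure (Rn n)} {g u : Rn n → ℝ} (h : IsSOLA n Φ K s p Ω μ g u)
    (hu : AEMeasurable u volume) (hg : BoundaryDatum n s p g)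
    (hΩ : IsOpen Ω) (hb : Bornology.IsBounded Ω) (x₀ : Rn n) {r : ℝ} (hr : 0 < r) :
    gex n s p u x₀ r < ⊤ := by
  have hp1 := one_lt_exponent hn hs1 hp
  have hq := qStar_lt_qBar hn hs hs1 hp
  have hqp : qStar p < p := hq.trans_le (min_le_right _ _)
  obtain ⟨P₀, hP₀⟩ := hb.subset_ball x₀
  set P := max P₀ r with hP
  have hPr : r ≤ P := le_max_right _ _
  have hP0 : 0 < P := hr.trans_le hPr
  have hΩP : Ω ⊆ ball x₀ P := hP₀.trans (ball_subset_ball (le_max_left _ _))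
  obtain ⟨C, -, hC⟩ := exists_gex_radius_le (s := s) (by omega : 1 ≤ n) hs hp1
    (σ := r / P) (by positivity)
  refine (hC u hu x₀ r P hr (by rw [div_mul_cancel₀ _ hP0.ne']) hPr).trans_lt
    (ENNReal.mul_lt_top ENNReal.ofReal_lt_top ?_)
  have hV := measure_ball_pos (volume : Measure (Rn n)) x₀ hP0
  refine ENNReal.add_lt_top.2 ⟨?_, ?_⟩
  · rw [wnorm_wloc _ _ _ hV.ne']
    refine ENNReal.rpow_lt_top_of_nonneg (by have := qStar_pos (p := p); positivity)
      (ENNReal.mul_lt_top (ENNReal.inv_lt_top.2 hV) ?_).ne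
    have h1 : ∫⁻ x in Ω, ENNReal.ofReal (|u x| ^ qStar p) < ⊤ :=
      (h.1 (s / 2) (qStar p) (by linarith) (by linarith) le_rfl hq).2.1
    have h2 : ∫⁻ x in ball x₀ P, (1 + ENNReal.ofReal (|g x| ^ p)) < ⊤ := by
      rw [lintegral_add_left measurable_const, lintegral_one, Measure.restrict_apply_univ]
      exact ENNReal.add_lt_top.2 ⟨measure_ball_lt_top, (hg.1 x₀ P hP0).2.1⟩
    have h3 : ∫⁻ x in ball x₀ P \ Ω, ENNReal.ofReal (|u x| ^ qStar p) ≤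
        ∫⁻ x in ball x₀ P, (1 + ENNReal.ofReal (|g x| ^ p)) := by
      refine le_trans (lintegral_mono_ae ?_) (lintegral_mono_set sdiff_subset)
      filter_upwards [ae_restrict_mem (measurableSet_ball.diff hΩ.measurableSet),
        ae_restrict_of_ae h.2.2.1] with x hx hxg
      rw [hxg hx.2, ← ENNReal.ofReal_one, ← ENNReal.ofReal_add one_pos.le (by positivity)]
      refine ENNReal.ofReal_le_ofReal ?_
      have hq0 := (qStar_pos (p := p)).le
      rcases le_total |g x| 1 with h4 | h4
      · have := Real.rpow_le_one (abs_nonneg (g x)) h4 hq0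
        have h5 : 0 ≤ |g x| ^ p := by positivity
        linarith
      · have := Real.rpow_le_rpow_of_exponent_le h4 hqp.le
        linarith
    refine ((lintegral_mono_set (t := Ω ∪ ball x₀ P \ Ω) ?_).trans
      (lintegral_union_le _ _ _)).trans_lt (ENNReal.add_lt_top.2 ⟨h1, h3.trans_lt h2⟩)
    intro x hx
    by_cases hxΩ : x ∈ Ω
    · exact Or.inl hxΩ
    · exact Or.inr ⟨hx, hxΩ⟩
  · rw [wnorm_wtail_congr hΩP h.2.2.1, ← tailFn_eq]
    exact hg.2.2.2 x₀ P hP0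

/-- The excess and the averages of a function on comparable balls are controlled by the excess on
the larger ball. -/
lemma exists_excess_radius_le (hn : 1 ≤ n) (hs : 0 < s) (hp : 1 < p) {σ : ℝ} (hσ : 0 < σ) :
    ∃ C : ℝ, 1 ≤ C ∧ ∀ (f : Rn n → ℝ), AEMeasurable f volume → ∀ (x₀ : Rn n) (t r : ℝ), 0 < t →
      gex n s p f x₀ t < ⊤ → σ * r ≤ t → t ≤ r →
      excess n s p f x₀ t ≤ ENNReal.ofReal C * excess n s p f x₀ r ∧
      ENNReal.ofReal |ballAvg n f x₀ t - ballAvg n f x₀ r| ≤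
        ENNReal.ofReal C * excess n s p f x₀ r := by
  obtain ⟨C₁, hC₁, H₁⟩ := exists_excess_le_gex n hs hp
  obtain ⟨C₂, hC₂, H₂⟩ := exists_gex_radius_le hn hs hp hσ
  refine ⟨C₁ * C₂, by nlinarith, fun f hf x₀ t r ht hfin h1 h2 => ?_⟩
  have h3 := H₂ (fun x => f x - ballAvg n f x₀ r) (hf.sub_const _) x₀ t r ht h1 h2
  rw [excess_eq f x₀ (ht.trans_le h2)]
  constructor
  · refine (H₁ f hf (ballAvg n f x₀ r) x₀ t ht).trans ?_
    rw [ENNReal.ofReal_mul (by linarith), mul_assoc]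
    gcongr
  · rw [← ballAvg_sub_const (ballAvg n f x₀ r) x₀ ht (integrable_ballProb hf x₀ ht hfin)]
    refine ((abs_ballAvg_le (s := s) (p := p) (hf.sub_const _) x₀ ht).trans h3).trans ?_
    gcongr
    nlinarith

lemma measurable_measure_ball (ν : Measure (Rn n)) (x₀ : Rn n) :
    Measurable fun ρ : ℝ => ν (ball x₀ ρ) :=
  Monotone.measurable fun _ _ h => measure_mono (ball_subset_ball h)

/-- The density of the truncated Wolff potential. -/
def wolffDensity (n : ℕ) (s p : ℝ) (ν : Measure (Rn n)) (x₀ : Rn n) (ρ : ℝ) : ℝ≥0∞ :=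
  (ν (ball x₀ ρ) / ENNReal.ofReal (ρ ^ ((n : ℝ) - s * p))) ^ (1 / (p - 1))

lemma measurable_wolffDensity (ν : Measure (Rn n)) (x₀ : Rn n) :
    Measurable (wolffDensity n s p ν x₀) :=
  ((measurable_measure_ball ν x₀).div
    (measurable_id.pow_const _).ennreal_ofReal).pow_const _

lemma setLIntegral_wolffDensity (ν : Measure (Rn n)) (x₀ : Rn n) (r : ℝ) :
    ∫⁻ R in Ioc 0 (r / 2), wolffDensity n s p ν x₀ (2 * R) / ENNReal.ofReal R =
      wolff n s p ν x₀ r := by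
  have h := setLIntegral_Ioc_scale two_pos 0 (r / 2)
    fun ρ => wolffDensity n s p ν x₀ ρ / ENNReal.ofReal ρ
  rw [mul_zero, mul_div_cancel₀ _ two_ne_zero] at h
  rw [wolff]
  refine Eq.trans ?_ h.symm
  rw [← lintegral_const_mul' _ _ ENNReal.ofReal_ne_top]
  refine lintegral_congr fun R => ?_
  rw [ENNReal.ofReal_mul two_pos.le, ← mul_div_assoc,
    ENNReal.mul_div_mul_left _ _ (by simp) ENNReal.ofReal_ne_top]

lemma ofReal_density_le (hp : 1 < p) (ν : Measure (Rn n)) [IsFiniteMeasure ν] (x₀ : Rn n)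
    {R : ℝ} (hR : 0 < R) :
    ENNReal.ofReal (((ν (closedBall x₀ R)).toReal * R ^ (s * p - n)) ^ (1 / (p - 1))) ≤
      ENNReal.ofReal ((2 ^ ((n : ℝ) - s * p)) ^ (1 / (p - 1))) *
        wolffDensity n s p ν x₀ (2 * R) := by
  have hz : 0 ≤ 1 / (p - 1) := by
    have : 0 < p - 1 := by linarith
    positivity
  rw [wolffDensity, ← ENNReal.ofReal_rpow_of_nonneg (by positivity) hz,
    ← ENNReal.ofReal_rpow_of_nonneg (by positivity) hz, ← ENNReal.mul_rpow_of_nonneg _ _ hz]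
  refine ENNReal.rpow_le_rpow ?_ hz
  rw [ENNReal.ofReal_mul ENNReal.toReal_nonneg, ENNReal.ofReal_toReal (measure_ne_top _ _),
    Real.mul_rpow two_pos.le hR.le, ENNReal.ofReal_mul (by positivity), ← mul_div_assoc,
    ENNReal.mul_div_mul_left _ _ (ENNReal.ofReal_pos.2 (by positivity)).ne' ENNReal.ofReal_ne_top,
    div_eq_mul_inv, ← ENNReal.ofReal_inv_of_pos (by positivity), ← Real.rpow_neg hR.le, neg_sub]
  gcongr
  exact closedBall_subset_ball (by linarith)

end

/-- Theorem 1.4, Global excess decay for SOLA. -/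
theorem global_excess_decay_SOLA
    (n : ℕ) (s p Λ : ℝ)
    (hn : 2 ≤ n) (hs : 0 < s) (hs1 : s < 1) (hp : 2 - s / (n : ℝ) < p) (hΛ : 1 ≤ Λ) :
    ∃ c : ℝ, 0 < c ∧
      ∀ (Φ : ℝ → ℝ) (K : Rn n → Rn n → ℝ) (Ω : Set (Rn n))
        (μ : MeasureTheory.SignedMeasure (Rn n)) (g u : Rn n → ℝ) (x₀ : Rn n) (r : ℝ),
        KernelBounds n Λ s p K → PhiBounds Λ p Φ →
        IsOpen Ω → Bornology.IsBounded Ω → BoundaryDatum n s p g →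
        IsSOLA n Φ K s p Ω μ g u →
        0 < r → ball x₀ r ⊆ Ω →
        wolff n s p μ.totalVariation x₀ r < ⊤ →
        ∃ L : ℝ,
          Tendsto (fun ρ => ballAvg n u x₀ ρ) (𝓝[>] (0 : ℝ)) (𝓝 L) ∧
          (∫⁻ t in Ioc (0 : ℝ) r, excess n s p u x₀ t / ENNReal.ofReal t) +
              ENNReal.ofReal |ballAvg n u x₀ r - L| ≤
            ENNReal.ofReal c * wolff n s p μ.totalVariation x₀ r +
              ENNReal.ofReal c * excess n s p u x₀ r := by
  have hp1 := one_lt_exponent hn hs1 hp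
  obtain ⟨σ, hσ, hσ4, C, hC, hdecay⟩ := sola_decay hn hs hs1 hp hΛ (θ := 1 / 2) (by norm_num)
  have hn1 : 1 ≤ n := by omega
  obtain ⟨C₁, hC₁, H₁⟩ := exists_excess_radius_le hn1 hs hp1 (σ := σ / 2) (by positivity)
  obtain ⟨C₂, hC₂, H₂⟩ := exists_excess_radius_le hn1 hs hp1 hσ
  obtain ⟨C₃, hC₃, H₃⟩ := exists_excess_le_gex n hs hp1
  set D : ℝ := (2 ^ ((n : ℝ) - s * p)) ^ (1 / (p - 1)) with hD
  set S := ENNReal.ofReal (2 / σ) * ENNReal.ofReal C₁ with hS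
  set T := ENNReal.ofReal C * ENNReal.ofReal D with hT
  set V := ENNReal.ofReal C₂ with hV
  set V' := ENNReal.ofReal (2 * C₂) with hV'
  set Q := (1 + V * V') * (2 * (S + T)) + V with hQ
  have hQfin : Q ≠ ⊤ := by
    simp only [hQ, hS, hT, hV, hV']
    finiteness
  have hQ0 : Q ≠ 0 := by
    have : V ≠ 0 := (ENNReal.ofReal_pos.2 (by linarith)).ne'
    simp [hQ, this]
  refine ⟨Q.toReal, ENNReal.toReal_pos hQ0 hQfin,
    fun Φ K Ω μ g u x₀ r hK hΦ hΩ hb hg hu hr hrΩ hW => ?_⟩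
  rw [ENNReal.ofReal_toReal hQfin]
  have hsola := hu
  obtain ⟨-, -, hug, uj, μj, gj, happ⟩ := hu
  have hum := happ.aemeasurable
  have hfin : ∀ t, 0 < t → gex n s p u x₀ t < ⊤ := fun t ht =>
    hsola.gex_lt_top hn hs hs1 hp hum hg hΩ hb x₀ ht
  set E := fun t => excess n s p u x₀ t with hE
  set w := wolff n s p μ.totalVariation x₀ r with hw
  have hEr : E r < ⊤ := by
    have := H₃ u hum 0 x₀ r hr
    simp only [sub_zero] at this
    exact this.trans_lt (ENNReal.mul_lt_top ENNReal.ofReal_lt_top (hfin r hr))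
  set W : ℝ → ℝ≥0∞ := fun R => T * wolffDensity n s p μ.totalVariation x₀ (2 * R) with hWdef
  have hWm : Measurable W :=
    ((measurable_wolffDensity _ x₀).comp (measurable_const_mul 2)).const_mul _
  have hdini := dini_absorb (E := E) hr hσ hσ4 hWm hEr
    (fun τ hτ => by
      obtain ⟨C', -, H'⟩ := exists_excess_radius_le hn1 hs hp1 hτ
      exact ⟨C', fun t ht h1 h2 => (H' u hum x₀ t r ht (hfin t ht) h1 h2).1⟩)
    (fun t ht h1 h2 => (H₁ u hum x₀ t r ht (hfin t ht) h1 h2).1)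
    (fun R hR hRr => by
      have := hdecay Φ K Ω μ g u uj μj gj x₀ R hK hΦ hb hug happ hR
        ((ball_subset_ball (by linarith)).trans hrΩ)
      refine this.trans ?_
      gcongr
      rw [ENNReal.ofReal_mul hC.le, hWdef, hT]
      simp only [mul_assoc]
      gcongr
      exact ofReal_density_le hp1 _ x₀ hR)
  have hWi : ∫⁻ t in Ioc 0 (r / 2), W t / ENNReal.ofReal t = T * w := by
    rw [hw, ← setLIntegral_wolffDensity, ← lintegral_const_mul' _ _ (by rw [hT]; finiteness)]
    simp only [hWdef, mul_div_assoc]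
  rw [hWi] at hdini
  set J := ∫⁻ t in Ioc 0 r, E t / ENNReal.ofReal t with hJ
  have hJ' : J ≤ 2 * (S * E r + T * w) := by rw [hS, mul_assoc]; exact hdini
  have hJfin : J < ⊤ := hJ'.trans_lt (by
    have : S ≠ ⊤ := by rw [hS]; finiteness
    have : T ≠ ⊤ := by rw [hT]; finiteness
    finiteness)
  obtain ⟨L, hL, hLr⟩ := exists_limit_of_dini (a := fun ρ => ballAvg n u x₀ ρ) hr hσ hσ4
    hEr hJfin
    (fun t R ht _ h1 h2 => (H₂ u hum x₀ t R ht (hfin t ht) h1 h2).1)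
    (fun t R ht _ h1 h2 => (H₂ u hum x₀ t R ht (hfin t ht) h1 h2).2)
  refine ⟨L, hL, ?_⟩
  calc J + ENNReal.ofReal |ballAvg n u x₀ r - L| ≤ J + V * (E r + V' * J) := by
        gcongr
    _ = (1 + V * V') * J + V * E r := by ring
    _ ≤ (1 + V * V') * (2 * (S * E r + T * w)) + V * E r := by gcongr
    _ = (1 + V * V') * (2 * T) * w + ((1 + V * V') * (2 * S) + V) * E r := by ring
    _ ≤ Q * w + Q * E r := by
        gcongr
        · refine le_trans ?_ le_self_add
          gcongr
          exact le_add_self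
        · rw [hQ]
          gcongr
          exact le_self_add
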